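/- Let n ≥ 2 and let Ω ⊂ ℂⁿ be a bounded strongly pseudoconvex domain with defining function ρ of class C⁴ on an open set U ⊇ closure(Ω). Let f₀ : ℂ → ℂⁿ be continuous on the closed unit disc closure(𝔻), holomorphic on 𝔻, with f₀(closure(𝔻)) ⊆ Ω. Let K ⊆ 𝔻 be compact, ε > 0, let a₁,…,a_l ∈ 𝔻 be finitely many points, d ∈ ℕ, and α ∈ (0,1). Then there exists a map f : closure(𝔻) → ℂⁿ, continuous on closure(𝔻) and holomorphic on 𝔻, such that: (i) f(𝔻) ⊆ Ω and ρ(f(ζ)) = 0 for every ζ with |ζ| = 1; (ii) the restriction f : 𝔻 → Ω is proper, i.e., for every compact L ⊆ Ω the set f⁻¹(L) ∩ 𝔻 is compact; (iii) sup_{ζ∈K} |f(ζ) − f₀(ζ)| < ε; (iv) for each j ∈ {1,…,l} and each m < d, the m-th complex derivative of f − f₀ vanishes at a_j; (v) for each m ∈ {0,1,2,3} the m-th complex derivative f^{(m)} extends continuously to closure(𝔻), and the extension of f^{(3)} is α-Hölder on closure(𝔻), i.e., there is C ≥ 0 with |f^{(3)}(ζ) − f^{(3)}(ξ)| ≤ C|ζ−ξ|^α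 for all ζ, ξ ∈ closure(𝔻). -/

import Mathlib

open Complex Metric Set Bornology

/-- Second real Fréchet derivative. -/
noncomputable def D2 {E : Type*} [NormedAddCommGroup E] [NormedSpace ℝ E]
    (ρ : E → ℝ) (z w v : E) : ℝ := fderiv ℝ (fderiv ℝ ρ) z w v

/-- The Levi form `L_ρ(z,w) = (1/4)(D²ρ(z)(w,w) + D²ρ(z)(iw,iw))`. -/
noncomputable def levi {E : Type*} [NormedAddCommGroup E] [NormedSpace ℂ E]
    (ρ : E → ℝ) (z w : E) : ℝ :=
  (1/4) * (D2 ρ z w w + D2 ρ z (Complex.I • w) (Complex.I • w))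

/-- The complex differential `∂ρ(z)(w) = (1/2)(Dρ(z)(w) − i·Dρ(z)(iw))`. -/
noncomputable def cdiff {E : Type*} [NormedAddCommGroup E] [NormedSpace ℂ E]
    (ρ : E → ℝ) (z w : E) : ℂ :=
  (1/2 : ℂ) * ((fderiv ℝ ρ z w : ℂ) - Complex.I * (fderiv ℝ ρ z (Complex.I • w) : ℂ))

open scoped InnerProductSpace Topology

/-- Trigonometric approximation on the unit circle, in polynomial form. -/
lemma exists_entire_approx_scalar (φ : ℂ → ℂ) (hφ : ContinuousOn φ (sphere 0 1)) {η : ℝ}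
    (hη : 0 < η) : ∃ M : ℕ, ∃ P : ℂ → ℂ, Differentiable ℂ P ∧
      ∀ ζ : ℂ, ‖ζ‖ = 1 → ‖ζ ^ M * φ ζ - P ζ‖ < η := by
  have : Fact (0 < 2 * Real.pi) := ⟨Real.two_pi_pos⟩
  have hpow : ∀ (k : ℤ) (x : AddCircle (2 * Real.pi)),
      (fourier k x : ℂ) = (fourier 1 x : ℂ) ^ k := by
    intro k x
    induction x using QuotientAddGroup.induction_on with
    | H t =>
      rw [fourier_coe_apply, fourier_coe_apply, ← Complex.exp_int_mul]
      congr 1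
      push_cast
      ring
  have hn1 : ∀ x : AddCircle (2 * Real.pi), ‖(fourier 1 x : ℂ)‖ = 1 := fun x => by
    rw [fourier_one]; exact Circle.norm_coe _
  let F : C(AddCircle (2 * Real.pi), ℂ) :=
    ⟨fun x => φ (fourier 1 x : ℂ), hφ.comp_continuous
      (fourier 1).continuous (fun x => by simpa using hn1 x)⟩
  have hF : F ∈ (Submodule.span ℂ (Set.range (fourier (T := 2 * Real.pi)))).topologicalClosure := by
    rw [span_fourier_closure_eq_top]; trivial
  obtain ⟨G, hG, hFG⟩ := Metric.mem_closure_iff.1 hF η hη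
  have key : ∀ G ∈ Submodule.span ℂ (Set.range (fourier (T := 2 * Real.pi))),
      ∃ M : ℕ, ∃ P : ℂ → ℂ, Differentiable ℂ P ∧
        ∀ x, (fourier 1 x : ℂ) ^ M * G x = P (fourier 1 x : ℂ) := by
    intro G hG
    induction hG using Submodule.span_induction with
    | mem x hx =>
      obtain ⟨n, rfl⟩ := hx
      refine ⟨n.natAbs, fun z => z ^ (n + n.natAbs).toNat, by fun_prop, fun x => ?_⟩
      have h0 : (fourier 1 x : ℂ) ≠ 0 := by
        rw [← norm_pos_iff, hn1]; exact one_pos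
      change _ = (fourier 1 x : ℂ) ^ (n + n.natAbs).toNat
      rw [hpow n, ← zpow_natCast, ← zpow_natCast, ← zpow_add₀ h0]
      congr 1
      omega
    | zero => exact ⟨0, 0, differentiable_const 0, by simp⟩
    | add x y _ _ h1 h2 =>
      obtain ⟨M, P, hP, h⟩ := h1
      obtain ⟨M', P', hP', h'⟩ := h2
      refine ⟨M + M', fun z => z ^ M' * P z + z ^ M * P' z, by fun_prop, fun t => ?_⟩
      change _ = (fourier 1 t : ℂ) ^ M' * P (fourier 1 t) + (fourier 1 t : ℂ) ^ M * P' (fourier 1 t)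
      rw [← h, ← h']
      simp only [ContinuousMap.add_apply]
      ring
    | smul c x _ h1 =>
      obtain ⟨M, P, hP, h⟩ := h1
      refine ⟨M, fun z => c * P z, by fun_prop, fun t => ?_⟩
      change _ = c * P (fourier 1 t)
      rw [← h]
      simp only [ContinuousMap.smul_apply, smul_eq_mul]
      ring
  obtain ⟨M, P, hP, h⟩ := key G hG
  refine ⟨M, P, hP, fun ζ hζ => ?_⟩
  let z : Circle := ⟨ζ, by simpa [Submonoid.unitSphere] using hζ⟩
  obtain ⟨x, hx⟩ := (AddCircle.homeomorphCircle (T := 2 * Real.pi) (by positivity)).surjective z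
  rw [AddCircle.homeomorphCircle_apply] at hx
  have hx' : (fourier 1 x : ℂ) = ζ := by rw [fourier_one, hx]
  have := h x
  rw [hx'] at this
  rw [← this, ← mul_sub, norm_mul, norm_pow, hζ, one_pow, one_mul]
  have h2 := (ContinuousMap.dist_lt_iff hη).1 hFG x
  rw [dist_eq_norm] at h2
  change ‖φ (fourier 1 x : ℂ) - G x‖ < η at h2
  rwa [hx'] at h2

lemma exists_entire_approx {n : ℕ} (φ : ℂ → EuclideanSpace ℂ (Fin n))
    (hφ : ContinuousOn φ (sphere 0 1)) {η : ℝ}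
    (hη : 0 < η) : ∃ M : ℕ, ∃ P : ℂ → EuclideanSpace ℂ (Fin n), Differentiable ℂ P ∧
      ∀ ζ : ℂ, ‖ζ‖ = 1 → ‖ζ ^ M • φ ζ - P ζ‖ < η := by
  have h1 : ∀ i : Fin n, ∃ M : ℕ, ∃ P : ℂ → ℂ, Differentiable ℂ P ∧
      ∀ ζ : ℂ, ‖ζ‖ = 1 → ‖ζ ^ M * φ ζ i - P ζ‖ < η / (n + 1) := fun i =>
    exists_entire_approx_scalar (fun ζ => φ ζ i)
      ((EuclideanSpace.proj (𝕜 := ℂ) i).continuous.comp_continuousOn hφ) (by positivity)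
  choose M P hP h using h1
  refine ⟨∑ i, M i, fun z => ∑ i, z ^ (∑ j ∈ Finset.univ.erase i, M j) •
    (P i z • EuclideanSpace.single i (1:ℂ)), by fun_prop, fun ζ hζ => ?_⟩
  have h2 : ζ ^ (∑ i, M i) • φ ζ = ∑ i, ζ ^ (∑ j ∈ Finset.univ.erase i, M j) •
    ((ζ ^ M i * φ ζ i) • EuclideanSpace.single i (1:ℂ)) := by
    ext k
    simp only [PiLp.smul_apply, WithLp.ofLp_sum, WithLp.ofLp_smul, Finset.sum_apply, Pi.smul_apply,
      PiLp.single_apply, smul_eq_mul]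
    refine Eq.symm ((Finset.sum_eq_single k (fun b _ hb => ?_) (by simp)).trans ?_)
    · rw [if_neg hb.symm]; simp
    · rw [if_pos rfl, ← Finset.add_sum_erase Finset.univ M (Finset.mem_univ k), pow_add]; ring
  rw [h2, ← Finset.sum_sub_distrib]
  calc _ ≤ ∑ i : Fin n, η / (n + 1) := by
        refine norm_sum_le_of_le _ fun i _ => ?_
        rw [← smul_sub, ← sub_smul, norm_smul, norm_smul, norm_pow, hζ, one_pow, one_mul]
        simpa using (h i ζ hζ).le
    _ = n * (η / (n + 1)) := by simp
    _ < η := by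
        rw [mul_div_assoc', div_lt_iff₀ (by positivity)]
        nlinarith

/-- Approximate solution of a Riemann–Hilbert problem with quadratic discs. -/
lemma exists_riemannHilbert {n : ℕ} {Ω : Set (EuclideanSpace ℂ (Fin n))} (hΩ : IsOpen Ω)
    {f V W : ℂ → EuclideanSpace ℂ (Fin n)} {b : ℂ → ℂ} (hf : DiffContOnCl ℂ f (ball 0 1))
    (hfΩ : MapsTo f (closedBall 0 1) Ω) (hb : Differentiable ℂ b)
    (hb0 : ∀ ζ : ℂ, ‖ζ‖ = 1 → b ζ ≠ 0)
    (hV : ContinuousOn V (sphere 0 1)) (hW : ContinuousOn W (sphere 0 1))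
    (hVW : ∀ ζ l : ℂ, ‖ζ‖ = 1 → ‖l‖ ≤ 1 → f ζ + l • V ζ + l ^ 2 • W ζ ∈ Ω)
    {K : Set ℂ} (hK : IsCompact K) (hKb : K ⊆ ball 0 1) {η : ℝ} (hη : 0 < η) :
    ∃ G : ℂ → EuclideanSpace ℂ (Fin n), DiffContOnCl ℂ G (ball 0 1) ∧
      MapsTo (fun z => f z + b z • G z) (closedBall 0 1) Ω ∧ (∀ z ∈ K, ‖b z • G z‖ < η) ∧
      ∀ ζ : ℂ, ‖ζ‖ = 1 → ∃ l : ℂ, ‖l‖ = 1 ∧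
        ‖f ζ + b ζ • G ζ - (f ζ + l • V ζ + l ^ 2 • W ζ)‖ < η := by
  have hfc : ContinuousOn f (closedBall 0 1) := by
    have := hf.continuousOn; rwa [closure_ball _ one_ne_zero] at this
  have hsub : sphere (0:ℂ) 1 ⊆ closedBall 0 1 := sphere_subset_closedBall
  -- compact sets in `Ω`
  have hC2 : IsCompact (f '' closedBall 0 1) := (isCompact_closedBall _ _).image_of_continuousOn hfc
  obtain ⟨δ₂, hδ₂, h2⟩ := hC2.exists_thickening_subset_open hΩ hfΩ.image_subset
  have hC1 : IsCompact ((fun p : ℂ × ℂ => f p.1 + p.2 • V p.1 + p.2 ^ 2 • W p.1) ''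
      (sphere 0 1 ×ˢ closedBall 0 1)) := by
    refine ((isCompact_sphere _ _).prod (isCompact_closedBall _ _)).image_of_continuousOn ?_
    have e1 : MapsTo (Prod.fst : ℂ × ℂ → ℂ) (sphere (0:ℂ) 1 ×ˢ closedBall (0:ℂ) 1)
      (sphere (0:ℂ) 1) := fun p hp => hp.1
    have := (hfc.mono hsub).comp continuousOn_fst e1
    have hV' := hV.comp continuousOn_fst e1
    have hW' := hW.comp continuousOn_fst e1
    exact (this.add (continuousOn_snd.smul hV')).add ((continuousOn_snd.pow 2).smul hW')
  obtain ⟨δ₁, hδ₁, h1⟩ := hC1.exists_thickening_subset_open hΩ (by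
    rintro _ ⟨⟨ζ, l⟩, ⟨h, h'⟩, rfl⟩
    exact hVW ζ l (by simpa using h) (by simpa using h'))
  obtain ⟨e, he, he1, he2, he3⟩ : ∃ e > 0, e ≤ δ₁ / 8 ∧ e ≤ δ₂ / 8 ∧ e ≤ η / 8 :=
    ⟨min (δ₁ / 8) (min (δ₂ / 8) (η / 8)), by positivity, min_le_left _ _,
      (min_le_right _ _).trans (min_le_left _ _), (min_le_right _ _).trans (min_le_right _ _)⟩
  obtain ⟨B, hB⟩ := (isCompact_closedBall (0:ℂ) 1).exists_bound_of_continuousOn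
    hb.continuous.continuousOn
  have hB0 : 0 ≤ B := (norm_nonneg _).trans (hB 0 (by simp))
  have hbc : ContinuousOn (fun ζ => (b ζ)⁻¹) (sphere 0 1) :=
    hb.continuous.continuousOn.inv₀ fun ζ hζ => hb0 ζ (by simpa using hζ)
  obtain ⟨M, P, hP, hPV⟩ := exists_entire_approx (fun ζ => (b ζ)⁻¹ • V ζ) (hbc.smul hV)
    (η := e / (B + 1)) (by positivity)
  obtain ⟨M', P', hP', hPW⟩ := exists_entire_approx (fun ζ => (b ζ)⁻¹ • W ζ) (hbc.smul hW)
    (η := e / (B + 1)) (by positivity)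
  have approx : ∀ (M : ℕ) (P V : ℂ → EuclideanSpace ℂ (Fin n)),
      (∀ ζ : ℂ, ‖ζ‖ = 1 → ‖ζ ^ M • (b ζ)⁻¹ • V ζ - P ζ‖ < e / (B + 1)) →
      ∀ ζ : ℂ, ‖ζ‖ = 1 → ‖b ζ • (ζ ^ M)⁻¹ • P ζ - V ζ‖ ≤ e := by
    intro M P V h ζ hζ
    have hζ0 : ζ ^ M ≠ 0 := pow_ne_zero _ (by rw [← norm_pos_iff, hζ]; exact one_pos)
    have : b ζ • (ζ ^ M)⁻¹ • P ζ - V ζ =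
        - (b ζ • (ζ ^ M)⁻¹ • (ζ ^ M • (b ζ)⁻¹ • V ζ - P ζ)) := by
      rw [smul_sub, smul_sub, inv_smul_smul₀ hζ0, smul_inv_smul₀ (hb0 ζ hζ)]
      abel
    rw [this, norm_neg, norm_smul, norm_smul, norm_inv, norm_pow, hζ, one_pow, inv_one, one_mul]
    calc _ ≤ B * (e / (B + 1)) := by
          gcongr
          · exact hB ζ (by simp [hζ])
          · exact (h ζ hζ).le
      _ ≤ e := by
          rw [mul_div_assoc', div_le_iff₀ (by positivity)]
          nlinarith
  have hQV := approx M P V hPV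
  have hQW := approx M' P' W hPW
  -- uniform continuity on an annulus
  have hann : IsCompact (closedBall (0:ℂ) 1 \ ball 0 (1/2)) :=
    (isCompact_closedBall _ _).diff isOpen_ball
  have hz0 : ∀ z ∈ closedBall (0:ℂ) 1 \ ball 0 (1/2), z ≠ 0 := by
    rintro z ⟨-, hz⟩ rfl
    exact hz (by simp)
  have hcont : ∀ (M : ℕ) (P : ℂ → EuclideanSpace ℂ (Fin n)), Differentiable ℂ P →
      ContinuousOn (fun z => b z • (z ^ M)⁻¹ • P z) (closedBall (0:ℂ) 1 \ ball 0 (1/2)) := by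
    intro M P hP
    exact hb.continuous.continuousOn.smul (((continuous_pow M).continuousOn.inv₀
      fun z hz => pow_ne_zero _ (hz0 z hz)).smul hP.continuous.continuousOn)
  have hu := hann.uniformContinuousOn_of_continuous
    ((hfc.mono sdiff_subset).prodMk ((hcont M P hP).prodMk (hcont M' P' hP')))
  rw [Metric.uniformContinuousOn_iff] at hu
  obtain ⟨d, hd, hu⟩ := hu e he
  obtain ⟨rK, ⟨hrK0, hrK1⟩, hrK⟩ := exists_pos_lt_subset_ball one_pos hK.isClosed hKb
  obtain ⟨r, hr1, hrK', hrd, hrh⟩ : ∃ r < 1, rK ≤ r ∧ 1 - d < r ∧ 1 / 2 ≤ r := by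
    have : max (max rK (1 - d)) (1 / 2) < 1 := by
      simp only [max_lt_iff]
      exact ⟨⟨hrK1, by linarith⟩, by norm_num⟩
    obtain ⟨r, h, h'⟩ := exists_between this
    simp only [max_lt_iff] at h
    exact ⟨r, h', h.1.1.le, h.1.2, h.2.le⟩
  have hr0 : 0 < r := by linarith
  obtain ⟨C, hC⟩ := (isCompact_closedBall (0:ℂ) 1).exists_bound_of_continuousOn
    hP.continuous.continuousOn
  obtain ⟨C', hC'⟩ := (isCompact_closedBall (0:ℂ) 1).exists_bound_of_continuousOn
    hP'.continuous.continuousOn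
  have hC0 : 0 ≤ C := (norm_nonneg _).trans (hC 0 (by simp))
  have hC0' : 0 ≤ C' := (norm_nonneg _).trans (hC' 0 (by simp))
  obtain ⟨k, hk⟩ := exists_pow_lt_of_lt_one (show 0 < e / (B * (C + C') + 1) by positivity) hr1
  rw [lt_div_iff₀ (by positivity)] at hk
  set N := k + M + M' with hN
  have hsmall : ∀ z : ℂ, ‖z‖ ≤ r →
      ‖b z • (z ^ (N - M) • P z + z ^ (2 * N - M') • P' z)‖ ≤ e := by
    intro z hz
    have hz1 : z ∈ closedBall (0:ℂ) 1 := by simpa using hz.trans hr1.le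
    have hp : ∀ j, k ≤ j → ‖z‖ ^ j ≤ r ^ k := fun j hj =>
      (pow_le_pow_left₀ (norm_nonneg _) hz j).trans (pow_le_pow_of_le_one hr0.le hr1.le hj)
    rw [norm_smul]
    calc _ ≤ B * (r ^ k * C + r ^ k * C') := by
          gcongr
          · exact hB z hz1
          · refine (norm_add_le _ _).trans ?_
            rw [norm_smul, norm_smul, norm_pow, norm_pow]
            gcongr
            · exact hp _ (by omega)
            · exact hC z hz1
            · exact hp _ (by omega)
            · exact hC' z hz1
      _ ≤ e := by nlinarith [pow_pos hr0 k]
  have hfact : ∀ z : ℂ, z ≠ 0 → b z • (z ^ (N - M) • P z + z ^ (2 * N - M') • P' z) =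
      z ^ N • (b z • (z ^ M)⁻¹ • P z) + (z ^ N) ^ 2 • (b z • (z ^ M')⁻¹ • P' z) := by
    intro z hz
    rw [smul_add, pow_sub₀ z hz (by omega), pow_sub₀ z hz (by omega), mul_smul, mul_smul,
      smul_comm (b z) (z ^ N), smul_comm (b z) (z ^ (2 * N)), ← pow_mul, mul_comm N 2]
  have hlarge : ∀ z : ℂ, r ≤ ‖z‖ → ‖z‖ ≤ 1 → ∃ ζ : ℂ, ‖ζ‖ = 1 ∧ dist z ζ < d ∧
      (‖z‖ = 1 → z = ζ) ∧
      ‖f z + b z • (z ^ (N - M) • P z + z ^ (2 * N - M') • P' z) -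
        (f ζ + z ^ N • V ζ + (z ^ N) ^ 2 • W ζ)‖ ≤ 5 * e := by
    intro z hz hz1
    have hzpos : 0 < ‖z‖ := by linarith
    have hz0' : z ≠ 0 := norm_pos_iff.1 hzpos
    have hζ : ‖z / (‖z‖ : ℂ)‖ = 1 := by
      rw [norm_div, Complex.norm_real, norm_norm, div_self hzpos.ne']
    have hdist : dist z (z / (‖z‖ : ℂ)) < d := by
      have : z - z / (‖z‖ : ℂ) = z / (‖z‖ : ℂ) * ((‖z‖ - 1 : ℝ) : ℂ) := by
        have : (‖z‖ : ℂ) ≠ 0 := by exact_mod_cast hzpos.ne'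
        push_cast; field_simp
      rw [dist_eq_norm, this, norm_mul, hζ, one_mul, Complex.norm_real, Real.norm_eq_abs,
        abs_of_nonpos (by linarith)]
      linarith
    refine ⟨z / (‖z‖ : ℂ), hζ, hdist, fun h => by simp [h], ?_⟩
    set ζ := z / (‖z‖ : ℂ)
    have hh := hu z ⟨by simpa using hz1, by simpa using (hrh.trans hz)⟩ ζ
      ⟨by simp [hζ], by simp [hζ]; norm_num⟩ hdist
    rw [Prod.dist_eq, Prod.dist_eq, max_lt_iff, max_lt_iff, dist_eq_norm, dist_eq_norm,
      dist_eq_norm] at hh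
    obtain ⟨g1, g2, g3⟩ := hh
    rw [hfact z hz0']
    have hl : ‖z ^ N‖ ≤ 1 := by rw [norm_pow]; exact pow_le_one₀ (norm_nonneg _) hz1
    have key : ∀ A A' B' B'' C' C'' X X'' : EuclideanSpace ℂ (Fin n),
        ‖A - A'‖ < e → ‖B' - B''‖ < e → ‖C' - C''‖ < e → ‖B'' - X‖ ≤ e → ‖C'' - X''‖ ≤ e →
        ‖A + (z ^ N • B' + (z ^ N) ^ 2 • C') - (A' + z ^ N • X + (z ^ N) ^ 2 • X'')‖ ≤ 5 * e := by
      intro A A' B' B'' C' C'' X X'' h1 h2 h3 h4 h5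
      have : A + (z ^ N • B' + (z ^ N) ^ 2 • C') - (A' + z ^ N • X + (z ^ N) ^ 2 • X'') =
        (A - A') + z ^ N • ((B' - B'') + (B'' - X)) +
          (z ^ N) ^ 2 • ((C' - C'') + (C'' - X'')) := by
        rw [sub_add_sub_cancel, sub_add_sub_cancel, smul_sub, smul_sub]; abel
      rw [this]
      have hs : ∀ (l : ℂ) (Y Z : EuclideanSpace ℂ (Fin n)), ‖l‖ ≤ 1 → ‖Y‖ < e → ‖Z‖ ≤ e →
          ‖l • (Y + Z)‖ ≤ 2 * e := by
        intro l Y Z hl hY hZ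
        rw [norm_smul]
        calc _ ≤ 1 * ‖Y + Z‖ := by gcongr
          _ ≤ 2 * e := by linarith [norm_add_le Y Z]
      have a1 := hs _ _ _ hl h2 h4
      have a2 := hs ((z ^ N) ^ 2) _ _
        (by rw [norm_pow]; exact pow_le_one₀ (norm_nonneg _) hl) h3 h5
      exact norm_add₃_le.trans (by linarith)
    exact key _ _ _ _ _ _ _ _ g1 g2 g3 (hQV ζ hζ) (hQW ζ hζ)
  refine ⟨fun z => z ^ (N - M) • P z + z ^ (2 * N - M') • P' z,
    Differentiable.diffContOnCl (by fun_prop), ?_, ?_, ?_⟩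
  · intro z hz
    have hz1 : ‖z‖ ≤ 1 := by simpa using hz
    rcases le_total ‖z‖ r with h | h
    · refine h2 (mem_thickening_iff.2 ⟨f z, mem_image_of_mem _ hz, ?_⟩)
      rw [dist_eq_norm, add_sub_cancel_left]
      exact (hsmall z h).trans_lt (by linarith)
    · obtain ⟨ζ, hζ, -, -, hb⟩ := hlarge z h hz1
      refine h1 (mem_thickening_iff.2 ⟨_, ⟨(ζ, z ^ N), ⟨by simpa using hζ, ?_⟩, rfl⟩, ?_⟩)
      · simpa using pow_le_one₀ (norm_nonneg _) hz1
      · rw [dist_eq_norm]; exact hb.trans_lt (by linarith)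
  · intro z hz
    exact (hsmall z ((mem_ball_zero_iff.1 (hrK hz)).le.trans hrK')).trans_lt (by linarith)
  · intro ζ hζ
    refine ⟨ζ ^ N, by simp [hζ], ?_⟩
    obtain ⟨ζ', -, -, h, hb⟩ := hlarge ζ (by linarith) hζ.le
    rw [← h hζ] at hb
    exact hb.trans_lt (by linarith)

lemma finrank_real_euclidean (n : ℕ) :
    Module.finrank ℝ (EuclideanSpace ℂ (Fin n)) = 2 * n := by
  rw [finrank_real_of_complex, finrank_euclideanSpace, Fintype.card_fin]

/-- A continuous unit section of the orthogonal complement of a nowhere vanishing vector field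
along a compact part of the circle. -/
lemma exists_unit_section {n : ℕ} (hn : 2 ≤ n) {X : ℂ → EuclideanSpace ℂ (Fin n)}
    (hX : ContinuousOn X (sphere 0 1)) {C : Set ℂ} (hC : IsCompact C) (hCs : C ⊆ sphere 0 1)
    (hX0 : ∀ ζ ∈ C, X ζ ≠ 0) :
    ∃ V : ℂ → EuclideanSpace ℂ (Fin n), ContinuousOn V (sphere 0 1) ∧
      (∀ ζ ∈ C, ⟪X ζ, V ζ⟫_ℂ = 0 ∧ ‖V ζ‖ = 1) ∧ ∀ ζ : ℂ, ‖V ζ‖ ≤ 1 := by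
  rcases C.eq_empty_or_nonempty with rfl | hne
  · exact ⟨0, continuousOn_const, by simp, by simp⟩
  have lower : ∀ Y : ℂ → EuclideanSpace ℂ (Fin n), ContinuousOn Y (sphere 0 1) →
      (∀ ζ ∈ C, Y ζ ≠ 0) → ∃ m > 0, ∀ ζ ∈ C, m ≤ ‖Y ζ‖ := by
    intro Y hY h0
    obtain ⟨ζ, hζ, h⟩ := hC.exists_isMinOn hne (hY.mono hCs).norm
    exact ⟨‖Y ζ‖, norm_pos_iff.2 (h0 ζ hζ), fun z hz => h hz⟩
  obtain ⟨m, hm, hmX⟩ := lower X hX hX0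
  obtain ⟨M, P, hP, hPX⟩ := exists_entire_approx X hX hm
  have hr : Dense (Set.range fun p : ℝ × ℂ => p.2 • P (Complex.exp (p.1 * I)))ᶜ := by
    apply ContDiff.dense_compl_range_of_finrank_lt_finrank
    · have h1 : ContDiff ℝ 1 P := hP.contDiff.restrict_scalars ℝ
      have h2 : ContDiff ℝ 1 (fun p : ℝ × ℂ => Complex.exp (p.1 * I)) := by
        have : ContDiff ℝ 1 (fun p : ℝ × ℂ => (p.1 : ℂ)) :=
          Complex.ofRealCLM.contDiff.comp contDiff_fst
        exact (this.mul contDiff_const).cexp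
      exact contDiff_snd.smul (h1.comp h2)
    · rw [finrank_real_euclidean, Module.finrank_prod, Module.finrank_self,
        Complex.finrank_real_complex]
      omega
  obtain ⟨e, he⟩ := hr.nonempty
  have hPc : ContinuousOn P (sphere 0 1) := hP.continuous.continuousOn
  set V₀ : ℂ → EuclideanSpace ℂ (Fin n) := fun ζ =>
    (⟪P ζ, P ζ⟫_ℂ) • e - ⟪P ζ, e⟫_ℂ • P ζ with hV₀
  set V₁ : ℂ → EuclideanSpace ℂ (Fin n) := fun ζ =>
    (⟪X ζ, X ζ⟫_ℂ) • V₀ ζ - ⟪X ζ, V₀ ζ⟫_ℂ • X ζ with hV₁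
  have hV₀c : ContinuousOn V₀ (sphere 0 1) :=
    ((ContinuousOn.inner (𝕜 := ℂ) hPc hPc).smul continuousOn_const).sub
      ((ContinuousOn.inner (𝕜 := ℂ) hPc continuousOn_const).smul hPc)
  have hV₁c : ContinuousOn V₁ (sphere 0 1) :=
    ((ContinuousOn.inner (𝕜 := ℂ) hX hX).smul hV₀c).sub
      ((ContinuousOn.inner (𝕜 := ℂ) hX hV₀c).smul hX)
  have orth₀ : ∀ ζ, ⟪P ζ, V₀ ζ⟫_ℂ = 0 := fun ζ => by
    simp only [hV₀, inner_sub_right, inner_smul_right]; ring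
  have orth₁ : ∀ ζ, ⟪X ζ, V₁ ζ⟫_ℂ = 0 := fun ζ => by
    simp only [hV₁, inner_sub_right, inner_smul_right]; ring
  have hV₁0 : ∀ ζ ∈ C, V₁ ζ ≠ 0 := by
    intro ζ hζ h0
    have hζ1 : ‖ζ‖ = 1 := by simpa using hCs hζ
    have hlt := (hPX ζ hζ1).trans_le (hmX ζ hζ)
    have hXX : ⟪X ζ, X ζ⟫_ℂ ≠ 0 := inner_self_ne_zero.2 (hX0 ζ hζ)
    -- `X` is not orthogonal to `P`
    have hPX0 : ⟪P ζ, X ζ⟫_ℂ ≠ 0 := by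
      intro h
      have h1 : ⟪ζ ^ M • X ζ - P ζ, X ζ⟫_ℂ = (starRingEnd ℂ) (ζ ^ M) * ⟪X ζ, X ζ⟫_ℂ := by
        rw [inner_sub_left, h, sub_zero, inner_smul_left]
      have h2 := norm_inner_le_norm (𝕜 := ℂ) (ζ ^ M • X ζ - P ζ) (X ζ)
      rw [h1, norm_mul, RCLike.norm_conj, norm_pow, hζ1, one_pow, one_mul,
        inner_self_eq_norm_sq_to_K] at h2
      simp only [norm_pow, coe_algebraMap, norm_real, norm_norm] at h2
      nlinarith [norm_pos_iff.2 (hX0 ζ hζ)]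
    have hP0 : P ζ ≠ 0 := fun h => hPX0 (by rw [h, inner_zero_left])
    have h3 : V₀ ζ = (⟪X ζ, V₀ ζ⟫_ℂ / ⟪X ζ, X ζ⟫_ℂ) • X ζ := by
      have : (⟪X ζ, X ζ⟫_ℂ) • V₀ ζ = ⟪X ζ, V₀ ζ⟫_ℂ • X ζ := sub_eq_zero.1 h0
      rw [div_eq_inv_mul, mul_smul, ← this, inv_smul_smul₀ hXX]
    have h4 : ⟪X ζ, V₀ ζ⟫_ℂ / ⟪X ζ, X ζ⟫_ℂ = 0 := by
      have := orth₀ ζ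
      rw [h3, inner_smul_right] at this
      exact (mul_eq_zero.1 this).resolve_right hPX0
    rw [h4, zero_smul] at h3
    have hPP : ⟪P ζ, P ζ⟫_ℂ ≠ 0 := inner_self_ne_zero.2 hP0
    apply he
    obtain ⟨t, ht⟩ := (Complex.norm_eq_one_iff ζ).1 hζ1
    refine ⟨(t, ⟪P ζ, e⟫_ℂ / ⟪P ζ, P ζ⟫_ℂ), ?_⟩
    have : (⟪P ζ, P ζ⟫_ℂ) • e = ⟪P ζ, e⟫_ℂ • P ζ := sub_eq_zero.1 h3
    simp only [ht]
    rw [div_eq_inv_mul, mul_smul, ← this, inv_smul_smul₀ hPP]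
  obtain ⟨μ, hμ, hμV⟩ := lower V₁ hV₁c hV₁0
  have hmax : ∀ ζ, 0 < max ‖V₁ ζ‖ μ := fun ζ => lt_max_of_lt_right hμ
  refine ⟨fun ζ => (max ‖V₁ ζ‖ μ)⁻¹ • V₁ ζ, ?_, fun ζ hζ => ⟨?_, ?_⟩, fun ζ => ?_⟩
  · exact ((ContinuousOn.sup hV₁c.norm continuousOn_const).inv₀ fun ζ _ => (hmax ζ).ne').smul hV₁c
  · rw [inner_smul_right_eq_smul, orth₁, smul_zero]
  · rw [norm_smul, max_eq_left (hμV ζ hζ), norm_inv, norm_norm]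
    exact inv_mul_cancel₀ (hμ.trans_le (hμV ζ hζ)).ne'
  · rw [norm_smul, norm_inv, Real.norm_of_nonneg (hmax ζ).le, inv_mul_le_iff₀ (hmax ζ), mul_one]
    exact le_max_left _ _

section KeyEstimate

variable {E : Type*} [NormedAddCommGroup E] [InnerProductSpace ℂ E] [FiniteDimensional ℂ E]

/-- The vector representing the complex-linear functional `w ↦ DT(w) - i DT(iw)`. -/
noncomputable def cgrad (T : E → ℝ) (p : E) : E :=
  have := FiniteDimensional.complete ℂ E
  (InnerProductSpace.toDual ℂ E).symm (StrongDual.extendRCLikeₗᵢ (𝕜 := ℂ) (fderiv ℝ T p))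

lemma inner_cgrad (T : E → ℝ) (p w : E) :
    ⟪cgrad T p, w⟫_ℂ = (fderiv ℝ T p w : ℂ) - I * (fderiv ℝ T p (I • w) : ℂ) := by
  have := FiniteDimensional.complete ℂ E
  rw [cgrad, InnerProductSpace.toDual_symm_apply]
  exact StrongDual.extendRCLike_apply (𝕜 := ℂ) _ _

lemma re_inner_cgrad (T : E → ℝ) (p w : E) : (⟪cgrad T p, w⟫_ℂ).re = fderiv ℝ T p w := by
  simp [inner_cgrad]

lemma cgrad_ne_zero {T : E → ℝ} {p : E} (h : fderiv ℝ T p ≠ 0) : cgrad T p ≠ 0 := by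
  intro h0
  apply h
  ext w
  rw [← re_inner_cgrad, h0, inner_zero_left]
  simp

lemma continuousOn_cgrad {T : E → ℝ} {O : Set E} (h : ContinuousOn (fderiv ℝ T) O) :
    ContinuousOn (cgrad T) O := by
  have := FiniteDimensional.complete ℂ E
  exact (InnerProductSpace.toDual ℂ E).symm.continuous.comp_continuousOn
    ((StrongDual.extendRCLikeₗᵢ (𝕜 := ℂ) (F := E)).continuous.comp_continuousOn h)

/-- The coefficient of the pluriharmonic part of the Hessian in the direction `V`. -/
noncomputable def quadCoeff (T : E → ℝ) (p V : E) : ℂ :=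
  (((D2 T p V V - D2 T p (I • V) (I • V)) / 2 : ℝ) - I * (D2 T p V (I • V) : ℝ)) / 2

/-- The second order correction that kills the pluriharmonic part of the Hessian. -/
noncomputable def corr (T : E → ℝ) (p V : E) : E :=
  -(quadCoeff T p V / ⟪cgrad T p, cgrad T p⟫_ℂ) • cgrad T p

omit [FiniteDimensional ℂ E] in
lemma D2_symm {T : E → ℝ} {p : E} (h : ContDiffAt ℝ 2 T p) (v w : E) :
    D2 T p v w = D2 T p w v :=
  (h.isSymmSndFDerivAt (by simp)).eq v w

omit [FiniteDimensional ℂ E] in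
lemma smul_eq_re_add_im (l : ℂ) (v : E) : l • v = l.re • v + l.im • (I • v) := by
  rw [← Complex.coe_smul, ← Complex.coe_smul, smul_smul, ← add_smul, Complex.re_add_im]

omit [FiniteDimensional ℂ E] in
lemma D2_smul_smul {T : E → ℝ} {p : E} (h : ContDiffAt ℝ 2 T p) (V : E) (l m : ℂ) :
    D2 T p (l • V) (m • V) = 2 * levi T p V * ((starRingEnd ℂ) l * m).re +
      2 * (quadCoeff T p V * l * m).re := by
  have hs := D2_symm h V (I • V)
  rw [smul_eq_re_add_im l, smul_eq_re_add_im m]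
  have e : D2 T p (l.re • V + l.im • I • V) (m.re • V + m.im • I • V) =
      l.re * m.re * D2 T p V V + l.re * m.im * D2 T p V (I • V) +
      l.im * m.re * D2 T p (I • V) V + l.im * m.im * D2 T p (I • V) (I • V) := by
    simp only [D2, map_add, map_smul, add_apply, smul_apply,
      smul_eq_mul]
    ring
  rw [e, ← hs, quadCoeff, levi]
  simp
  ring

omit [FiniteDimensional ℂ E] in
lemma levi_smul (T : E → ℝ) (p V : E) (t : ℝ) : levi T p (t • V) = t ^ 2 * levi T p V := by
  simp only [levi, D2, smul_comm Complex.I t, map_smul, smul_apply, smul_eq_mul]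
  ring

lemma fderiv_corr {T : E → ℝ} {p : E} (h : fderiv ℝ T p ≠ 0) (V : E) (l : ℂ) :
    fderiv ℝ T p (l • corr T p V) = - (quadCoeff T p V * l).re := by
  have hX : ⟪cgrad T p, cgrad T p⟫_ℂ ≠ 0 := inner_self_ne_zero.2 (cgrad_ne_zero h)
  rw [← re_inner_cgrad, inner_smul_right, corr, neg_smul, inner_neg_right, inner_smul_right,
    div_mul_cancel₀ _ hX, mul_neg, Complex.neg_re, mul_comm]

/-- Uniform first order Taylor expansion near a compact set. -/
lemma exists_uniform_taylor {F G : Type*} [NormedAddCommGroup F] [NormedSpace ℝ F]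
    [NormedAddCommGroup G] [NormedSpace ℝ G] {f : F → G} {O Z : Set F} (hO : IsOpen O)
    (hf : ContDiffOn ℝ 1 f O) (hZ : IsCompact Z) (hZO : Z ⊆ O) {κ : ℝ} (hκ : 0 < κ) :
    ∃ r > 0, ∀ p ∈ Z, ∀ h, ‖h‖ < r → p + h ∈ O ∧ ‖f (p + h) - f p - fderiv ℝ f p h‖ ≤ κ * ‖h‖ := by
  have hc : ContinuousOn (fderiv ℝ f) O := hf.continuousOn_fderiv_of_isOpen hO le_rfl
  have h1 := hZ.uniformContinuousAt_of_continuousAt (fderiv ℝ f)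
    (fun a ha => hc.continuousAt (hO.mem_nhds (hZO ha))) (Metric.dist_mem_uniformity hκ)
  obtain ⟨r₁, hr₁, h1⟩ := Metric.mem_uniformity_dist.1 h1
  obtain ⟨r₂, hr₂, h2⟩ := hZ.exists_thickening_subset_open hO hZO
  refine ⟨min r₁ r₂, by positivity, fun p hp h hh => ?_⟩
  have hb : ∀ x ∈ ball p (min r₁ r₂), x ∈ O := fun x hx => h2 (mem_thickening_iff.2
    ⟨p, hp, (mem_ball.1 hx).trans_le (min_le_right _ _)⟩)
  have hph : p + h ∈ ball p (min r₁ r₂) := by simpa using hh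
  refine ⟨hb _ hph, ?_⟩
  have := (convex_ball p (min r₁ r₂)).norm_image_sub_le_of_norm_fderiv_le' (𝕜 := ℝ) (f := f)
    (φ := fderiv ℝ f p) (C := κ)
    (fun x hx => ((hf.contDiffAt (hO.mem_nhds (hb x hx))).differentiableAt (by norm_num)))
    (fun x hx => ?_) (mem_ball_self (by positivity)) hph
  · simpa using this
  · have h3 := h1 (a := p) (b := x) (by
      rw [dist_comm]; exact (mem_ball.1 hx).trans_le (min_le_left _ _)) hp
    rw [← dist_eq_norm, dist_comm]
    exact (show dist _ _ < κ from h3).le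

end KeyEstimate

section KeyEstimate

variable {E : Type*} [NormedAddCommGroup E] [InnerProductSpace ℂ E] [FiniteDimensional ℂ E]

omit [FiniteDimensional ℂ E] in
lemma norm_quadCoeff_le {T : E → ℝ} {p : E} {C : ℝ} (h : ‖fderiv ℝ (fderiv ℝ T) p‖ ≤ C)
    {V : E} (hV : ‖V‖ ≤ 1) : ‖quadCoeff T p V‖ ≤ C := by
  have hC : 0 ≤ C := le_trans (ContinuousLinearMap.opNorm_nonneg _) h
  have hD : ∀ v w : E, ‖v‖ ≤ 1 → ‖w‖ ≤ 1 → |D2 T p v w| ≤ C := by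
    intro v w hv hw
    rw [D2, ← Real.norm_eq_abs]
    calc _ ≤ ‖fderiv ℝ (fderiv ℝ T) p‖ * ‖v‖ * ‖w‖ := ContinuousLinearMap.le_opNorm₂ _ _ _
      _ ≤ C * 1 * 1 := by gcongr
      _ = C := by ring
  have hI : ‖I • V‖ ≤ 1 := by rw [norm_smul, Complex.norm_I, one_mul]; exact hV
  have h1 := hD V V hV hV
  have h2 := hD _ _ hI hI
  have h3 := hD V _ hV hI
  rw [quadCoeff, norm_div, div_le_iff₀ (by simp)]
  refine (norm_sub_le _ _).trans ?_
  rw [norm_mul, Complex.norm_I, one_mul, Complex.norm_real, Complex.norm_real, Real.norm_eq_abs,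
    Real.norm_eq_abs, abs_div]
  have := abs_sub (D2 T p V V) (D2 T p (I • V) (I • V))
  have h2' : ‖(2:ℂ)‖ = 2 := by simp
  rw [h2', abs_two]
  linarith

/-- Along the quadratic disc `l ↦ p + l V + l² W` with `V` in the complex tangent space and `W` the
correction, `T` grows like the Levi form, uniformly on compacts. -/
lemma exists_key_estimate {T : E → ℝ} {O Z : Set E} (hO : IsOpen O)
    (hT : ContDiffOn ℝ 2 T O) (hZ : IsCompact Z) (hZO : Z ⊆ O)
    (hD : ∀ p ∈ Z, fderiv ℝ T p ≠ 0) {κ : ℝ} (hκ : 0 < κ) :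
    ∃ r > 0, ∀ p ∈ Z, ∀ V : E, ‖V‖ ≤ 1 → ⟪cgrad T p, V⟫_ℂ = 0 → ∀ l : ℂ, ‖l‖ ≤ r →
      p + l • V + l ^ 2 • corr T p V ∈ O ∧ ∀ m : ℂ,
      |fderiv ℝ T (p + l • V + l ^ 2 • corr T p V) (m • V + (2 * l * m) • corr T p V) -
        2 * levi T p V * ((starRingEnd ℂ) l * m).re| ≤ κ * ‖l‖ * ‖m‖ := by
  have hT1 : ContDiffOn ℝ 1 (fderiv ℝ T) O := hT.fderiv_of_isOpen hO (by norm_num)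
  have hT0 : ContinuousOn (fderiv ℝ T) O := hT1.continuousOn
  have hT2 : ContinuousOn (fderiv ℝ (fderiv ℝ T)) O := hT1.continuousOn_fderiv_of_isOpen hO le_rfl
  obtain ⟨C, hC⟩ : ∃ C, ∀ p ∈ Z, ‖fderiv ℝ (fderiv ℝ T) p‖ ≤ C := by
    exact hZ.exists_bound_of_continuousOn (E := E →L[ℝ] E →L[ℝ] ℝ) (hT2.mono hZO)
  obtain ⟨m, hm, hmX⟩ : ∃ m > 0, ∀ p ∈ Z, m ≤ ‖cgrad T p‖ := by
    rcases Z.eq_empty_or_nonempty with rfl | hne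
    · exact ⟨1, one_pos, by simp⟩
    obtain ⟨p, hp, h⟩ := hZ.exists_isMinOn hne ((continuousOn_cgrad hT0).mono hZO).norm
    exact ⟨_, norm_pos_iff.2 (cgrad_ne_zero (hD p hp)), fun z hz => h hz⟩
  obtain ⟨B, hB0, hCB, hWB⟩ : ∃ B : ℝ, 1 ≤ B ∧ C ≤ B ∧ C / m ≤ B :=
    ⟨max 1 (max C (C / m)), le_max_left _ _, (le_max_left _ _).trans (le_max_right _ _),
      (le_max_right _ _).trans (le_max_right _ _)⟩
  have hW : ∀ p ∈ Z, ∀ V : E, ‖V‖ ≤ 1 → ‖corr T p V‖ ≤ B := by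
    intro p hp V hV
    have hq := norm_quadCoeff_le (hC p hp) hV
    have hX := hm.trans_le (hmX p hp)
    have hC0 : 0 ≤ C := (norm_nonneg _).trans hq
    refine le_trans ?_ hWB
    rw [corr, norm_smul, norm_neg, norm_div, inner_self_eq_norm_sq_to_K]
    simp only [norm_pow, coe_algebraMap, norm_real, norm_norm]
    rw [div_mul_eq_mul_div, div_le_div_iff₀ (by positivity) hm]
    calc ‖quadCoeff T p V‖ * ‖cgrad T p‖ * m ≤ C * ‖cgrad T p‖ * ‖cgrad T p‖ := by
          gcongr; exact hmX p hp
      _ = C * ‖cgrad T p‖ ^ 2 := by ring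
  set κ' := κ / (2 * (1 + B) * (1 + 2 * B)) with hκ'
  obtain ⟨r, hr, htay⟩ := exists_uniform_taylor hO hT1 hZ hZO (κ := κ') (by positivity)
  obtain ⟨s, hs, hs1, hsr, hsκ⟩ : ∃ s > 0, s ≤ 1 ∧ (1 + B) * s < r ∧
      s * (B * (B * (1 + 2 * B) + 2 * B)) ≤ κ / 2 := by
    refine ⟨min 1 (min (r / (2 * (1 + B))) (κ / 2 / (B * (B * (1 + 2 * B) + 2 * B)))),
      by positivity,
      min_le_left _ _, ?_, ?_⟩
    · calc (1 + B) * min 1 (min (r / (2 * (1 + B))) _) ≤ (1 + B) * (r / (2 * (1 + B))) := by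
            gcongr; exact (min_le_right _ _).trans (min_le_left _ _)
        _ = r / 2 := by field_simp
        _ < r := by linarith
    · rw [← le_div_iff₀ (by positivity)]
      exact (min_le_right _ _).trans (min_le_right _ _)
  refine ⟨s, hs, fun p hp V hV hXV l hl => ?_⟩
  set W := corr T p V with hWdef
  have hWn : ‖W‖ ≤ B := hW p hp V hV
  set h := l • V + l ^ 2 • W with hh
  have hl1 : ‖l‖ ≤ 1 := hl.trans hs1
  have hhn : ‖h‖ ≤ (1 + B) * ‖l‖ := by
    calc ‖h‖ ≤ ‖l‖ * ‖V‖ + ‖l‖ ^ 2 * ‖W‖ := by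
          refine (norm_add_le _ _).trans ?_
          rw [norm_smul, norm_smul, norm_pow]
      _ ≤ ‖l‖ * 1 + (1 * ‖l‖) * B := by
          rw [pow_two]; gcongr
      _ = (1 + B) * ‖l‖ := by ring
  have hhr : ‖h‖ < r := hhn.trans_lt (lt_of_le_of_lt (by gcongr) hsr)
  obtain ⟨hmem, ht⟩ := htay p hp h hhr
  rw [add_assoc, ← hh]
  refine ⟨hmem, fun μ => ?_⟩
  set k := μ • V + (2 * l * μ) • W with hk
  have hkn : ‖k‖ ≤ (1 + 2 * B) * ‖μ‖ := by
    calc ‖k‖ ≤ ‖μ‖ * ‖V‖ + 2 * ‖l‖ * ‖μ‖ * ‖W‖ := by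
          refine (norm_add_le _ _).trans ?_
          simp [norm_smul]
      _ ≤ ‖μ‖ * 1 + 2 * 1 * ‖μ‖ * B := by gcongr
      _ = (1 + 2 * B) * ‖μ‖ := by ring
  have hcd : ContDiffAt ℝ 2 T p := hT.contDiffAt (hO.mem_nhds (hZO hp))
  have e1 : fderiv ℝ T p k = -(2 * (quadCoeff T p V * l * μ).re) := by
    rw [hk, map_add, ← re_inner_cgrad, inner_smul_right, hXV, hWdef, fderiv_corr (hD p hp)]
    simp
    ring
  have e2 := D2_smul_smul hcd V l μ
  have e3 : D2 T p h k = D2 T p (l • V) (μ • V) + D2 T p (l ^ 2 • W) k +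
      D2 T p (l • V) ((2 * l * μ) • W) := by
    simp only [D2, hh, hk, map_add, add_apply]
    ring
  have hDb : ∀ v w : E, |D2 T p v w| ≤ B * ‖v‖ * ‖w‖ := by
    intro v w
    rw [D2, ← Real.norm_eq_abs]
    refine (ContinuousLinearMap.le_opNorm₂ _ _ _).trans ?_
    gcongr
    exact (hC p hp).trans hCB
  have b1 : |D2 T p (l ^ 2 • W) k| ≤ B * (‖l‖ ^ 2 * B) * ((1 + 2 * B) * ‖μ‖) := by
    refine (hDb _ _).trans ?_
    rw [norm_smul, norm_pow]
    gcongr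
  have b2 : |D2 T p (l • V) ((2 * l * μ) • W)| ≤ B * (‖l‖ * 1) * (2 * ‖l‖ * ‖μ‖ * B) := by
    refine (hDb _ _).trans ?_
    rw [norm_smul, norm_smul, norm_mul, norm_mul]
    simp only [Complex.norm_ofNat]
    gcongr
  have b3 : |fderiv ℝ T (p + h) k - fderiv ℝ T p k - D2 T p h k| ≤
      κ' * ((1 + B) * ‖l‖) * ((1 + 2 * B) * ‖μ‖) := by
    have : fderiv ℝ T (p + h) k - fderiv ℝ T p k - D2 T p h k =
      (fderiv ℝ T (p + h) - fderiv ℝ T p - fderiv ℝ (fderiv ℝ T) p h) k := by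
      simp [D2]
    rw [this, ← Real.norm_eq_abs]
    refine (ContinuousLinearMap.le_opNorm _ _).trans ?_
    gcongr
    exact ht.trans (by gcongr)
  have e4 : κ' * ((1 + B) * ‖l‖) * ((1 + 2 * B) * ‖μ‖) = κ / 2 * ‖l‖ * ‖μ‖ := by
    rw [hκ']; field_simp
  have b4 : B * (‖l‖ ^ 2 * B) * ((1 + 2 * B) * ‖μ‖) + B * (‖l‖ * 1) * (2 * ‖l‖ * ‖μ‖ * B) ≤
      κ / 2 * ‖l‖ * ‖μ‖ := by
    calc _ = (‖l‖ * (B * (B * (1 + 2 * B) + 2 * B))) * ‖l‖ * ‖μ‖ := by ring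
      _ ≤ (s * (B * (B * (1 + 2 * B) + 2 * B))) * ‖l‖ * ‖μ‖ := by gcongr
      _ ≤ _ := by gcongr
  have e5 : fderiv ℝ T (p + h) k - 2 * levi T p V * ((starRingEnd ℂ) l * μ).re =
      (fderiv ℝ T (p + h) k - fderiv ℝ T p k - D2 T p h k) + D2 T p (l ^ 2 • W) k +
        D2 T p (l • V) ((2 * l * μ) • W) := by
    rw [e3, e2, e1]; ring
  rw [e5]
  refine (abs_add_three _ _ _).trans ?_
  linarith

omit [FiniteDimensional ℂ E] in
/-- Growth of `T` along quadratic discs. -/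
lemma le_of_key_estimate {T : E → ℝ} {O : Set E} (hO : IsOpen O)
    (hT : ContDiffOn ℝ 2 T O) {p V W : E} {κ r : ℝ} (h : ∀ l : ℂ, ‖l‖ ≤ r →
      p + l • V + l ^ 2 • W ∈ O ∧ ∀ m : ℂ,
      |fderiv ℝ T (p + l • V + l ^ 2 • W) (m • V + (2 * l * m) • W) -
        2 * levi T p V * ((starRingEnd ℂ) l * m).re| ≤ κ * ‖l‖ * ‖m‖) {l : ℂ} (hl : ‖l‖ ≤ r) :
    T p + (levi T p V - κ / 2) * ‖l‖ ^ 2 ≤ T (p + l • V + l ^ 2 • W) := by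
  have hs : ∀ s ∈ Icc (0:ℝ) 1, ‖(s:ℂ) * l‖ ≤ r := by
    intro s hs
    rw [norm_mul, Complex.norm_real, Real.norm_of_nonneg hs.1]
    nlinarith [norm_nonneg l, hs.2]
  set γ : ℝ → E := fun s => p + ((s:ℂ) * l) • V + ((s:ℂ) * l) ^ 2 • W with hγ
  have hγd : ∀ s : ℝ, HasDerivAt γ (l • V + (2 * ((s:ℂ) * l) * l) • W) s := by
    intro s
    have h1 : HasDerivAt (fun s : ℝ => (s:ℂ) * l) l s := by
      simpa using (Complex.ofRealCLM.hasDerivAt (x := s)).mul_const l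
    have h2 := h1.pow 2
    have h3 := ((h1.smul_const V).const_add p).add (h2.smul_const W)
    refine h3.congr_deriv ?_
    norm_num
  set φ : ℝ → ℝ := fun s => T (γ s) - (levi T p V - κ / 2) * ‖l‖ ^ 2 * s ^ 2 with hφ
  have hφd : ∀ s ∈ Icc (0:ℝ) 1, HasDerivAt φ (fderiv ℝ T (γ s) (l • V + (2 * ((s:ℂ) * l) * l) • W) -
      (levi T p V - κ / 2) * ‖l‖ ^ 2 * (2 * s)) s := by
    intro s hs'
    have h1 : HasFDerivAt T (fderiv ℝ T (γ s)) (γ s) :=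
      ((hT.contDiffAt (hO.mem_nhds (h _ (hs s hs')).1)).differentiableAt (by norm_num)).hasFDerivAt
    have h2 := h1.comp_hasDerivAt s (hγd s)
    have h3 := ((hasDerivAt_pow 2 s).const_mul ((levi T p V - κ / 2) * ‖l‖ ^ 2))
    refine (h2.sub h3).congr_deriv ?_
    norm_num
  have hmono : MonotoneOn φ (Icc 0 1) := by
    refine monotoneOn_of_deriv_nonneg (convex_Icc 0 1)
      (fun s hs => (hφd s hs).continuousAt.continuousWithinAt)
      (fun s hs => (hφd s (interior_subset hs)).differentiableAt.differentiableWithinAt)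
      (fun s hs' => ?_)
    have hsI := interior_subset hs'
    rw [(hφd s hsI).deriv]
    have h1 := (h _ (hs s hsI)).2 l
    have h2 : ((starRingEnd ℂ) ((s:ℂ) * l) * l).re = s * ‖l‖ ^ 2 := by
      rw [map_mul, mul_assoc, Complex.conj_mul', Complex.conj_ofReal, ← Complex.ofReal_pow,
        ← Complex.ofReal_mul, Complex.ofReal_re]
    rw [h2, norm_mul, Complex.norm_real, Real.norm_of_nonneg hsI.1] at h1
    have h3 := (abs_le.1 h1).1
    simp only [hγ]
    nlinarith
  have := hmono (left_mem_Icc.2 zero_le_one) (right_mem_Icc.2 zero_le_one) zero_le_one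
  simp only [hφ, hγ] at this
  simp at this
  linarith

end KeyEstimate

section LeviBound

variable {E : Type*} [NormedAddCommGroup E] [InnerProductSpace ℂ E] [FiniteDimensional ℂ E]

omit [FiniteDimensional ℂ E] in
lemma continuousOn_levi {T : E → ℝ} {O : Set E} (hO : IsOpen O) (hT : ContDiffOn ℝ 2 T O)
    {X : Type*} [TopologicalSpace X] {s : Set X} {p V : X → E} (hp : ContinuousOn p s)
    (hV : ContinuousOn V s) (hps : MapsTo p s O) :
    ContinuousOn (fun x => levi T (p x) (V x)) s := by
  have hT1 : ContDiffOn ℝ 1 (fderiv ℝ T) O := hT.fderiv_of_isOpen hO (by norm_num)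
  have hT2 : ContinuousOn (fderiv ℝ (fderiv ℝ T)) O := hT1.continuousOn_fderiv_of_isOpen hO le_rfl
  have h := hT2.comp hp hps
  have hI : ContinuousOn (fun x => I • V x) s := hV.const_smul I
  exact continuousOn_const.mul (((h.clm_apply hV).clm_apply hV).add
    ((h.clm_apply hI).clm_apply hI))

lemma exists_levi_lower {T : E → ℝ} {O Z : Set E} (hO : IsOpen O)
    (hT : ContDiffOn ℝ 2 T O) (hZ : IsCompact Z) (hZO : Z ⊆ O)
    (hL : ∀ p ∈ Z, ∀ w : E, w ≠ 0 → 0 < levi T p w) :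
    ∃ m > 0, ∀ p ∈ Z, ∀ w : E, m * ‖w‖ ^ 2 ≤ levi T p w := by
  have := FiniteDimensional.proper ℂ E
  have key : ∃ m > 0, ∀ q ∈ Z ×ˢ sphere (0:E) 1, m ≤ levi T q.1 q.2 := by
    have hK : IsCompact (Z ×ˢ sphere (0:E) 1) := hZ.prod (isCompact_sphere 0 1)
    rcases (Z ×ˢ sphere (0:E) 1).eq_empty_or_nonempty with h | hne
    · exact ⟨1, one_pos, by simp [h]⟩
    obtain ⟨q, hq, h⟩ := hK.exists_isMinOn hne (continuousOn_levi hO hT continuousOn_fst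
      continuousOn_snd fun q hq => hZO hq.1)
    refine ⟨_, hL q.1 hq.1 q.2 ?_, fun z hz => h hz⟩
    have := hq.2
    rintro h0
    simp [h0] at this
  obtain ⟨m, hm, h⟩ := key
  refine ⟨m, hm, fun p hp w => ?_⟩
  rcases eq_or_ne w 0 with rfl | hw
  · simp [levi, D2]
  have hw' : ‖w‖ ≠ 0 := norm_ne_zero_iff.2 hw
  have h1 := h (p, ‖w‖⁻¹ • w) ⟨hp, by simp [norm_smul, hw']⟩
  have h2 := levi_smul T p (‖w‖⁻¹ • w) ‖w‖
  rw [smul_inv_smul₀ hw'] at h2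
  rw [h2, mul_comm]
  gcongr

lemma continuousAt_comp_corr {T : E → ℝ} {O : Set E} (hO : IsOpen O) (hT : ContDiffOn ℝ 2 T O)
    {X : Type*} [TopologicalSpace X] {s : Set X} {p V : X → E} {x : X}
    (hp : ContinuousWithinAt p s x) (hV : ContinuousWithinAt V s x) (hpx : p x ∈ O)
    (hD : fderiv ℝ T (p x) ≠ 0) :
    ContinuousWithinAt (fun x => corr T (p x) (V x)) s x := by
  have hT1 : ContDiffOn ℝ 1 (fderiv ℝ T) O := hT.fderiv_of_isOpen hO (by norm_num)
  have hT2 : ContinuousOn (fderiv ℝ (fderiv ℝ T)) O := hT1.continuousOn_fderiv_of_isOpen hO le_rfl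
  have h := (hT2.continuousAt (hO.mem_nhds hpx)).comp_continuousWithinAt hp
  have hc := ((continuousOn_cgrad hT1.continuousOn).continuousAt
    (hO.mem_nhds hpx)).comp_continuousWithinAt hp
  have hI : ContinuousWithinAt (fun x => I • V x) s x := hV.const_smul I
  have a1 := (h.clm_apply hV).clm_apply hV
  have a2 := (h.clm_apply hI).clm_apply hI
  have a3 := (h.clm_apply hV).clm_apply hI
  have hq : ContinuousWithinAt (fun x => quadCoeff T (p x) (V x)) s x := by
    unfold quadCoeff D2
    refine (((Complex.continuous_ofReal.continuousAt.comp_continuousWithinAt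
      ((a1.sub a2).div_const 2))).sub (continuousWithinAt_const.mul
      (Complex.continuous_ofReal.continuousAt.comp_continuousWithinAt a3))).div_const 2
  exact ((hq.div (ContinuousWithinAt.inner (𝕜 := ℂ) hc hc)
    (inner_self_ne_zero.2 (cgrad_ne_zero hD))).neg).smul hc

end LeviBound

section Push

variable {n : ℕ}

/-- An analytic disc in `Ω`, continuous up to the boundary. -/
def IsDisc (Ω : Set (EuclideanSpace ℂ (Fin n))) (f : ℂ → EuclideanSpace ℂ (Fin n)) : Prop :=
  DiffContOnCl ℂ f (ball 0 1) ∧ MapsTo f (closedBall 0 1) Ω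

/-- `f'` is a modification of `f` divisible by `b` and small on `K`. -/
def Near (b : ℂ → ℂ) (K : Set ℂ) (η : ℝ) (f f' : ℂ → EuclideanSpace ℂ (Fin n)) : Prop :=
  ∃ G : ℂ → EuclideanSpace ℂ (Fin n), DiffContOnCl ℂ G (ball 0 1) ∧
    (f' = fun z => f z + b z • G z) ∧ ∀ z ∈ K, ‖b z • G z‖ < η

/-- `f` can be modified, as little as desired, to a disc in `Ω` with property `Q`. -/
def Reaches (b : ℂ → ℂ) (K : Set ℂ) (Ω : Set (EuclideanSpace ℂ (Fin n)))
    (Q : (ℂ → EuclideanSpace ℂ (Fin n)) → Prop) (f : ℂ → EuclideanSpace ℂ (Fin n)) : Prop :=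
  ∀ η > 0, ∃ f', IsDisc Ω f' ∧ Near b K η f f' ∧ Q f'

variable {b : ℂ → ℂ} {K : Set ℂ} {Ω : Set (EuclideanSpace ℂ (Fin n))}
  {f f' f'' : ℂ → EuclideanSpace ℂ (Fin n)}

lemma IsDisc.continuousOn (h : IsDisc Ω f) : ContinuousOn f (closedBall 0 1) := by
  have := h.1.continuousOn; rwa [closure_ball _ one_ne_zero] at this

lemma Near.refl {η : ℝ} (hη : 0 < η) : Near b K η f f :=
  ⟨0, diffContOnCl_const, by simp, by simpa using fun _ _ => hη⟩

lemma Near.trans {η η' : ℝ} (h : Near b K η f f') (h' : Near b K η' f' f'') :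
    Near b K (η + η') f f'' := by
  obtain ⟨G, hG, e, hn⟩ := h
  obtain ⟨G', hG', e', hn'⟩ := h'
  refine ⟨G + G', hG.add hG', ?_, fun z hz => ?_⟩
  · rw [e', e]; ext1 z; simp only [Pi.add_apply, smul_add]; abel
  · rw [Pi.add_apply, smul_add]
    exact (norm_add_le _ _).trans_lt (add_lt_add (hn z hz) (hn' z hz))

lemma Reaches.refl {Q : (ℂ → EuclideanSpace ℂ (Fin n)) → Prop} (hf : IsDisc Ω f) (hQ : Q f) :
    Reaches b K Ω Q f := fun _ hη => ⟨f, hf, Near.refl hη, hQ⟩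

lemma Reaches.trans {Q Q' : (ℂ → EuclideanSpace ℂ (Fin n)) → Prop} (h : Reaches b K Ω Q f)
    (h' : ∀ f', IsDisc Ω f' → Q f' → Reaches b K Ω Q' f') : Reaches b K Ω Q' f := by
  intro η hη
  obtain ⟨f', hf', hn, hQ⟩ := h (η / 2) (by positivity)
  obtain ⟨f'', hf'', hn', hQ'⟩ := h' f' hf' hQ (η / 2) (by positivity)
  exact ⟨f'', hf'', by simpa using hn.trans hn', hQ'⟩

lemma exists_modulus {T : EuclideanSpace ℂ (Fin n) → ℝ} (hΩ : IsOpen Ω) (hT : ContinuousOn T Ω)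
    {S : Set (EuclideanSpace ℂ (Fin n))} (hS : IsCompact S) (hSΩ : S ⊆ Ω) {ε : ℝ} (hε : 0 < ε) :
    ∃ η > 0, ∀ x ∈ S, ∀ y, ‖y - x‖ < η → |T y - T x| < ε := by
  have h := hS.uniformContinuousAt_of_continuousAt T
    (fun a ha => hT.continuousAt (hΩ.mem_nhds (hSΩ ha))) (Metric.dist_mem_uniformity hε)
  obtain ⟨η, hη, h⟩ := Metric.mem_uniformity_dist.1 h
  refine ⟨η, hη, fun x hx y hy => ?_⟩
  have := h (show dist x y < η by rwa [dist_comm, dist_eq_norm]) hx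
  rwa [Set.mem_ofPred_eq, dist_comm, Real.dist_eq] at this

/-- One step of the boundary push. -/
lemma exists_push_step (hn : 2 ≤ n) (hΩ : IsOpen Ω) (hb : Differentiable ℂ b)
    (hb0 : ∀ ζ : ℂ, ‖ζ‖ = 1 → b ζ ≠ 0) (hK : IsCompact K) (hKb : K ⊆ ball 0 1)
    {T : EuclideanSpace ℂ (Fin n) → ℝ} (hT : ContDiffOn ℝ 2 T Ω) {lo hi hi' : ℝ} (hhi : hi' < hi)
    (hc : IsCompact {z ∈ Ω | T z ≤ hi})
    (hL : ∀ z ∈ Ω, lo ≤ T z → T z ≤ hi → ∀ w : EuclideanSpace ℂ (Fin n), w ≠ 0 → 0 < levi T z w)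
    (hD : ∀ z ∈ Ω, lo ≤ T z → T z ≤ hi → fderiv ℝ T z ≠ 0) :
    ∃ c > 0, ∀ f, IsDisc Ω f → (∀ ζ : ℂ, ‖ζ‖ = 1 → lo ≤ T (f ζ)) →
      Reaches b K Ω (fun f' => ∀ ζ : ℂ, ‖ζ‖ = 1 → min (T (f ζ) + c) hi' ≤ T (f' ζ)) f := by
  set Z := {z ∈ Ω | T z ≤ hi} ∩ {z ∈ Ω | lo ≤ T z} with hZdef
  have hZΩ : Z ⊆ Ω := fun z hz => hz.1.1
  have hZ : IsCompact Z := by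
    have : Z = {z ∈ Ω | T z ≤ hi} ∩ T ⁻¹' Ici lo := by
      ext z; simp [hZdef]; tauto
    rw [this]
    obtain ⟨u, hu, h⟩ := continuousOn_iff_isClosed.1 (hT.continuousOn.mono
      (fun z hz => hz.1 : {z ∈ Ω | T z ≤ hi} ⊆ Ω)) (Ici lo) isClosed_Ici
    rw [inter_comm, h, inter_comm]
    exact hc.inter_right hu
  obtain ⟨m, hm, hmL⟩ := exists_levi_lower hΩ hT hZ hZΩ fun p hp => hL p hp.1.1 hp.2.2 hp.1.2
  obtain ⟨r, hr, hkey⟩ := exists_key_estimate hΩ hT hZ hZΩ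
    (fun p hp => hD p hp.1.1 hp.2.2 hp.1.2) hm
  have hgrow : ∀ p ∈ Z, ∀ V : EuclideanSpace ℂ (Fin n), ‖V‖ = 1 → ⟪cgrad T p, V⟫_ℂ = 0 →
      ∀ l : ℂ, ‖l‖ ≤ r → p + l • V + l ^ 2 • corr T p V ∈ Ω ∧
        T p + m / 2 * ‖l‖ ^ 2 ≤ T (p + l • V + l ^ 2 • corr T p V) := by
    intro p hp V hV hX l hl
    have h1 := hkey p hp V hV.le hX
    refine ⟨(h1 l hl).1, le_trans ?_ (le_of_key_estimate hΩ hT h1 hl)⟩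
    have := hmL p hp V
    rw [hV] at this
    have : m / 2 * ‖l‖ ^ 2 ≤ (levi T p V - m / 2) * ‖l‖ ^ 2 := by gcongr; linarith
    linarith
  set hi'' := (hi' + hi) / 2 with hhi''
  have h1 : hi' < hi'' := by rw [hhi'']; linarith
  have h2 : hi'' < hi := by rw [hhi'']; linarith
  refine ⟨m / 4 * r ^ 2, by positivity, fun f hf hlo η hη => ?_⟩
  have hfs : ContinuousOn f (sphere 0 1) := hf.continuousOn.mono sphere_subset_closedBall
  have hfΩ : MapsTo f (sphere 0 1) Ω := hf.2.mono_left sphere_subset_closedBall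
  have hTf : ContinuousOn (fun ζ => T (f ζ)) (sphere 0 1) := hT.continuousOn.comp hfs hfΩ
  set C := sphere (0:ℂ) 1 ∩ (fun ζ => T (f ζ)) ⁻¹' Iic hi with hCdef
  have hC : IsCompact C := by
    obtain ⟨u, hu, h⟩ := continuousOn_iff_isClosed.1 hTf (Iic hi) isClosed_Iic
    rw [hCdef, inter_comm, h, inter_comm]
    exact (isCompact_sphere 0 1).inter_right hu
  have hCZ : ∀ ζ ∈ C, f ζ ∈ Z := fun ζ hζ =>
    ⟨⟨hfΩ hζ.1, hζ.2⟩, hfΩ hζ.1, hlo ζ (by simpa using hζ.1)⟩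
  have hT1 : ContinuousOn (fderiv ℝ T) Ω := hT.continuousOn_fderiv_of_isOpen hΩ (by norm_num)
  obtain ⟨V, hV, hVC, hV1⟩ := exists_unit_section hn (X := fun ζ => cgrad T (f ζ))
    ((continuousOn_cgrad hT1).comp hfs hfΩ) hC inter_subset_left
    (fun ζ hζ => cgrad_ne_zero (hD _ (hCZ ζ hζ).1.1 (hCZ ζ hζ).2.2 (hCZ ζ hζ).1.2))
  -- cutoff
  set χ : ℂ → ℝ := fun ζ => max 0 (min 1 ((hi - T (f ζ)) / (hi - hi''))) with hχ
  have hχc : ContinuousOn χ (sphere 0 1) :=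
    continuousOn_const.sup (continuousOn_const.inf ((continuousOn_const.sub hTf).div_const _))
  have hχ0 : ∀ ζ, 0 ≤ χ ζ := fun ζ => le_max_left _ _
  have hχ1 : ∀ ζ, χ ζ ≤ 1 := fun ζ => max_le zero_le_one (min_le_left _ _)
  have hχe : ∀ ζ, T (f ζ) ≤ hi'' → χ ζ = 1 := by
    intro ζ hζ
    have : 1 ≤ (hi - T (f ζ)) / (hi - hi'') := by rw [le_div_iff₀ (by linarith)]; linarith
    simp only [hχ, min_eq_left this, max_eq_right zero_le_one]
  have hχz : ∀ ζ, hi < T (f ζ) → χ ζ = 0 := by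
    intro ζ hζ
    have : (hi - T (f ζ)) / (hi - hi'') ≤ 0 := div_nonpos_of_nonpos_of_nonneg (by linarith)
      (by linarith)
    simp only [hχ, max_eq_left ((min_le_right _ _).trans this)]
  set ψ : ℂ → ℂ := fun ζ => ((r * χ ζ : ℝ) : ℂ) with hψ
  have hψc : ContinuousOn ψ (sphere 0 1) :=
    Complex.continuous_ofReal.comp_continuousOn (continuousOn_const.mul hχc)
  have hψn : ∀ ζ, ‖ψ ζ‖ = r * χ ζ := fun ζ => by
    rw [hψ]; simp only [Complex.norm_real]; exact Real.norm_of_nonneg (mul_nonneg hr.le (hχ0 ζ))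
  set V₁ := fun ζ => ψ ζ • V ζ with hV₁
  set W₁ := fun ζ => ψ ζ ^ 2 • corr T (f ζ) (V ζ) with hW₁
  have hV₁c : ContinuousOn V₁ (sphere 0 1) := hψc.smul hV
  have hW₁c : ContinuousOn W₁ (sphere 0 1) := by
    intro ζ hζ
    by_cases hz : T (f ζ) ≤ hi
    · have hpZ := hCZ ζ ⟨hζ, hz⟩
      exact ((hψc ζ hζ).pow 2).smul (continuousAt_comp_corr hΩ hT (hfs ζ hζ) (hV ζ hζ) (hfΩ hζ)
        (hD _ hpZ.1.1 hpZ.2.2 hpZ.1.2))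
    · have hev := (hTf ζ hζ).eventually (lt_mem_nhds (not_le.1 hz))
      refine (continuousWithinAt_const (b := (0 : EuclideanSpace ℂ (Fin n)))).congr_of_eventuallyEq
        ?_ ?_
      · filter_upwards [hev] with x hx
        simp [hW₁, hψ, hχz x hx]
      · simp [hW₁, hψ, hχz ζ (not_le.1 hz)]
  have hpt : ∀ ζ l : ℂ, ‖ζ‖ = 1 → f ζ + l • V₁ ζ + l ^ 2 • W₁ ζ =
      f ζ + (l * ψ ζ) • V ζ + (l * ψ ζ) ^ 2 • corr T (f ζ) (V ζ) := by
    intro ζ l _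
    simp only [hV₁, hW₁, smul_smul, mul_pow]
  have hall : ∀ ζ l : ℂ, ‖ζ‖ = 1 → ‖l‖ ≤ 1 → f ζ + l • V₁ ζ + l ^ 2 • W₁ ζ ∈ Ω ∧
      T (f ζ) + m / 2 * ‖l * ψ ζ‖ ^ 2 ≤ T (f ζ + l • V₁ ζ + l ^ 2 • W₁ ζ) := by
    intro ζ l hζ hl
    have hζs : ζ ∈ sphere (0:ℂ) 1 := by simpa using hζ
    rw [hpt ζ l hζ]
    by_cases hz : T (f ζ) ≤ hi
    · have hzC : ζ ∈ C := ⟨hζs, hz⟩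
      refine hgrow _ (hCZ ζ hzC) _ (hVC ζ hzC).2 (hVC ζ hzC).1 _ ?_
      rw [norm_mul, hψn]
      calc ‖l‖ * (r * χ ζ) ≤ 1 * (r * 1) := by
            have := hχ0 ζ; have := hχ1 ζ; gcongr
        _ = r := by ring
    · have : ψ ζ = 0 := by simp [hψ, hχz ζ (not_le.1 hz)]
      simp [this, hfΩ hζs]
  -- compact set of boundary values
  set S := (fun q : ℂ × ℂ => f q.1 + q.2 • V₁ q.1 + q.2 ^ 2 • W₁ q.1) ''
    (sphere 0 1 ×ˢ sphere 0 1) with hS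
  have hSc : IsCompact S := by
    refine ((isCompact_sphere 0 1).prod (isCompact_sphere 0 1)).image_of_continuousOn ?_
    have p1 : MapsTo (Prod.fst : ℂ × ℂ → ℂ) (sphere 0 1 ×ˢ sphere 0 1) (sphere 0 1) :=
      fun q hq => hq.1
    exact ((hfs.comp continuousOn_fst p1).add (continuousOn_snd.smul
      (hV₁c.comp continuousOn_fst p1))).add ((continuousOn_snd.pow 2).smul
      (hW₁c.comp continuousOn_fst p1))
  have hSΩ : S ⊆ Ω := by
    rintro _ ⟨⟨ζ, l⟩, ⟨hζ, hl⟩, rfl⟩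
    exact (hall ζ l (by simpa using hζ) (by simpa using (le_of_eq hl))).1
  obtain ⟨η₁, hη₁, hmod⟩ := exists_modulus hΩ hT.continuousOn hSc hSΩ
    (ε := min (m / 4 * r ^ 2) (hi'' - hi')) (lt_min (by positivity) (by linarith))
  obtain ⟨G, hG, hGΩ, hGK, hGs⟩ := exists_riemannHilbert hΩ hf.1 hf.2 hb hb0 hV₁c hW₁c
    (fun ζ l hζ hl => (hall ζ l hζ hl).1) hK hKb (lt_min hη hη₁)
  refine ⟨fun z => f z + b z • G z, ⟨hf.1.add ((hb.diffContOnCl).smul hG), hGΩ⟩,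
    ⟨G, hG, rfl, fun z hz => (hGK z hz).trans_le (min_le_left _ _)⟩, fun ζ hζ => ?_⟩
  obtain ⟨l, hl, hlt⟩ := hGs ζ hζ
  have hmem : f ζ + l • V₁ ζ + l ^ 2 • W₁ ζ ∈ S :=
    ⟨(ζ, l), ⟨by simpa using hζ, by simpa using hl⟩, rfl⟩
  have h3 := hmod _ hmem _ (hlt.trans_le (min_le_right _ _))
  have h4 := (abs_lt.1 h3).1
  have h5 := (hall ζ l hζ hl.le).2
  rw [norm_mul, hl, one_mul, hψn] at h5
  have h6 := min_le_left (m / 4 * r ^ 2) (hi'' - hi')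
  have h7 := min_le_right (m / 4 * r ^ 2) (hi'' - hi')
  simp only
  by_cases hz : T (f ζ) ≤ hi''
  · rw [hχe ζ hz] at h5
    refine (min_le_left _ _).trans ?_
    nlinarith
  · refine (min_le_right _ _).trans ?_
    have : 0 ≤ m / 2 * (r * χ ζ) ^ 2 := by positivity
    linarith

/-- The boundary of a disc can be pushed through a noncritical shell. -/
theorem reaches_of_noncritical (hn : 2 ≤ n) (hΩ : IsOpen Ω) (hb : Differentiable ℂ b)
    (hb0 : ∀ ζ : ℂ, ‖ζ‖ = 1 → b ζ ≠ 0) (hK : IsCompact K) (hKb : K ⊆ ball 0 1)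
    {T : EuclideanSpace ℂ (Fin n) → ℝ} (hT : ContDiffOn ℝ 2 T Ω) {lo hi hi' : ℝ} (hhi : hi' < hi)
    (hc : IsCompact {z ∈ Ω | T z ≤ hi})
    (hL : ∀ z ∈ Ω, lo ≤ T z → T z ≤ hi → ∀ w : EuclideanSpace ℂ (Fin n), w ≠ 0 → 0 < levi T z w)
    (hD : ∀ z ∈ Ω, lo ≤ T z → T z ≤ hi → fderiv ℝ T z ≠ 0) (hf : IsDisc Ω f)
    (hlo : ∀ ζ : ℂ, ‖ζ‖ = 1 → lo ≤ T (f ζ)) :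
    Reaches b K Ω (fun f' => ∀ ζ : ℂ, ‖ζ‖ = 1 → hi' ≤ T (f' ζ)) f := by
  rcases le_or_gt hi' lo with h | h
  · exact Reaches.refl hf fun ζ hζ => h.trans (hlo ζ hζ)
  obtain ⟨c, hc0, hstep⟩ := exists_push_step hn hΩ hb hb0 hK hKb hT hhi hc hL hD
  have key : ∀ k : ℕ, Reaches b K Ω (fun f' => ∀ ζ : ℂ, ‖ζ‖ = 1 →
      min (lo + k * c) hi' ≤ T (f' ζ)) f := by
    intro k
    induction k with
    | zero => exact Reaches.refl hf fun ζ hζ => (min_le_left _ _).trans (by simpa using hlo ζ hζ)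
    | succ k ih =>
      refine ih.trans fun f' hf' hQ => ?_
      have hlo' : ∀ ζ : ℂ, ‖ζ‖ = 1 → lo ≤ T (f' ζ) := fun ζ hζ =>
        le_trans (le_min (le_add_of_nonneg_right (by positivity)) h.le) (hQ ζ hζ)
      intro η hη
      obtain ⟨f'', h1, h2, h3⟩ := hstep f' hf' hlo' η hη
      refine ⟨f'', h1, h2, fun ζ hζ => le_trans ?_ (h3 ζ hζ)⟩
      refine le_min ?_ (min_le_right _ _)
      rcases min_le_iff.1 (hQ ζ hζ) with h4 | h4
      · refine (min_le_left _ _).trans ?_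
        push_cast; linarith
      · refine (min_le_right _ _).trans ?_
        linarith
  obtain ⟨k, hk⟩ := exists_nat_gt ((hi' - lo) / c)
  rw [div_lt_iff₀ hc0] at hk
  have := key k
  rwa [min_eq_right (by linarith)] at this

end Push

section RealSecondDerivative

variable {E : Type*} [NormedAddCommGroup E] [NormedSpace ℝ E]

lemma D2_eq_of_line {φ : E → ℝ} {z w : E} (h : ContDiffAt ℝ 2 φ z) {ψ' : ℝ → ℝ} {c : ℝ}
    (h1 : ∀ᶠ s in 𝓝 (0:ℝ), HasDerivAt (fun s : ℝ => φ (z + s • w)) (ψ' s) s)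
    (h2 : HasDerivAt ψ' c 0) : D2 φ z w w = c := by
  have hline : ∀ s : ℝ, HasDerivAt (fun s : ℝ => z + s • w) w s := fun s => by
    simpa using ((hasDerivAt_id s).smul_const w).const_add z
  have hcont : Filter.Tendsto (fun s : ℝ => z + s • w) (𝓝 0) (𝓝 z) := by
    have := (hline 0).continuousAt.tendsto
    simpa using this
  have hd : ∀ᶠ y in 𝓝 z, DifferentiableAt ℝ φ y := by
    filter_upwards [h.eventually (by simp)] with y hy
    exact hy.differentiableAt (by norm_num)
  have e : (fun s : ℝ => fderiv ℝ φ (z + s • w) w) =ᶠ[𝓝 0] ψ' := by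
    filter_upwards [h1, hcont.eventually hd] with s hs hs'
    exact (hs'.hasFDerivAt.comp_hasDerivAt s (hline s)).unique hs
  have hf : DifferentiableAt ℝ (fderiv ℝ φ) (z + (0:ℝ) • w) := by
    rw [zero_smul, add_zero]
    exact (h.fderiv_right (m := 1) (by norm_num)).differentiableAt (by norm_num)
  have h3 : HasDerivAt (fun s : ℝ => fderiv ℝ φ (z + s • w) w) (D2 φ z w w) 0 := by
    have h4 := hf.hasFDerivAt.comp_hasDerivAt (0:ℝ) (hline 0)
    have h5 := h4.clm_apply (hasDerivAt_const (0:ℝ) w)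
    simpa [D2] using h5
  exact h3.unique (h2.congr_of_eventuallyEq e)

lemma D2_congr {φ ψ : E → ℝ} {z : E} (h : φ =ᶠ[𝓝 z] ψ) (w v : E) : D2 φ z w v = D2 ψ z w v := by
  rw [D2, D2, h.fderiv.fderiv_eq]

end RealSecondDerivative

section SecondDerivative

variable {E : Type*} [NormedAddCommGroup E] [NormedSpace ℂ E]

lemma levi_congr {φ ψ : E → ℝ} {z : E} (h : φ =ᶠ[𝓝 z] ψ) (w : E) :
    levi φ z w = levi ψ z w := by
  rw [levi, levi, D2_congr h, D2_congr h]

lemma levi_add_const (φ : E → ℝ) (c : ℝ) (z w : E) : levi (fun x => φ x + c) z w = levi φ z w := by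
  have : fderiv ℝ (fun x => φ x + c) = fderiv ℝ φ := by
    ext1 x; exact fderiv_add_const c
  rw [levi, levi, D2, D2, D2, D2, this]

end SecondDerivative

section Bending

open Real in
/-- A concave bending function. -/
lemma exists_bending {ν : ℝ} (hν : 0 < ν) :
    ∃ (g : ℝ → ℝ) (g' : ℝ → ℝ) (g'' : ℝ → ℝ) (t₁ M : ℝ), ContDiff ℝ 2 g ∧ 1 ≤ M ∧ 1 ≤ t₁ ∧ t₁ ≤ M ∧
      (∀ t, HasDerivAt g (g' t) t) ∧ (∀ t, HasDerivAt g' (g'' t) t) ∧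
      (∀ t, t ≤ 1 → g t = t) ∧ (∀ t, M ≤ t → g t = t₁) ∧ (∀ t, 0 ≤ g' t) ∧ (∀ t, g' t ≤ 1) ∧
      (∀ t, 0 ≤ t → -ν ≤ t * g'' t) ∧ (∀ t, g'' t ≤ 0) := by
  have hσ : ContDiff ℝ 1 smoothTransition := smoothTransition.contDiff
  set σ' := deriv smoothTransition with hσ'
  have hσd : ∀ t, HasDerivAt smoothTransition (σ' t) t := fun t =>
    (hσ.differentiable (by norm_num) t).hasDerivAt
  have hσc : Continuous σ' := hσ.continuous_deriv le_rfl
  have hσ0 : ∀ t, 0 ≤ σ' t := fun t => smoothTransition.monotone.deriv_nonneg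
  obtain ⟨C, hC0, hC⟩ : ∃ C > 0, ∀ t, σ' t ≤ C := by
    obtain ⟨C, hC⟩ := (isCompact_Icc (a := (0:ℝ)) (b := 1)).exists_bound_of_continuousOn
      hσc.continuousOn
    refine ⟨max C 1, by positivity, fun t => ?_⟩
    by_cases h : t ∈ Icc (0:ℝ) 1
    · exact (le_abs_self _).trans ((hC t h).trans (le_max_left _ _))
    · have : σ' t = 0 := by
        rw [mem_Icc, not_and_or, not_le, not_le] at h
        rcases h with h | h
        · have : smoothTransition =ᶠ[𝓝 t] fun _ => 0 := by
            filter_upwards [Iio_mem_nhds h] with s hs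
            exact smoothTransition.zero_of_nonpos (le_of_lt hs)
          rw [hσ', this.deriv_eq]; simp
        · have : smoothTransition =ᶠ[𝓝 t] fun _ => 1 := by
            filter_upwards [Ioi_mem_nhds h] with s hs
            exact smoothTransition.one_of_one_le (le_of_lt hs)
          rw [hσ', this.deriv_eq]; simp
      rw [this]; positivity
  set k := ν / C with hk
  have hk0 : 0 < k := by positivity
  set h : ℝ → ℝ := fun t => if t ≤ 1 then 1 else 1 - smoothTransition (k * Real.log t) with hh
  set h' : ℝ → ℝ := fun t => if t ≤ 1 then 0 else - (σ' (k * Real.log t) * (k * t⁻¹)) with hh'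
  have hone : ∀ t, 0 < t → h t = 1 - smoothTransition (k * Real.log t) := by
    intro t ht
    by_cases h1 : t ≤ 1
    · simp only [hh, if_pos h1]
      rw [smoothTransition.zero_of_nonpos, sub_zero]
      exact mul_nonpos_of_nonneg_of_nonpos hk0.le (Real.log_nonpos ht.le h1)
    · simp only [hh, if_neg h1]
  have hσ'z : ∀ t, t ≤ 0 → σ' t = 0 := by
    intro t ht
    have hmin : IsLocalMin smoothTransition t := by
      refine Filter.Eventually.of_forall fun s => ?_
      rw [smoothTransition.zero_of_nonpos ht]; exact smoothTransition.nonneg s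
    exact hmin.deriv_eq_zero
  have hone' : ∀ t, 0 < t → h' t = - (σ' (k * Real.log t) * (k * t⁻¹)) := by
    intro t ht
    by_cases h1 : t ≤ 1
    · simp only [hh', if_pos h1]
      rw [hσ'z, zero_mul, neg_zero]
      exact mul_nonpos_of_nonneg_of_nonpos hk0.le (Real.log_nonpos ht.le h1)
    · simp only [hh', if_neg h1]
  have hd : ∀ t, HasDerivAt h (h' t) t := by
    intro t
    rcases lt_or_ge 0 t with ht | ht
    · rw [hone' t ht]
      have h1 := ((hσd (k * Real.log t)).comp t ((Real.hasDerivAt_log ht.ne').const_mul k))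
      have h2 := h1.const_sub 1
      refine h2.congr_of_eventuallyEq ?_
      filter_upwards [Ioi_mem_nhds ht] with s hs
      exact hone s hs
    · have h1 : h' t = 0 := by simp only [hh']; rw [if_pos (by linarith)]
      rw [h1]
      refine (hasDerivAt_const t (1:ℝ)).congr_of_eventuallyEq ?_
      filter_upwards [Iio_mem_nhds (show t < 1 by linarith)] with s hs
      simp only [hh]; rw [if_pos (le_of_lt hs)]
  have hhc : Continuous h := continuous_iff_continuousAt.2 fun t => (hd t).continuousAt
  have hh'c : Continuous h' := by
    refine continuous_iff_continuousAt.2 fun t => ?_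
    rcases lt_or_ge 0 t with ht | ht
    · have : ContinuousAt (fun t => - (σ' (k * Real.log t) * (k * t⁻¹))) t := by
        have := Real.continuousAt_log ht.ne'
        have := continuousAt_inv₀ ht.ne'
        have h3 : ContinuousAt (fun t => σ' (k * Real.log t)) t :=
          hσc.continuousAt.comp (continuousAt_const.mul (Real.continuousAt_log ht.ne'))
        exact (h3.mul (continuousAt_const.mul this)).neg
      refine this.congr ?_
      filter_upwards [Ioi_mem_nhds ht] with s hs
      exact (hone' s hs).symm
    · refine (continuousAt_const (y := (0:ℝ))).congr ?_
      filter_upwards [Iio_mem_nhds (show t < 1 by linarith)] with s hs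
      simp only [hh']; rw [if_pos (le_of_lt hs)]
  have hh0 : ∀ t, 0 ≤ h t := by
    intro t; simp only [hh]; split_ifs
    · exact zero_le_one
    · have := smoothTransition.le_one (k * Real.log t); linarith
  have hh1 : ∀ t, h t ≤ 1 := by
    intro t; simp only [hh]; split_ifs
    · exact le_rfl
    · have := smoothTransition.nonneg (k * Real.log t); linarith
  set g : ℝ → ℝ := fun t => ∫ s in (0:ℝ)..t, h s with hg
  have hgd : ∀ t, HasDerivAt g (h t) t := fun t =>
    intervalIntegral.integral_hasDerivAt_right (hhc.intervalIntegrable _ _)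
      hhc.aestronglyMeasurable.stronglyMeasurableAtFilter hhc.continuousAt
  have hg1 : ∀ t, t ≤ 1 → g t = t := by
    intro t ht
    have : ∫ s in (0:ℝ)..t, h s = ∫ s in (0:ℝ)..t, (1:ℝ) := by
      refine intervalIntegral.integral_congr fun s hs => ?_
      have : s ≤ 1 := by
        rcases mem_uIcc.1 hs with h | h
        · exact h.2.trans ht
        · exact h.2.trans zero_le_one
      simp only [hh, if_pos this]
    simp [hg, this]
  set M := Real.exp (1 / k) with hM
  have hM1 : 1 ≤ M := Real.one_le_exp (by positivity)
  have hgmono : Monotone g := monotone_of_deriv_nonneg (fun t => (hgd t).differentiableAt)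
    fun t => by rw [(hgd t).deriv]; exact hh0 t
  have hhM : ∀ t, M ≤ t → h t = 0 := by
    intro t ht
    rw [hone t (by linarith), smoothTransition.one_of_one_le, sub_self]
    have : 1 / k ≤ Real.log t := by
      rw [Real.le_log_iff_exp_le (by linarith)]; exact ht
    calc 1 = k * (1 / k) := by field_simp
      _ ≤ _ := by gcongr
  refine ⟨g, h, h', g M, M, ?_, hM1, ?_, ?_, hgd, hd, hg1, ?_, hh0, hh1, ?_, ?_⟩
  · have e : deriv g = h := funext fun t => (hgd t).deriv
    have e' : deriv h = h' := funext fun t => (hd t).deriv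
    rw [show (2 : WithTop ℕ∞) = 1 + 1 by norm_num, contDiff_succ_iff_deriv]
    refine ⟨fun t => (hgd t).differentiableAt, by simp, ?_⟩
    rw [e, contDiff_one_iff_deriv, e']
    exact ⟨fun t => (hd t).differentiableAt, hh'c⟩
  · have := hgmono hM1
    rwa [hg1 1 le_rfl] at this
  · have : Monotone fun t => t - g t := by
      refine monotone_of_deriv_nonneg
        (fun t => ((hasDerivAt_id t).sub (hgd t)).differentiableAt) fun t => ?_
      have := ((hasDerivAt_id t).sub (hgd t)).deriv
      have h2 := hh1 t
      change 0 ≤ deriv (id - g) t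
      rw [this]; linarith
    have := this (show (1:ℝ) ≤ M from hM1)
    simp only [hg1 1 le_rfl] at this
    linarith
  · intro t ht
    have : ∫ s in M..t, h s = 0 := by
      rw [intervalIntegral.integral_congr (g := fun _ => 0)]
      · simp
      · intro s hs
        rw [uIcc_of_le ht] at hs
        exact hhM s hs.1
    have h2 := intervalIntegral.integral_add_adjacent_intervals (hhc.intervalIntegrable 0 M)
      (hhc.intervalIntegrable (μ := MeasureTheory.volume) M t)
    rw [this, add_zero] at h2
    exact h2.symm
  · intro t ht
    rcases ht.eq_or_lt with rfl | ht
    · simp; positivity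
    · rw [hone' t ht]
      have h1 := hC (k * Real.log t)
      have : t * -(σ' (k * Real.log t) * (k * t⁻¹)) = - (k * σ' (k * Real.log t)) := by
        field_simp
      rw [this, neg_le_neg_iff]
      calc k * σ' (k * Real.log t) ≤ k * C := by gcongr
        _ = ν := by rw [hk]; field_simp
  · intro t
    simp only [hh']; split_ifs with h1
    · exact le_rfl
    · have := hσ0 (k * Real.log t)
      have : 0 < t := by linarith
      rw [neg_nonpos]; positivity

end Bending

section Bend

variable {E F : Type*} [NormedAddCommGroup E] [InnerProductSpace ℂ E] [FiniteDimensional ℂ E]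
  [NormedAddCommGroup F] [InnerProductSpace ℝ F]

/-- The quadratic model of a Morse function, bent along the negative directions by `g`. -/
noncomputable def bend (α β : E →L[ℝ] F) (g : ℝ → ℝ) (p z : E) : ℝ :=
  ‖β (z - p)‖ ^ 2 - ‖α (z - p)‖ ^ 2 + g (‖α (z - p)‖ ^ 2)

lemma hasDerivAt_norm_sq_line (x y : F) (s : ℝ) :
    HasDerivAt (fun s : ℝ => ‖x + s • y‖ ^ 2) (2 * ⟪x, y⟫_ℝ + 2 * ‖y‖ ^ 2 * s) s := by
  have e : (fun s : ℝ => ‖x + s • y‖ ^ 2) =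
      fun s : ℝ => ‖x‖ ^ 2 + s * (2 * ⟪x, y⟫_ℝ) + s ^ 2 * ‖y‖ ^ 2 := by
    ext s
    rw [norm_add_sq_real, inner_smul_right, norm_smul, mul_pow, Real.norm_eq_abs, sq_abs]
    ring
  rw [e]
  have h := (((hasDerivAt_id s).mul_const (2 * ⟪x, y⟫_ℝ)).const_add (‖x‖ ^ 2)).add
    ((hasDerivAt_pow 2 s).mul_const (‖y‖ ^ 2))
  refine h.congr_deriv ?_
  norm_num
  ring

variable {α β : E →L[ℝ] F} {g g' g'' : ℝ → ℝ}

omit [FiniteDimensional ℂ E] in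
lemma hasDerivAt_bend_line (hg : ∀ t, HasDerivAt g (g' t) t) (p z w : E) (s : ℝ) :
    HasDerivAt (fun s : ℝ => bend α β g p (z + s • w))
      ((2 * ⟪β (z - p), β w⟫_ℝ + 2 * ‖β w‖ ^ 2 * s) -
        (2 * ⟪α (z - p), α w⟫_ℝ + 2 * ‖α w‖ ^ 2 * s) +
        g' (‖α (z - p) + s • α w‖ ^ 2) * (2 * ⟪α (z - p), α w⟫_ℝ + 2 * ‖α w‖ ^ 2 * s)) s := by
  have ha := hasDerivAt_norm_sq_line (α (z - p)) (α w) s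
  have hb := hasDerivAt_norm_sq_line (β (z - p)) (β w) s
  have e : (fun s : ℝ => bend α β g p (z + s • w)) = fun s : ℝ =>
      ‖β (z - p) + s • β w‖ ^ 2 - ‖α (z - p) + s • α w‖ ^ 2 + g (‖α (z - p) + s • α w‖ ^ 2) := by
    ext s
    simp only [bend, add_sub_right_comm z, map_add, map_smul]
  rw [e]
  exact (hb.sub ha).add ((hg _).comp s ha)

omit [FiniteDimensional ℂ E] in
lemma contDiff_bend (hg : ContDiff ℝ 2 g) (p : E) : ContDiff ℝ 2 (bend α β g p) := by
  have h1 : ContDiff ℝ 2 fun z : E => ‖α (z - p)‖ ^ 2 :=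
    (α.contDiff.comp (contDiff_id.sub contDiff_const)).norm_sq ℝ
  have h2 : ContDiff ℝ 2 fun z : E => ‖β (z - p)‖ ^ 2 :=
    (β.contDiff.comp (contDiff_id.sub contDiff_const)).norm_sq ℝ
  exact (h2.sub h1).add (hg.comp h1)

omit [FiniteDimensional ℂ E] in
lemma D2_bend (hgc : ContDiff ℝ 2 g) (hg : ∀ t, HasDerivAt g (g' t) t)
    (hg' : ∀ t, HasDerivAt g' (g'' t) t) (p z w : E) :
    D2 (bend α β g p) z w w = 2 * ‖β w‖ ^ 2 - 2 * ‖α w‖ ^ 2 +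
      (g'' (‖α (z - p)‖ ^ 2) * (2 * ⟪α (z - p), α w⟫_ℝ) ^ 2 +
        g' (‖α (z - p)‖ ^ 2) * (2 * ‖α w‖ ^ 2)) := by
  refine D2_eq_of_line (contDiff_bend hgc p).contDiffAt
    (Filter.Eventually.of_forall fun s => hasDerivAt_bend_line hg p z w s) ?_
  have ha := hasDerivAt_norm_sq_line (α (z - p)) (α w) 0
  have hl : ∀ a b : ℝ, HasDerivAt (fun s : ℝ => 2 * a + 2 * b * s) (2 * b) 0 := fun a b => by
    simpa using ((hasDerivAt_id (0:ℝ)).const_mul (2 * b)).const_add (2 * a)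
  have h := ((hl ⟪β (z - p), β w⟫_ℝ (‖β w‖ ^ 2)).sub (hl ⟪α (z - p), α w⟫_ℝ (‖α w‖ ^ 2))).add
    (((hg' _).comp (0:ℝ) ha).mul (hl ⟪α (z - p), α w⟫_ℝ (‖α w‖ ^ 2)))
  refine h.congr_deriv ?_
  simp
  ring

omit [FiniteDimensional ℂ E] in
lemma fderiv_bend (hgc : ContDiff ℝ 2 g) (hg : ∀ t, HasDerivAt g (g' t) t) (p z : E) {v : E}
    (h1 : α v = 0) (h2 : β v = β (z - p)) :
    fderiv ℝ (bend α β g p) z v = 2 * ‖β (z - p)‖ ^ 2 := by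
  have hl : HasDerivAt (fun s : ℝ => z + s • v) v 0 := by
    simpa using ((hasDerivAt_id (0:ℝ)).smul_const v).const_add z
  have hd : DifferentiableAt ℝ (bend α β g p) (z + (0:ℝ) • v) :=
    (contDiff_bend hgc p).contDiffAt.differentiableAt (by norm_num)
  have h3 := hd.hasFDerivAt.comp_hasDerivAt (0:ℝ) hl
  have h4 := h3.unique (hasDerivAt_bend_line hg p z v 0)
  rw [zero_smul, add_zero] at h4
  rw [h4, h1, h2]
  simp

omit [FiniteDimensional ℂ E] in
lemma levi_bend_ge (hgc : ContDiff ℝ 2 g) (hg : ∀ t, HasDerivAt g (g' t) t)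
    (hg' : ∀ t, HasDerivAt g' (g'' t) t) (h0 : ∀ t, 0 ≤ g' t) (h2 : ∀ t, g'' t ≤ 0) {ν : ℝ}
    (hν : ∀ t, 0 ≤ t → -ν ≤ t * g'' t) (p z w : E) :
    (1 / 2) * (‖β w‖ ^ 2 + ‖β (I • w)‖ ^ 2 - (1 + 2 * ν) * (‖α w‖ ^ 2 + ‖α (I • w)‖ ^ 2)) ≤
      levi (bend α β g p) z w := by
  have key : ∀ w : E, 2 * ‖β w‖ ^ 2 - 2 * (1 + 2 * ν) * ‖α w‖ ^ 2 ≤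
      D2 (bend α β g p) z w w := by
    intro w
    rw [D2_bend hgc hg hg']
    set A := ‖α (z - p)‖ ^ 2 with hA
    have hcs : ⟪α (z - p), α w⟫_ℝ ^ 2 ≤ A * ‖α w‖ ^ 2 := by
      have := abs_real_inner_le_norm (α (z - p)) (α w)
      rw [hA, ← mul_pow, ← sq_abs]
      gcongr
    have hA0 : 0 ≤ A := by positivity
    have e1 := hν A hA0
    have e2 : 0 ≤ g' A * (2 * ‖α w‖ ^ 2) := mul_nonneg (h0 A) (by positivity)
    have e3 : g'' A * (2 * ⟪α (z - p), α w⟫_ℝ) ^ 2 ≥ g'' A * (4 * (A * ‖α w‖ ^ 2)) := by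
      refine mul_le_mul_of_nonpos_left ?_ (h2 A)
      nlinarith
    have e4 : g'' A * (4 * (A * ‖α w‖ ^ 2)) ≥ -ν * (4 * ‖α w‖ ^ 2) := by
      calc -ν * (4 * ‖α w‖ ^ 2) ≤ (A * g'' A) * (4 * ‖α w‖ ^ 2) := by gcongr
        _ = _ := by ring
    linarith
  rw [levi]
  linarith [key w, key (I • w)]

/-- `T` is exactly quadratic near `p`, in split form. -/
def QuadNear (T : E → ℝ) (p : E) (r : ℝ) (α β : E →L[ℝ] F) : Prop :=
  (∀ z ∈ ball p r, T z = T p + (‖β (z - p)‖ ^ 2 - ‖α (z - p)‖ ^ 2)) ∧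
    (∀ z, ∃ v, α v = 0 ∧ β v = β z) ∧ ∀ z, α z = 0 → β z = 0 → z = 0

omit [FiniteDimensional ℂ E] in
lemma QuadNear.levi {T : E → ℝ} {p : E} {r : ℝ} (h : QuadNear T p r α β) (hr : 0 < r) (w : E) :
    levi T p w = (1 / 2) * (‖β w‖ ^ 2 + ‖β (I • w)‖ ^ 2 - (‖α w‖ ^ 2 + ‖α (I • w)‖ ^ 2)) := by
  have e : T =ᶠ[𝓝 p] fun z => bend α β (fun _ => 0) p z + T p := by
    filter_upwards [ball_mem_nhds p hr] with z hz
    rw [h.1 z hz, bend]; ring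
  have hD : ∀ w : E, D2 (bend α β (fun _ => 0) p) p w w = 2 * ‖β w‖ ^ 2 - 2 * ‖α w‖ ^ 2 := by
    intro w
    rw [D2_bend (g' := fun _ => 0) (g'' := fun _ => 0) contDiff_const
      (fun t => hasDerivAt_const t _) (fun t => hasDerivAt_const t _)]
    ring
  rw [levi_congr e, levi_add_const, _root_.levi, hD, hD]
  ring

lemma QuadNear.exists_nu {T : E → ℝ} {p : E} {r : ℝ} (h : QuadNear T p r α β) (hr : 0 < r)
    {O : Set E} (hO : IsOpen O) (hT : ContDiffOn ℝ 2 T O) (hp : p ∈ O)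
    (hL : ∀ w : E, w ≠ 0 → 0 < _root_.levi T p w) :
    ∃ ν > 0, ∀ ν' ≤ ν, ∀ w : E, w ≠ 0 →
      (1 + 2 * ν') * (‖α w‖ ^ 2 + ‖α (I • w)‖ ^ 2) < ‖β w‖ ^ 2 + ‖β (I • w)‖ ^ 2 := by
  obtain ⟨m, hm, hmL⟩ := exists_levi_lower hO hT (isCompact_singleton (x := p)) (by simpa using hp)
    (by simpa using hL)
  refine ⟨m / (2 * (‖α‖ ^ 2 + 1)), by positivity, fun ν' hν' w hw => ?_⟩
  have h1 := hmL p rfl w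
  rw [h.levi hr] at h1
  have hw0 : 0 < ‖w‖ ^ 2 := by positivity
  have a1 : ‖α w‖ ^ 2 ≤ ‖α‖ ^ 2 * ‖w‖ ^ 2 := by
    rw [← mul_pow]; gcongr; exact α.le_opNorm w
  have a2 : ‖α (I • w)‖ ^ 2 ≤ ‖α‖ ^ 2 * ‖w‖ ^ 2 := by
    rw [← mul_pow]; gcongr
    refine (α.le_opNorm _).trans ?_
    rw [norm_smul, Complex.norm_I, one_mul]
  have h2 : 2 * ν' * (‖α w‖ ^ 2 + ‖α (I • w)‖ ^ 2) < 2 * (m * ‖w‖ ^ 2) := by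
    calc 2 * ν' * (‖α w‖ ^ 2 + ‖α (I • w)‖ ^ 2)
        ≤ 2 * (m / (2 * (‖α‖ ^ 2 + 1))) * (‖α‖ ^ 2 * ‖w‖ ^ 2 + ‖α‖ ^ 2 * ‖w‖ ^ 2) := by gcongr
      _ = 2 * (m * ‖w‖ ^ 2) * (‖α‖ ^ 2 / (‖α‖ ^ 2 + 1)) := by field_simp; ring
      _ < 2 * (m * ‖w‖ ^ 2) * 1 := by
        gcongr
        rw [div_lt_one (by positivity)]; linarith
      _ = _ := mul_one _
  linarith

end Bend

lemma finrank_ker_lt {n : ℕ} (hn : 2 ≤ n) {F : Type*} [NormedAddCommGroup F] [InnerProductSpace ℝ F]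
    {β : EuclideanSpace ℂ (Fin n) →L[ℝ] F} (h : ∀ w, β w = 0 → β (I • w) = 0 → w = 0) :
    Module.finrank ℝ (LinearMap.ker (β : EuclideanSpace ℂ (Fin n) →ₗ[ℝ] F)) + 1 < 2 * n := by
  set N := LinearMap.ker (β : EuclideanSpace ℂ (Fin n) →ₗ[ℝ] F) with hN
  have hfin : FiniteDimensional ℝ (EuclideanSpace ℂ (Fin n)) := by infer_instance
  let J : EuclideanSpace ℂ (Fin n) →ₗ[ℝ] EuclideanSpace ℂ (Fin n) :=
    (LinearMap.lsmul ℂ (EuclideanSpace ℂ (Fin n)) I).restrictScalars ℝ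
  have hJ : ∀ w, J w = I • w := fun w => rfl
  have hJi : Function.Injective J := by
    intro x y hxy
    rw [hJ, hJ] at hxy
    exact smul_right_injective _ I_ne_zero hxy
  have hdis : Disjoint N (N.map J) := by
    rw [Submodule.disjoint_def]
    rintro x hx ⟨y, hy, rfl⟩
    have : y = 0 := h y hy (by simpa [hN, hJ] using hx)
    simp [this]
  have h1 := Submodule.finrank_add_finrank_le_of_disjoint hdis
  rw [← (Submodule.equivMapOfInjective J hJi N).finrank_eq, finrank_real_euclidean] at h1
  omega

section Avoid

variable {n : ℕ}

/-- `b` is entire, zero free on the circle, and discs can be divided by it with an entire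
remainder. -/
def IsDivisor (n : ℕ) (b : ℂ → ℂ) : Prop :=
  Differentiable ℂ b ∧ (∀ ζ : ℂ, ‖ζ‖ = 1 → b ζ ≠ 0) ∧
    ∀ f : ℂ → EuclideanSpace ℂ (Fin n), DiffContOnCl ℂ f (ball 0 1) →
      ∃ H q : ℂ → EuclideanSpace ℂ (Fin n), Differentiable ℂ H ∧ DiffContOnCl ℂ q (ball 0 1) ∧
        ∀ z ∈ closedBall (0:ℂ) 1, f z = H z + b z • q z

lemma DiffContOnCl.exists_dilation {q : ℂ → EuclideanSpace ℂ (Fin n)}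
    (hq : DiffContOnCl ℂ q (ball 0 1)) {η : ℝ} (hη : 0 < η) :
    ∃ r : ℝ, 0 < r ∧ r < 1 ∧ ∀ z ∈ closedBall (0:ℂ) 1, ‖q (r * z) - q z‖ < η := by
  have hc : ContinuousOn q (closedBall 0 1) := by
    have := hq.continuousOn; rwa [closure_ball _ one_ne_zero] at this
  have hu := (isCompact_closedBall (0:ℂ) 1).uniformContinuousOn_of_continuous hc
  obtain ⟨δ, hδ, h⟩ := Metric.uniformContinuousOn_iff.1 hu η hη
  have hm : 0 < min (δ / 2) (1 / 2) := by positivity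
  have hm2 := min_le_right (δ / 2) (1 / 2)
  have hm1 := min_le_left (δ / 2) (1 / 2)
  refine ⟨1 - min (δ / 2) (1 / 2), by linarith, by linarith, fun z hz => ?_⟩
  have hz1 : ‖z‖ ≤ 1 := by simpa using hz
  rw [← dist_eq_norm]
  refine h _ ?_ _ hz ?_
  · rw [mem_closedBall_zero_iff, norm_mul, Complex.norm_real, Real.norm_of_nonneg (by linarith)]
    nlinarith [norm_nonneg z]
  · rw [dist_eq_norm]
    have : ((1 - min (δ / 2) (1 / 2) : ℝ) : ℂ) * z - z = -((min (δ / 2) (1 / 2) : ℝ) : ℂ) * z := by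
      push_cast; ring
    rw [this, norm_mul, norm_neg, Complex.norm_real, Real.norm_of_nonneg hm.le]
    nlinarith [norm_nonneg z]

lemma DiffContOnCl.comp_dilation {q : ℂ → EuclideanSpace ℂ (Fin n)}
    (hq : DiffContOnCl ℂ q (ball 0 1)) {r : ℝ} (hr : 0 < r) :
    DifferentiableOn ℂ (fun z => q (r * z)) (ball 0 r⁻¹) := by
  refine hq.differentiableOn.comp ((differentiable_id.const_mul _).differentiableOn) fun z hz => ?_
  rw [mem_ball_zero_iff] at hz
  rw [mem_ball_zero_iff, norm_mul, Complex.norm_real, Real.norm_of_nonneg hr.le]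
  calc r * ‖z‖ < r * r⁻¹ := by gcongr
    _ = 1 := mul_inv_cancel₀ hr.ne'

variable {b : ℂ → ℂ} {K : Set ℂ} {Ω : Set (EuclideanSpace ℂ (Fin n))}
  {f : ℂ → EuclideanSpace ℂ (Fin n)}

/-- The boundary of a disc can be perturbed off finitely many affine subspaces of small
dimension. -/
theorem reaches_avoid (hn : 2 ≤ n) (hΩ : IsOpen Ω) (hb : IsDivisor n b) (hKb : K ⊆ ball 0 1)
    (hf : IsDisc Ω f)
    (P : Finset (EuclideanSpace ℂ (Fin n)))
    (N : EuclideanSpace ℂ (Fin n) → Submodule ℝ (EuclideanSpace ℂ (Fin n)))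
    (hN : ∀ p ∈ P, Module.finrank ℝ (N p) + 1 < 2 * n) {κ : ℝ} (hκ : 0 < κ) :
    Reaches b K Ω (fun f' => (∀ z ∈ closedBall (0:ℂ) 1, ‖f' z - f z‖ < κ) ∧
      ∀ ζ : ℂ, ‖ζ‖ = 1 → ∀ p ∈ P, f' ζ - p ∉ N p) f := by
  intro η hη
  obtain ⟨hbd, hb0, hdiv⟩ := hb
  obtain ⟨H, q, hH, hq, hfe⟩ := hdiv f hf.1
  have hSc : IsCompact (f '' closedBall 0 1) :=
    (isCompact_closedBall 0 1).image_of_continuousOn hf.continuousOn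
  obtain ⟨ρ, hρ, hρΩ⟩ := hSc.exists_thickening_subset_open hΩ hf.2.image_subset
  obtain ⟨B, hB⟩ := (isCompact_closedBall (0:ℂ) 1).exists_bound_of_continuousOn
    hbd.continuous.continuousOn
  have hB0 : 0 ≤ B := (norm_nonneg _).trans (hB 0 (by simp))
  obtain ⟨η₁, hη₁, hη₁B⟩ : ∃ η₁ > 0, B * (η₁ + η₁) < min κ (min η ρ) := by
    refine ⟨min κ (min η ρ) / (2 * (B + 1)), by positivity, ?_⟩
    have hm : 0 < min κ (min η ρ) := by positivity
    calc B * (min κ (min η ρ) / (2 * (B + 1)) + min κ (min η ρ) / (2 * (B + 1)))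
        = min κ (min η ρ) * (B / (B + 1)) := by field_simp; ring
      _ < min κ (min η ρ) * 1 := by gcongr; rw [div_lt_one (by positivity)]; linarith
      _ = _ := mul_one _
  obtain ⟨r, hr, hr1, hrq⟩ := hq.exists_dilation hη₁
  have hqr := hq.comp_dilation hr
  have hr1' : 1 < r⁻¹ := (one_lt_inv₀ hr).2 hr1
  -- the generic translation
  have hdense : Dense (⋃ p ∈ (P : Set (EuclideanSpace ℂ (Fin n))), range fun s : ℝ × N p =>
      (b (exp (s.1 * I)))⁻¹ • (p + (s.2 : EuclideanSpace ℂ (Fin n)) - H (exp (s.1 * I))) -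
        q (r * exp (s.1 * I)))ᶜ := by
    refine dense_compl_of_dimH_lt_finrank ?_
    have hle : dimH (⋃ p ∈ (P : Set (EuclideanSpace ℂ (Fin n))), range fun s : ℝ × N p =>
      (b (exp (s.1 * I)))⁻¹ • (p + (s.2 : EuclideanSpace ℂ (Fin n)) - H (exp (s.1 * I))) -
        q (r * exp (s.1 * I))) ≤ ((2 * n - 1 : ℕ) : ENNReal) := by
      rw [dimH_bUnion P.countable_toSet]
      refine iSup₂_le fun p hp => ?_
      have hcd : ContDiff ℝ 1 fun s : ℝ × N p =>
          (b (exp (s.1 * I)))⁻¹ • (p + (s.2 : EuclideanSpace ℂ (Fin n)) - H (exp (s.1 * I))) -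
            q (r * exp (s.1 * I)) := by
        have he : ContDiff ℝ 1 fun s : ℝ × N p => exp (s.1 * I) :=
          ((ofRealCLM.contDiff.comp contDiff_fst).mul contDiff_const).cexp
        have hb' : ContDiff ℝ 1 b := (hbd.contDiff (n := 1)).restrict_scalars ℝ
        have hH' : ContDiff ℝ 1 H := (hH.contDiff (n := 1)).restrict_scalars ℝ
        have hq' : ContDiffOn ℝ 1 (fun z => q (r * z)) (ball 0 r⁻¹) :=
          (hqr.contDiffOn isOpen_ball (n := 1)).restrict_scalars ℝ
        have hmem : ∀ s : ℝ × N p, exp (s.1 * I) ∈ ball (0:ℂ) r⁻¹ := fun s => by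
          rw [mem_ball_zero_iff, norm_exp_ofReal_mul_I]; exact hr1'
        have hsub : ContDiff ℝ 1 fun s : ℝ × N p => (s.2 : EuclideanSpace ℂ (Fin n)) :=
          (N p).subtypeL.contDiff.comp contDiff_snd
        refine ContDiff.sub (((hb'.comp he).inv fun s => hb0 _ (norm_exp_ofReal_mul_I _)).smul
          ((contDiff_const.add hsub).sub (hH'.comp he))) ?_
        exact hq'.comp_contDiff he hmem
      refine hcd.dimH_range_le.trans ?_
      rw [Module.finrank_prod, Module.finrank_self]
      exact_mod_cast (by have := hN p hp; omega)
    refine hle.trans_lt ?_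
    rw [finrank_real_euclidean]
    exact_mod_cast (by omega)
  obtain ⟨e, he, hemem⟩ := hdense.exists_dist_lt 0 hη₁
  rw [dist_zero_left] at hemem
  have hcl : closedBall (0:ℂ) 1 ⊆ ball 0 r⁻¹ := closedBall_subset_ball hr1'
  have hG : DiffContOnCl ℂ (fun z => q (r * z) - q z + e) (ball 0 1) := by
    refine ((DifferentiableOn.diffContOnCl ?_).sub hq).add_const e
    rw [closure_ball _ one_ne_zero]
    exact hqr.mono hcl
  have hsm : ∀ z ∈ closedBall (0:ℂ) 1, ‖b z • (q (r * z) - q z + e)‖ < min κ (min η ρ) := by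
    intro z hz
    refine lt_of_le_of_lt ?_ hη₁B
    rw [norm_smul]
    have h1 := hB z hz
    have h2 := (hrq z hz).le
    have h3 := norm_add_le (q (r * z) - q z) e
    gcongr
    linarith
  refine ⟨fun z => f z + b z • (q (r * z) - q z + e), ⟨hf.1.add (hbd.diffContOnCl.smul hG), ?_⟩,
    ⟨_, hG, rfl, ?_⟩, ?_, ?_⟩
  · intro z hz
    refine hρΩ (mem_thickening_iff.2 ⟨f z, mem_image_of_mem f hz, ?_⟩)
    rw [dist_eq_norm, add_sub_cancel_left]
    exact (hsm z hz).trans_le ((min_le_right _ _).trans (min_le_right _ _))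
  · intro z hz
    exact (hsm z (ball_subset_closedBall (hKb hz))).trans_le
      ((min_le_right _ _).trans (min_le_left _ _))
  · intro z hz
    rw [add_sub_cancel_left]
    exact (hsm z hz).trans_le (min_le_left _ _)
  · intro ζ hζ p hp hmem
    refine he (mem_iUnion₂.2 ⟨p, hp, ?_⟩)
    have hζe : exp (ζ.arg * I) = ζ := by
      have := norm_mul_exp_arg_mul_I ζ
      rwa [hζ, ofReal_one, one_mul] at this
    refine ⟨(ζ.arg, ⟨_, hmem⟩), ?_⟩
    have hζb := hb0 ζ hζ
    simp only [hζe]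
    rw [hfe ζ (by simp [hζ])]
    have : p + (H ζ + b ζ • q ζ + b ζ • (q (r * ζ) - q ζ + e) - p) - H ζ =
        b ζ • (q (r * ζ) + e) := by
      rw [smul_add, smul_add, smul_sub]; abel
    rw [this, inv_smul_smul₀ hζb, add_sub_cancel_left]

end Avoid

section Crossing

lemma Finset.exists_pos_le {X : Type*} (P : Finset X) (φ : X → ℝ) (h : ∀ p ∈ P, 0 < φ p) :
    ∃ r > 0, ∀ p ∈ P, r ≤ φ p := by
  classical
  induction P using Finset.induction_on with
  | empty => exact ⟨1, one_pos, by simp⟩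
  | insert a s _ ih =>
    obtain ⟨r, hr, hrs⟩ := ih fun p hp => h p (Finset.mem_insert_of_mem hp)
    refine ⟨min r (φ a), lt_min hr (h a (Finset.mem_insert_self _ _)), fun p hp => ?_⟩
    rcases Finset.mem_insert.1 hp with rfl | hp
    · exact min_le_right _ _
    · exact (min_le_left _ _).trans (hrs p hp)

lemma exists_scaled_bending {ν : ℝ} (hν : 0 < ν) :
    ∃ M : ℝ, 1 ≤ M ∧ ∀ ε > 0, ∃ (g : ℝ → ℝ) (g' : ℝ → ℝ) (g'' : ℝ → ℝ) (t₁ : ℝ),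
      ContDiff ℝ 2 g ∧ ε ≤ t₁ ∧ t₁ ≤ M * ε ∧
      (∀ t, HasDerivAt g (g' t) t) ∧ (∀ t, HasDerivAt g' (g'' t) t) ∧
      (∀ t, t ≤ ε → g t = t) ∧ (∀ t, M * ε ≤ t → g t = t₁) ∧ (∀ t, 0 ≤ g' t) ∧
      (∀ t, 0 ≤ t → -ν ≤ t * g'' t) ∧ (∀ t, g'' t ≤ 0) ∧ Monotone g ∧ (∀ t, 0 ≤ t → g t ≤ t) ∧
      (∀ t, g t ≤ t₁) := by
  obtain ⟨g, g', g'', t₁, M, hc, hM, ht₁, ht₁M, hg, hg', h1, h2, h3, h4, h5, h6⟩ :=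
      exists_bending hν
  refine ⟨M, hM, fun ε hε => ?_⟩
  have hs : ∀ t : ℝ, HasDerivAt (fun t : ℝ => t / ε) (1 / ε) t := fun t =>
    (hasDerivAt_id t).div_const ε
  have hd : ∀ t, HasDerivAt (fun t => ε * g (t / ε)) (g' (t / ε)) t := fun t => by
    exact (((hg (t / ε)).comp t (hs t)).const_mul ε).congr_deriv (by field_simp)
  have hmono : Monotone fun t => ε * g (t / ε) :=
    monotone_of_hasDerivAt_nonneg hd fun t => h3 _
  refine ⟨fun t => ε * g (t / ε), fun t => g' (t / ε), fun t => g'' (t / ε) * (1 / ε), ε * t₁,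
    ?_, by nlinarith, by nlinarith, hd, ?_, ?_, ?_, fun t => h3 _, ?_, ?_, hmono, ?_, ?_⟩
  · exact contDiff_const.mul (hc.comp (contDiff_id.div_const ε))
  · exact fun t => (hg' (t / ε)).comp t (hs t)
  · intro t ht
    have : t / ε ≤ 1 := (div_le_one hε).2 ht
    simp only
    rw [h1 _ this]; field_simp
  · intro t ht
    simp only
    rw [h2 _ ((le_div_iff₀ hε).2 ht)]
  · intro t ht
    have := h5 (t / ε) (by positivity)
    calc -ν ≤ t / ε * g'' (t / ε) := this
      _ = _ := by ring
  · intro t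
    have := h6 (t / ε)
    have h : (0:ℝ) ≤ 1 / ε := by positivity
    nlinarith
  · have hmono2 : Monotone fun t => t - ε * g (t / ε) :=
      monotone_of_hasDerivAt_nonneg (fun t => (hasDerivAt_id t).sub (hd t))
        fun t => by simpa using h4 (t / ε)
    intro t ht
    have := hmono2 ht
    simp only [zero_div, h1 0 zero_le_one] at this
    linarith
  · intro t
    have := hmono (le_max_left t (M * ε))
    simp only at this ⊢
    rwa [h2 (max t (M * ε) / ε) ((le_div_iff₀ hε).2 (le_max_right _ _))] at this

variable {n : ℕ} {F : Type*} [NormedAddCommGroup F] [InnerProductSpace ℝ F]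

lemma QuadNear.exists_coercive {T : EuclideanSpace ℂ (Fin n) → ℝ} {p : EuclideanSpace ℂ (Fin n)}
    {r : ℝ} {α β : EuclideanSpace ℂ (Fin n) →L[ℝ] F} (h : QuadNear T p r α β) :
    ∃ c > 0, ∀ w, c * ‖w‖ ^ 2 ≤ ‖α w‖ ^ 2 + ‖β w‖ ^ 2 := by
  have hinj : LinearMap.ker ((α.prod β : EuclideanSpace ℂ (Fin n) →L[ℝ] F × F) :
      EuclideanSpace ℂ (Fin n) →ₗ[ℝ] F × F) = ⊥ := by
    rw [LinearMap.ker_eq_bot']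
    intro w hw
    have : (α w, β w) = (0, 0) := hw
    exact h.2.2 w (Prod.ext_iff.1 this).1 (Prod.ext_iff.1 this).2
  obtain ⟨C, hC, hA⟩ := LinearMap.exists_antilipschitzWith _ hinj
  have hC' : (0:ℝ) < C := hC
  refine ⟨1 / C ^ 2, by positivity, fun w => ?_⟩
  have h1 : ‖w‖ ≤ C * ‖(α w, β w)‖ := by
    have := hA.le_mul_dist w 0
    simpa [dist_eq_norm] using this
  have h2 : ‖(α w, β w)‖ ^ 2 ≤ ‖α w‖ ^ 2 + ‖β w‖ ^ 2 := by
    rw [Prod.norm_def]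
    rcases max_cases ‖α w‖ ‖β w‖ with h | h <;> rw [h.1] <;>
      nlinarith [sq_nonneg ‖α w‖, sq_nonneg ‖β w‖]
  rw [one_div, inv_mul_le_iff₀ (by positivity)]
  calc ‖w‖ ^ 2 ≤ (C * ‖(α w, β w)‖) ^ 2 := by gcongr
    _ = C ^ 2 * ‖(α w, β w)‖ ^ 2 := by ring
    _ ≤ _ := by gcongr

end Crossing

section CrossingFunction

variable {n : ℕ} {F : Type*} [NormedAddCommGroup F] [InnerProductSpace ℝ F]

/-- A function that has no critical points on positive levels near `c`, used to push discs across
the critical level `c` of `T`. -/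
lemma exists_crossing_function (hn : 2 ≤ n) {Ω : Set (EuclideanSpace ℂ (Fin n))} (hΩ : IsOpen Ω)
    {T : EuclideanSpace ℂ (Fin n) → ℝ} (hT : ContDiffOn ℝ 2 T Ω)
    (hL : ∀ z ∈ Ω, ∀ w : EuclideanSpace ℂ (Fin n), w ≠ 0 → 0 < levi T z w)
    {c c₁ : ℝ} (hcc : c < c₁) (hc : IsCompact {z ∈ Ω | T z ≤ c₁})
    (hfin : {z ∈ Ω | T z ≤ c₁ ∧ fderiv ℝ T z = 0}.Finite)
    (hquad : ∀ z ∈ Ω, T z ≤ c₁ → fderiv ℝ T z = 0 →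
      ∃ r > 0, ∃ α β : EuclideanSpace ℂ (Fin n) →L[ℝ] F, QuadNear T z r α β) :
    ∃ (Tn : EuclideanSpace ℂ (Fin n) → ℝ) (ε hi hi' : ℝ) (P : Finset (EuclideanSpace ℂ (Fin n)))
      (N : EuclideanSpace ℂ (Fin n) → Submodule ℝ (EuclideanSpace ℂ (Fin n))),
      0 < ε ∧ hi' < hi ∧ ContDiffOn ℝ 2 Tn Ω ∧ IsCompact {z ∈ Ω | Tn z ≤ hi} ∧
      (∀ z ∈ Ω, 0 < Tn z → Tn z ≤ hi → (∀ w : EuclideanSpace ℂ (Fin n), w ≠ 0 → 0 < levi Tn z w) ∧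
        fderiv ℝ Tn z ≠ 0) ∧
      (∀ p ∈ P, Module.finrank ℝ (N p) + 1 < 2 * n) ∧
      (∀ z ∈ Ω, c - ε ≤ T z → (∀ p ∈ P, z - p ∉ N p) → 0 < Tn z) ∧
      (∀ z ∈ Ω, hi' ≤ Tn z → c + ε ≤ T z) := by
  classical
  set S := hfin.toFinset with hS
  have hSmem : ∀ z, z ∈ S ↔ z ∈ Ω ∧ T z ≤ c₁ ∧ fderiv ℝ T z = 0 := fun z => by
    rw [hS, Finite.mem_toFinset]; rfl
  set P := S.filter fun z => T z = c with hP
  have hPmem : ∀ {z}, z ∈ P → z ∈ Ω ∧ T z = c ∧ fderiv ℝ T z = 0 := fun {z} hz => by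
    rw [hP, Finset.mem_filter, hSmem] at hz
    exact ⟨hz.1.1, hz.2, hz.1.2.2⟩
  have hq : ∀ p, ∃ r : ℝ, ∃ α β : EuclideanSpace ℂ (Fin n) →L[ℝ] F, p ∈ P →
      0 < r ∧ QuadNear T p r α β := by
    intro p
    by_cases hp : p ∈ P
    · obtain ⟨h1, h2, h3⟩ := hPmem hp
      obtain ⟨r, hr, α, β, h⟩ := hquad p h1 (h2.trans_le hcc.le) h3
      exact ⟨r, α, β, fun _ => ⟨hr, h⟩⟩
    · exact ⟨0, 0, 0, fun h => absurd h hp⟩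
  choose r α β hrq using hq
  -- constants
  have hν' : ∀ p, ∃ ν : ℝ, p ∈ P → 0 < ν ∧ ∀ ν' ≤ ν, ∀ w : EuclideanSpace ℂ (Fin n), w ≠ 0 →
      (1 + 2 * ν') * (‖α p w‖ ^ 2 + ‖α p (I • w)‖ ^ 2) < ‖β p w‖ ^ 2 + ‖β p (I • w)‖ ^ 2 := by
    intro p
    by_cases hp : p ∈ P
    · obtain ⟨ν, h1, h2⟩ := (hrq p hp).2.exists_nu (hrq p hp).1 hΩ hT (hPmem hp).1
        (hL p (hPmem hp).1)
      exact ⟨ν, fun _ => ⟨h1, h2⟩⟩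
    · exact ⟨0, fun h => absurd h hp⟩
  choose νp hνp using hν'
  obtain ⟨ν, hν, hνle⟩ := P.exists_pos_le νp fun p hp => (hνp p hp).1
  have hc₀' : ∀ p, ∃ c₀ : ℝ, p ∈ P → 0 < c₀ ∧ ∀ w, c₀ * ‖w‖ ^ 2 ≤ ‖α p w‖ ^ 2 + ‖β p w‖ ^ 2 := by
    intro p
    by_cases hp : p ∈ P
    · obtain ⟨ν, h1, h2⟩ := (hrq p hp).2.exists_coercive
      exact ⟨ν, fun _ => ⟨h1, h2⟩⟩
    · exact ⟨0, fun h => absurd h hp⟩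
  choose cp hcp using hc₀'
  obtain ⟨c₀, hc₀, hc₀le⟩ := P.exists_pos_le cp fun p hp => (hcp p hp).1
  have hrad : ∀ p, ∃ s : ℝ, p ∈ P → 0 < s ∧ ball p s ⊆ Ω ∩ ball p (r p) := by
    intro p
    by_cases hp : p ∈ P
    · obtain ⟨s, hs, h⟩ := Metric.isOpen_iff.1 (hΩ.inter (isOpen_ball (x := p) (ε := r p))) p
        ⟨(hPmem hp).1, mem_ball_self (hrq p hp).1⟩
      exact ⟨s, fun _ => ⟨hs, h⟩⟩
    · exact ⟨0, fun h => absurd h hp⟩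
  choose sp hsp using hrad
  obtain ⟨s, hs, hsle⟩ := P.exists_pos_le sp fun p hp => (hsp p hp).1
  obtain ⟨δ, hδ, hδle⟩ := (P ×ˢ P).exists_pos_le (fun x => if x.1 = x.2 then 1 else dist x.1 x.2)
    fun x _ => by
      split_ifs with h
      · exact one_pos
      · exact dist_pos.2 h
  obtain ⟨γ, hγ, hγle⟩ := (S \ P).exists_pos_le (fun z => |T z - c|) fun z hz => by
    rw [Finset.mem_sdiff] at hz
    refine abs_pos.2 (sub_ne_zero.2 fun h => hz.2 ?_)
    rw [hP, Finset.mem_filter]; exact ⟨hz.1, h⟩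
  obtain ⟨R, hR, hRs, hRδ⟩ : ∃ R > 0, R < s ∧ 2 * R < δ := by
    refine ⟨min s δ / 4, by positivity, ?_, ?_⟩
    · linarith [min_le_left s δ]
    · linarith [min_le_right s δ]
  obtain ⟨M, hM, hbend⟩ := exists_scaled_bending hν
  obtain ⟨e, he, he1, he2, he3⟩ : ∃ e > 0, 3 * (M * e) < γ ∧ 3 * (M * e) < c₁ - c ∧
      5 * (M * e) < c₀ * (R / 2) ^ 2 := by
    have hc' : 0 < c₁ - c := sub_pos.2 hcc
    have hm : 0 < min γ (min (c₁ - c) (c₀ * (R / 2) ^ 2)) := by positivity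
    refine ⟨min γ (min (c₁ - c) (c₀ * (R / 2) ^ 2)) / (6 * M), by positivity, ?_, ?_, ?_⟩ <;>
      rw [show M * (min γ (min (c₁ - c) (c₀ * (R / 2) ^ 2)) / (6 * M)) =
        min γ (min (c₁ - c) (c₀ * (R / 2) ^ 2)) / 6 by field_simp]
    · linarith [min_le_left γ (min (c₁ - c) (c₀ * (R / 2) ^ 2))]
    · linarith [min_le_right γ (min (c₁ - c) (c₀ * (R / 2) ^ 2)),
        min_le_left (c₁ - c) (c₀ * (R / 2) ^ 2)]
    · linarith [min_le_right γ (min (c₁ - c) (c₀ * (R / 2) ^ 2)),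
        min_le_right (c₁ - c) (c₀ * (R / 2) ^ 2)]
  obtain ⟨g, g', g'', t₁, hgc, het₁, ht₁M, hg, hg', hgs, hgl, hg0, hgν, hg2, hgm, hgle, hgt₁⟩ :=
    hbend e he
  set t₂ := M * e with ht₂
  have ht₂0 : 0 < t₂ := by positivity
  have het₂ : e ≤ t₂ := het₁.trans ht₁M
  let χ : ∀ p : EuclideanSpace ℂ (Fin n), ContDiffBump p := fun p =>
    ⟨R / 2, R, by positivity, by linarith⟩
  let u : EuclideanSpace ℂ (Fin n) → EuclideanSpace ℂ (Fin n) → ℝ := fun p z =>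
    χ p z * (t₁ - g (‖α p (z - p)‖ ^ 2))
  have hu0 : ∀ p z, 0 ≤ u p z := fun p z =>
      mul_nonneg (χ p).nonneg (by linarith [hgt₁ (‖α p (z - p)‖ ^ 2)])
  have hg00 : g 0 = 0 := hgs 0 he.le
  have hu1 : ∀ p z, u p z ≤ t₁ := fun p z => by
    have h1 : 0 ≤ g (‖α p (z - p)‖ ^ 2) := hg00 ▸ hgm (sq_nonneg ‖α p (z - p)‖)
    have h2 := (χ p).nonneg (x := z)
    have h3 := (χ p).le_one (x := z)
    have h4 := hgt₁ (‖α p (z - p)‖ ^ 2)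
    calc u p z ≤ 1 * (t₁ - g (‖α p (z - p)‖ ^ 2)) := by
          apply mul_le_mul_of_nonneg_right h3; linarith
      _ ≤ t₁ := by linarith
  have hufar : ∀ p z, R ≤ dist z p → u p z = 0 := fun p z h => by
    simp only [u]; rw [(χ p).zero_of_le_dist h, zero_mul]
  have hdisj : ∀ p ∈ P, ∀ q ∈ P, ∀ z, dist z p ≤ R → q ≠ p → R < dist z q := by
    intro p hp q hq z hz hqp
    have h1 := hδle (q, p) (Finset.mk_mem_product hq hp)
    simp only [if_neg hqp] at h1
    have := dist_triangle_left q p z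
    linarith
  set Tn : EuclideanSpace ℂ (Fin n) → ℝ := fun z => T z - c + t₁ - ∑ p ∈ P, u p z with hTn
  have hsum0 : ∀ z, 0 ≤ ∑ p ∈ P, u p z := fun z => Finset.sum_nonneg fun p _ => hu0 p z
  have hsum1 : ∀ z, ∑ p ∈ P, u p z ≤ t₁ := by
    intro z
    by_cases h : ∃ p ∈ P, dist z p ≤ R
    · obtain ⟨p, hp, hz⟩ := h
      rw [Finset.sum_eq_single_of_mem p hp fun q hq hqp => hufar q z (hdisj p hp q hq z hz hqp).le]
      exact hu1 p z
    · push Not at h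
      rw [Finset.sum_eq_zero fun p hp => hufar p z (h p hp).le]
      linarith
  have hTc : ContDiffOn ℝ 2 Tn Ω := by
    refine ((hT.sub contDiffOn_const).add contDiffOn_const).sub ?_
    refine ContDiffOn.sum fun p _ => (ContDiff.contDiffOn ?_)
    exact (χ p).contDiff.mul (contDiff_const.sub
      (hgc.comp (((α p).contDiff.comp (contDiff_id.sub contDiff_const)).norm_sq ℝ)))
  have hquadR : ∀ p ∈ P, ∀ z, dist z p ≤ R →
      T z = c + (‖β p (z - p)‖ ^ 2 - ‖α p (z - p)‖ ^ 2) := by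
    intro p hp z hz
    have h1 := (hsp p hp).2 (show z ∈ ball p (sp p) from
      mem_ball.2 (hz.trans_lt (hRs.trans_le (hsle p hp))))
    rw [(hrq p hp).2.1 z h1.2, (hPmem hp).2.1]
  have hinner : ∀ p ∈ P, ∀ z, dist z p < R / 2 → Tn z = bend (α p) (β p) g p z := by
    intro p hp z hz
    have hzR : dist z p ≤ R := by linarith
    simp only [hTn]
    rw [Finset.sum_eq_single_of_mem p hp fun q hq hqp => hufar q z (hdisj p hp q hq z hzR hqp).le,
      hquadR p hp z hzR]
    simp only [u]
    rw [(χ p).one_of_mem_closedBall (mem_closedBall.2 hz.le), bend]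
    ring
  have houter : ∀ z ∈ Ω, T z - c ≤ 3 * t₂ → (∀ p ∈ P, R / 2 ≤ dist z p) →
      Tn =ᶠ[𝓝 z] fun z => T z + (t₁ - c) := by
    intro z hz hTz hd
    have hev : ∀ᶠ y in 𝓝 z, ∀ p ∈ P, u p y = 0 := by
      rw [Filter.eventually_all_finset]
      intro p hp
      rcases lt_or_ge R (dist z p) with h | h
      · have hco : ContinuousAt (fun y => dist y p) z := by fun_prop
        filter_upwards [hco.eventually (lt_mem_nhds h)] with y hy using hufar p y hy.le
      · have h1 := hquadR p hp z h
        have h2 := (hcp p hp).2 (z - p)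
        have h3 : c₀ * (R / 2) ^ 2 ≤ cp p * ‖z - p‖ ^ 2 := by
          have h4 := hd p hp
          rw [dist_eq_norm] at h4
          have h5 := hc₀le p hp
          have h6 : 0 ≤ cp p := hc₀.le.trans h5
          gcongr
        have h6 : t₂ < ‖α p (z - p)‖ ^ 2 := by linarith
        have hco : ContinuousAt (fun y => ‖α p (y - p)‖ ^ 2) z := by fun_prop
        filter_upwards [hco.eventually (lt_mem_nhds h6)] with y hy
        simp only [u]
        rw [hgl _ hy.le, sub_self, mul_zero]
    filter_upwards [hev] with y hy
    simp only [hTn]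
    rw [Finset.sum_eq_zero hy]
    ring
  refine ⟨Tn, e / 2, 3 * t₂, 2 * t₂, P, fun p => LinearMap.ker (β p : _ →ₗ[ℝ] F), by positivity,
    by linarith, hTc, ?_, ?_, ?_, ?_, ?_⟩
  · have h1 : {z ∈ Ω | Tn z ≤ 3 * t₂} = {z ∈ {z ∈ Ω | T z ≤ c₁} | Tn z ≤ 3 * t₂} := by
      ext z
      simp only [Set.mem_ofPred_eq]
      constructor
      · rintro ⟨h1, h2⟩
        refine ⟨⟨h1, ?_⟩, h2⟩
        have := hsum1 z
        simp only [hTn] at h2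
        linarith
      · rintro ⟨⟨h1, -⟩, h2⟩; exact ⟨h1, h2⟩
    rw [h1]
    refine IsCompact.of_isClosed_subset hc ?_ (sep_subset _ _)
    exact (hTc.continuousOn.mono (sep_subset _ _)).preimage_isClosed_of_isClosed hc.isClosed
      isClosed_Iic
  · intro z hz hpos hle
    by_cases h : ∃ p ∈ P, dist z p < R / 2
    · obtain ⟨p, hp, hzp⟩ := h
      have hev : Tn =ᶠ[𝓝 z] bend (α p) (β p) g p := by
        filter_upwards [isOpen_ball.mem_nhds (mem_ball.2 hzp)] with y hy
        exact hinner p hp y hy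
      constructor
      · intro w hw
        rw [levi_congr hev]
        have h1 := levi_bend_ge (α := α p) (β := β p) hgc hg hg' hg0 hg2 hgν p z w
        have h2 := (hνp p hp).2 ν (hνle p hp) w hw
        linarith
      · intro h0
        rw [hev.fderiv_eq] at h0
        obtain ⟨v, hv1, hv2⟩ := (hrq p hp).2.2.1 (z - p)
        have h1 := fderiv_bend (α := α p) (β := β p) hgc hg p z hv1 hv2
        rw [h0] at h1
        have h2 : ‖β p (z - p)‖ ^ 2 = 0 := by
          rw [zero_apply] at h1; linarith
        rw [hinner p hp z hzp, bend, h2] at hpos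
        have := hgle _ (sq_nonneg ‖α p (z - p)‖)
        linarith
    · push Not at h
      have hs1 := hsum1 z
      have hs0 := hsum0 z
      have hTz : T z - c ≤ 3 * t₂ := by
        simp only [hTn] at hle; linarith
      have hev := houter z hz hTz h
      constructor
      · intro w hw
        rw [levi_congr hev, levi_add_const]
        exact hL z hz w hw
      · intro h0
        rw [hev.fderiv_eq, fderiv_add_const] at h0
        have hzS : z ∈ S := (hSmem z).2 ⟨hz, by linarith, h0⟩
        have hzP : z ∉ P := fun hzP => by
          have := h z hzP
          rw [dist_self] at this
          linarith
        have h1 := hγle z (Finset.mem_sdiff.2 ⟨hzS, hzP⟩)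
        have h2 := hev.eq_of_nhds
        rw [h2] at hpos
        have : |T z - c| ≤ 3 * t₂ := abs_le.2 ⟨by linarith, hTz⟩
        linarith
  · intro p hp
    refine finrank_ker_lt hn fun w hw1 hw2 => ?_
    by_contra hw
    have h1 := hL p (hPmem hp).1 w hw
    rw [(hrq p hp).2.levi (hrq p hp).1, hw1, hw2] at h1
    have h2 := sq_nonneg ‖α p w‖
    have h3 := sq_nonneg ‖α p (I • w)‖
    simp only [norm_zero] at h1
    linarith
  · intro z hz hTz hzN
    by_cases h : ∃ p ∈ P, dist z p < R / 2
    · obtain ⟨p, hp, hzp⟩ := h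
      rw [hinner p hp z hzp, bend]
      have h1 := hquadR p hp z (by linarith)
      rcases le_or_gt (‖α p (z - p)‖ ^ 2) e with hA | hA
      · rw [hgs _ hA]
        have : β p (z - p) ≠ 0 := fun h => hzN p hp h
        have : 0 < ‖β p (z - p)‖ ^ 2 := by positivity
        linarith
      · have := hgm hA.le
        rw [hgs e le_rfl] at this
        linarith
    · push Not at h
      rcases le_or_gt (T z - c) (3 * t₂) with h1 | h1
      · rw [(houter z hz h1 h).eq_of_nhds]
        linarith
      · have := hsum1 z
        simp only [hTn]
        linarith
  · intro z hz h1
    have := hsum0 z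
    simp only [hTn] at h1
    linarith

end CrossingFunction

section Cross

variable {n : ℕ} {F : Type*} [NormedAddCommGroup F] [InnerProductSpace ℝ F]
  {b : ℂ → ℂ} {K : Set ℂ} {Ω : Set (EuclideanSpace ℂ (Fin n))}

/-- Discs can be pushed across a critical level with quadratic critical points. -/
theorem reaches_cross (hn : 2 ≤ n) (hΩ : IsOpen Ω) (hb : IsDivisor n b) (hK : IsCompact K)
    (hKb : K ⊆ ball 0 1)
    {T : EuclideanSpace ℂ (Fin n) → ℝ} (hT : ContDiffOn ℝ 2 T Ω)
    (hL : ∀ z ∈ Ω, ∀ w : EuclideanSpace ℂ (Fin n), w ≠ 0 → 0 < levi T z w)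
    {c c₁ : ℝ} (hcc : c < c₁) (hc : IsCompact {z ∈ Ω | T z ≤ c₁})
    (hfin : {z ∈ Ω | T z ≤ c₁ ∧ fderiv ℝ T z = 0}.Finite)
    (hquad : ∀ z ∈ Ω, T z ≤ c₁ → fderiv ℝ T z = 0 →
      ∃ r > 0, ∃ α β : EuclideanSpace ℂ (Fin n) →L[ℝ] F, QuadNear T z r α β) :
    ∃ ε > 0, ∀ f, IsDisc Ω f → (∀ ζ : ℂ, ‖ζ‖ = 1 → c - ε ≤ T (f ζ)) →
      Reaches b K Ω (fun f' => ∀ ζ : ℂ, ‖ζ‖ = 1 → c + ε ≤ T (f' ζ)) f := by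
  obtain ⟨Tn, ε, hi, hi', P, N, hε, hhi, hTn, hcn, hreg, hN, hstart, hend⟩ :=
    exists_crossing_function hn hΩ hT hL hcc hc hfin hquad
  refine ⟨ε / 2, by positivity, fun f hf hfT => ?_⟩
  have hSc : IsCompact (f '' closedBall 0 1) :=
    (isCompact_closedBall 0 1).image_of_continuousOn hf.continuousOn
  obtain ⟨κ, hκ, hmod⟩ := exists_modulus hΩ hT.continuousOn hSc hf.2.image_subset (half_pos hε)
  refine Reaches.trans (reaches_avoid hn hΩ hb hKb hf P N hN hκ) fun f₁ hf₁ hQ => ?_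
  have hpos : ∀ ζ ∈ sphere (0:ℂ) 1, 0 < Tn (f₁ ζ) := by
    intro ζ hζ
    have hζ1 : ‖ζ‖ = 1 := by simpa using hζ
    have hζ' : ζ ∈ closedBall (0:ℂ) 1 := sphere_subset_closedBall hζ
    refine hstart _ (hf₁.2 hζ') ?_ (hQ.2 ζ hζ1)
    have h1 := hmod (f ζ) (mem_image_of_mem f hζ') (f₁ ζ) (hQ.1 ζ hζ')
    have h2 := hfT ζ hζ1
    have := (abs_lt.1 h1).1
    linarith
  have hcont : ContinuousOn (fun ζ => Tn (f₁ ζ)) (sphere 0 1) :=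
    hTn.continuousOn.comp (hf₁.continuousOn.mono sphere_subset_closedBall)
      (hf₁.2.mono_left sphere_subset_closedBall)
  obtain ⟨ζ₀, hζ₀, hmin⟩ := (isCompact_sphere (0:ℂ) 1).exists_isMinOn ⟨1, by simp⟩ hcont
  have hR := reaches_of_noncritical (K := K) (lo := Tn (f₁ ζ₀)) hn hΩ hb.1 hb.2.1 hK hKb hTn hhi hcn
    (fun z hz h1 h2 => (hreg z hz ((hpos ζ₀ hζ₀).trans_le h1) h2).1)
    (fun z hz h1 h2 => (hreg z hz ((hpos ζ₀ hζ₀).trans_le h1) h2).2) hf₁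
    (fun ζ hζ => hmin (by simpa using hζ))
  intro η hη
  obtain ⟨f₂, h1, h2, h3⟩ := hR η hη
  refine ⟨f₂, h1, h2, fun ζ hζ => ?_⟩
  have := hend (f₂ ζ) (h1.2 (by simp [hζ])) (h3 ζ hζ)
  linarith

end Cross

section Split

variable {E : Type*} [NormedAddCommGroup E] [NormedSpace ℝ E] [FiniteDimensional ℝ E]

/-- A nondegenerate real quadratic form is a difference of squares of norms. -/
lemma exists_split_quadratic (B : E →L[ℝ] E →L[ℝ] ℝ) (hs : ∀ v w, B v w = B w v)
    (hB : ∀ w, B w = 0 → w = 0) :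
    ∃ α β : E →L[ℝ] EuclideanSpace ℝ (Fin (Module.finrank ℝ E)),
      (∀ w, (1 / 2) * B w w = ‖β w‖ ^ 2 - ‖α w‖ ^ 2) ∧
      (∀ z, ∃ v, α v = 0 ∧ β v = β z) ∧ ∀ z, α z = 0 → β z = 0 → z = 0 := by
  let L : LinearMap.BilinForm ℝ E := LinearMap.mk₂ ℝ (fun v w => (1 / 2) * B v w)
    (fun v v' w => by simp [mul_add]) (fun c v w => by simp; ring) (fun v w w' => by simp [mul_add])
    (fun c v w => by simp; ring)
  have hL : ∀ v w, L v w = (1 / 2) * B v w := fun v w => rfl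
  let Q : QuadraticForm ℝ E := LinearMap.BilinMap.toQuadraticMap L
  have hQ : ∀ w, Q w = (1 / 2) * B w w := fun w => rfl
  have hass : QuadraticMap.associated (R := ℝ) Q = L := by
    refine QuadraticMap.associated_left_inverse ℝ fun v w => ?_
    rw [hL, hL, hs]
  obtain ⟨w, hw, ⟨e⟩⟩ := QuadraticForm.equivalent_one_neg_one_weighted_sum_squared Q (by
    rw [hass]
    intro x hx
    refine hB x (ContinuousLinearMap.ext fun y => ?_)
    have := hx y
    rw [hL] at this
    rw [zero_apply]
    linarith)
  have he : ∀ z, ∑ i, w i * (e z i * e z i) = (1 / 2) * B z z := by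
    intro z
    have := e.map_app z
    rw [QuadraticMap.weightedSumSquares_apply, hQ] at this
    exact this
  let φ : (Fin (Module.finrank ℝ E) → ℝ) → E →ₗ[ℝ] EuclideanSpace ℝ (Fin (Module.finrank ℝ E)) :=
    fun s => (WithLp.linearEquiv 2 ℝ (Fin (Module.finrank ℝ E) → ℝ)).symm.toLinearMap ∘ₗ
      LinearMap.pi fun i => s i • (LinearMap.proj i ∘ₗ e.toLinearEquiv.toLinearMap)
  have hφ : ∀ s z i, φ s z i = s i * e z i := fun s z i => rfl
  refine ⟨(φ fun i => if w i = -1 then 1 else 0).toContinuousLinearMap,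
    (φ fun i => if w i = -1 then 0 else 1).toContinuousLinearMap, fun z => ?_, fun z => ?_,
    fun z h1 h2 => ?_⟩
  · rw [← he, EuclideanSpace.norm_sq_eq, EuclideanSpace.norm_sq_eq, ← Finset.sum_sub_distrib]
    refine Finset.sum_congr rfl fun i _ => ?_
    simp only [LinearMap.coe_toContinuousLinearMap', hφ, Real.norm_eq_abs, sq_abs]
    rcases hw i with h | h
    · rw [if_pos h, if_pos h, h]; ring
    · rw [if_neg (by rw [h]; norm_num), if_neg (by rw [h]; norm_num), h]; ring
  · refine ⟨e.toLinearEquiv.symm fun i => if w i = -1 then 0 else e z i, ?_, ?_⟩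
    · ext i
      have : e (e.toLinearEquiv.symm fun i => if w i = -1 then 0 else e z i) =
        fun i => if w i = -1 then 0 else e z i := e.toLinearEquiv.apply_symm_apply _
      simp only [LinearMap.coe_toContinuousLinearMap', hφ, this]
      split_ifs <;> simp
    · ext i
      have : e (e.toLinearEquiv.symm fun i => if w i = -1 then 0 else e z i) =
        fun i => if w i = -1 then 0 else e z i := e.toLinearEquiv.apply_symm_apply _
      simp only [LinearMap.coe_toContinuousLinearMap', hφ, this]
      split_ifs <;> simp
  · have : e z = 0 := by
      funext i
      have h1' := congrArg (fun v => v i) h1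
      have h2' := congrArg (fun v => v i) h2
      simp only [LinearMap.coe_toContinuousLinearMap', hφ] at h1' h2'
      by_cases h : w i = -1
      · simpa [h] using h1'
      · simpa [h] using h2'
    exact e.toLinearEquiv.map_eq_zero_iff.1 this

end Split

section Product

variable {E : Type*} [NormedAddCommGroup E] [NormedSpace ℝ E]

lemma ContDiffAt.hasDerivAt_line {φ : E → ℝ} {z : E} (h : ContDiffAt ℝ 2 φ z) (w : E) :
    (∀ᶠ s : ℝ in 𝓝 0, HasDerivAt (fun s : ℝ => φ (z + s • w)) (fderiv ℝ φ (z + s • w) w) s) ∧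
      HasDerivAt (fun s : ℝ => fderiv ℝ φ (z + s • w) w) (D2 φ z w w) 0 := by
  have hl : ∀ s : ℝ, HasDerivAt (fun s : ℝ => z + s • w) w s := fun s => by
    simpa using ((hasDerivAt_id s).smul_const w).const_add z
  constructor
  · have h1 : ∀ᶠ y in 𝓝 z, DifferentiableAt ℝ φ y := by
      filter_upwards [h.eventually (by norm_num)] with y hy
      exact hy.differentiableAt (by norm_num)
    have h2 : Filter.Tendsto (fun s : ℝ => z + s • w) (𝓝 0) (𝓝 z) := by
      have := (hl 0).continuousAt.tendsto
      simpa using this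
    filter_upwards [h2.eventually h1] with s hs
    exact hs.hasFDerivAt.comp_hasDerivAt s (hl s)
  · have h1 : ContDiffAt ℝ 1 (fderiv ℝ φ) z := h.fderiv_right (by norm_num)
    have h2 := (h1.differentiableAt (by norm_num)).hasFDerivAt
    have h3 : HasFDerivAt (fderiv ℝ φ) (fderiv ℝ (fderiv ℝ φ) z) (z + (0:ℝ) • w) := by
        simpa using h2
    have h4 := h3.comp_hasDerivAt (0:ℝ) (hl 0)
    exact ((ContinuousLinearMap.apply ℝ ℝ w).hasFDerivAt.comp_hasDerivAt (0:ℝ) h4)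

lemma D2_mul {φ ψ : E → ℝ} {z : E} (hφ : ContDiffAt ℝ 2 φ z) (hψ : ContDiffAt ℝ 2 ψ z) (w : E) :
    D2 (fun y => φ y * ψ y) z w w =
      D2 φ z w w * ψ z + 2 * (fderiv ℝ φ z w * fderiv ℝ ψ z w) + φ z * D2 ψ z w w := by
  obtain ⟨h1, h2⟩ := hφ.hasDerivAt_line w
  obtain ⟨h3, h4⟩ := hψ.hasDerivAt_line w
  refine D2_eq_of_line (hφ.mul hψ) (ψ' := fun s : ℝ => fderiv ℝ φ (z + s • w) w * ψ (z + s • w) +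
    φ (z + s • w) * fderiv ℝ ψ (z + s • w) w) ?_ ?_
  · filter_upwards [h1, h3] with s hs hs'
    exact hs.mul hs'
  · have := (h2.mul h3.self_of_nhds).add (h1.self_of_nhds.mul h4)
    exact this.congr_deriv (by rw [zero_smul, add_zero]; ring)

lemma D2_sub {φ ψ : E → ℝ} {z : E} (hφ : ContDiffAt ℝ 2 φ z) (hψ : ContDiffAt ℝ 2 ψ z) (w : E) :
    D2 (fun y => φ y - ψ y) z w w = D2 φ z w w - D2 ψ z w w := by
  obtain ⟨h1, h2⟩ := hφ.hasDerivAt_line w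
  obtain ⟨h3, h4⟩ := hψ.hasDerivAt_line w
  refine D2_eq_of_line (hφ.sub hψ) (ψ' := fun s : ℝ => fderiv ℝ φ (z + s • w) w -
    fderiv ℝ ψ (z + s • w) w) ?_ (h2.sub h4)
  filter_upwards [h1, h3] with s hs hs'
  exact hs.sub hs'

omit [NormedSpace ℝ E] in
lemma HasCompactSupport.exists_norm_bound {G : Type*} [SeminormedAddCommGroup G] {f : E → G}
    (hc : Continuous f) (hs : HasCompactSupport f) : ∃ C, ∀ z, ‖f z‖ ≤ C :=
  hs.exists_bound_of_continuous hc

variable (E) in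
lemma exists_unit_cutoff [FiniteDimensional ℝ E] :
    ∃ (θ : E → ℝ) (C : ℝ), 0 ≤ C ∧ ContDiff ℝ 3 θ ∧ (∀ z, 0 ≤ θ z) ∧ (∀ z, θ z ≤ 1) ∧
      (∀ z, ‖z‖ ≤ 1 / 2 → θ z = 1) ∧ (∀ z, 1 ≤ ‖z‖ → θ z = 0) ∧
      (∀ z, ‖fderiv ℝ θ z‖ ≤ C) ∧ ∀ z, ‖fderiv ℝ (fderiv ℝ θ) z‖ ≤ C := by
  obtain ⟨f, hf1, hf2⟩ : ∃ f : ContDiffBump (0:E), f.rIn = 1 / 2 ∧ f.rOut = 1 :=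
    ⟨⟨1 / 2, 1, by norm_num, by norm_num⟩, rfl, rfl⟩
  have h3 : ContDiff ℝ 3 (f : E → ℝ) := f.contDiff
  have hs := f.hasCompactSupport
  have h1 : ∀ z, ‖z‖ ≤ 1 / 2 → f z = 1 := fun z hz => f.one_of_mem_closedBall (by
    rw [mem_closedBall_zero_iff, hf1]; exact hz)
  have h0 : ∀ z, 1 ≤ ‖z‖ → f z = 0 := fun z hz => f.zero_of_le_dist (by
    rw [dist_zero_right, hf2]; exact hz)
  have hn : ∀ z, 0 ≤ f z := fun z => f.nonneg
  have hl : ∀ z, f z ≤ 1 := fun z => f.le_one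
  generalize (f : E → ℝ) = θ at h3 hs h1 h0 hn hl
  have hθ1 : ContDiff ℝ 2 (fderiv ℝ θ) := h3.fderiv_right (by norm_num)
  have hθ2 : ContDiff ℝ 1 (fderiv ℝ (fderiv ℝ θ)) := hθ1.fderiv_right (by norm_num)
  have hs1 : HasCompactSupport (fderiv ℝ θ) := hs.fderiv (𝕜 := ℝ)
  have hs2 : HasCompactSupport (fderiv ℝ (fderiv ℝ θ)) := hs1.fderiv (𝕜 := ℝ)
  obtain ⟨C₁, hC₁⟩ := HasCompactSupport.exists_norm_bound hθ1.continuous hs1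
  obtain ⟨C₂, hC₂⟩ :=
    HasCompactSupport.exists_norm_bound (G := E →L[ℝ] E →L[ℝ] ℝ) hθ2.continuous hs2
  exact ⟨θ, max C₁ C₂, ((norm_nonneg _).trans (hC₁ 0)).trans (le_max_left _ _), h3, hn, hl, h1, h0,
    fun z => (hC₁ z).trans (le_max_left _ _), fun z => (hC₂ z).trans (le_max_right _ _)⟩

/-- Cutoffs at scale `R` with the natural derivative bounds. -/
lemma exists_cutoff [FiniteDimensional ℝ E] (p : E) :
    ∃ C : ℝ, 0 ≤ C ∧ ∀ R > 0, ∃ χ : E → ℝ, ContDiff ℝ 2 χ ∧ (∀ z, 0 ≤ χ z) ∧ (∀ z, χ z ≤ 1) ∧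
      (∀ z, dist z p ≤ R / 2 → χ z = 1) ∧ (∀ z, R ≤ dist z p → χ z = 0) ∧
      (∀ z w, |fderiv ℝ χ z w| ≤ C / R * ‖w‖) ∧ ∀ z w, |D2 χ z w w| ≤ C / R ^ 2 * ‖w‖ ^ 2 := by
  obtain ⟨θ, C, hC, hθ, hn, hl, h1, h0, hC₁, hC₂⟩ := exists_unit_cutoff E
  refine ⟨C, hC, fun R hR => ?_⟩
  have hm : ∀ z : E, ‖R⁻¹ • (z - p)‖ = dist z p / R := fun z => by
    rw [norm_smul, Real.norm_of_nonneg (by positivity), dist_eq_norm]; field_simp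
  have hcd : ContDiff ℝ 2 fun z : E => R⁻¹ • (z - p) :=
      contDiff_const.smul (contDiff_id.sub contDiff_const)
  have hχc : ContDiff ℝ 2 fun z : E => θ (R⁻¹ • (z - p)) := (hθ.of_le (by norm_num)).comp hcd
  have hline : ∀ (z w : E) (s : ℝ), R⁻¹ • (z + s • w - p) = R⁻¹ • (z - p) + s • (R⁻¹ • w) := by
    intro z w s
    rw [smul_comm s, ← smul_add]; congr 1; abel
  have hlin : ∀ (z w : E) (s : ℝ),
      HasDerivAt (fun s : ℝ => R⁻¹ • (z - p) + s • (R⁻¹ • w)) (R⁻¹ • w) s :=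
    fun z w s => by simpa using ((hasDerivAt_id s).smul_const (R⁻¹ • w)).const_add (R⁻¹ • (z - p))
  have hfd : ∀ z w,
      fderiv ℝ (fun z : E => θ (R⁻¹ • (z - p))) z w = R⁻¹ * fderiv ℝ θ (R⁻¹ • (z - p)) w := by
    intro z w
    have h1 : HasFDerivAt (fun z : E => R⁻¹ • (z - p)) (R⁻¹ • ContinuousLinearMap.id ℝ E) z :=
      ((hasFDerivAt_id z).sub_const p).const_smul R⁻¹
    have h2 := ((hθ.differentiable (by norm_num)) (R⁻¹ • (z - p))).hasFDerivAt
    exact (congrArg (fun L : E →L[ℝ] ℝ => L w) (h2.comp z h1).fderiv).trans (by simp)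
  refine ⟨fun z => θ (R⁻¹ • (z - p)), hχc, fun z => hn _, fun z => hl _, ?_, ?_, ?_, ?_⟩
  · intro z hz
    refine h1 _ ?_
    rw [hm, div_le_iff₀ hR]
    linarith
  · intro z hz
    refine h0 _ ?_
    rw [hm, le_div_iff₀ hR]
    linarith
  · intro z w
    rw [hfd, abs_mul, abs_of_nonneg (by positivity : 0 ≤ R⁻¹)]
    have h1 : |fderiv ℝ θ (R⁻¹ • (z - p)) w| ≤ C * ‖w‖ :=
      (fderiv ℝ θ (R⁻¹ • (z - p))).le_of_opNorm_le (hC₁ _) w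
    calc R⁻¹ * |fderiv ℝ θ (R⁻¹ • (z - p)) w| ≤ R⁻¹ * (C * ‖w‖) := by gcongr
      _ = _ := by ring
  · intro z w
    obtain ⟨h1, h2⟩ := (hθ.contDiffAt (x := R⁻¹ • (z - p))).of_le (by norm_num : (2:WithTop ℕ∞) ≤ 3)
      |>.hasDerivAt_line (R⁻¹ • w)
    have hD : D2 (fun z : E => θ (R⁻¹ • (z - p))) z w w =
        D2 θ (R⁻¹ • (z - p)) (R⁻¹ • w) (R⁻¹ • w) := by
      refine D2_eq_of_line hχc.contDiffAt ?_ h2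
      filter_upwards [h1] with s hs
      simp only [hline]
      exact hs
    rw [hD, D2]
    have h3 := (fderiv ℝ (fderiv ℝ θ) (R⁻¹ • (z - p))).le_of_opNorm_le (hC₂ _) (R⁻¹ • w)
    have h4 := (fderiv ℝ (fderiv ℝ θ) (R⁻¹ • (z - p)) (R⁻¹ • w)).le_of_opNorm_le h3 (R⁻¹ • w)
    rw [Real.norm_eq_abs, norm_smul, Real.norm_of_nonneg (by positivity : 0 ≤ R⁻¹)] at h4
    refine h4.trans ?_
    refine le_of_eq ?_
    field_simp

end Product

section Modification

variable {E : Type*} [NormedAddCommGroup E] [NormedSpace ℝ E]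

omit [NormedSpace ℝ E] in
lemma ContinuousOn.exists_ball_norm_sub_lt {G : Type*} [SeminormedAddCommGroup G] {f : E → G}
    {Ω : Set E} (hf : ContinuousOn f Ω) (hΩ : IsOpen Ω) {p : E} (hp : p ∈ Ω) {ω : ℝ} (hω : 0 < ω) :
    ∃ R > 0, ball p R ⊆ Ω ∧ ∀ z ∈ ball p R, ‖f z - f p‖ < ω := by
  obtain ⟨R₁, hR₁, h1⟩ := Metric.continuousAt_iff.1 (hf.continuousAt (hΩ.mem_nhds hp)) ω hω
  obtain ⟨R₂, hR₂, h2⟩ := Metric.isOpen_iff.1 hΩ p hp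
  refine ⟨min R₁ R₂, lt_min hR₁ hR₂, (ball_subset_ball (min_le_right _ _)).trans h2, fun z hz => ?_⟩
  rw [← dist_eq_norm]
  exact h1 (ball_subset_ball (min_le_left _ _) hz)

lemma quadratic_derivs (B : E →L[ℝ] E →L[ℝ] ℝ) (hs : ∀ v w, B v w = B w v) (p : E) (t : ℝ) :
    ContDiff ℝ 2 (fun z => t + (1 / 2) * B (z - p) (z - p)) ∧
    (∀ z, HasFDerivAt (fun z => t + (1 / 2) * B (z - p) (z - p)) (B (z - p)) z) ∧
    fderiv ℝ (fun z => t + (1 / 2) * B (z - p) (z - p)) = fun z => B (z - p) := by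
  have hd : ∀ z, HasFDerivAt (fun z => t + (1 / 2) * B (z - p) (z - p)) (B (z - p)) z := by
    intro z
    have h1 : HasFDerivAt (fun z : E => z - p) (ContinuousLinearMap.id ℝ E) z :=
      (hasFDerivAt_id z).sub_const p
    have h2 := ((B.hasFDerivAt_of_bilinear h1 h1).const_mul (1 / 2)).const_add t
    refine h2.congr_fderiv (ContinuousLinearMap.ext fun w => ?_)
    simp [hs w z, hs w p]
    ring
  refine ⟨?_, hd, funext fun z => (hd z).fderiv⟩
  have h1 : ContDiff ℝ 2 fun z : E => z - p := contDiff_id.sub contDiff_const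
  exact contDiff_const.add (contDiff_const.mul ((B.contDiff.comp h1).clm_apply h1))

lemma exists_second_order_error {T : E → ℝ} {Ω : Set E} (hΩ : IsOpen Ω) (hT : ContDiffOn ℝ 2 T Ω)
    {p : E} (hp : p ∈ Ω) (hcrit : fderiv ℝ T p = 0)
    (hs : ∀ v w, fderiv ℝ (fderiv ℝ T) p v w = fderiv ℝ (fderiv ℝ T) p w v) {ω : ℝ} (hω : 0 < ω) :
    ∃ R > 0, ball p R ⊆ Ω ∧ ∀ z ∈ ball p R,
      |T z - (T p + (1 / 2) * fderiv ℝ (fderiv ℝ T) p (z - p) (z - p))| ≤ ω * ‖z - p‖ ^ 2 ∧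
      (∀ w, |fderiv ℝ T z w - fderiv ℝ (fderiv ℝ T) p (z - p) w| ≤ ω * ‖z - p‖ * ‖w‖) ∧
      (∀ w, |D2 T z w w - fderiv ℝ (fderiv ℝ T) p w w| ≤ ω * ‖w‖ ^ 2) := by
  set B := fderiv ℝ (fderiv ℝ T) p with hB
  obtain ⟨hQ, hQd, hQf⟩ := quadratic_derivs B hs p (T p)
  have hT1 : ContDiffOn ℝ 1 (fderiv ℝ T) Ω := hT.fderiv_of_isOpen hΩ (by norm_num)
  have hT2 : ContinuousOn (fderiv ℝ (fderiv ℝ T)) Ω := hT1.continuousOn_fderiv_of_isOpen hΩ le_rfl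
  obtain ⟨R, hR, hRΩ, hb'⟩ := hT2.exists_ball_norm_sub_lt
    (G := E →L[ℝ] E →L[ℝ] ℝ) hΩ hp hω
  have hb : ∀ z ∈ ball p R, ‖fderiv ℝ (fderiv ℝ T) z - B‖ ≤ ω := fun z hz => (hb' z hz).le
  refine ⟨R, hR, hRΩ, ?_⟩
  have hd1 : ∀ z ∈ ball p R, ‖fderiv ℝ T z - B (z - p)‖ ≤ ω * ‖z - p‖ := by
    intro z hz
    have := (convex_ball p R).norm_image_sub_le_of_norm_hasFDerivWithin_le
      (f := fun z => fderiv ℝ T z - B (z - p)) (f' := fun z => fderiv ℝ (fderiv ℝ T) z - B) (C := ω)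
      (fun y hy => by
        have h3 : HasFDerivAt (fderiv ℝ T) (fderiv ℝ (fderiv ℝ T) y) y :=
          ((hT1.contDiffAt (hΩ.mem_nhds (hRΩ hy))).differentiableAt (by norm_num)).hasFDerivAt
        have h4 : HasFDerivAt (fun z : E => B (z - p)) B y := by
          exact B.hasFDerivAt.comp y ((hasFDerivAt_id y).sub_const p)
        exact (h3.sub h4).hasFDerivWithinAt) hb (mem_ball_self hR) hz
    simpa [hcrit] using this
  intro z hz
  refine ⟨?_, fun w => ?_, fun w => ?_⟩
  · have hsub : closedBall p ‖z - p‖ ⊆ ball p R :=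
      closedBall_subset_ball (by rw [← dist_eq_norm]; exact hz)
    have := (convex_closedBall p ‖z - p‖).norm_image_sub_le_of_norm_hasFDerivWithin_le
      (f := fun z => T z - (T p + (1 / 2) * B (z - p) (z - p)))
      (f' := fun z => fderiv ℝ T z - B (z - p)) (C := ω * ‖z - p‖)
      (fun y hy => by
        have h3 : HasFDerivAt T (fderiv ℝ T y) y :=
          ((hT.contDiffAt (hΩ.mem_nhds (hRΩ (hsub hy)))).differentiableAt (by norm_num)).hasFDerivAt
        exact (h3.sub (hQd y)).hasFDerivWithinAt)
      (fun y hy => (hd1 y (hsub hy)).trans (by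
        rw [mem_closedBall, dist_eq_norm] at hy
        gcongr)) (mem_closedBall_self (norm_nonneg _)) (mem_closedBall.2 (dist_eq_norm z p).le)
    rw [Real.norm_eq_abs] at this
    simp only [sub_self, map_zero, mul_zero, add_zero, sub_zero] at this
    calc _ ≤ _ := this
      _ = _ := by ring
  · exact (fderiv ℝ T z - B (z - p)).le_of_opNorm_le (hd1 z hz) w
  · have h3 := (fderiv ℝ (fderiv ℝ T) z - B).le_of_opNorm_le (hb z hz) w
    have h4 := ((fderiv ℝ (fderiv ℝ T) z - B) w).le_of_opNorm_le h3 w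
    rw [D2]
    calc _ ≤ ω * ‖w‖ * ‖w‖ := h4
      _ = _ := by ring

end Modification

section Modification

variable {E : Type*} [NormedAddCommGroup E] [InnerProductSpace ℂ E] [FiniteDimensional ℂ E]

lemma exists_antilipschitz_bound {B : E →L[ℝ] E →L[ℝ] ℝ} (hB : ∀ w, B w = 0 → w = 0) :
    ∃ k > 0, ∀ w, k * ‖w‖ ≤ ‖B w‖ := by
  have : FiniteDimensional ℝ E := FiniteDimensional.complexToReal E
  have hinj : (B : E →ₗ[ℝ] E →L[ℝ] ℝ).ker = ⊥ := LinearMap.ker_eq_bot'.2 hB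
  obtain ⟨K, hK, h⟩ := LinearMap.exists_antilipschitzWith (B : E →ₗ[ℝ] E →L[ℝ] ℝ) hinj
  have hK' : (0:ℝ) < K := hK
  refine ⟨(K:ℝ)⁻¹, by positivity, fun w => ?_⟩
  have h1 := h.le_mul_dist w 0
  rw [dist_zero_right, map_zero, dist_zero_right] at h1
  rw [inv_mul_le_iff₀ hK']
  exact h1

/-- Near a nondegenerate critical point a strongly plurisubharmonic function can be made exactly
quadratic by a perturbation which creates no critical points. -/
lemma exists_quadratic_modification {T : E → ℝ} {Ω : Set E} (hΩ : IsOpen Ω)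
    (hT : ContDiffOn ℝ 2 T Ω) (hL : ∀ z ∈ Ω, ∀ w : E, w ≠ 0 → 0 < levi T z w) {p : E} (hp : p ∈ Ω)
    (hcrit : fderiv ℝ T p = 0) (hnd : ∀ w, fderiv ℝ (fderiv ℝ T) p w = 0 → w = 0) {δ : ℝ}
    (hδ : 0 < δ) :
    ∃ T' : E → ℝ, ContDiffOn ℝ 2 T' Ω ∧ (∀ z ∈ Ω, ∀ w : E, w ≠ 0 → 0 < levi T' z w) ∧
      (∀ z ∈ Ω, |T' z - T z| ≤ δ) ∧ (∀ z, δ ≤ dist z p → T' z = T z) ∧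
      (∀ z ∈ Ω, fderiv ℝ T' z = 0 ↔ fderiv ℝ T z = 0) ∧
      ∃ r > 0, ∃ α β : E →L[ℝ] EuclideanSpace ℝ (Fin (Module.finrank ℝ E)),
        QuadNear T' p r α β := by
  have : FiniteDimensional ℝ E := FiniteDimensional.complexToReal E
  have := FiniteDimensional.proper ℂ E
  have hs : ∀ v w, fderiv ℝ (fderiv ℝ T) p v w = fderiv ℝ (fderiv ℝ T) p w v := fun v w =>
    D2_symm (hT.contDiffAt (hΩ.mem_nhds hp)) v w
  obtain ⟨C, hC, hcut⟩ := exists_cutoff p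
  obtain ⟨k, hk, hkB⟩ := exists_antilipschitz_bound hnd
  obtain ⟨R₁, hR₁, hR₁Ω⟩ := Metric.isOpen_iff.1 hΩ p hp
  have hcb : closedBall p (R₁ / 2) ⊆ Ω := (closedBall_subset_ball (by linarith)).trans hR₁Ω
  obtain ⟨m, hm, hmL⟩ := exists_levi_lower hΩ hT (isCompact_closedBall p (R₁ / 2)) hcb
    fun z hz => hL z (hcb hz)
  obtain ⟨ω, hω, hω1, hω2, hω3⟩ : ∃ ω > 0, ω * (1 + C) < k ∧ (3 * C + 1) * ω < m ∧ ω ≤ 1 := by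
    refine ⟨min 1 (min (k / (2 * (1 + C))) (m / (2 * (3 * C + 1)))), by positivity, ?_, ?_,
      min_le_left _ _⟩
    · calc _ ≤ k / (2 * (1 + C)) * (1 + C) := by
            gcongr; exact (min_le_right _ _).trans (min_le_left _ _)
        _ = k / 2 := by field_simp
        _ < k := by linarith
    · calc _ ≤ (3 * C + 1) * (m / (2 * (3 * C + 1))) := by
            gcongr; exact (min_le_right _ _).trans (min_le_right _ _)
        _ = m / 2 := by field_simp
        _ < m := by linarith
  obtain ⟨R₀, hR₀, hR₀Ω, herr⟩ := exists_second_order_error hΩ hT hp hcrit hs hω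
  obtain ⟨R, hR, hRR₀, hRR₁, hRδ, hR1⟩ : ∃ R > 0, R < R₀ ∧ R ≤ R₁ / 2 ∧ R ≤ δ ∧ R ≤ 1 := by
    refine ⟨min (min (R₀ / 2) (R₁ / 2)) (min δ 1), by positivity, ?_, ?_, ?_, ?_⟩
    · exact ((min_le_left _ _).trans (min_le_left _ _)).trans_lt (by linarith)
    · exact (min_le_left _ _).trans (min_le_right _ _)
    · exact (min_le_right _ _).trans (min_le_left _ _)
    · exact (min_le_right _ _).trans (min_le_right _ _)
  obtain ⟨χ, hχ, hχ0, hχ1, hχone, hχzero, hχd, hχD⟩ := hcut R hR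
  set B := fderiv ℝ (fderiv ℝ T) p with hB
  obtain ⟨hQ, hQd, hQf⟩ := quadratic_derivs B hs p (T p)
  set Q : E → ℝ := fun z => T p + (1 / 2) * B (z - p) (z - p) with hQdef
  have hQD : ∀ z w, D2 Q z w w = B w w := by
    intro z w
    have h4 : HasFDerivAt (fun z : E => B (z - p)) B z :=
      B.hasFDerivAt.comp z ((hasFDerivAt_id z).sub_const p)
    rw [D2, hQf, h4.fderiv]
  set T' : E → ℝ := fun z => T z - χ z * (T z - Q z) with hT'
  have hTc : ∀ z ∈ Ω, ContDiffAt ℝ 2 T z := fun z hz => hT.contDiffAt (hΩ.mem_nhds hz)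
  have hEc : ∀ z ∈ Ω, ContDiffAt ℝ 2 (fun z => T z - Q z) z := fun z hz =>
    (hTc z hz).sub hQ.contDiffAt
  have hPc : ∀ z ∈ Ω, ContDiffAt ℝ 2 (fun z => χ z * (T z - Q z)) z := fun z hz =>
    hχ.contDiffAt.mul (hEc z hz)
  have hT'c : ContDiffOn ℝ 2 T' Ω := fun z hz => ((hTc z hz).sub (hPc z hz)).contDiffWithinAt
  have hfar : ∀ z, R ≤ dist z p → T' z = T z := fun z hz => by simp [hT', hχzero z hz]
  have hfar' : ∀ z, R < dist z p → T' =ᶠ[𝓝 z] T := fun z hz => by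
    filter_upwards [(isOpen_lt continuous_const (continuous_id.dist continuous_const)).mem_nhds hz]
      with y hy
    exact hfar y (le_of_lt hy)
  have hnear : ∀ z ∈ ball p (R / 2), T' z = Q z := fun z hz => by
    simp [hT', hχone z (mem_ball.1 hz).le]
  have hin : ∀ z, dist z p ≤ R → z ∈ ball p R₀ := fun z hz => mem_ball.2 (hz.trans_lt hRR₀)
  have hexp : ∀ z, dist z p ≤ R → ‖z - p‖ ≤ R := fun z hz => by rwa [← dist_eq_norm]
  refine ⟨T', hT'c, fun z hz w hw => ?_, fun z hz => ?_, fun z hz => hfar z (hRδ.trans hz),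
    fun z hz => ?_, R / 2, by positivity, ?_⟩
  · rcases lt_or_ge R (dist z p) with h | h
    · rw [levi_congr (hfar' z h)]; exact hL z hz w hw
    have hD : ∀ v : E, D2 T z v v - (3 * C + 1) * ω * ‖v‖ ^ 2 ≤ D2 T' z v v := by
      intro v
      obtain ⟨e0, e1, e2⟩ := herr z (hin z h)
      have hE1 : fderiv ℝ (fun z => T z - Q z) z v = fderiv ℝ T z v - B (z - p) v := by
        rw [fderiv_fun_sub ((hTc z hz).differentiableAt (by norm_num)) (hQd z).differentiableAt,
          (hQd z).fderiv]; rfl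
      rw [hT', D2_sub (hTc z hz) (hPc z hz), D2_mul hχ.contDiffAt (hEc z hz), D2_sub (hTc z hz)
        hQ.contDiffAt, hQD, hE1]
      have b1 : |D2 χ z v v * (T z - Q z)| ≤ C * ω * ‖v‖ ^ 2 := by
        rw [abs_mul]
        calc _ ≤ (C / R ^ 2 * ‖v‖ ^ 2) * (ω * R ^ 2) := by
              refine mul_le_mul (hχD z v) (e0.trans ?_) (abs_nonneg _) (by positivity)
              have := hexp z h
              gcongr
          _ = _ := by field_simp
      have b2 : |fderiv ℝ χ z v * (fderiv ℝ T z v - B (z - p) v)| ≤ C * ω * ‖v‖ ^ 2 := by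
        rw [abs_mul]
        calc _ ≤ (C / R * ‖v‖) * (ω * R * ‖v‖) := by
              refine mul_le_mul (hχd z v) ((e1 v).trans ?_) (abs_nonneg _) (by positivity)
              have := hexp z h
              gcongr
          _ = _ := by field_simp
      have b3 : |χ z * (D2 T z v v - B v v)| ≤ ω * ‖v‖ ^ 2 := by
        rw [abs_mul, abs_of_nonneg (hχ0 z)]
        calc _ ≤ 1 * (ω * ‖v‖ ^ 2) := mul_le_mul (hχ1 z) (e2 v) (abs_nonneg _) zero_le_one
          _ = _ := one_mul _
      have := abs_le.1 b1; have := abs_le.1 b2; have := abs_le.1 b3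
      linarith
    have h1 := hD w
    have h2 := hD (I • w)
    have h3 := hmL z (mem_closedBall.2 (h.trans hRR₁)) w
    have h4 : ‖I • w‖ = ‖w‖ := by rw [norm_smul, norm_I, one_mul]
    rw [h4] at h2
    have h5 : 0 < ‖w‖ ^ 2 := by have := norm_pos_iff.2 hw; positivity
    rw [levi] at h3 ⊢
    nlinarith
  · rcases lt_or_ge R (dist z p) with h | h
    · rw [hfar z h.le, sub_self, abs_zero]; exact hδ.le
    obtain ⟨e0, -, -⟩ := herr z (hin z h)
    have : T' z - T z = -(χ z * (T z - Q z)) := by simp [hT']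
    rw [this, abs_neg, abs_mul, abs_of_nonneg (hχ0 z)]
    have h1 := hexp z h
    have h0 := norm_nonneg (z - p)
    calc _ ≤ 1 * (ω * ‖z - p‖ ^ 2) := mul_le_mul (hχ1 z) e0 (abs_nonneg _) zero_le_one
      _ ≤ 1 * (1 * (R * 1)) := by gcongr; nlinarith
      _ ≤ δ := by linarith
  · rcases lt_or_ge R (dist z p) with h | h
    · rw [(hfar' z h).fderiv_eq]
    obtain ⟨e0, e1, -⟩ := herr z (hin z h)
    have hzp : ∀ (S : E → ℝ), (∀ w, |fderiv ℝ S z w - B (z - p) w| ≤ ω * (1 + C) * ‖z - p‖ * ‖w‖) →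
        fderiv ℝ S z = 0 → z = p := by
      intro S hS h0
      have h1 : ‖B (z - p)‖ ≤ ω * (1 + C) * ‖z - p‖ :=
        ContinuousLinearMap.opNorm_le_bound _ (by positivity) fun w => by
          have := hS w
          rwa [h0, zero_apply, zero_sub, abs_neg] at this
      have h2 := hkB (z - p)
      by_contra hne
      have h3 : 0 < ‖z - p‖ := norm_pos_iff.2 (sub_ne_zero.2 hne)
      nlinarith
    have hp' : fderiv ℝ T' p = 0 := by
      have : T' =ᶠ[𝓝 p] Q := by
        filter_upwards [ball_mem_nhds p (half_pos hR)] with y hy using hnear y hy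
      rw [this.fderiv_eq, (hQd p).fderiv, sub_self, map_zero]
    constructor
    · intro h0
      rw [hzp T' (fun w => ?_) h0]; exact hcrit
      have hd : fderiv ℝ T' z w = fderiv ℝ T z w - (χ z * (fderiv ℝ T z w - B (z - p) w) +
          (T z - Q z) * fderiv ℝ χ z w) := by
        have h1 : HasFDerivAt T (fderiv ℝ T z) z :=
          ((hTc z hz).differentiableAt (by norm_num)).hasFDerivAt
        have h2 : HasFDerivAt χ (fderiv ℝ χ z) z :=
          (hχ.contDiffAt.differentiableAt (by norm_num)).hasFDerivAt
        have h3 : HasFDerivAt T' _ z := h1.sub (h2.mul (h1.sub (hQd z)))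
        rw [h3.fderiv]
        rfl
      have : fderiv ℝ T' z w - B (z - p) w = (1 - χ z) * (fderiv ℝ T z w - B (z - p) w) -
          (T z - Q z) * fderiv ℝ χ z w := by rw [hd]; ring
      rw [this]
      have h1 := hexp z h
      have hc0 := hχ0 z
      have hc1 := hχ1 z
      calc _ ≤ |(1 - χ z) * (fderiv ℝ T z w - B (z - p) w)| + |(T z - Q z) * fderiv ℝ χ z w| :=
            abs_sub _ _
        _ ≤ 1 * (ω * ‖z - p‖ * ‖w‖) + (ω * ‖z - p‖ ^ 2) * (C / R * ‖w‖) := by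
            rw [abs_mul, abs_mul, abs_of_nonneg (by linarith : 0 ≤ 1 - χ z)]
            exact add_le_add (mul_le_mul (by linarith) (e1 w) (abs_nonneg _) zero_le_one)
              (mul_le_mul e0 (hχd z w) (abs_nonneg _) (by positivity))
        _ = (1 + C * (‖z - p‖ / R)) * (ω * ‖z - p‖ * ‖w‖) := by field_simp
        _ ≤ (1 + C * 1) * (ω * ‖z - p‖ * ‖w‖) := by
            gcongr
            exact (div_le_one hR).2 h1
        _ = _ := by ring
    · intro h0
      rw [hzp T (fun w => (e1 w).trans ?_) h0]; exact hp'
      have : ω * ‖z - p‖ * ‖w‖ ≤ ω * ‖z - p‖ * ‖w‖ * (1 + C) := by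
        refine le_mul_of_one_le_right (by positivity) (by linarith)
      linarith
  · obtain ⟨α, β, h1, h2, h3⟩ := exists_split_quadratic B hs hnd
    refine ⟨α, β, fun z hz => ?_, h2, h3⟩
    rw [hnear z hz, hnear p (mem_ball_self (half_pos hR)), ← h1]
    simp [hQdef]

end Modification

section Sard

variable {E : Type*} [NormedAddCommGroup E] [NormedSpace ℝ E] [FiniteDimensional ℝ E]

open MeasureTheory in
/-- Small linear perturbations of a `C²` function generically have nondegenerate critical points. -/
lemma exists_small_regular_value {T : E → ℝ} {Ω : Set E} (hΩ : IsOpen Ω) (hT : ContDiffOn ℝ 2 T Ω)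
    {η : ℝ} (hη : 0 < η) :
    ∃ e : E →L[ℝ] ℝ, ‖e‖ < η ∧ ∀ z ∈ Ω, fderiv ℝ T z = e →
      ∀ w, fderiv ℝ (fderiv ℝ T) z w = 0 → w = 0 := by
  let _ : MeasurableSpace E := borel E
  have _ : BorelSpace E := ⟨rfl⟩
  have hfr : Module.finrank ℝ (E →L[ℝ] ℝ) = Module.finrank ℝ E := by
    rw [← (LinearMap.toContinuousLinearMap (𝕜 := ℝ) (E := E) (F' := ℝ)).finrank_eq]
    exact Subspace.dual_finrank_eq
  let Φ : (E →L[ℝ] ℝ) ≃L[ℝ] E := ContinuousLinearEquiv.ofFinrankEq hfr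
  have hT1 : ContDiffOn ℝ 1 (fderiv ℝ T) Ω := hT.fderiv_of_isOpen hΩ (by norm_num)
  let μ : Measure E := Measure.addHaar
  set s : Set E := {z ∈ Ω | ∃ w, fderiv ℝ (fderiv ℝ T) z w = 0 ∧ w ≠ 0} with hs
  have h0 : μ ((fun z => Φ (fderiv ℝ T z)) '' s) = 0 := by
    refine addHaar_image_eq_zero_of_det_fderivWithin_eq_zero μ
      (f' := fun z => (Φ : (E →L[ℝ] ℝ) →L[ℝ] E).comp (fderiv ℝ (fderiv ℝ T) z)) (fun z hz => ?_)
      fun z hz => ?_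
    · have h3 : HasFDerivAt (fderiv ℝ T) (fderiv ℝ (fderiv ℝ T) z) z :=
        ((hT1.contDiffAt (hΩ.mem_nhds hz.1)).differentiableAt (by norm_num)).hasFDerivAt
      exact ((Φ : (E →L[ℝ] ℝ) →L[ℝ] E).hasFDerivAt.comp z h3).hasFDerivWithinAt
    · obtain ⟨-, w, hw, hw0⟩ := hz
      by_contra hne
      refine hw0 ?_
      have hk := (LinearMap.equivOfDetNeZero _ hne).injective
      refine hk ?_
      rw [map_zero]
      change Φ (fderiv ℝ (fderiv ℝ T) z w) = 0
      rw [hw, map_zero]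
  have hopen : IsOpen (Φ.symm ⁻¹' ball (0 : E →L[ℝ] ℝ) η) := isOpen_ball.preimage Φ.symm.continuous
  have hpos : 0 < μ (Φ.symm ⁻¹' ball (0 : E →L[ℝ] ℝ) η) :=
    hopen.measure_pos μ ⟨0, by simp [hη]⟩
  obtain ⟨x, hx, hxs⟩ : ∃ x ∈ Φ.symm ⁻¹' ball (0 : E →L[ℝ] ℝ) η,
      x ∉ (fun z => Φ (fderiv ℝ T z)) '' s := by
    by_contra! h
    exact hpos.ne' (measure_mono_null h h0)
  refine ⟨Φ.symm x, by simpa using hx, fun z hz he w hw => ?_⟩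
  by_contra hne
  exact hxs ⟨z, ⟨hz, w, hw, hne⟩, by simp [he]⟩

end Sard

section Morse

variable {E : Type*} [NormedAddCommGroup E] [InnerProductSpace ℂ E] [FiniteDimensional ℂ E]

lemma finite_critical_points {T : E → ℝ} {Ω A : Set E} (hΩ : IsOpen Ω)
    (hT : ContDiffOn ℝ 2 T Ω) (hA : IsCompact A) (hAΩ : A ⊆ Ω)
    (hnd : ∀ z ∈ Ω, fderiv ℝ T z = 0 → ∀ w, fderiv ℝ (fderiv ℝ T) z w = 0 → w = 0) :
    {z ∈ A | fderiv ℝ T z = 0}.Finite := by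
  have hT1 : ContDiffOn ℝ 1 (fderiv ℝ T) Ω := hT.fderiv_of_isOpen hΩ (by norm_num)
  have key : ∀ p ∈ Ω, ∃ U ∈ 𝓝 p, ∀ z ∈ U, fderiv ℝ T z = 0 → z = p := by
    intro p hp
    by_cases hc : fderiv ℝ T p = 0
    · obtain ⟨k, hk, hkB⟩ := exists_antilipschitz_bound (hnd p hp hc)
      obtain ⟨R, hR, -, herr⟩ := exists_second_order_error hΩ hT hp hc
        (fun v w => D2_symm (hT.contDiffAt (hΩ.mem_nhds hp)) v w) (half_pos hk)
      refine ⟨ball p R, ball_mem_nhds p hR, fun z hz h0 => ?_⟩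
      have h1 : ‖fderiv ℝ (fderiv ℝ T) p (z - p)‖ ≤ k / 2 * ‖z - p‖ :=
        ContinuousLinearMap.opNorm_le_bound _ (by positivity) fun w => by
          have := (herr z hz).2.1 w
          rwa [h0, zero_apply, zero_sub, abs_neg] at this
      have h2 := hkB (z - p)
      by_contra hne
      have h3 : 0 < ‖z - p‖ := norm_pos_iff.2 (sub_ne_zero.2 hne)
      nlinarith
    · have h1 := (hT1.continuousOn.continuousAt (hΩ.mem_nhds hp)).eventually_ne hc
      exact ⟨_, h1, fun z hz h0 => absurd h0 hz⟩
  choose! U hU hUp using key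
  obtain ⟨t, htA, ht⟩ := hA.elim_nhds_subcover U fun p hp => hU p (hAΩ hp)
  refine (t.finite_toSet).subset fun z hz => ?_
  obtain ⟨p, hp, hzp⟩ := mem_iUnion₂.1 (ht hz.1)
  rw [hUp p (hAΩ (htA p hp)) z hzp hz.2]
  exact hp

omit [FiniteDimensional ℂ E] in
lemma QuadNear.mono {F : Type*} [NormedAddCommGroup F] [InnerProductSpace ℝ F] {T T' : E → ℝ}
    {p : E} {r r' : ℝ} {α β : E →L[ℝ] F} (h : QuadNear T p r α β) (hr : r' ≤ r) (hr' : 0 < r')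
    (he : ∀ z ∈ ball p r', T' z = T z) : QuadNear T' p r' α β :=
  ⟨fun z hz => by
    rw [he z hz, he p (mem_ball_self hr'), h.1 z (ball_subset_ball hr hz)], h.2⟩

lemma exists_quadratic_modifications {T : E → ℝ} {Ω : Set E} (hΩ : IsOpen Ω)
    (hT : ContDiffOn ℝ 2 T Ω) (hL : ∀ z ∈ Ω, ∀ w : E, w ≠ 0 → 0 < levi T z w) (P : Finset E)
    (hP : ∀ p ∈ P, p ∈ Ω ∧ fderiv ℝ T p = 0)
    (hnd : ∀ p ∈ P, ∀ w, fderiv ℝ (fderiv ℝ T) p w = 0 → w = 0) {δ : ℝ} (hδ : 0 < δ)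
    (s : Finset E) (hsP : s ⊆ P) :
    ∃ T' : E → ℝ, ContDiffOn ℝ 2 T' Ω ∧ (∀ z ∈ Ω, ∀ w : E, w ≠ 0 → 0 < levi T' z w) ∧
      (∀ z ∈ Ω, |T' z - T z| ≤ δ) ∧ (∀ z ∈ Ω, fderiv ℝ T' z = 0 ↔ fderiv ℝ T z = 0) ∧
      (∀ p ∈ P, p ∉ s → ∀ w, fderiv ℝ (fderiv ℝ T') p w = 0 → w = 0) ∧
      ∀ p ∈ s, ∃ r > 0, ∃ α β : E →L[ℝ] EuclideanSpace ℝ (Fin (Module.finrank ℝ E)),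
        QuadNear T' p r α β := by
  classical
  induction s using Finset.induction_on generalizing δ with
  | empty => exact ⟨T, hT, hL, fun z _ => by simp [hδ.le], fun z _ => Iff.rfl,
      fun p hp _ => hnd p hp,
      by simp⟩
  | insert p s hps ih =>
    obtain ⟨T', h1, h2, h3, h4, h5, h6⟩ := ih (half_pos hδ)
      (fun q hq => hsP (Finset.mem_insert_of_mem hq))
    have hpP : p ∈ P := hsP (Finset.mem_insert_self _ _)
    obtain ⟨η, hη, hη'⟩ : ∃ η > 0, ∀ q ∈ P.erase p, η ≤ dist q p :=
      Finset.exists_pos_le _ (fun q => dist q p) fun q hq => dist_pos.2 (Finset.ne_of_mem_erase hq)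
    obtain ⟨T'', g1, g2, g3, g4, g5, g6⟩ := exists_quadratic_modification hΩ h1 h2 (hP p hpP).1
      ((h4 p (hP p hpP).1).2 (hP p hpP).2) (h5 p hpP hps) (δ := min (δ / 2) (η / 2)) (by positivity)
    have hsep : ∀ q ∈ P, q ≠ p → ∀ z ∈ ball q (η / 2), T'' z = T' z := by
      intro q hq hqp z hz
      refine g4 z ((min_le_right _ _).trans ?_)
      have h7 := hη' q (Finset.mem_erase.2 ⟨hqp, hq⟩)
      have h8 := dist_triangle q z p
      rw [dist_comm q z] at h8
      have := mem_ball.1 hz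
      linarith
    refine ⟨T'', g1, g2, fun z hz => ?_, fun z hz => (g5 z hz).trans (h4 z hz),
      fun q hq hqs w hw => ?_, fun q hq => ?_⟩
    · have e1 := abs_le.1 ((g3 z hz).trans (min_le_left _ _))
      have e2 := abs_le.1 (h3 z hz)
      exact abs_le.2 ⟨by linarith, by linarith⟩
    · have hqp : q ≠ p := fun h => hqs (h ▸ Finset.mem_insert_self _ _)
      have he : T'' =ᶠ[𝓝 q] T' := by
        filter_upwards [ball_mem_nhds q (half_pos hη)] with z hz using hsep q hq hqp z hz
      rw [he.fderiv.fderiv_eq] at hw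
      exact h5 q hq (fun h => hqs (Finset.mem_insert_of_mem h)) w hw
    · rcases Finset.mem_insert.1 hq with rfl | hqs
      · exact g6
      · obtain ⟨r, hr, α, β, hQ⟩ := h6 q hqs
        have hqp : q ≠ p := fun h => hps (h ▸ hqs)
        exact ⟨min r (η / 2), by positivity, α, β, hQ.mono (min_le_left _ _) (by positivity)
          fun z hz => hsep q (hsP hq) hqp z (ball_subset_ball (min_le_right _ _) hz)⟩

end Morse

section Morse

variable {E : Type*} [NormedAddCommGroup E] [InnerProductSpace ℂ E] [FiniteDimensional ℂ E]

omit [FiniteDimensional ℂ E] in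
lemma isCompact_sublevel {T T' : E → ℝ} {Ω : Set E} {c c' : ℝ} (hT' : ContinuousOn T' Ω)
    (hc : IsCompact {z ∈ Ω | T z ≤ c}) (h : ∀ z ∈ Ω, T' z ≤ c' → T z ≤ c) :
    IsCompact {z ∈ Ω | T' z ≤ c'} := by
  have h1 : IsClosed ({z ∈ Ω | T z ≤ c} ∩ T' ⁻¹' Iic c') :=
    (hT'.mono fun z hz => hz.1).preimage_isClosed_of_isClosed hc.isClosed isClosed_Iic
  refine hc.of_isClosed_subset ?_ fun z hz => ⟨hz.1, h z hz.1 hz.2⟩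
  convert h1 using 1
  ext z
  exact ⟨fun hz => ⟨⟨hz.1, h z hz.1 hz.2⟩, hz.2⟩, fun hz => ⟨hz.1.1, hz.2⟩⟩

/-- Approximation by strongly plurisubharmonic functions with isolated, exactly quadratic
critical points. -/
lemma exists_morse_approximation {T : E → ℝ} {Ω : Set E} (hΩ : IsOpen Ω) (hbd : IsBounded Ω)
    (hT : ContDiffOn ℝ 2 T Ω) (hL : ∀ z ∈ Ω, ∀ w : E, w ≠ 0 → 0 < levi T z w) {c : ℝ}
    (hc : IsCompact {z ∈ Ω | T z ≤ c}) {δ : ℝ} (hδ : 0 < δ) :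
    ∃ T' : E → ℝ, ContDiffOn ℝ 2 T' Ω ∧ (∀ z ∈ Ω, ∀ w : E, w ≠ 0 → 0 < levi T' z w) ∧
      (∀ z ∈ Ω, |T' z - T z| ≤ δ) ∧ IsCompact {z ∈ Ω | T' z ≤ c - δ} ∧
      {z ∈ Ω | T' z ≤ c - δ ∧ fderiv ℝ T' z = 0}.Finite ∧
      ∀ z ∈ Ω, T' z ≤ c - δ → fderiv ℝ T' z = 0 →
        ∃ r > 0, ∃ α β : E →L[ℝ] EuclideanSpace ℝ (Fin (Module.finrank ℝ E)),
          QuadNear T' z r α β := by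
  have : FiniteDimensional ℝ E := FiniteDimensional.complexToReal E
  obtain ⟨M, hM0, hM⟩ : ∃ M > 0, ∀ z ∈ Ω, ‖z‖ ≤ M := hbd.exists_pos_norm_le
  obtain ⟨e, he, hreg⟩ := exists_small_regular_value hΩ hT (η := δ / (4 * M)) (by positivity)
  have hTd : ∀ z ∈ Ω, HasFDerivAt T (fderiv ℝ T z) z := fun z hz =>
    ((hT.contDiffAt (hΩ.mem_nhds hz)).differentiableAt (by norm_num)).hasFDerivAt
  set S : E → ℝ := fun z => T z - e z with hS
  have hSc : ContDiffOn ℝ 2 S Ω := hT.sub e.contDiff.contDiffOn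
  have hSd : ∀ z ∈ Ω, fderiv ℝ S z = fderiv ℝ T z - e := fun z hz =>
    ((hTd z hz).sub e.hasFDerivAt).fderiv
  have hSd2 : ∀ z ∈ Ω, fderiv ℝ (fderiv ℝ S) z = fderiv ℝ (fderiv ℝ T) z := fun z hz => by
    have h1 : fderiv ℝ S =ᶠ[𝓝 z] fun z => fderiv ℝ T z - e := by
      filter_upwards [hΩ.mem_nhds hz] with y hy using hSd y hy
    rw [h1.fderiv_eq, fderiv_sub_const]
  have hSL : ∀ z ∈ Ω, ∀ w : E, w ≠ 0 → 0 < levi S z w := fun z hz w hw => by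
    rw [levi, D2, D2, hSd2 z hz]
    exact hL z hz w hw
  have hST : ∀ z ∈ Ω, |S z - T z| ≤ δ / 4 := fun z hz => by
    have h1 : S z - T z = -e z := by simp [hS]
    rw [h1, abs_neg]
    calc |e z| ≤ δ / (4 * M) * M := e.le_of_opNorm_le_of_le he.le (hM z hz)
      _ = δ / 4 := by field_simp
  have hnd : ∀ z ∈ Ω, fderiv ℝ S z = 0 → ∀ w, fderiv ℝ (fderiv ℝ S) z w = 0 → w = 0 := by
    intro z hz h0 w hw
    rw [hSd2 z hz] at hw
    rw [hSd z hz, sub_eq_zero] at h0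
    exact hreg z hz h0 w hw
  have hSK : IsCompact {z ∈ Ω | S z ≤ c - δ / 4} := isCompact_sublevel hSc.continuousOn hc
    fun z hz h => by have := abs_le.1 (hST z hz); linarith
  have hfin := finite_critical_points hΩ hSc hSK (fun z hz => hz.1) hnd
  have hmem : ∀ {p}, p ∈ hfin.toFinset ↔ (p ∈ Ω ∧ S p ≤ c - δ / 4) ∧ fderiv ℝ S p = 0 := by
    intro p; rw [hfin.mem_toFinset]; rfl
  obtain ⟨T', g1, g2, g3, g4, -, g6⟩ := exists_quadratic_modifications hΩ hSc hSL hfin.toFinset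
    (fun p hp => ⟨(hmem.1 hp).1.1, (hmem.1 hp).2⟩)
    (fun p hp => hnd p (hmem.1 hp).1.1 (hmem.1 hp).2) (δ := δ / 4) (by positivity)
    hfin.toFinset subset_rfl
  have hcr : ∀ z ∈ Ω, T' z ≤ c - δ → fderiv ℝ T' z = 0 → z ∈ hfin.toFinset := fun z hz h1 h2 =>
    hmem.2 ⟨⟨hz, by have := abs_le.1 (g3 z hz); linarith⟩, (g4 z hz).1 h2⟩
  have hT'T : ∀ z ∈ Ω, |T' z - T z| ≤ δ := fun z hz => by
    have e1 := abs_le.1 (g3 z hz)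
    have e2 := abs_le.1 (hST z hz)
    exact abs_le.2 ⟨by linarith, by linarith⟩
  refine ⟨T', g1, g2, hT'T, isCompact_sublevel g1.continuousOn hc fun z hz h => ?_, ?_,
    fun z hz h1 h2 => g6 z (hcr z hz h1 h2)⟩
  · have := abs_le.1 (hT'T z hz); linarith
  · exact hfin.toFinset.finite_toSet.subset fun z hz => hcr z hz.1 hz.2.1 hz.2.2

end Morse

section Reach

variable {n : ℕ} {b : ℂ → ℂ} {K : Set ℂ} {Ω : Set (EuclideanSpace ℂ (Fin n))}

/-- The boundary of a disc can be pushed beyond any level with compact sublevel set. -/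
theorem reaches_level (hn : 2 ≤ n) (hΩ : IsOpen Ω) (hbd : IsBounded Ω) (hb : IsDivisor n b)
    (hK : IsCompact K) (hKb : K ⊆ ball 0 1) {T : EuclideanSpace ℂ (Fin n) → ℝ}
    (hT : ContDiffOn ℝ 2 T Ω) (hL : ∀ z ∈ Ω, ∀ w : EuclideanSpace ℂ (Fin n), w ≠ 0 → 0 < levi T z w)
    {c c' : ℝ} (hcc : c' < c) (hc : IsCompact {z ∈ Ω | T z ≤ c})
    {f : ℂ → EuclideanSpace ℂ (Fin n)} (hf : IsDisc Ω f) :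
    Reaches b K Ω (fun f' => ∀ ζ : ℂ, ‖ζ‖ = 1 → c' ≤ T (f' ζ)) f := by
  obtain ⟨S, hS, hSL, hST, hSc, hfin, hquad⟩ := exists_morse_approximation hΩ hbd hT hL hc
    (δ := (c - c') / 4) (by linarith)
  set c₂ := c - 2 * ((c - c') / 4) with hc₂
  suffices h : Reaches b K Ω (fun f' => ∀ ζ : ℂ, ‖ζ‖ = 1 → c₂ ≤ S (f' ζ)) f by
    refine h.trans fun f' hf' hQ => Reaches.refl hf' fun ζ hζ => ?_
    have h1 := hQ ζ hζ
    have h2 := abs_le.1 (hST _ (hf'.2 (mem_closedBall_zero_iff.2 hζ.le)))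
    linarith
  set A : Set ℝ := {t | t ≤ c₂ ∧ Reaches b K Ω (fun f' => ∀ ζ : ℂ, ‖ζ‖ = 1 → t ≤ S (f' ζ)) f}
  have hmono : ∀ {t t' : ℝ} {g}, t' ≤ t → Reaches b K Ω
      (fun f' => ∀ ζ : ℂ, ‖ζ‖ = 1 → t ≤ S (f' ζ)) g →
      Reaches b K Ω (fun f' => ∀ ζ : ℂ, ‖ζ‖ = 1 → t' ≤ S (f' ζ)) g := fun htt h =>
    h.trans fun f' hf' hQ => Reaches.refl hf' fun ζ hζ => htt.trans (hQ ζ hζ)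
  obtain ⟨t₀, ht₀⟩ : A.Nonempty := by
    have h1 : ContinuousOn (fun z => S (f z)) (sphere 0 1) :=
      hS.continuousOn.comp (hf.continuousOn.mono sphere_subset_closedBall)
        fun z hz => hf.2 (sphere_subset_closedBall hz)
    obtain ⟨x, -, hx⟩ := (isCompact_sphere (0:ℂ) 1).exists_isMinOn
      (NormedSpace.sphere_nonempty.2 zero_le_one) h1
    refine ⟨min c₂ (S (f x)), min_le_left _ _, Reaches.refl hf fun ζ hζ => ?_⟩
    exact (min_le_right _ _).trans (hx (mem_sphere_zero_iff_norm.2 hζ))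
  have hbdd : BddAbove A := ⟨c₂, fun t ht => ht.1⟩
  have hs : sSup A ≤ c₂ := csSup_le ⟨t₀, ht₀⟩ fun t ht => ht.1
  obtain ⟨ε, hε, hcross⟩ := reaches_cross (c := sSup A) hn hΩ hb hK hKb hS hSL
    (by linarith : sSup A < c - (c - c') / 4) hSc hfin hquad
  obtain ⟨t, ht, htl⟩ := exists_lt_of_lt_csSup ⟨t₀, ht₀⟩ (by linarith : sSup A - ε < sSup A)
  have h1 : Reaches b K Ω (fun f' => ∀ ζ : ℂ, ‖ζ‖ = 1 → sSup A + ε ≤ S (f' ζ)) f :=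
    ht.2.trans fun f' hf' hQ => hcross f' hf' fun ζ hζ => htl.le.trans (hQ ζ hζ)
  by_cases h2 : c₂ ≤ sSup A + ε
  · exact hmono h2 h1
  · have : sSup A + ε ≤ sSup A := le_csSup hbdd ⟨(not_le.1 h2).le, h1⟩
    linarith

end Reach

/-- A global Hölder bound, with explicit exponent and constant, for functions on the line. -/
def HolderBound {G : Type*} [NormedAddCommGroup G] (α M : ℝ) (u : ℝ → G) : Prop :=
  ∀ t s, ‖u t - u s‖ ≤ M * |t - s| ^ α

/-- Real trigonometric approximation by real parts of entire functions. -/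
lemma exists_entire_re_approx {u : ℝ → ℝ} (hu : Continuous u)
    (hp : Function.Periodic u (2 * Real.pi)) {η : ℝ} (hη : 0 < η) :
    ∃ p : ℂ → ℂ, Differentiable ℂ p ∧ ∀ t : ℝ, |(p (cexp (t * I))).re - u t| ≤ η := by
  have : Fact (0 < 2 * Real.pi) := ⟨Real.two_pi_pos⟩
  have hfou : ∀ (k : ℤ) (t : ℝ), (fourier k (t : AddCircle (2 * Real.pi)) : ℂ) =
      cexp (t * I) ^ k := by
    intro k t
    rw [fourier_coe_apply, ← Complex.exp_int_mul]
    congr 1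
    push_cast
    field_simp
  let F : C(AddCircle (2 * Real.pi), ℂ) := ⟨fun x => ((hp.lift x : ℝ) : ℂ), by
    refine continuous_ofReal.comp ?_
    exact continuous_coinduced_dom.mpr hu⟩
  have hF : F ∈ (Submodule.span ℂ (Set.range (fourier (T := 2 * Real.pi)))).topologicalClosure := by
    rw [span_fourier_closure_eq_top]; trivial
  obtain ⟨G, hG, hFG⟩ := Metric.mem_closure_iff.1 hF η hη
  have key : ∀ G ∈ Submodule.span ℂ (Set.range (fourier (T := 2 * Real.pi))),
      ∀ c : ℂ, ∃ p : ℂ → ℂ, Differentiable ℂ p ∧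
        ∀ t : ℝ, (p (cexp (t * I))).re = (c * G (t : AddCircle (2 * Real.pi))).re := by
    intro G hG
    induction hG using Submodule.span_induction with
    | mem x hx =>
      obtain ⟨n, rfl⟩ := hx
      intro c
      rcases le_total 0 n with h | h
      · obtain ⟨k, rfl⟩ := Int.eq_ofNat_of_zero_le h
        refine ⟨fun z => c * z ^ k, by fun_prop, fun t => ?_⟩
        rw [hfou]
        simp
      · obtain ⟨k, hk⟩ := Int.eq_ofNat_of_zero_le (neg_nonneg.2 h)
        obtain rfl : n = -(k : ℤ) := by omega
        refine ⟨fun z => (starRingEnd ℂ) c * z ^ k, by fun_prop, fun t => ?_⟩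
        rw [hfou, ← conj_re]
        congr 1
        simp only [map_mul, conj_conj, map_pow, ← exp_conj, conj_ofReal, conj_I, zpow_neg,
          zpow_natCast, mul_neg, Complex.exp_neg, inv_pow]
    | zero => exact fun c => ⟨0, differentiable_const 0, by simp⟩
    | add x y _ _ h1 h2 =>
      intro c
      obtain ⟨p, hp, h⟩ := h1 c
      obtain ⟨q, hq, h'⟩ := h2 c
      refine ⟨fun z => p z + q z, by fun_prop, fun t => ?_⟩
      rw [add_re, h, h', ← add_re, ← mul_add]
      rfl
    | smul a x _ h1 =>
      intro c
      obtain ⟨p, hp, h⟩ := h1 (c * a)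
      refine ⟨p, hp, fun t => ?_⟩
      rw [h, mul_assoc]
      rfl
  obtain ⟨p, hp', h⟩ := key G hG 1
  refine ⟨p, hp', fun t => ?_⟩
  rw [h, one_mul]
  have h2 := (ContinuousMap.dist_lt_iff hη).1 hFG (t : AddCircle (2 * Real.pi))
  rw [dist_eq_norm] at h2
  change ‖((u t : ℝ) : ℂ) - G t‖ < η at h2
  have h3 := (abs_re_le_norm (((u t : ℝ) : ℂ) - G t)).trans h2.le
  rw [sub_re, ofReal_re, abs_sub_comm] at h3
  exact h3

/-- Maximum principle for real parts. -/
lemma re_le_of_re_le_on_sphere {g : ℂ → ℂ} (hg : DiffContOnCl ℂ g (ball 0 1)) {s : ℝ}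
    (h : ∀ ζ, ‖ζ‖ = 1 → (g ζ).re ≤ s) {z : ℂ} (hz : ‖z‖ ≤ 1) : (g z).re ≤ s := by
  have h1 : DiffContOnCl ℂ (fun z => cexp (g z)) (ball 0 1) :=
    ⟨hg.1.cexp, hg.2.cexp⟩
  have h2 : ‖cexp (g z)‖ ≤ Real.exp s := by
    refine Complex.norm_le_of_forall_mem_frontier_norm_le isBounded_ball h1 (fun w hw => ?_) ?_
    · rw [frontier_ball _ one_ne_zero, mem_sphere_zero_iff_norm] at hw
      rw [Complex.norm_exp]
      exact Real.exp_le_exp.2 (h w hw)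
    · rw [closure_ball _ one_ne_zero]
      simpa using hz
  rw [Complex.norm_exp] at h2
  exact Real.exp_le_exp.1 h2

lemma norm_le_of_norm_le_on_sphere {E : Type*} [NormedAddCommGroup E] [NormedSpace ℂ E]
    {g : ℂ → E} (hg : DiffContOnCl ℂ g (ball 0 1)) {s : ℝ}
    (h : ∀ ζ, ‖ζ‖ = 1 → ‖g ζ‖ ≤ s) {z : ℂ} (hz : ‖z‖ ≤ 1) : ‖g z‖ ≤ s := by
  refine Complex.norm_le_of_forall_mem_frontier_norm_le isBounded_ball hg (fun w hw => ?_) ?_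
  · rw [frontier_ball _ one_ne_zero, mem_sphere_zero_iff_norm] at hw
    exact h w hw
  · rw [closure_ball _ one_ne_zero]
    simpa using hz

/-- A harmonic majorant for a power of the distance to a boundary point. -/
lemma rpow_norm_le_re_cpow {α : ℝ} (hα : 0 < α) (hα1 : α < 1) {w : ℂ} (hw : 0 ≤ w.re) :
    Real.cos (α * (Real.pi / 2)) * ‖w‖ ^ α ≤ (w ^ (α : ℂ)).re := by
  rcases eq_or_ne w 0 with rfl | h0
  · simp [hα.ne', Real.zero_rpow]
  have h1 : |w.arg| ≤ Real.pi / 2 := Complex.abs_arg_le_pi_div_two_iff.2 hw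
  rw [cpow_ofReal_re, mul_comm]
  refine mul_le_mul_of_nonneg_left ?_ (by positivity)
  rw [← Real.cos_abs (w.arg * α), abs_mul, abs_of_pos hα, mul_comm]
  have := Real.pi_pos
  refine Real.cos_le_cos_of_nonneg_of_le_pi (by positivity) (by nlinarith) ?_
  gcongr

lemma abs_re_sub_le_of_holderBound {α : ℝ} (hα : 0 < α) (hα1 : α < 1) {u : ℝ → ℝ} {M : ℝ}
    (hM : 0 ≤ M) (hu : HolderBound α M u)
    {p : ℂ → ℂ} (hp : DiffContOnCl ℂ p (ball 0 1)) {ε : ℝ}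
    (h : ∀ t : ℝ, |(p (cexp (t * I))).re - u t| ≤ ε) (t₀ : ℝ) {z : ℂ} (hz : ‖z‖ ≤ 1) :
    |(p z).re - u t₀| ≤ ε + (Real.pi / 2) ^ α / Real.cos (α * (Real.pi / 2)) * M *
      ‖1 - z * cexp (-(t₀ * I))‖ ^ α := by
  have hpi := Real.pi_pos
  set k := Real.cos (α * (Real.pi / 2)) with hk
  have hk0 : 0 < k := Real.cos_pos_of_mem_Ioo ⟨by nlinarith, by nlinarith⟩
  set C := (Real.pi / 2) ^ α / k * M with hC
  have hC0 : 0 ≤ C := by positivity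
  have hn : ‖cexp (-(t₀ * I))‖ = 1 := by
    rw [← neg_mul, ← ofReal_neg]
    exact norm_exp_ofReal_mul_I _
  let q : ℂ → ℂ := fun z => (1 - z * cexp (-(t₀ * I))) ^ (α : ℂ)
  have hre : ∀ z : ℂ, ‖z‖ ≤ 1 → 0 ≤ (1 - z * cexp (-(t₀ * I))).re := fun z hz => by
    rw [sub_re, one_re, sub_nonneg]
    refine (re_le_norm _).trans ?_
    rwa [norm_mul, hn, mul_one]
  have hq : DiffContOnCl ℂ q (ball 0 1) := by
    refine ⟨fun w hw => ?_, ?_⟩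
    · refine DifferentiableAt.differentiableWithinAt ?_
      refine DifferentiableAt.cpow (by fun_prop) (by fun_prop) (Or.inl ?_)
      rw [sub_re, one_re, sub_pos]
      refine (re_le_norm _).trans_lt ?_
      rw [norm_mul, hn, mul_one]
      simpa using hw
    · rw [closure_ball _ one_ne_zero]
      intro w hw
      refine ContinuousAt.continuousWithinAt ?_
      refine ContinuousAt.comp (f := fun w : ℂ => 1 - w * cexp (-(t₀ * I)))
        (g := fun w : ℂ => w ^ (α : ℂ)) ?_ (by fun_prop)
      exact continuousAt_cpow_const_of_re_pos (Or.inl (hre w (by simpa using hw))) (by simpa)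
  have hbd : ∀ ζ : ℂ, ‖ζ‖ = 1 → |(p ζ).re - u t₀| ≤ ε + C * (q ζ).re := by
    intro ζ hζ
    set w := ζ * cexp (-(t₀ * I)) with hw
    have hw1 : ‖w‖ = 1 := by rw [norm_mul, hn, hζ, one_mul]
    have hζw : cexp ((t₀ + w.arg : ℝ) * I) = ζ := by
      have h1 := norm_mul_exp_arg_mul_I w
      rw [hw1, ofReal_one, one_mul] at h1
      rw [ofReal_add, add_mul, Complex.exp_add, h1, hw, mul_left_comm, ← Complex.exp_add]
      simp
    have h1 := h (t₀ + w.arg)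
    rw [hζw] at h1
    have h2 := hu (t₀ + w.arg) t₀
    rw [add_sub_cancel_left, Real.norm_eq_abs] at h2
    have h3 : |w.arg| ≤ Real.pi / 2 * ‖1 - w‖ := by
      have := Complex.angle_le_mul_norm_sub (x := 1) (y := w) (by simp) hw1
      rwa [Complex.angle_one_left (by rw [← norm_pos_iff, hw1]; exact one_pos)] at this
    have h4 : |w.arg| ^ α ≤ (Real.pi / 2) ^ α * ‖1 - w‖ ^ α := by
      rw [← Real.mul_rpow (by positivity) (norm_nonneg _)]
      gcongr
    have h5 := rpow_norm_le_re_cpow hα hα1 (hre ζ hζ.le)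
    have h6 : M * |w.arg| ^ α ≤ C * (q ζ).re := by
      calc M * |w.arg| ^ α ≤ M * ((Real.pi / 2) ^ α * ‖1 - w‖ ^ α) := by gcongr
        _ = C * (k * ‖1 - w‖ ^ α) := by rw [hC]; field_simp
        _ ≤ C * (q ζ).re := by gcongr
    calc |(p ζ).re - u t₀| ≤ |(p ζ).re - u (t₀ + w.arg)| + |u (t₀ + w.arg) - u t₀| :=
          abs_sub_le _ _ _
      _ ≤ _ := by linarith
  have hqn : (q z).re ≤ ‖1 - z * cexp (-(t₀ * I))‖ ^ α := by
    refine (re_le_norm _).trans ?_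
    exact (norm_cpow_le _ _).trans (by simp)
  have h7 : C * (q z).re ≤ C * ‖1 - z * cexp (-(t₀ * I))‖ ^ α := by gcongr
  have hCq : DiffContOnCl ℂ (fun z => (C : ℂ) * q z) (ball 0 1) :=
    hq.const_smul (C : ℂ)
  rw [abs_le]
  constructor
  · have := re_le_of_re_le_on_sphere (hp.neg.sub hCq) (s := ε - u t₀) (fun ζ hζ => by
      have := (abs_le.1 (hbd ζ hζ)).1
      simp only [Pi.sub_apply, Pi.neg_apply, sub_re, neg_re, re_ofReal_mul]
      linarith) hz
    simp only [Pi.sub_apply, Pi.neg_apply, sub_re, neg_re, re_ofReal_mul] at this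
    linarith
  · have := re_le_of_re_le_on_sphere (hp.sub hCq) (s := ε + u t₀) (fun ζ hζ => by
      have := (abs_le.1 (hbd ζ hζ)).2
      simp only [Pi.sub_apply, sub_re, re_ofReal_mul]
      linarith) hz
    simp only [Pi.sub_apply, sub_re, re_ofReal_mul] at this
    linarith

lemma norm_deriv_le_of_abs_re_sub_le {p : ℂ → ℂ} {z₀ : ℂ} {δ S a : ℝ} (hδ : 0 < δ) (hS : 0 < S)
    (hp : DifferentiableOn ℂ p (ball z₀ δ)) (h : ∀ z ∈ ball z₀ δ, |(p z).re - a| ≤ S) :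
    ‖deriv p z₀‖ ≤ 8 * S / δ := by
  have hd : DifferentiableAt ℂ p z₀ := hp.differentiableAt (ball_mem_nhds _ hδ)
  refine hd.hasDerivAt.le_of_lip' (by positivity) ?_
  filter_upwards [ball_mem_nhds z₀ (half_pos hδ)] with z hz
  have hz' : ‖z - z₀‖ < δ / 2 := mem_ball_iff_norm.1 hz
  have hmap : ∀ w ∈ ball (0 : ℂ) δ, z₀ + w ∈ ball z₀ δ := fun w hw => by simpa using hw
  have := Complex.borelCaratheodory_zero (f := fun w => p (z₀ + w) - p z₀) (M := 2 * S) (R := δ)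
    (z := z - z₀) (by positivity) ?_ ?_ hδ (by rw [mem_ball_zero_iff]; linarith) (by simp)
  · rw [add_sub_cancel] at this
    refine this.trans ?_
    rw [div_le_iff₀ (by linarith), div_mul_eq_mul_div, div_mul_eq_mul_div, le_div_iff₀ hδ]
    nlinarith [mul_nonneg hS.le (norm_nonneg (z - z₀))]
  · refine DifferentiableOn.sub_const ?_ _
    exact hp.comp (by fun_prop) hmap
  · intro w hw
    have h1 := abs_le.1 (h _ (hmap w hw))
    have h2 := abs_le.1 (h _ (mem_ball_self hδ))
    simp only [Set.mem_ofPred_eq, sub_re]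
    linarith

/-- The growth of the derivative of a holomorphic function whose real part has Hölder boundary
values. -/
lemma norm_deriv_le_of_holderBound {α : ℝ} (hα : 0 < α) (hα1 : α < 1) {u : ℝ → ℝ} {M : ℝ}
    (hM : 0 ≤ M) (hu : HolderBound α M u)
    {p : ℂ → ℂ} (hp : DiffContOnCl ℂ p (ball 0 1)) {ε : ℝ} (hε : 0 < ε)
    (h : ∀ t : ℝ, |(p (cexp (t * I))).re - u t| ≤ ε) {z : ℂ} (hz : ‖z‖ < 1) :
    ‖deriv p z‖ ≤ 8 * (ε + (Real.pi / 2) ^ α / Real.cos (α * (Real.pi / 2)) * M *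
      (2 * (1 - ‖z‖)) ^ α) / (1 - ‖z‖) := by
  have hpi := Real.pi_pos
  have hk0 : 0 < Real.cos (α * (Real.pi / 2)) :=
    Real.cos_pos_of_mem_Ioo ⟨by nlinarith, by nlinarith⟩
  have hδ : 0 < 1 - ‖z‖ := by linarith
  have hsub : ball z (1 - ‖z‖) ⊆ ball 0 1 := fun w hw => by
    rw [mem_ball_iff_norm] at hw
    rw [mem_ball_zero_iff]
    have := norm_sub_norm_le w z
    linarith
  refine norm_deriv_le_of_abs_re_sub_le (a := u z.arg) hδ (by positivity)
    (hp.differentiableOn.mono hsub) fun w hw => ?_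
  refine (abs_re_sub_le_of_holderBound hα hα1 hM hu hp h z.arg
    (mem_ball_zero_iff.1 (hsub hw)).le).trans ?_
  have hn : ‖cexp (-(z.arg * I))‖ = 1 := by
    rw [← neg_mul, ← ofReal_neg]
    exact norm_exp_ofReal_mul_I _
  have h1 : z * cexp (-(z.arg * I)) = ‖z‖ := by
    conv_lhs => rw [← norm_mul_exp_arg_mul_I z]
    rw [mul_assoc, ← Complex.exp_add]
    simp
  have h2 : ‖1 - w * cexp (-(z.arg * I))‖ ≤ 2 * (1 - ‖z‖) := by
    have : 1 - w * cexp (-(z.arg * I)) = (1 - ‖z‖ : ℝ) - (w - z) * cexp (-(z.arg * I)) := by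
      rw [sub_mul, h1]
      push_cast
      ring
    rw [this]
    refine (norm_sub_le _ _).trans ?_
    rw [norm_mul, hn, norm_real, Real.norm_of_nonneg hδ.le]
    rw [mem_ball_iff_norm] at hw
    linarith
  gcongr

/-- The Hardy–Littlewood lemma. -/
lemma norm_sub_le_of_norm_deriv_le {α : ℝ} (hα : 0 < α) (hα1 : α < 1) {A : ℝ}
    {q : ℂ → ℂ} (hq : DiffContOnCl ℂ q (ball 0 1))
    (h : ∀ z, ‖z‖ < 1 → ‖deriv q z‖ ≤ A * (1 - ‖z‖) ^ (α - 1)) {z w : ℂ} (hz : ‖z‖ ≤ 1)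
    (hw : ‖w‖ ≤ 1) : ‖q z - q w‖ ≤ (2 / α + 1) * A * ‖z - w‖ ^ α := by
  have hA : 0 ≤ A := by
    have := (norm_nonneg _).trans (h 0 (by simp))
    simpa using this
  have hcont : ContinuousOn q (closedBall 0 1) := hq.continuousOn_ball
  have radial : ∀ {z : ℂ}, ‖z‖ ≤ 1 → ∀ {δ : ℝ}, 0 ≤ δ → δ ≤ 1 →
      ‖q z - q ((1 - δ : ℝ) * z)‖ ≤ A / α * δ ^ α := by
    intro z hz δ hδ hδ1
    have hmul : ∀ s : ℝ, 0 ≤ s → ‖(s : ℂ) * z‖ ≤ s := fun s hs => by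
      rw [norm_mul, norm_real, Real.norm_of_nonneg hs]
      nlinarith
    have := image_norm_le_of_norm_deriv_right_le_deriv_boundary'
      (f := fun s : ℝ => q (s * z) - q ((1 - δ : ℝ) * z)) (a := 1 - δ) (b := 1)
      (f' := fun s => deriv q (s * z) * z)
      (B := fun s => A / α * (δ ^ α - (1 - s) ^ α)) (B' := fun s => A * (1 - s) ^ (α - 1))
      ?_ ?_ ?_ ?_ ?_ ?_ (x := 1) ⟨by linarith, le_rfl⟩
    · simpa [hα.ne', Real.zero_rpow] using this
    · refine ContinuousOn.sub ?_ continuousOn_const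
      refine hcont.comp (by fun_prop) fun s hs => ?_
      rw [mem_closedBall_zero_iff]
      exact (hmul s (by linarith [hs.1])).trans hs.2
    · intro s hs
      have h1 : ‖(s : ℂ) * z‖ < 1 := (hmul s (by linarith [hs.1])).trans_lt hs.2
      have h2 : HasDerivAt q (deriv q (s * z)) (s * z) :=
        (hq.differentiableAt isOpen_ball (by simpa using h1)).hasDerivAt
      have h3 : HasDerivAt (fun s : ℝ => (s : ℂ) * z) z s := by
        simpa using (ofRealCLM.hasDerivAt (x := s)).mul_const z
      exact ((h2.comp s h3).sub_const _).hasDerivWithinAt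
    · simp
    · refine ContinuousOn.mul continuousOn_const (continuousOn_const.sub ?_)
      exact (continuousOn_const.sub continuousOn_id).rpow_const fun _ _ => Or.inr hα.le
    · intro s hs
      have h1 : HasDerivAt (fun s : ℝ => (1 - s) ^ α) (-1 * α * (1 - s) ^ (α - 1)) s :=
        ((hasDerivAt_id s).const_sub 1).rpow_const (Or.inl (by simp only [id]; linarith [hs.2]))
      have h2 := (h1.const_sub (δ ^ α)).const_mul (A / α)
      refine (h2.congr_deriv ?_).hasDerivWithinAt
      field_simp
      try ring
    · intro s hs
      have h0 : 0 ≤ s := by linarith [hs.1]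
      have h1 : ‖(s : ℂ) * z‖ ≤ s := hmul s h0
      have h2 := h _ (h1.trans_lt hs.2)
      have h3 : (1 - ‖(s : ℂ) * z‖) ^ (α - 1) ≤ (1 - s) ^ (α - 1) :=
        Real.rpow_le_rpow_of_nonpos (by linarith [hs.2]) (by linarith) (by linarith)
      calc ‖deriv q (s * z) * z‖ ≤ ‖deriv q (s * z)‖ * 1 := by rw [norm_mul]; gcongr
        _ ≤ A * (1 - ‖(s : ℂ) * z‖) ^ (α - 1) := by rwa [mul_one]
        _ ≤ _ := by gcongr
  rcases eq_or_ne z w with rfl | hne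
  · simp [hα.ne', Real.zero_rpow]
  set d := ‖z - w‖ with hd
  have hd0 : 0 < d := norm_pos_iff.2 (sub_ne_zero.2 hne)
  set δ := min d 1 with hδ
  have hδ0 : 0 < δ := lt_min hd0 one_pos
  have hδ1 : δ ≤ 1 := min_le_right _ _
  have hδd : δ ≤ d := min_le_left _ _
  have h1 := radial hz hδ0.le hδ1
  have h2 := radial hw hδ0.le hδ1
  have h3 : ‖q ((1 - δ : ℝ) * z) - q ((1 - δ : ℝ) * w)‖ ≤ A * d ^ α := by
    rcases le_total 1 d with h1d | h1d
    · rw [hδ, min_eq_right h1d]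
      simp only [sub_self, ofReal_zero, zero_mul, norm_zero]
      positivity
    · have hdd : δ = d := min_eq_left h1d
      have hin : ∀ z : ℂ, ‖z‖ ≤ 1 → ((1 - δ : ℝ) : ℂ) * z ∈ closedBall (0 : ℂ) (1 - δ) := by
        intro z hz
        rw [mem_closedBall_zero_iff, norm_mul, norm_real, Real.norm_of_nonneg (by linarith)]
        nlinarith
      have := (convex_closedBall (0 : ℂ) (1 - δ)).norm_image_sub_le_of_norm_deriv_le (f := q)
        (C := A * δ ^ (α - 1)) (fun x hx => ?_) (fun x hx => ?_) (hin w hw) (hin z hz)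
      · refine this.trans ?_
        rw [← mul_sub, norm_mul, norm_real, Real.norm_of_nonneg (by linarith), ← hd, hdd,
          Real.rpow_sub_one hd0.ne']
        have : 0 ≤ A * d ^ α := by positivity
        calc A * (d ^ α / d) * ((1 - d) * d) = A * d ^ α * (1 - d) := by field_simp
          _ ≤ A * d ^ α := by nlinarith
      · refine hq.differentiableAt isOpen_ball ?_
        rw [mem_closedBall_zero_iff] at hx
        rw [mem_ball_zero_iff]
        linarith
      · rw [mem_closedBall_zero_iff] at hx
        refine (h x (by linarith)).trans ?_
        gcongr A * ?_
        exact Real.rpow_le_rpow_of_nonpos hδ0 (by linarith) (by linarith)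
  have h4 : A / α * δ ^ α ≤ A / α * d ^ α := by gcongr
  have h5 : ‖q z - q w‖ ≤ ‖q z - q ((1 - δ : ℝ) * z)‖ + ‖q ((1 - δ : ℝ) * z) -
      q ((1 - δ : ℝ) * w)‖ + ‖q w - q ((1 - δ : ℝ) * w)‖ := by
    rw [norm_sub_rev (q w)]
    refine le_trans (le_of_eq ?_) (norm_add₃_le)
    congr 1
    ring
  calc ‖q z - q w‖ ≤ A / α * d ^ α + A * d ^ α + A / α * d ^ α := by linarith
    _ = _ := by ring

lemma HolderBound.continuous {G : Type*} [NormedAddCommGroup G] {α M : ℝ} (hα : 0 < α)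
    {u : ℝ → G} (hu : HolderBound α M u) : Continuous u := by
  refine continuous_iff_continuousAt.2 fun s => ?_
  refine tendsto_iff_norm_sub_tendsto_zero.2 ?_
  have h1 : Filter.Tendsto (fun t : ℝ => M * |t - s| ^ α) (𝓝 s) (𝓝 0) := by
    have : ContinuousAt (fun t : ℝ => M * |t - s| ^ α) s := by
      refine continuousAt_const.mul (ContinuousAt.rpow_const ?_ (Or.inr hα.le))
      fun_prop
    simpa [ContinuousAt, hα.ne', Real.zero_rpow] using this
  exact squeeze_zero (fun _ => norm_nonneg _) (fun t => hu t s) h1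

lemma HolderBound.mono {G : Type*} [NormedAddCommGroup G] {α M M' : ℝ}
    {u : ℝ → G} (hu : HolderBound α M u) (h : M ≤ M') : HolderBound α M' u := fun t s =>
  (hu t s).trans (by gcongr)

lemma HolderBound.of_forall_lt {G : Type*} [NormedAddCommGroup G] {α M : ℝ} {u : ℝ → G}
    (hu : ∀ M' > M, HolderBound α M' u) : HolderBound α M u := by
  intro t s
  refine ge_of_tendsto (f := fun M' : ℝ => M' * |t - s| ^ α) (x := 𝓝[>] M) ?_
    (eventually_nhdsWithin_of_forall fun M' hM' => hu M' hM' t s)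
  have : ContinuousAt (fun M' : ℝ => M' * |t - s| ^ α) M := by fun_prop
  exact this.tendsto.mono_left nhdsWithin_le_nhds

/-- Entire functions with uniform Hölder bounds whose real parts approximate a given Hölder
function on the circle. -/
lemma exists_holder_entire_approx {α : ℝ} (hα : 0 < α) (hα1 : α < 1) : ∃ K > 0,
    ∀ (u : ℝ → ℝ) (M : ℝ), 0 < M → HolderBound α M u → Function.Periodic u (2 * Real.pi) →
      ∀ η > 0, ∃ q : ℂ → ℂ, Differentiable ℂ q ∧
        (∀ z w, ‖z‖ ≤ 1 → ‖w‖ ≤ 1 → ‖q z - q w‖ ≤ K * M * ‖z - w‖ ^ α) ∧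
        (∀ t : ℝ, |(q (cexp (t * I))).re - u t| ≤ η) ∧ (q 0).im = 0 := by
  have hpi := Real.pi_pos
  have hk0 : 0 < Real.cos (α * (Real.pi / 2)) :=
    Real.cos_pos_of_mem_Ioo ⟨by nlinarith, by nlinarith⟩
  set c := (Real.pi / 2) ^ α / Real.cos (α * (Real.pi / 2)) with hc
  have hc0 : 0 < c := by positivity
  refine ⟨(2 / α + 1) * (8 * (1 + c * 2 ^ α)), by positivity, fun u M hM hu hper η hη => ?_⟩
  obtain ⟨τ, hτ0, hτ1, hτ⟩ : ∃ τ : ℝ, 0 < τ ∧ τ < 1 ∧ M * τ ^ α + c * M * τ ^ α ≤ η := by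
    have h1 : ContinuousAt (fun τ : ℝ => M * τ ^ α + c * M * τ ^ α) 0 := by
      have : ContinuousAt (fun τ : ℝ => τ ^ α) 0 := Real.continuousAt_rpow_const _ _ (Or.inr hα.le)
      fun_prop
    have h2 : ∀ᶠ τ in 𝓝[>] (0 : ℝ), M * τ ^ α + c * M * τ ^ α < η :=
      nhdsWithin_le_nhds (h1.eventually (gt_mem_nhds (by simpa [hα.ne', Real.zero_rpow] using hη)))
    obtain ⟨τ, h3, h4⟩ := (h2.and (Ioo_mem_nhdsGT one_pos)).exists
    exact ⟨τ, h4.1, h4.2, h3.le⟩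
  obtain ⟨p, hp, hpu⟩ := exists_entire_re_approx (hu.continuous hα) hper
    (η := M * τ ^ α) (by positivity)
  have hpd : DiffContOnCl ℂ p (ball 0 1) := hp.diffContOnCl
  have hnr : ∀ z : ℂ, ‖((1 - τ : ℝ) : ℂ) * z‖ = (1 - τ) * ‖z‖ := fun z => by
    rw [norm_mul, norm_real, Real.norm_of_nonneg (by linarith)]
  let q : ℂ → ℂ := fun z => p ((1 - τ : ℝ) * z) - (p 0).im * I
  have hq : Differentiable ℂ q := by
    refine Differentiable.sub_const ?_ _
    exact hp.comp (by fun_prop)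
  refine ⟨q, hq, fun z w hz hw => ?_, fun t => ?_, by simp [q]⟩
  · have := norm_sub_le_of_norm_deriv_le hα hα1 (A := 8 * (1 + c * 2 ^ α) * M)
      hq.diffContOnCl (fun z hz => ?_) hz hw
    · exact this.trans_eq (by ring)
    · have hd : HasDerivAt q (deriv p ((1 - τ : ℝ) * z) * (1 - τ : ℝ)) z := by
        have h1 : HasDerivAt (fun z : ℂ => ((1 - τ : ℝ) : ℂ) * z) ((1 - τ : ℝ) : ℂ) z := by
          simpa using (hasDerivAt_id z).const_mul ((1 - τ : ℝ) : ℂ)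
        exact ((hp _).hasDerivAt.comp z h1).sub_const _
      rw [hd.deriv]
      have h0 := norm_nonneg z
      have hlt : ‖((1 - τ : ℝ) : ℂ) * z‖ < 1 := by rw [hnr]; nlinarith
      have h2 := norm_deriv_le_of_holderBound hα hα1 hM.le hu hpd
        (ε := M * τ ^ α) (by positivity) hpu hlt
      rw [hnr] at h2
      set δ := 1 - (1 - τ) * ‖z‖ with hδ
      have hδτ : τ ≤ δ := by nlinarith
      have hδz : 1 - ‖z‖ ≤ δ := by nlinarith
      have hδ0 : 0 < δ := by linarith
      have h3 : 8 * (M * τ ^ α + c * M * (2 * δ) ^ α) / δ ≤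
          8 * (1 + c * 2 ^ α) * M * δ ^ (α - 1) := by
        rw [Real.rpow_sub_one hδ0.ne', Real.mul_rpow (by norm_num) hδ0.le]
        have : τ ^ α ≤ δ ^ α := by gcongr
        rw [mul_div_assoc', div_le_div_iff_of_pos_right hδ0]
        calc 8 * (M * τ ^ α + c * M * (2 ^ α * δ ^ α))
            ≤ 8 * (M * δ ^ α + c * M * (2 ^ α * δ ^ α)) := by gcongr
          _ = _ := by ring
      calc ‖deriv p ((1 - τ : ℝ) * z) * (1 - τ : ℝ)‖ ≤ ‖deriv p ((1 - τ : ℝ) * z)‖ * 1 := by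
            rw [norm_mul, norm_real, Real.norm_of_nonneg (by linarith)]
            gcongr
            linarith
        _ ≤ 8 * (1 + c * 2 ^ α) * M * δ ^ (α - 1) := by
            rw [mul_one]; exact h2.trans h3
        _ ≤ _ := by
            gcongr 8 * (1 + c * 2 ^ α) * M * ?_
            exact Real.rpow_le_rpow_of_nonpos (by linarith) hδz (by linarith)
  · have h1 := abs_re_sub_le_of_holderBound hα hα1 hM.le hu hpd hpu t
      (z := (1 - τ : ℝ) * cexp (t * I)) (by rw [hnr, norm_exp_ofReal_mul_I]; linarith)
    have h2 : ‖1 - ((1 - τ : ℝ) : ℂ) * cexp (t * I) * cexp (-(t * I))‖ = τ := by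
      rw [mul_assoc, ← Complex.exp_add, add_neg_cancel, Complex.exp_zero, mul_one,
        ← ofReal_one, ← ofReal_sub, norm_real, sub_sub_cancel, Real.norm_of_nonneg hτ0.le]
    rw [h2] at h1
    simp only [q, sub_re, re_ofReal_mul, I_re, mul_zero, sub_zero]
    exact h1.trans hτ

/-- Hölder regularity up to the boundary from Hölder regularity on the boundary. -/
lemma exists_holder_closedBall {α : ℝ} (hα : 0 < α) (hα1 : α < 1) {p : ℂ → ℂ}
    (hp : DiffContOnCl ℂ p (ball 0 1)) {M : ℝ} (hM : 0 ≤ M)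
    (h : HolderBound α M (fun t : ℝ => p (cexp (t * I)))) :
    ∃ C, 0 ≤ C ∧ ∀ z w, ‖z‖ ≤ 1 → ‖w‖ ≤ 1 → ‖p z - p w‖ ≤ C * ‖z - w‖ ^ α := by
  have hpi := Real.pi_pos
  have hk0 : 0 < Real.cos (α * (Real.pi / 2)) :=
    Real.cos_pos_of_mem_Ioo ⟨by nlinarith, by nlinarith⟩
  set c := (Real.pi / 2) ^ α / Real.cos (α * (Real.pi / 2)) with hc
  have hc0 : 0 < c := by positivity
  have hu : HolderBound α M (fun t : ℝ => (p (cexp (t * I))).re) := fun t s => by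
    rw [← sub_re]
    exact (abs_re_le_norm _).trans (h t s)
  refine ⟨(2 / α + 1) * (8 * (c * 2 ^ α * M)), by positivity, fun z w hz hw =>
    norm_sub_le_of_norm_deriv_le hα hα1 hp (fun z hz => ?_) hz hw⟩
  have hδ : 0 < 1 - ‖z‖ := by linarith
  have h1 : ∀ ε > 0, ‖deriv p z‖ ≤ 8 * (ε + c * M * (2 * (1 - ‖z‖)) ^ α) / (1 - ‖z‖) :=
    fun ε hε => norm_deriv_le_of_holderBound hα hα1 hM hu hp hε
      (fun t => by simpa using hε.le) hz
  have h2 : ‖deriv p z‖ ≤ 8 * (0 + c * M * (2 * (1 - ‖z‖)) ^ α) / (1 - ‖z‖) := by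
    refine ge_of_tendsto (f := fun ε : ℝ => 8 * (ε + c * M * (2 * (1 - ‖z‖)) ^ α) / (1 - ‖z‖))
      (x := 𝓝[>] 0) ?_ (eventually_nhdsWithin_of_forall fun ε hε => h1 ε hε)
    have : ContinuousAt (fun ε : ℝ => 8 * (ε + c * M * (2 * (1 - ‖z‖)) ^ α) / (1 - ‖z‖)) 0 := by
      fun_prop
    exact this.tendsto.mono_left nhdsWithin_le_nhds
  refine h2.trans_eq ?_
  rw [Real.rpow_sub_one hδ.ne', Real.mul_rpow (by norm_num) hδ.le]
  field_simp
  ring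

/-- Interpolation between the mean square and a Hölder bound. -/
lemma abs_le_of_integral_sq_le {α : ℝ} (hα : 0 < α) {φ : ℝ → ℝ} {A L d : ℝ} (hA : 0 ≤ A)
    (hL : 0 ≤ L) (hφ : HolderBound α A φ) (hper : Function.Periodic φ (2 * Real.pi))
    (hd : 0 < d) (hd' : d ≤ 2 * Real.pi) (h : ∫ t in (0 : ℝ)..2 * Real.pi, φ t ^ 2 ≤ L ^ 2)
    (t : ℝ) : |φ t| ≤ 2 * A * d ^ α + 2 * L / Real.sqrt d := by
  have hc := hφ.continuous hα
  by_contra! hlt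
  set S := |φ t| with hS
  have hL' : 0 ≤ 2 * L / Real.sqrt d := by positivity
  have hA' : 0 ≤ A * d ^ α := by positivity
  have h1 : ∀ s ∈ Icc t (t + d), (S / 2) ^ 2 ≤ φ s ^ 2 := by
    intro s hs
    have h2 := hφ t s
    have h3 : |t - s| ^ α ≤ d ^ α := by
      refine Real.rpow_le_rpow (abs_nonneg _) ?_ hα.le
      rw [abs_le]
      constructor <;> linarith [hs.1, hs.2]
    have h4 : A * |t - s| ^ α ≤ A * d ^ α := by gcongr
    have h5 : |φ t| - |φ s| ≤ |φ t - φ s| := abs_sub_abs_le_abs_sub _ _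
    rw [Real.norm_eq_abs] at h2
    rw [← sq_abs (φ s)]
    have h6 : S / 2 ≤ |φ s| := by linarith
    gcongr
  have h2 : d * (S / 2) ^ 2 ≤ ∫ s in t..t + d, φ s ^ 2 := by
    have := intervalIntegral.integral_mono_on (μ := MeasureTheory.volume)
      (f := fun _ => (S / 2) ^ 2) (g := fun s => φ s ^ 2)
      (a := t) (b := t + d) (by linarith) intervalIntegrable_const
      ((hc.pow 2).intervalIntegrable _ _) h1
    simpa using this
  have h3 : ∫ s in t..t + d, φ s ^ 2 ≤ ∫ s in t..t + 2 * Real.pi, φ s ^ 2 := by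
    refine intervalIntegral.integral_mono_interval le_rfl (by linarith) (by linarith)
      (Filter.Eventually.of_forall fun s => sq_nonneg (φ s)) ((hc.pow 2).intervalIntegrable _ _)
  have hper2 : Function.Periodic (fun s => φ s ^ 2) (2 * Real.pi) := fun s => by
    simp only [hper s]
  have h4 := hper2.intervalIntegral_add_eq t 0
  rw [zero_add] at h4
  have h5 : d * (S / 2) ^ 2 ≤ L ^ 2 := by linarith
  have hsd : 0 < Real.sqrt d := Real.sqrt_pos.2 hd
  have h6 : 2 * L / Real.sqrt d < S := by nlinarith
  rw [div_lt_iff₀ hsd] at h6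
  have h7 : (2 * L) ^ 2 < (S * Real.sqrt d) ^ 2 := by gcongr
  rw [mul_pow, mul_pow, Real.sq_sqrt hd.le] at h7
  nlinarith

/-- Limits of functions in the disc algebra whose boundary values converge uniformly. -/
lemma exists_diffContOnCl_of_tendstoUniformly {ι : Type*} {l : Filter ι} [l.NeBot]
    {h : ι → ℂ → ℂ} (hh : ∀ i, DiffContOnCl ℂ (h i) (ball 0 1)) {g : ℝ → ℂ}
    (hg : TendstoUniformly (fun i (t : ℝ) => h i (cexp (t * I))) g l) :
    ∃ H : ℂ → ℂ, DiffContOnCl ℂ H (ball 0 1) ∧ TendstoUniformlyOn h H l (closedBall 0 1) := by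
  have hU : UniformCauchySeqOn h l (closedBall 0 1) := by
    intro s hs
    obtain ⟨ε, hε, hs⟩ := Metric.mem_uniformity_dist.1 hs
    have h1 := (Metric.tendstoUniformly_iff.1 hg) (ε / 3) (by positivity)
    filter_upwards [h1.prod_mk h1] with m hm z hz
    refine hs ?_
    rw [dist_eq_norm]
    refine lt_of_le_of_lt (norm_le_of_norm_le_on_sphere ((hh m.1).sub (hh m.2)) (s := 2 * ε / 3)
      (fun ζ hζ => ?_) (mem_closedBall_zero_iff.1 hz)) (by linarith)
    have h2 := hm.1 ζ.arg
    have h3 := hm.2 ζ.arg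
    have hζ' : cexp (ζ.arg * I) = ζ := by
      have := norm_mul_exp_arg_mul_I ζ
      rwa [hζ, ofReal_one, one_mul] at this
    rw [hζ'] at h2 h3
    rw [Pi.sub_apply, ← dist_eq_norm]
    have := dist_triangle_left (h m.1 ζ) (h m.2 ζ) (g ζ.arg)
    linarith
  have hex : ∀ z : ℂ, ∃ w : ℂ, z ∈ closedBall (0 : ℂ) 1 → Filter.Tendsto
      (fun i => h i z) l (𝓝 w) := by
    intro z
    by_cases hz : z ∈ closedBall (0 : ℂ) 1
    · have : Cauchy (Filter.map (fun i => h i z) l) := by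
        refine ⟨Filter.map_neBot, ?_⟩
        rw [Filter.prod_map_map_eq]
        exact fun s hs => (hU s hs).mono fun m hm => hm z hz
      obtain ⟨w, hw⟩ := cauchy_map_iff_exists_tendsto.1 this
      exact ⟨w, fun _ => hw⟩
    · exact ⟨0, fun h => absurd h hz⟩
  choose H hH using hex
  have hT := hU.tendstoUniformlyOn_of_tendsto (f := H) hH
  refine ⟨H, ⟨?_, ?_⟩, hT⟩
  · refine TendstoLocallyUniformlyOn.differentiableOn (φ := l) (F := h) ?_
      (Filter.Eventually.of_forall fun i => (hh i).differentiableOn) isOpen_ball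
    exact (hT.mono ball_subset_closedBall).tendstoLocallyUniformlyOn
  · rw [closure_ball _ one_ne_zero]
    exact hT.continuousOn (Filter.Eventually.of_forall fun i => (hh i).continuousOn_ball).frequently

/-- `v` is the harmonic conjugate of `u` on the unit circle, normalized at the center. -/
def IsHarmonicConj (u v : ℝ → ℝ) : Prop :=
  ∃ h : ℂ → ℂ, DiffContOnCl ℂ h (ball 0 1) ∧ (∀ t : ℝ, h (cexp (t * I)) = u t + v t * I) ∧
    (h 0).im = 0

namespace IsHarmonicConj

variable {u v u' v' : ℝ → ℝ}

lemma cexp_add_two_pi (t : ℝ) : cexp (((t + 2 * Real.pi : ℝ) : ℂ) * I) = cexp (t * I) := by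
  push_cast
  rw [add_mul, Complex.exp_add, exp_two_pi_mul_I, mul_one]

lemma periodic (h : IsHarmonicConj u v) :
    Function.Periodic u (2 * Real.pi) ∧ Function.Periodic v (2 * Real.pi) := by
  obtain ⟨h, _, h1, _⟩ := h
  have h2 : ∀ t, u t = (h (cexp (t * I))).re := fun t => by rw [h1]; simp
  have h3 : ∀ t, v t = (h (cexp (t * I))).im := fun t => by rw [h1]; simp
  constructor
  · intro t
    rw [h2, h2, cexp_add_two_pi]
  · intro t
    rw [h3, h3, cexp_add_two_pi]

lemma continuous (h : IsHarmonicConj u v) : Continuous u ∧ Continuous v := by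
  obtain ⟨h, hd, h1, _⟩ := h
  have h2 : ∀ t, u t = (h (cexp (t * I))).re := fun t => by rw [h1]; simp
  have h3 : ∀ t, v t = (h (cexp (t * I))).im := fun t => by rw [h1]; simp
  have hc : Continuous fun t : ℝ => h (cexp (t * I)) :=
    hd.continuousOn_ball.comp_continuous (by fun_prop) fun t => by
      simp [norm_exp_ofReal_mul_I]
  exact ⟨(continuous_re.comp hc).congr fun t => (h2 t).symm,
    (continuous_im.comp hc).congr fun t => (h3 t).symm⟩

lemma sub (h : IsHarmonicConj u v) (h' : IsHarmonicConj u' v') :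
    IsHarmonicConj (fun t => u t - u' t) (fun t => v t - v' t) := by
  obtain ⟨h, hd, h1, h0⟩ := h
  obtain ⟨h', hd', h1', h0'⟩ := h'
  refine ⟨h - h', hd.sub hd', fun t => ?_, by simp [h0, h0']⟩
  rw [Pi.sub_apply, h1, h1']
  push_cast
  ring

lemma const_mul (h : IsHarmonicConj u v) (c : ℝ) : IsHarmonicConj (fun t => c * u t)
    (fun t => c * v t) := by
  obtain ⟨h, hd, h1, h0⟩ := h
  refine ⟨(c : ℂ) • h, hd.const_smul (c : ℂ), fun t => ?_, by simp [h0]⟩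
  rw [Pi.smul_apply, h1, smul_eq_mul]
  push_cast
  ring

lemma translate (h : IsHarmonicConj u v) (a : ℝ) : IsHarmonicConj (fun t => u (t + a))
    (fun t => v (t + a)) := by
  obtain ⟨h, hd, h1, h0⟩ := h
  have hn : ∀ z : ℂ, ‖cexp (a * I) * z‖ = ‖z‖ := fun z => by
    rw [norm_mul, norm_exp_ofReal_mul_I, one_mul]
  refine ⟨fun z => h (cexp (a * I) * z), ⟨?_, ?_⟩, fun t => ?_, by simpa using h0⟩
  · refine hd.differentiableOn.comp (by fun_prop) fun z hz => ?_
    simpa [hn] using hz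
  · rw [closure_ball _ one_ne_zero]
    refine hd.continuousOn_ball.comp (by fun_prop) fun z hz => ?_
    simpa [hn] using hz
  · beta_reduce
    rw [← h1, ← Complex.exp_add]
    congr 2
    push_cast
    ring

lemma tendsto {ι : Type*} {l : Filter ι} [l.NeBot] {p q : ι → ℝ → ℝ}
    (h : ∀ i, IsHarmonicConj (p i) (q i)) (hp : TendstoUniformly p u l)
    (hq : TendstoUniformly q v l) :
    IsHarmonicConj u v := by
  choose h hd h1 h0 using h
  have hT : TendstoUniformly (fun i (t : ℝ) => h i (cexp (t * I))) (fun t => u t + v t * I) l := by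
    rw [Metric.tendstoUniformly_iff] at hp hq ⊢
    intro ε hε
    filter_upwards [hp (ε / 2) (by positivity), hq (ε / 2) (by positivity)] with i hi hi' t
    rw [h1, dist_eq_norm]
    have : (u t + v t * I : ℂ) - (p i t + q i t * I) =
        (u t - p i t : ℝ) + (v t - q i t : ℝ) * I := by
      push_cast
      ring
    rw [this]
    refine (norm_add_le _ _).trans_lt ?_
    rw [norm_mul, norm_I, mul_one, norm_real, norm_real, ← dist_eq_norm, ← dist_eq_norm]
    linarith [hi t, hi' t]
  obtain ⟨H, hH, hHT⟩ := exists_diffContOnCl_of_tendstoUniformly hd hT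
  refine ⟨H, hH, fun t => ?_, ?_⟩
  · exact tendsto_nhds_unique (hHT.tendsto_at (by simp [norm_exp_ofReal_mul_I])) (hT.tendsto_at t)
  · have h2 := (continuous_im.tendsto _).comp
      (hHT.tendsto_at (x := 0) (by simp))
    refine tendsto_nhds_unique h2 ?_
    simp [Function.comp_def, h0]

/-- The conjugation operator contracts the mean square norm. -/
lemma integral_sq_le (h : IsHarmonicConj u v) :
    ∫ t in (0 : ℝ)..2 * Real.pi, v t ^ 2 ≤ ∫ t in (0 : ℝ)..2 * Real.pi, u t ^ 2 := by
  obtain ⟨hu, hv⟩ := h.continuous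
  obtain ⟨h, hd, h1, h0⟩ := h
  have hd2 : DiffContOnCl ℂ (fun z => h z • h z) (ball 0 1) := hd.smul hd
  have h2 := hd2.circleIntegral_sub_inv_smul (w := 0) (by simp)
  rw [circleIntegral] at h2
  have h3 : ∀ θ : ℝ, deriv (circleMap 0 1) θ • ((circleMap 0 1 θ - 0)⁻¹ •
      (h (circleMap 0 1 θ) • h (circleMap 0 1 θ))) = I * (u θ + v θ * I) ^ 2 := by
    intro θ
    rw [deriv_circleMap, circleMap_zero, ofReal_one, one_mul, h1]
    simp only [smul_eq_mul, sub_zero]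
    field_simp [Complex.exp_ne_zero]
  simp only [h3] at h2
  rw [intervalIntegral.integral_const_mul, smul_eq_mul, mul_comm (2 * (Real.pi : ℂ)) I, mul_assoc]
    at h2
  have h4 := mul_left_cancel₀ I_ne_zero h2
  have h5 := congrArg re h4
  have h00 : h 0 = ((h 0).re : ℂ) := Complex.ext rfl (by simpa using h0)
  rw [h00] at h5
  have h6 : (∫ t in (0 : ℝ)..2 * Real.pi, ((u t : ℂ) + v t * I) ^ 2).re =
      ∫ t in (0 : ℝ)..2 * Real.pi, (u t ^ 2 - v t ^ 2) := by
    have h7 := reCLM.intervalIntegral_comp_comm (μ := MeasureTheory.volume) (a := 0)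
      (b := 2 * Real.pi) (f := fun t : ℝ => ((u t : ℂ) + v t * I) ^ 2)
      (Continuous.intervalIntegrable (by fun_prop) _ _)
    simp only [reCLM_apply] at h7
    rw [← h7]
    refine intervalIntegral.integral_congr fun t _ => ?_
    simp [pow_two]
  rw [h6, intervalIntegral.integral_sub (f := fun t => u t ^ 2) (g := fun t => v t ^ 2)
    ((hu.pow 2).intervalIntegrable _ _) ((hv.pow 2).intervalIntegrable _ _)] at h5
  have h9 : (2 * (Real.pi : ℂ) * (((h 0).re : ℂ) • ((h 0).re : ℂ))).re =
      2 * Real.pi * (h 0).re ^ 2 := by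
    simp [pow_two]
  rw [h9] at h5
  have := Real.pi_pos
  nlinarith [mul_nonneg this.le (sq_nonneg (h 0).re)]

lemma unique (h : IsHarmonicConj u v) (h' : IsHarmonicConj u v') : v = v' := by
  have h1 := h.sub h'
  have hc := h1.continuous.2
  have hp := h1.periodic.2
  have h2 := h1.integral_sq_le
  simp only [sub_self, ne_eq, OfNat.ofNat_ne_zero, not_false_eq_true, zero_pow,
    intervalIntegral.integral_zero] at h2
  have hpi := Real.pi_pos
  funext t
  by_contra hne
  have hp2 : Function.Periodic (fun t => (v t - v' t) ^ 2) (2 * Real.pi) := fun s => by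
    have := hp s
    simp only at this ⊢
    rw [this]
  have h3 := hp2.intervalIntegral_add_eq t 0
  rw [zero_add] at h3
  have h4 : 0 < ∫ s in t..t + 2 * Real.pi, (v s - v' s) ^ 2 :=
    intervalIntegral.integral_pos (by linarith) (hc.pow 2).continuousOn (fun s _ => sq_nonneg _)
      ⟨t, ⟨le_rfl, by linarith⟩, by have := sub_ne_zero.2 hne; positivity⟩
  linarith

end IsHarmonicConj

lemma norm_cexp_sub_cexp_le (t s : ℝ) : ‖cexp (t * I) - cexp (s * I)‖ ≤ |t - s| := by
  have h1 : cexp (t * I) - cexp (s * I) = cexp (s * I) * (cexp (I * (t - s : ℝ)) - 1) := by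
    rw [mul_sub, ← Complex.exp_add, mul_one]
    congr 2
    push_cast
    ring
  rw [h1, norm_mul, norm_exp_ofReal_mul_I, one_mul]
  exact Real.norm_exp_I_mul_ofReal_sub_one_le

lemma HolderBound.sub {G : Type*} [NormedAddCommGroup G] {α M M' : ℝ} {u v : ℝ → G}
    (hu : HolderBound α M u) (hv : HolderBound α M' v) :
    HolderBound α (M + M') fun t => u t - v t := fun t s => by
  rw [sub_sub_sub_comm, add_mul]
  exact (norm_sub_le _ _).trans (add_le_add (hu t s) (hv t s))

lemma HolderBound.of_tendsto {G : Type*} [NormedAddCommGroup G] {ι : Type*} {l : Filter ι}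
    [l.NeBot] {α M : ℝ} {q : ι → ℝ → G} {v : ℝ → G} (hq : ∀ i, HolderBound α M (q i))
    (h : ∀ t, Filter.Tendsto (fun i => q i t) l (𝓝 (v t))) : HolderBound α M v := fun t s =>
  le_of_tendsto ((h t).sub (h s)).norm (Filter.Eventually.of_forall fun i => hq i t s)

lemma exists_interpolation {α : ℝ} (hα : 0 < α) {γ : ℝ} (hγ : 0 < γ) : ∃ C > 0,
    ∀ (φ : ℝ → ℝ) (A L : ℝ), 0 ≤ A → 0 ≤ L → HolderBound α A φ →
      Function.Periodic φ (2 * Real.pi) → ∫ t in (0 : ℝ)..2 * Real.pi, φ t ^ 2 ≤ L ^ 2 →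
      ∀ t, |φ t| ≤ γ * A + C * L := by
  have hpi := Real.pi_pos
  obtain ⟨d, hd0, hd1, hd⟩ : ∃ d : ℝ, 0 < d ∧ d ≤ 2 * Real.pi ∧ 2 * d ^ α ≤ γ := by
    have h1 : ContinuousAt (fun τ : ℝ => 2 * τ ^ α) 0 :=
      continuousAt_const.mul (Real.continuousAt_rpow_const _ _ (Or.inr hα.le))
    have h2 : ∀ᶠ τ in 𝓝[>] (0 : ℝ), 2 * τ ^ α < γ :=
      nhdsWithin_le_nhds (h1.eventually (gt_mem_nhds (by simpa [hα.ne', Real.zero_rpow] using hγ)))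
    obtain ⟨τ, h3, h4⟩ := (h2.and (Ioo_mem_nhdsGT (mul_pos two_pos hpi))).exists
    exact ⟨τ, h4.1, h4.2.le, h3.le⟩
  refine ⟨2 / Real.sqrt d, by positivity, fun φ A L hA hL hφ hper h t => ?_⟩
  refine (abs_le_of_integral_sq_le hα hA hL hφ hper hd0 hd1 h t).trans ?_
  refine add_le_add ?_ (by rw [div_mul_eq_mul_div])
  calc 2 * A * d ^ α = 2 * d ^ α * A := by ring
    _ ≤ γ * A := by gcongr

/-- Mean square convergence and uniform Hölder bounds imply uniform convergence. -/
lemma exists_tendstoUniformly_of_integral_sq {α : ℝ} (hα : 0 < α) {ι : Type*} {l : Filter ι}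
    [l.NeBot] {q : ι → ℝ → ℝ} {A : ℝ} (hA : 0 ≤ A) (hq : ∀ i, HolderBound α A (q i))
    (hper : ∀ i, Function.Periodic (q i) (2 * Real.pi))
    (h : ∀ ε > 0, ∀ᶠ m in l ×ˢ l,
      ∫ t in (0 : ℝ)..2 * Real.pi, (q m.1 t - q m.2 t) ^ 2 ≤ ε ^ 2) :
    ∃ v : ℝ → ℝ, TendstoUniformly q v l := by
  have hU : UniformCauchySeqOn q l univ := by
    intro s hs
    obtain ⟨ε, hε, hs⟩ := Metric.mem_uniformity_dist.1 hs
    obtain ⟨C, hC, hinterp⟩ := exists_interpolation hα (γ := ε / (4 * (2 * A + 1))) (by positivity)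
    filter_upwards [h (ε / (4 * C)) (by positivity)] with m hm t _
    refine hs ?_
    rw [Real.dist_eq]
    have hp : Function.Periodic (fun t => q m.1 t - q m.2 t) (2 * Real.pi) := fun t => by
      simp only [hper m.1 t, hper m.2 t]
    have h1 := hinterp _ (A + A) _ (by positivity) (by positivity) ((hq m.1).sub (hq m.2)) hp hm t
    have h2 : ε / (4 * (2 * A + 1)) * (A + A) ≤ ε / 4 := by
      rw [div_mul_eq_mul_div, div_le_div_iff₀ (by positivity) (by norm_num)]
      nlinarith
    have h3 : C * (ε / (4 * C)) = ε / 4 := by field_simp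
    beta_reduce at h1
    linarith
  have hex : ∀ t : ℝ, ∃ w : ℝ, Filter.Tendsto (fun i => q i t) l (𝓝 w) := fun t =>
    cauchy_map_iff_exists_tendsto.1 (hU.cauchy_map (mem_univ t))
  choose v hv using hex
  exact ⟨v, tendstoUniformlyOn_univ.1 (hU.tendstoUniformlyOn_of_tendsto fun t _ => hv t)⟩

/-- Privalov's theorem: the conjugation operator is bounded on Hölder spaces. -/
lemma exists_isHarmonicConj {α : ℝ} (hα : 0 < α) (hα1 : α < 1) : ∃ K > 0,
    ∀ (u : ℝ → ℝ) (M : ℝ), 0 ≤ M → HolderBound α M u → Function.Periodic u (2 * Real.pi) →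
      ∃ v, IsHarmonicConj u v ∧ HolderBound α (K * M) v := by
  have hpi := Real.pi_pos
  obtain ⟨K, hK, hap⟩ := exists_holder_entire_approx hα hα1
  have main : ∀ (u : ℝ → ℝ) (M : ℝ), 0 < M → HolderBound α M u →
      Function.Periodic u (2 * Real.pi) → ∃ v, IsHarmonicConj u v ∧ HolderBound α (K * M) v := by
    intro u M hM hu hper
    choose q hq hqh hqu hq0 using fun k : ℕ => hap u M hM hu hper (1 / ((k : ℝ) + 1))
      (by positivity)
    let p : ℕ → ℝ → ℝ := fun k t => (q k (cexp (t * I))).re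
    let v : ℕ → ℝ → ℝ := fun k t => (q k (cexp (t * I))).im
    have hconj : ∀ k, IsHarmonicConj (p k) (v k) := fun k =>
      ⟨q k, (hq k).diffContOnCl, fun t => (re_add_im _).symm, hq0 k⟩
    have hvH : ∀ k, HolderBound α (K * M) (v k) := fun k t s => by
      simp only [v]
      rw [← sub_im]
      refine (abs_im_le_norm _).trans ((hqh k _ _ (by rw [norm_exp_ofReal_mul_I])
        (by rw [norm_exp_ofReal_mul_I])).trans ?_)
      gcongr
      exact norm_cexp_sub_cexp_le t s
    have hpu : TendstoUniformly p u Filter.atTop := by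
      rw [Metric.tendstoUniformly_iff]
      intro ε hε
      filter_upwards [tendsto_one_div_add_atTop_nhds_zero_nat.eventually (gt_mem_nhds hε)]
        with k hk t
      rw [dist_comm, Real.dist_eq]
      exact (hqu k t).trans_lt hk
    obtain ⟨w, hw⟩ := exists_tendstoUniformly_of_integral_sq hα (by positivity) hvH
      (fun k => (hconj k).periodic.2) (l := Filter.atTop) (fun ε hε => by
        have h1 := (Metric.tendstoUniformly_iff.1 hpu) (ε / 8) (by positivity)
        filter_upwards [h1.prod_mk h1] with m hm
        have h2 := ((hconj m.1).sub (hconj m.2))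
        refine h2.integral_sq_le.trans ?_
        have h3 := intervalIntegral.integral_mono_on (μ := MeasureTheory.volume)
          (f := fun t => (p m.1 t - p m.2 t) ^ 2) (g := fun _ => (ε / 4) ^ 2)
          (a := 0) (b := 2 * Real.pi) (by positivity)
          ((h2.continuous.1.pow 2).intervalIntegrable _ _) intervalIntegrable_const
          (fun t _ => by
            have h4 := hm.1 t
            have h5 := hm.2 t
            rw [← sq_abs]
            have := dist_triangle_left (p m.1 t) (p m.2 t) (u t)
            rw [Real.dist_eq (p m.1 t)] at this
            gcongr
            linarith)
        refine h3.trans ?_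
        rw [intervalIntegral.integral_const, smul_eq_mul]
        nlinarith [Real.pi_le_four, sq_nonneg ε])
    exact ⟨w, IsHarmonicConj.tendsto hconj hpu hw, HolderBound.of_tendsto hvH hw.tendsto_at⟩
  refine ⟨K, hK, fun u M hM hu hper => ?_⟩
  obtain ⟨v, hv, _⟩ := main u (M + 1) (by positivity) (hu.mono (by linarith)) hper
  refine ⟨v, hv, HolderBound.of_forall_lt fun M' hM' => ?_⟩
  have hpos : M < M' / K := by rwa [lt_div_iff₀ hK, mul_comm]
  obtain ⟨v', hv', hh⟩ := main u (M' / K) (hM.trans_lt hpos) (hu.mono hpos.le) hper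
  rw [hv.unique hv', mul_div_cancel₀ _ hK.ne'] at *
  exact hh

/-- `K` bounds the conjugation operator on `α`-Hölder functions. -/
def IsPrivalovConst (α K : ℝ) : Prop :=
  0 < K ∧ ∀ (u v : ℝ → ℝ) (M : ℝ), 0 ≤ M → IsHarmonicConj u v → HolderBound α M u →
    HolderBound α (K * M) v

lemma exists_isPrivalovConst {α : ℝ} (hα : 0 < α) (hα1 : α < 1) : ∃ K, IsPrivalovConst α K := by
  obtain ⟨K, hK, h⟩ := exists_isHarmonicConj hα hα1
  refine ⟨K, hK, fun u v M hM huv hu => ?_⟩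
  obtain ⟨v', hv', hh⟩ := h u M hM hu huv.periodic.1
  rwa [huv.unique hv']

lemma integral_sq_le_of_abs_le {f : ℝ → ℝ} (hf : Continuous f) {m : ℝ} (h : ∀ t, |f t| ≤ m) :
    ∫ t in (0 : ℝ)..2 * Real.pi, f t ^ 2 ≤ 8 * m ^ 2 := by
  have h3 := intervalIntegral.integral_mono_on (μ := MeasureTheory.volume)
    (f := fun t => f t ^ 2) (g := fun _ => m ^ 2)
    (a := 0) (b := 2 * Real.pi) (by positivity)
    ((hf.pow 2).intervalIntegrable _ _) intervalIntegrable_const (fun t _ => by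
      rw [← sq_abs]
      have := h t
      gcongr)
  refine h3.trans ?_
  rw [intervalIntegral.integral_const, smul_eq_mul]
  nlinarith [Real.pi_le_four, sq_nonneg m]

lemma integral_sq_le_of_linear {P Q b c : ℝ → ℝ} {m : ℝ} (h : IsHarmonicConj P Q)
    (hP : ∀ t, P t = c t + b t * Q t) (hb : ∀ t, |b t| ≤ 1 / 2) (hc : ∀ t, |c t| ≤ m) :
    ∫ t in (0 : ℝ)..2 * Real.pi, Q t ^ 2 ≤ (6 * m) ^ 2 := by
  have h1 := h.integral_sq_le
  obtain ⟨hPc, hQc⟩ := h.continuous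
  have h2 := intervalIntegral.integral_mono_on (μ := MeasureTheory.volume)
    (f := fun t => P t ^ 2) (g := fun t => 2 * m ^ 2 + 1 / 2 * Q t ^ 2)
    (a := 0) (b := 2 * Real.pi) (by positivity)
    ((hPc.pow 2).intervalIntegrable _ _)
    (Continuous.intervalIntegrable (by fun_prop) _ _)
    (fun t _ => by
      have h3 : c t ^ 2 ≤ m ^ 2 := by
        rw [← sq_abs]
        have := hc t
        gcongr
      have h4 : b t ^ 2 ≤ (1 / 2) ^ 2 := by
        rw [← sq_abs]
        have := hb t
        gcongr
      rw [hP]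
      have h5 : (b t * Q t) ^ 2 ≤ (1 / 2) ^ 2 * Q t ^ 2 := by
        rw [mul_pow]
        gcongr
      nlinarith [sq_nonneg (c t - b t * Q t)])
  rw [intervalIntegral.integral_add intervalIntegrable_const
    (Continuous.intervalIntegrable (by fun_prop) _ _), intervalIntegral.integral_const,
    intervalIntegral.integral_const_mul (1 / 2 : ℝ), smul_eq_mul] at h2
  nlinarith [Real.pi_le_four, sq_nonneg m]

/-- A priori estimate for a linear Riemann–Hilbert problem with small coefficient. -/
lemma exists_apriori_holderBound {α K κ M : ℝ} (hα : 0 < α) (hK : IsPrivalovConst α K)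
    (hκ : 0 ≤ κ) (hκ2 : κ ≤ 1 / 2) (hκK : κ * K ≤ 1 / 4) (hM : 0 ≤ M) : ∃ A B, 0 ≤ A ∧ 0 ≤ B ∧
    ∀ (P Q b c : ℝ → ℝ) (A₀ : ℝ), IsHarmonicConj P Q → (∀ t, P t = c t + b t * Q t) →
      (∀ t, |b t| ≤ κ) → (∀ t, |c t| ≤ M) → HolderBound α M b → HolderBound α M c →
      HolderBound α A₀ P →
      HolderBound α A P ∧ HolderBound α A Q ∧ ∀ t, |Q t| ≤ B := by
  obtain ⟨hK0, hK⟩ := hK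
  obtain ⟨C, hC, hinterp⟩ := exists_interpolation hα (γ := 1 / (4 * (M + 1) * K)) (by positivity)
  set M' := M + M * (6 * C * M) with hM'
  have hM'0 : 0 ≤ M' := by positivity
  refine ⟨max (2 * M') (K * (2 * M')), 2 * M' + C * (6 * M), by positivity, by positivity,
    fun P Q b c A₀ h hP hb hc hbH hcH hPH => ?_⟩
  have hsq := integral_sq_le_of_linear h hP (fun t => (hb t).trans hκ2) hc
  have hQb : ∀ A, 0 ≤ A → HolderBound α A P →
      ∀ t, |Q t| ≤ 1 / (4 * (M + 1)) * A + C * (6 * M) := by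
    intro A hA hPA t
    refine (hinterp Q (K * A) (6 * M) (by positivity) (by positivity) (hK P Q A hA h hPA)
      h.periodic.2 hsq t).trans_eq ?_
    field_simp
  have step : ∀ A, 0 ≤ A → HolderBound α A P → HolderBound α (M' + A / 2) P := by
    intro A hA hPA t s
    have h1 := hK P Q A hA h hPA t s
    have h2 := hQb A hA hPA s
    have h3 := hbH t s
    have h4 := hcH t s
    rw [Real.norm_eq_abs] at *
    have h5 : P t - P s = (c t - c s) + (b t * (Q t - Q s) + (b t - b s) * Q s) := by
      rw [hP, hP]
      ring
    have hr : 0 ≤ |t - s| ^ α := by positivity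
    calc |P t - P s| ≤ |c t - c s| + (|b t| * |Q t - Q s| + |b t - b s| * |Q s|) := by
          rw [h5, ← abs_mul, ← abs_mul]
          exact (abs_add_le _ _).trans (add_le_add le_rfl (abs_add_le _ _))
      _ ≤ M * |t - s| ^ α + (κ * (K * A * |t - s| ^ α) +
          M * |t - s| ^ α * (1 / (4 * (M + 1)) * A + C * (6 * M))) := by
          have := hb t
          gcongr
      _ = (M + M * (6 * C * M) + (κ * K) * A + M / (M + 1) * (A / 4)) * |t - s| ^ α := by
          field_simp
          ring
      _ ≤ (M' + A / 2) * |t - s| ^ α := by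
          have h6 : M / (M + 1) ≤ 1 := by
            rw [div_le_one (by positivity)]
            linarith
          have h7 : κ * K * A ≤ 1 / 4 * A := by gcongr
          have h8 : M / (M + 1) * (A / 4) ≤ 1 * (A / 4) := by gcongr
          refine mul_le_mul_of_nonneg_right ?_ hr
          linarith
  have hP0 : HolderBound α (max A₀ 0) P := hPH.mono (le_max_left _ _)
  have hiter : ∀ n : ℕ, HolderBound α (2 * M' + max A₀ 0 / 2 ^ n) P := by
    intro n
    induction n with
    | zero => exact hP0.mono (by simp [hM'0])
    | succ n ih =>
      refine (step _ (by positivity) ih).mono (le_of_eq ?_)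
      rw [pow_succ]
      field_simp
      ring
  have hfin : HolderBound α (2 * M') P := HolderBound.of_forall_lt fun M'' hM'' => by
    have h1 : Filter.Tendsto (fun n : ℕ => max A₀ 0 / 2 ^ n) Filter.atTop (𝓝 0) :=
      tendsto_const_nhds.div_atTop (tendsto_pow_atTop_atTop_of_one_lt one_lt_two)
    obtain ⟨n, hn⟩ := (h1.eventually (gt_mem_nhds (sub_pos.2 hM''))).exists
    exact (hiter n).mono (by linarith)
  refine ⟨hfin.mono (le_max_left _ _), (hK P Q _ (by positivity) h hfin).mono (le_max_right _ _),
    fun t => (hQb _ (by positivity) hfin t).trans ?_⟩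
  have : 1 / (4 * (M + 1)) ≤ 1 := by
    rw [div_le_one (by positivity)]
    linarith
  have := mul_le_mul_of_nonneg_right this (mul_nonneg zero_le_two hM'0)
  linarith

/-- Stability of solutions of linear Riemann–Hilbert problems under uniform convergence of the
coefficients. -/
lemma exists_limit_of_linear {α K κ M : ℝ} (hα : 0 < α) (hK : IsPrivalovConst α K)
    (hκ : 0 ≤ κ) (hκ2 : κ ≤ 1 / 2) (hκK : κ * K ≤ 1 / 4) (hM : 0 ≤ M) {ι : Type*}
    {l : Filter ι} [l.NeBot] {P Q b c : ι → ℝ → ℝ} {A₀ : ι → ℝ} {b₀ c₀ : ℝ → ℝ}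
    (h : ∀ i, IsHarmonicConj (P i) (Q i)) (hP : ∀ i t, P i t = c i t + b i t * Q i t)
    (hb : ∀ i t, |b i t| ≤ κ) (hc : ∀ i t, |c i t| ≤ M) (hbH : ∀ i, HolderBound α M (b i))
    (hcH : ∀ i, HolderBound α M (c i)) (hPH : ∀ i, HolderBound α (A₀ i) (P i))
    (hbl : TendstoUniformly b b₀ l) (hcl : TendstoUniformly c c₀ l) :
    ∃ P₀ Q₀ A, 0 ≤ A ∧ IsHarmonicConj P₀ Q₀ ∧ HolderBound α A P₀ ∧ HolderBound α A Q₀ ∧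
      TendstoUniformly P P₀ l ∧ TendstoUniformly Q Q₀ l ∧ ∀ t, P₀ t = c₀ t + b₀ t * Q₀ t := by
  obtain ⟨A, B, hA, hB, hap⟩ := exists_apriori_holderBound hα hK hκ hκ2 hκK hM
  have hap' := fun i => hap (P i) (Q i) (b i) (c i) (A₀ i) (h i) (hP i) (hb i) (hc i) (hbH i)
    (hcH i) (hPH i)
  obtain ⟨Q₀, hQ₀⟩ := exists_tendstoUniformly_of_integral_sq hα hA (fun i => (hap' i).2.1)
    (fun i => (h i).periodic.2) (l := l) (fun ε hε => by
      have h1 := (Metric.tendstoUniformly_iff.1 hbl) (ε / (24 * (B + 1))) (by positivity)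
      have h2 := (Metric.tendstoUniformly_iff.1 hcl) (ε / 24) (by positivity)
      filter_upwards [(h1.and h2).prod_mk (h1.and h2)] with m hm
      have h3 := integral_sq_le_of_linear ((h m.1).sub (h m.2)) (b := b m.2)
        (c := fun t => (c m.1 t - c m.2 t) + (b m.1 t - b m.2 t) * Q m.1 t) (m := ε / 6)
        (fun t => by simp only [hP]; ring) (fun t => (hb _ t).trans hκ2) (fun t => by
          have h4 := hm.1.1 t
          have h5 := hm.1.2 t
          have h6 := hm.2.1 t
          have h7 := hm.2.2 t
          have h8 := dist_triangle_left (b m.1 t) (b m.2 t) (b₀ t)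
          have h9 := dist_triangle_left (c m.1 t) (c m.2 t) (c₀ t)
          rw [Real.dist_eq (b m.1 t)] at h8
          rw [Real.dist_eq (c m.1 t)] at h9
          have h10 := (hap' m.1).2.2 t
          refine (abs_add_le _ _).trans ?_
          rw [abs_mul]
          have h11 : |b m.1 t - b m.2 t| * |Q m.1 t| ≤ (2 * (ε / (24 * (B + 1)))) * B := by
            gcongr
            linarith
          have h12 : (2 * (ε / (24 * (B + 1)))) * B ≤ ε / 12 := by
            have : (2 * (ε / (24 * (B + 1)))) * B = ε / 12 * (B / (B + 1)) := by
              field_simp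
              ring
            rw [this]
            refine mul_le_of_le_one_right (by positivity) ?_
            rw [div_le_one (by positivity)]
            linarith
          linarith)
      exact h3.trans_eq (by ring))
  have hQB : ∀ t, |Q₀ t| ≤ B := fun t =>
    le_of_tendsto (hQ₀.tendsto_at t).abs (Filter.Eventually.of_forall fun i => (hap' i).2.2 t)
  have hbκ : ∀ t, |b₀ t| ≤ κ := fun t =>
    le_of_tendsto (hbl.tendsto_at t).abs (Filter.Eventually.of_forall fun i => hb i t)
  have hPl : TendstoUniformly P (fun t => c₀ t + b₀ t * Q₀ t) l := by
    rw [Metric.tendstoUniformly_iff] at hbl hcl ⊢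
    intro ε hε
    filter_upwards [hbl (ε / (4 * (B + 1))) (by positivity), hcl (ε / 4) (by positivity),
      (Metric.tendstoUniformly_iff.1 hQ₀) (ε / 4) (by positivity)] with i h1 h2 h3 t
    have h1 := h1 t
    have h2 := h2 t
    have h3 := h3 t
    rw [Real.dist_eq] at *
    have h4 : c₀ t + b₀ t * Q₀ t - P i t =
        (c₀ t - c i t) + ((b₀ t - b i t) * Q₀ t + b i t * (Q₀ t - Q i t)) := by
      rw [hP]
      ring
    have h5 : |b₀ t - b i t| * |Q₀ t| ≤ ε / (4 * (B + 1)) * B := by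
      have := hQB t
      gcongr
    have h6 : ε / (4 * (B + 1)) * B ≤ ε / 4 := by
      have : ε / (4 * (B + 1)) * B = ε / 4 * (B / (B + 1)) := by field_simp
      rw [this]
      refine mul_le_of_le_one_right (by positivity) ?_
      rw [div_le_one (by positivity)]
      linarith
    have h7 : |b i t| * |Q₀ t - Q i t| ≤ 1 * (ε / 4) := by
      have := (hb i t).trans hκ2
      gcongr
      linarith
    rw [h4]
    refine (abs_add_le _ _).trans_lt ?_
    have h8 := abs_add_le ((b₀ t - b i t) * Q₀ t) (b i t * (Q₀ t - Q i t))
    rw [abs_mul, abs_mul] at h8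
    linarith
  exact ⟨_, Q₀, A, hA, IsHarmonicConj.tendsto h hPl hQ₀,
    HolderBound.of_tendsto (fun i => (hap' i).1) hPl.tendsto_at,
    HolderBound.of_tendsto (fun i => (hap' i).2.1) hQ₀.tendsto_at, hPl, hQ₀, fun t => rfl⟩

/-- Functions on the line with `k` derivatives, all of them bounded and `α`-Hölder. -/
def Reg (α : ℝ) : ℕ → (ℝ → ℝ) → Prop
  | 0, g => ∃ M, 0 ≤ M ∧ HolderBound α M g ∧ ∀ t, |g t| ≤ M
  | k + 1, g => (∃ M, 0 ≤ M ∧ HolderBound α M g ∧ ∀ t, |g t| ≤ M) ∧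
      ∃ g' : ℝ → ℝ, (∀ t, HasDerivAt g (g' t) t) ∧ Reg α k g'

lemma Reg.zero {α : ℝ} {k : ℕ} {g : ℝ → ℝ} (h : Reg α k g) : Reg α 0 g := by
  cases k with
  | zero => exact h
  | succ k => exact h.1

lemma Reg.of_succ {α : ℝ} {k : ℕ} {g : ℝ → ℝ} (h : Reg α (k + 1) g) : Reg α k g := by
  induction k generalizing g with
  | zero => exact h.zero
  | succ k ih =>
    obtain ⟨h0, g', hg, h1⟩ := h
    exact ⟨h0, g', hg, ih h1⟩

lemma Reg.add {α : ℝ} {k : ℕ} {f g : ℝ → ℝ} (hf : Reg α k f) (hg : Reg α k g) :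
    Reg α k fun t => f t + g t := by
  induction k generalizing f g with
  | zero =>
    obtain ⟨M, hM, h1, h2⟩ := hf
    obtain ⟨N, hN, h3, h4⟩ := hg
    refine ⟨M + N, by positivity, fun t s => ?_, fun t =>
      (abs_add_le _ _).trans (add_le_add (h2 t) (h4 t))⟩
    rw [add_sub_add_comm, add_mul]
    exact (norm_add_le _ _).trans (add_le_add (h1 t s) (h3 t s))
  | succ k ih =>
    refine ⟨?_, ?_⟩
    · obtain ⟨M, hM, h1, h2⟩ := hf.1
      obtain ⟨N, hN, h3, h4⟩ := hg.1
      refine ⟨M + N, by positivity, fun t s => ?_, fun t =>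
        (abs_add_le _ _).trans (add_le_add (h2 t) (h4 t))⟩
      rw [add_sub_add_comm, add_mul]
      exact (norm_add_le _ _).trans (add_le_add (h1 t s) (h3 t s))
    · obtain ⟨_, f', hf', h5⟩ := hf
      obtain ⟨_, g', hg', h6⟩ := hg
      exact ⟨_, fun t => (hf' t).add (hg' t), ih h5 h6⟩

lemma HolderBound.mul {α M N : ℝ} {f g : ℝ → ℝ} (h1 : HolderBound α M f) (h2 : ∀ t, |f t| ≤ M)
    (h3 : HolderBound α N g) (h4 : ∀ t, |g t| ≤ N) :
    HolderBound α (2 * (M * N)) fun t => f t * g t := by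
  intro t s
  have h5 : f t * g t - f s * g s = f t * (g t - g s) + (f t - f s) * g s := by ring
  rw [h5, Real.norm_eq_abs]
  refine (abs_add_le _ _).trans ?_
  rw [abs_mul, abs_mul]
  have h6 := h1 t s
  have h7 := h3 t s
  rw [Real.norm_eq_abs] at h6 h7
  calc |f t| * |g t - g s| + |f t - f s| * |g s|
      ≤ M * (N * |t - s| ^ α) + M * |t - s| ^ α * N := by
        have := (abs_nonneg _).trans (h2 t)
        have := (abs_nonneg _).trans h6
        have := h2 t
        have := h4 s
        gcongr
    _ = _ := by ring

lemma Reg.mul {α : ℝ} {k : ℕ} {f g : ℝ → ℝ} (hf : Reg α k f) (hg : Reg α k g) :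
    Reg α k fun t => f t * g t := by
  have h0 : ∀ {f g : ℝ → ℝ}, Reg α 0 f → Reg α 0 g → Reg α 0 fun t => f t * g t := by
    rintro f g ⟨M, hM, h1, h2⟩ ⟨N, hN, h3, h4⟩
    refine ⟨2 * (M * N), by positivity, h1.mul h2 h3 h4, fun t => ?_⟩
    rw [abs_mul]
    calc |f t| * |g t| ≤ M * N := by
          have := h2 t
          have := h4 t
          gcongr
      _ ≤ 2 * (M * N) := by nlinarith [mul_nonneg hM hN]
  induction k generalizing f g with
  | zero => exact h0 hf hg
  | succ k ih =>
    refine ⟨h0 hf.zero hg.zero, ?_⟩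
    have hf1 := hf.of_succ
    have hg1 := hg.of_succ
    obtain ⟨_, f', hf', h5⟩ := hf
    obtain ⟨_, g', hg', h6⟩ := hg
    exact ⟨_, fun t => (hf' t).mul (hg' t), (ih h5 hg1).add (ih hf1 h6)⟩

/-- Difference quotients inherit uniform Hölder bounds from the derivative. -/
lemma HolderBound.diffQuot {α M : ℝ} {c c' : ℝ → ℝ} (hc : ∀ t, HasDerivAt c (c' t) t)
    (h : HolderBound α M c') (s : ℝ) : HolderBound α M fun t => (c (t + s) - c t) / s := by
  intro t t'
  rcases eq_or_ne s 0 with rfl | hs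
  · have h1 := (norm_nonneg _).trans (h t t')
    simpa using h1
  have h2 := convex_univ.norm_image_sub_le_of_norm_hasDerivWithin_le
    (f := fun x => c (t + x) - c (t' + x)) (f' := fun x => c' (t + x) - c' (t' + x))
    (s := univ) (x := 0) (y := s) (C := M * |t - t'| ^ α) (fun x _ =>
      (((hc (t + x)).comp_const_add t x).sub ((hc (t' + x)).comp_const_add t' x)).hasDerivWithinAt)
    (fun x _ => by
      refine (h _ _).trans_eq ?_
      congr 3
      ring) (mem_univ _) (mem_univ _)
  have h3 : (c (t + s) - c t) / s - (c (t' + s) - c t') / s =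
      ((c (t + s) - c (t' + s)) - (c (t + 0) - c (t' + 0))) / s := by
    rw [add_zero, add_zero]
    ring
  rw [h3, norm_div, div_le_iff₀ (norm_pos_iff.2 hs)]
  simpa using h2

lemma abs_diffQuot_sub_le {α M : ℝ} (hα : 0 ≤ α) (hM : 0 ≤ M) {c c' : ℝ → ℝ}
    (hc : ∀ t, HasDerivAt c (c' t) t) (h : HolderBound α M c') {s : ℝ} (hs : s ≠ 0) (t : ℝ) :
    |(c (t + s) - c t) / s - c' t| ≤ M * |s| ^ α := by
  have h2 := (convex_uIcc 0 s).norm_image_sub_le_of_norm_hasDerivWithin_le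
    (f := fun x => c (t + x) - c' t * x) (f' := fun x => c' (t + x) - c' t)
    (x := 0) (y := s) (C := M * |s| ^ α) (fun x _ => by
      have h1 : HasDerivAt (fun x => c (t + x) - c' t * x) (c' (t + x) - c' t * 1) x :=
        ((hc (t + x)).comp_const_add t x).sub ((hasDerivAt_id x).const_mul (c' t))
      rw [mul_one] at h1
      exact h1.hasDerivWithinAt)
    (fun x hx => by
      refine (h _ _).trans ?_
      have : |x| ≤ |s| := by
        simpa using abs_sub_left_of_mem_uIcc hx
      rw [add_sub_cancel_left]
      gcongr) left_mem_uIcc right_mem_uIcc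
  have h3 : (c (t + s) - c t) / s - c' t =
      ((c (t + s) - c' t * s) - (c (t + 0) - c' t * 0)) / s := by
    rw [add_zero]
    field_simp
    ring
  rw [h3, abs_div, div_le_iff₀ (abs_pos.2 hs)]
  simpa using h2

lemma tendstoUniformly_of_abs_le {ι : Type*} {l : Filter ι} {f : ι → ℝ → ℝ} {f₀ : ℝ → ℝ}
    {e : ι → ℝ} (he : Filter.Tendsto e l (𝓝 0)) (h : ∀ i t, |f i t - f₀ t| ≤ e i) :
    TendstoUniformly f f₀ l := by
  rw [Metric.tendstoUniformly_iff]
  intro ε hε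
  filter_upwards [he.eventually (gt_mem_nhds hε)] with i hi t
  rw [dist_comm, Real.dist_eq]
  exact (h i t).trans_lt hi

/-- The punctured neighbourhoods of zero, as a filter on the nonzero increments. -/
def punctured : Filter {s : ℝ // s ≠ 0} := Filter.comap Subtype.val (𝓝 0)

lemma map_punctured : Filter.map Subtype.val punctured = 𝓝[≠] (0 : ℝ) := by
  have := Filter.subtype_coe_map_comap {s : ℝ | s ≠ 0} (𝓝 0)
  exact this

instance : punctured.NeBot := by
  rw [← Filter.map_neBot_iff Subtype.val, map_punctured]
  infer_instance

lemma tendsto_abs_rpow_punctured {α : ℝ} (hα : 0 < α) (M : ℝ) :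
    Filter.Tendsto (fun s : {s : ℝ // s ≠ 0} => M * |s.1| ^ α) punctured (𝓝 0) := by
  have h1 : ContinuousAt (fun s : ℝ => M * |s| ^ α) 0 :=
    continuousAt_const.mul (continuous_abs.continuousAt.rpow_const (Or.inr hα.le))
  have h2 : Filter.Tendsto (fun s : ℝ => M * |s| ^ α) (𝓝 0) (𝓝 0) := by
    simpa [ContinuousAt, hα.ne', Real.zero_rpow] using h1
  exact h2.comp Filter.tendsto_comap

lemma hasDerivAt_of_tendsto_punctured {f : ℝ → ℝ} {f' t : ℝ}
    (h : Filter.Tendsto (fun s : {s : ℝ // s ≠ 0} => (f (t + s.1) - f t) / s.1) punctured (𝓝 f')) :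
    HasDerivAt f f' t := by
  rw [hasDerivAt_iff_tendsto_slope_zero, ← map_punctured, Filter.tendsto_map'_iff]
  refine h.congr fun s => ?_
  simp only [Function.comp_apply, smul_eq_mul]
  rw [div_eq_inv_mul]

/-- Differentiability of solutions of Riemann–Hilbert problems whose difference quotients solve
uniformly controlled linear problems. -/
lemma exists_hasDerivAt_of_diffQuot {α K κ M A₀ : ℝ} (hα : 0 < α) (hK : IsPrivalovConst α K)
    (hκ : 0 ≤ κ) (hκ2 : κ ≤ 1 / 2) (hκK : κ * K ≤ 1 / 4) (hM : 0 ≤ M)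
    {p g : ℝ → ℝ} (h : IsHarmonicConj p g) (hp : HolderBound α A₀ p)
    {b c : {s : ℝ // s ≠ 0} → ℝ → ℝ} {b₀ c₀ : ℝ → ℝ}
    (hpg : ∀ (s : {s : ℝ // s ≠ 0}) t,
        p (t + s.1) - p t = s.1 * c s t + b s t * (g (t + s.1) - g t))
    (hb : ∀ s t, |b s t| ≤ κ) (hc : ∀ s t, |c s t| ≤ M) (hbH : ∀ s, HolderBound α M (b s))
    (hcH : ∀ s, HolderBound α M (c s))
    (hbl : TendstoUniformly b b₀ punctured) (hcl : TendstoUniformly c c₀ punctured) :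
    ∃ p' g' A, 0 ≤ A ∧ IsHarmonicConj p' g' ∧ HolderBound α A p' ∧ HolderBound α A g' ∧
      (∀ t, HasDerivAt p (p' t) t) ∧ (∀ t, HasDerivAt g (g' t) t) ∧
      ∀ t, p' t = c₀ t + b₀ t * g' t := by
  obtain ⟨p', g', A, hA, h1, h2, h3, h4, h5, h6⟩ := exists_limit_of_linear hα hK hκ hκ2 hκK hM
    (l := punctured) (P := fun s t => (p (t + s.1) - p t) / s.1)
    (Q := fun s t => (g (t + s.1) - g t) / s.1) (b := b) (c := c)
    (A₀ := fun s => (A₀ + A₀) / |s.1|) (b₀ := b₀) (c₀ := c₀)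
    (fun s => by
      have := ((h.translate s.1).sub h).const_mul s.1⁻¹
      simpa only [div_eq_inv_mul] using this)
    (fun s t => by
      have := s.2
      rw [hpg]
      field_simp)
    hb hc hbH hcH (fun s => by
      intro t t'
      have h1 : HolderBound α A₀ fun t => p (t + s.1) := fun t t' => by
        have := hp (t + s.1) (t' + s.1)
        rwa [add_sub_add_right_eq_sub] at this
      have h2 := (h1.sub hp) t t'
      rw [← sub_div, norm_div, div_mul_eq_mul_div, Real.norm_eq_abs s.1]
      have := s.2
      gcongr) hbl hcl
  exact ⟨p', g', A, hA, h1, h2, h3,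
    fun t => hasDerivAt_of_tendsto_punctured (h4.tendsto_at t),
    fun t => hasDerivAt_of_tendsto_punctured (h5.tendsto_at t), h6⟩

lemma abs_le_of_periodic_continuous {f : ℝ → ℝ} (hf : Continuous f)
    (hp : Function.Periodic f (2 * Real.pi)) : ∃ M, 0 ≤ M ∧ ∀ t, |f t| ≤ M := by
  obtain ⟨M, hM⟩ := isCompact_Icc.exists_bound_of_continuousOn (s := Icc 0 (2 * Real.pi))
    hf.continuousOn
  refine ⟨max M 0, le_max_right _ _, fun t => ?_⟩
  obtain ⟨s, hs, hts⟩ := hp.exists_mem_Ico₀ (by positivity) t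
  rw [hts]
  exact (hM s ⟨hs.1, hs.2.le⟩).trans (le_max_left _ _)

lemma IsHarmonicConj.reg_zero {α A : ℝ} (hα : 0 < α) {p g : ℝ → ℝ} (h : IsHarmonicConj p g)
    (hA : 0 ≤ A) (hp : HolderBound α A p) (hg : HolderBound α A g) : Reg α 0 p ∧ Reg α 0 g := by
  obtain ⟨M, hM, h1⟩ := abs_le_of_periodic_continuous (hp.continuous hα) h.periodic.1
  obtain ⟨N, hN, h2⟩ := abs_le_of_periodic_continuous (hg.continuous hα) h.periodic.2
  exact ⟨⟨max A M, by positivity, hp.mono (le_max_left _ _),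
    fun t => (h1 t).trans (le_max_right _ _)⟩,
    ⟨max A N, by positivity, hg.mono (le_max_left _ _), fun t => (h2 t).trans (le_max_right _ _)⟩⟩

/-- Regularity for linear Riemann–Hilbert problems with small coefficient. -/
lemma Reg.of_linear {α K κ : ℝ} (hα : 0 < α) (hK : IsPrivalovConst α K)
    (hκ : 0 ≤ κ) (hκ2 : κ ≤ 1 / 2) (hκK : κ * K ≤ 1 / 4) {k : ℕ}
    {p g b c : ℝ → ℝ} {A : ℝ} (h : IsHarmonicConj p g) (hA : 0 ≤ A) (hp : HolderBound α A p)
    (hpg : ∀ t, p t = c t + b t * g t) (hbκ : ∀ t, |b t| ≤ κ) (hb : Reg α k b) (hc : Reg α k c) :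
    Reg α k p ∧ Reg α k g := by
  have hK0 := hK.1
  have h0 := h.reg_zero hα (le_max_of_le_left hA) (hp.mono (le_max_left A (K * A)))
    ((hK.2 p g A hA h hp).mono (le_max_right A (K * A)))
  induction k generalizing p g c A with
  | zero => exact h0
  | succ k ih =>
    have hgk := (ih h hA hp hpg hb.of_succ hc.of_succ h0).2
    have hbk := hb.of_succ
    obtain ⟨_, b', hb', hbr⟩ := hb
    obtain ⟨_, c', hc', hcr⟩ := hc
    obtain ⟨Mb, hMb, hbH, hbB⟩ := hbr.zero
    obtain ⟨Mc, hMc, hcH, hcB⟩ := hcr.zero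
    obtain ⟨Mg, hMg, hgH, hgB⟩ := h0.2
    obtain ⟨Mb0, hMb0, hbH0, _⟩ := hbk.zero
    have hquot : ∀ {c c' : ℝ → ℝ} {M : ℝ}, (∀ t, HasDerivAt c (c' t) t) → (∀ t, |c' t| ≤ M) →
        ∀ s t, |(c (t + s) - c t) / s| ≤ M := by
      intro c c' M hc hM s t
      have hM0 := (abs_nonneg _).trans (hM 0)
      rcases eq_or_ne s 0 with rfl | hs
      · simpa using hM0
      have h2 := convex_univ.norm_image_sub_le_of_norm_hasDerivWithin_le
        (f := c) (f' := c') (s := univ) (x := t) (y := t + s) (C := M)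
        (fun x _ => (hc x).hasDerivWithinAt) (fun x _ => hM x) (mem_univ _) (mem_univ _)
      rw [abs_div, div_le_iff₀ (abs_pos.2 hs)]
      simpa using h2
    have hgs : ∀ s, HolderBound α Mg fun t => g (t + s) := fun s t t' => by
      have := hgH (t + s) (t' + s)
      rwa [add_sub_add_right_eq_sub] at this
    obtain ⟨p', g', A', hA', h1, h2, h3, h4, h5, h6⟩ := exists_hasDerivAt_of_diffQuot hα hK hκ hκ2
      hκK (M := Mb0 + (Mc + 2 * (Mb * Mg))) (by positivity) h hp (b := fun _ => b)
      (c := fun s t => (c (t + s.1) - c t) / s.1 + (b (t + s.1) - b t) / s.1 * g (t + s.1))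
      (b₀ := b) (c₀ := fun t => c' t + b' t * g t)
      (fun s t => by
        have := s.2
        rw [hpg, hpg]
        field_simp
        ring)
      (fun _ => hbκ)
      (fun s t => by
        refine (abs_add_le _ _).trans ?_
        rw [abs_mul]
        have h1 := hquot hc' hcB s.1 t
        have h2 : |(b (t + s.1) - b t) / s.1| * |g (t + s.1)| ≤ Mb * Mg := by
          have := hquot hb' hbB s.1 t
          have := hgB (t + s.1)
          gcongr
        have := mul_nonneg hMb hMg
        linarith)
      (fun s => hbH0.mono (by nlinarith [mul_nonneg hMb hMg]))
      (fun s t t' => by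
        have e1 := HolderBound.diffQuot hc' hcH s.1 t t'
        have e2 := HolderBound.mul (HolderBound.diffQuot hb' hbH s.1) (hquot hb' hbB s.1) (hgs s.1)
          (fun t => hgB (t + s.1)) t t'
        have e3 : 0 ≤ Mb0 * |t - t'| ^ α := by positivity
        rw [add_sub_add_comm, add_mul, add_mul]
        refine (norm_add_le _ _).trans ?_
        linarith)
      (tendstoUniformly_of_abs_le (e := fun _ => 0) tendsto_const_nhds (by simp))
      (tendstoUniformly_of_abs_le (tendsto_abs_rpow_punctured hα (Mc + (Mb * Mg + Mb * Mg)))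
        (fun s t => by
          have e1 := abs_diffQuot_sub_le hα.le hMc hc' hcH s.2 t
          have e2 := abs_diffQuot_sub_le hα.le hMb hb' hbH s.2 t
          have e3 := hgH (t + s.1) t
          rw [add_sub_cancel_left, Real.norm_eq_abs] at e3
          have e4 : (c (t + s.1) - c t) / s.1 + (b (t + s.1) - b t) / s.1 * g (t + s.1) -
              (c' t + b' t * g t) = ((c (t + s.1) - c t) / s.1 - c' t) +
              (((b (t + s.1) - b t) / s.1 - b' t) * g (t + s.1) + b' t * (g (t + s.1) - g t)) := by
            ring
          rw [e4]
          refine (abs_add_le _ _).trans ?_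
          refine (add_le_add le_rfl (abs_add_le _ _)).trans ?_
          rw [abs_mul, abs_mul]
          have e5 := hgB (t + s.1)
          have e6 := hbB t
          calc _ ≤ Mc * |s.1| ^ α + (Mb * |s.1| ^ α * Mg + Mb * (Mg * |s.1| ^ α)) := by gcongr
            _ = _ := by ring))
    have hK' := (hK.2 p' g' A' hA' h1 h2)
    have h7 := ih h1 hA' h2 h6 hbk (hcr.add (hbr.mul hgk))
      (h1.reg_zero hα hA' h2 h3)
    exact ⟨⟨h0.1, p', h4, h7.1⟩, ⟨h0.2, g', h5, h7.2⟩⟩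

/-- Functions of two variables, both of them angles. -/
def IsBiperiodic {G : Type*} (F : ℝ × ℝ → G) : Prop :=
  ∀ x, F (x + (2 * Real.pi, 0)) = F x ∧ F (x + (0, 2 * Real.pi)) = F x

lemma IsBiperiodic.exists_bound {G : Type*} [NormedAddCommGroup G] {F : ℝ × ℝ → G}
    (h : IsBiperiodic F) (hF : Continuous F) : ∃ M, 0 ≤ M ∧ ∀ x, ‖F x‖ ≤ M := by
  have hpi := Real.two_pi_pos
  obtain ⟨M, hM⟩ := (isCompact_Icc (a := ((0, 0) : ℝ × ℝ))
    (b := ((2 * Real.pi, 2 * Real.pi) : ℝ × ℝ))).exists_bound_of_continuousOn hF.continuousOn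
  refine ⟨max M 0, le_max_right _ _, fun x => le_max_of_le_left ?_⟩
  obtain ⟨x, y⟩ := x
  have h1 : Function.Periodic (fun x => F (x, y)) (2 * Real.pi) := fun x => by
    simpa using (h (x, y)).1
  obtain ⟨x', hx', hx⟩ := h1.exists_mem_Ico₀ hpi x
  have h2 : Function.Periodic (fun y => F (x', y)) (2 * Real.pi) := fun y => by
    simpa using (h (x', y)).2
  obtain ⟨y', hy', hy⟩ := h2.exists_mem_Ico₀ hpi y
  have h3 := hM (x', y') ⟨⟨hx'.1, hy'.1⟩, ⟨hx'.2.le, hy'.2.le⟩⟩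
  rwa [← hy, ← hx] at h3

lemma IsBiperiodic.fderiv {G : Type*} [NormedAddCommGroup G] [NormedSpace ℝ G] {F : ℝ × ℝ → G}
    (h : IsBiperiodic F) : IsBiperiodic (fderiv ℝ F) := fun x => by
  have h1 : (fun x => F (x + (2 * Real.pi, 0))) = F := funext fun x => (h x).1
  have h2 : (fun x => F (x + (0, 2 * Real.pi))) = F := funext fun x => (h x).2
  rw [← fderiv_comp_add_right, ← fderiv_comp_add_right, h1, h2]
  exact ⟨rfl, rfl⟩

lemma IsBiperiodic.fderiv_apply {F : ℝ × ℝ → ℝ} (h : IsBiperiodic F) (w : ℝ × ℝ) :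
    IsBiperiodic fun x => _root_.fderiv ℝ F x w := fun x => by
  simp only [(h.fderiv x).1, (h.fderiv x).2]
  exact ⟨trivial, trivial⟩

lemma ContDiff.fderiv_apply_const {F : ℝ × ℝ → ℝ} {k : ℕ} (h : ContDiff ℝ (k + 1 : ℕ) F)
    (w : ℝ × ℝ) : ContDiff ℝ k fun x => fderiv ℝ F x w :=
  (h.fderiv_right (m := k) (by norm_cast)).clm_apply contDiff_const

lemma IsBiperiodic.exists_holder {α : ℝ} (hα : 0 < α) (hα1 : α ≤ 1) {F : ℝ × ℝ → ℝ}
    (h : IsBiperiodic F) (hF : ContDiff ℝ 1 F) : ∃ M, 0 ≤ M ∧ (∀ x, |F x| ≤ M) ∧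
      ∀ x₁ x₂ y₁ y₂, |F (x₁, y₁) - F (x₂, y₂)| ≤ M * |x₁ - x₂| ^ α + M * |y₁ - y₂| := by
  obtain ⟨M, hM, hFM⟩ := h.exists_bound hF.continuous
  obtain ⟨L, hL, hFL⟩ := h.fderiv.exists_bound (hF.continuous_fderiv one_ne_zero)
  have hlip : ∀ x y, ‖F x - F y‖ ≤ L * ‖x - y‖ := fun x y =>
    convex_univ.norm_image_sub_le_of_norm_fderiv_le (𝕜 := ℝ)
      (fun z _ => (hF.differentiable one_ne_zero z)) (fun z _ => hFL z) (mem_univ _) (mem_univ _)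
  refine ⟨2 * M + L, by positivity, fun x => (hFM x).trans (by linarith), fun x₁ x₂ y₁ y₂ => ?_⟩
  have h1 : |F (x₁, y₁) - F (x₂, y₁)| ≤ (2 * M + L) * |x₁ - x₂| ^ α := by
    rcases le_total |x₁ - x₂| 1 with h1 | h1
    · have h2 := hlip (x₁, y₁) (x₂, y₁)
      have h3 : ‖((x₁, y₁) : ℝ × ℝ) - (x₂, y₁)‖ = |x₁ - x₂| := by simp [Prod.norm_def]
      rw [h3, Real.norm_eq_abs] at h2
      have h4 : |x₁ - x₂| ≤ |x₁ - x₂| ^ α := by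
        simpa using Real.rpow_le_rpow_of_exponent_ge' (abs_nonneg (x₁ - x₂)) h1 hα.le hα1
      have := abs_nonneg (x₁ - x₂)
      nlinarith
    · have h2 := (abs_sub _ _).trans (add_le_add (hFM (x₁, y₁)) (hFM (x₂, y₁)))
      have h3 := Real.one_le_rpow h1 hα.le
      nlinarith
  have h2 : |F (x₂, y₁) - F (x₂, y₂)| ≤ (2 * M + L) * |y₁ - y₂| := by
    have h2 := hlip (x₂, y₁) (x₂, y₂)
    have h3 : ‖((x₂, y₁) : ℝ × ℝ) - (x₂, y₂)‖ = |y₁ - y₂| := by simp [Prod.norm_def]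
    rw [h3, Real.norm_eq_abs] at h2
    have := abs_nonneg (y₁ - y₂)
    nlinarith
  exact (abs_sub_le _ (F (x₂, y₁)) _).trans (add_le_add h1 h2)

lemma hasDerivAt_comp_graph {F : ℝ × ℝ → ℝ} (hF : Differentiable ℝ F) {v : ℝ → ℝ} {v' t : ℝ}
    (hv : HasDerivAt v v' t) : HasDerivAt (fun t => F (t, v t))
      (fderiv ℝ F (t, v t) (1, 0) + fderiv ℝ F (t, v t) (0, 1) * v') t := by
  have h1 := (hF (t, v t)).hasFDerivAt.comp_hasDerivAt t ((hasDerivAt_id t).prodMk hv)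
  have h2 : ((1, v') : ℝ × ℝ) = (1, 0) + v' • (0, 1) := by simp
  rw [h2, map_add, map_smul, smul_eq_mul, mul_comm v'] at h1
  exact h1

lemma Reg.comp_graph {α : ℝ} (hα : 0 < α) (hα1 : α ≤ 1) {k : ℕ} {F : ℝ × ℝ → ℝ}
    (h : IsBiperiodic F) (hF : ContDiff ℝ (k + 1 : ℕ) F) {v : ℝ → ℝ} (hv : Reg α k v) :
    Reg α k fun t => F (t, v t) := by
  have h0 : Reg α 0 fun t => F (t, v t) := by
    obtain ⟨M, hM, h1, h2⟩ := h.exists_holder hα hα1 (hF.of_le (by norm_cast; omega))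
    obtain ⟨A, hA, h3, _⟩ := hv.zero
    refine ⟨M + M * A, by positivity, fun t s => ?_, fun t => (h1 _).trans (by nlinarith)⟩
    refine (h2 _ _ _ _).trans ?_
    have := h3 t s
    rw [Real.norm_eq_abs] at this
    nlinarith
  induction k generalizing F v with
  | zero => exact h0
  | succ k ih =>
    have hvk := hv.of_succ
    obtain ⟨_, v', hv', h1⟩ := hv
    refine ⟨h0, _, fun t => hasDerivAt_comp_graph (hF.differentiable (by simp)) (hv' t), ?_⟩
    have h2 : ∀ w, Reg α k fun t => fderiv ℝ F (t, v t) w := fun w => by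
      have h3 := hF.fderiv_apply_const w
      refine ih (h.fderiv_apply w) h3 hvk ?_
      obtain ⟨M, hM, h1, h2⟩ :=
          (h.fderiv_apply w).exists_holder hα hα1 (h3.of_le (by norm_cast; omega))
      obtain ⟨A, hA, h3, _⟩ := hvk.zero
      refine ⟨M + M * A, by positivity, fun t s => ?_, fun t => (h1 _).trans (by nlinarith)⟩
      refine (h2 _ _ _ _).trans ?_
      have := h3 t s
      rw [Real.norm_eq_abs] at this
      nlinarith
    exact (h2 _).add ((h2 _).mul h1)

lemma abs_sub_le_of_abs_fderiv_le {F : ℝ × ℝ → ℝ} (hF : Differentiable ℝ F) {κ : ℝ}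
    (h : ∀ x, |fderiv ℝ F x (0, 1)| ≤ κ) (t y₁ y₂ : ℝ) :
    |F (t, y₁) - F (t, y₂)| ≤ κ * |y₁ - y₂| :=
  convex_univ.norm_image_sub_le_of_norm_hasDerivWithin_le (f := fun y => F (t, y))
    (f' := fun y => fderiv ℝ F (t, y) (0, 1)) (fun y _ =>
      ((hF (t, y)).hasFDerivAt.comp_hasDerivAt y
        ((hasDerivAt_const y t).prodMk (hasDerivAt_id y))).hasDerivWithinAt)
    (fun _ _ => h _) (mem_univ _) (mem_univ _)

/-- Existence of Hölder solutions of a nonlinear Riemann–Hilbert problem. -/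
lemma exists_isHarmonicConj_graph {α K κ : ℝ} (hα : 0 < α) (hα1 : α < 1) (hK : IsPrivalovConst α K)
    (hκ : 0 ≤ κ) (hκ2 : κ ≤ 1 / 2) (hκK : κ * K ≤ 1 / 4) {F : ℝ × ℝ → ℝ} (h : IsBiperiodic F)
    (hF : ContDiff ℝ 1 F) (hFκ : ∀ x, |fderiv ℝ F x (0, 1)| ≤ κ) :
    ∃ v A, 0 ≤ A ∧ HolderBound α A v ∧ IsHarmonicConj (fun t => F (t, v t)) v := by
  classical
  have hK0 := hK.1
  obtain ⟨M, hM, hFM, hFH⟩ := h.exists_holder hα hα1.le hF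
  have hlip := abs_sub_le_of_abs_fderiv_le (hF.differentiable one_ne_zero) hFκ
  obtain ⟨_, _, hex⟩ := exists_isHarmonicConj hα hα1
  let T : (ℝ → ℝ) → ℝ → ℝ := fun u => if hu : ∃ v, IsHarmonicConj u v then hu.choose else 0
  have hT : ∀ u A, 0 ≤ A → HolderBound α A u → Function.Periodic u (2 * Real.pi) →
      IsHarmonicConj u (T u) := by
    intro u A hA hu hp
    obtain ⟨v, hv, _⟩ := hex u A hA hu hp
    have hu : ∃ v, IsHarmonicConj u v := ⟨v, hv⟩
    simp only [T, dif_pos hu]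
    exact hu.choose_spec
  let u : ℕ → ℝ → ℝ := fun k => Nat.rec (fun _ => 0) (fun _ w t => F (t, T w t)) k
  have hu : ∀ k, HolderBound α (2 * M) (u k) ∧ Function.Periodic (u k) (2 * Real.pi) := by
    intro k
    induction k with
    | zero =>
      refine ⟨fun t s => ?_, fun t => rfl⟩
      have h1 : 0 ≤ 2 * M * |t - s| ^ α := by positivity
      simpa [u] using h1
    | succ k ih =>
      have h1 := hT _ _ (by positivity) ih.1 ih.2
      have h2 := hK.2 _ _ _ (by positivity) h1 ih.1
      refine ⟨fun t s => ?_, fun t => ?_⟩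
      · have h3 := hFH t s (T (u k) t) (T (u k) t)
        have h4 := hlip s (T (u k) t) (T (u k) s)
        have h5 := h2 t s
        rw [Real.norm_eq_abs] at h5
        rw [sub_self, abs_zero, mul_zero, add_zero] at h3
        have h6 := (abs_sub_le _ _ _).trans (add_le_add h3 h4)
        refine h6.trans ?_
        have h7 : 0 ≤ |t - s| ^ α := by positivity
        have h8 : 0 ≤ M * |t - s| ^ α := by positivity
        nlinarith [mul_le_mul_of_nonneg_left h5 hκ, mul_le_mul_of_nonneg_right hκK h8]
      · have h3 := h1.periodic.2 t
        have h4 := (h (t, T (u k) t)).1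
        simp only [Prod.mk_add_mk, add_zero] at h4
        change F (t + 2 * Real.pi, T (u k) (t + 2 * Real.pi)) = F (t, T (u k) t)
        rw [h3, h4]
  let v : ℕ → ℝ → ℝ := fun k => T (u k)
  have hv : ∀ k, IsHarmonicConj (u k) (v k) := fun k => hT _ _ (by positivity) (hu k).1 (hu k).2
  have hvH : ∀ k, HolderBound α (K * (2 * M)) (v k) := fun k =>
    hK.2 _ _ _ (by positivity) (hv k) (hu k).1
  have hus : ∀ k t, u (k + 1) t = F (t, v k t) := fun _ _ => rfl
  have huM : ∀ k t, |u k t| ≤ M := by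
    intro k t
    cases k with
    | zero => simpa [u] using hM
    | succ k => exact hFM _
  have hd : ∀ N i j, ∫ t in (0 : ℝ)..2 * Real.pi, (v (i + N) t - v (j + N) t) ^ 2 ≤
      32 * M ^ 2 * (1 / 4) ^ N := by
    intro N
    induction N with
    | zero =>
      intro i j
      have h1 := (hv i).sub (hv j)
      refine h1.integral_sq_le.trans ?_
      refine (integral_sq_le_of_abs_le h1.continuous.1 (m := 2 * M) (fun t => ?_)).trans ?_
      · have := (abs_sub _ _).trans (add_le_add (huM i t) (huM j t))
        linarith
      · simp only [pow_zero]
        linarith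
    | succ N ih =>
      intro i j
      have h1 := (hv (i + N + 1)).sub (hv (j + N + 1))
      refine h1.integral_sq_le.trans ?_
      have h2 := (hv (i + N)).sub (hv (j + N))
      have h3 := intervalIntegral.integral_mono_on (μ := MeasureTheory.volume)
        (f := fun t => (u (i + N + 1) t - u (j + N + 1) t) ^ 2)
        (g := fun t => 1 / 4 * (v (i + N) t - v (j + N) t) ^ 2) (a := 0) (b := 2 * Real.pi)
        (by positivity) ((h1.continuous.1.pow 2).intervalIntegrable _ _)
        (((h2.continuous.2.pow 2).intervalIntegrable _ _).const_mul _)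
        (fun t _ => by
          rw [hus, hus, ← sq_abs, ← sq_abs (v _ t - _)]
          have h4 := hlip t (v (i + N) t) (v (j + N) t)
          have h5 : |F (t, v (i + N) t) - F (t, v (j + N) t)| ≤
              1 / 2 * |v (i + N) t - v (j + N) t| :=
            h4.trans (mul_le_mul_of_nonneg_right hκ2 (abs_nonneg _))
          have := pow_le_pow_left₀ (abs_nonneg _) h5 2
          rw [mul_pow] at this
          linarith)
      refine h3.trans ?_
      rw [intervalIntegral.integral_const_mul]
      have := ih i j
      rw [pow_succ (1 / 4 : ℝ)]
      linarith
  obtain ⟨v₀, hv₀⟩ := exists_tendstoUniformly_of_integral_sq hα (A := K * (2 * M)) (by positivity)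
    hvH (fun k => (hv k).periodic.2) (l := Filter.atTop) (fun ε hε => by
      have h1 : Filter.Tendsto (fun N : ℕ => 32 * M ^ 2 * (1 / 4 : ℝ) ^ N) Filter.atTop (𝓝 0) := by
        simpa using (tendsto_pow_atTop_nhds_zero_of_lt_one (by norm_num : (0 : ℝ) ≤ 1 / 4)
          (by norm_num)).const_mul (32 * M ^ 2)
      obtain ⟨N, hN⟩ := (h1.eventually (gt_mem_nhds (pow_pos hε 2))).exists
      filter_upwards [(Filter.eventually_ge_atTop N).prod_mk
        (Filter.eventually_ge_atTop N)] with m hm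
      have h2 := hd N (m.1 - N) (m.2 - N)
      rw [Nat.sub_add_cancel hm.1, Nat.sub_add_cancel hm.2] at h2
      exact h2.trans hN.le)
  refine ⟨v₀, K * (2 * M), by positivity, .of_tendsto hvH (fun t => hv₀.tendsto_at t), ?_⟩
  refine IsHarmonicConj.tendsto (l := Filter.atTop) (fun k => hv (k + 1)) ?_ ?_
  · rw [Metric.tendstoUniformly_iff] at hv₀ ⊢
    intro ε hε
    filter_upwards [hv₀ ε hε] with k hk t
    have h1 := hlip t (v₀ t) (v k t)
    have h2 := hk t
    rw [Real.dist_eq] at h2 ⊢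
    rw [hus]
    have := abs_nonneg (v₀ t - v k t)
    nlinarith
  · exact fun s hs => (Filter.tendsto_add_atTop_nat 1).eventually (hv₀ s hs)

lemma HolderBound.segment {α A : ℝ} {v : ℝ → ℝ} (hv : HolderBound α A v) {s τ : ℝ}
    (hτ : τ ∈ Icc (0 : ℝ) 1) : HolderBound α A fun t => v t + τ * (v (t + s) - v t) := by
  intro t t'
  have h1 := hv t t'
  have h2 := hv (t + s) (t' + s)
  rw [add_sub_add_right_eq_sub] at h2
  rw [Real.norm_eq_abs] at *
  have h3 : v t + τ * (v (t + s) - v t) - (v t' + τ * (v (t' + s) - v t')) =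
      (1 - τ) * (v t - v t') + τ * (v (t + s) - v (t' + s)) := by ring
  have h4 : 0 ≤ 1 - τ := sub_nonneg.2 hτ.2
  rw [h3]
  refine (abs_add_le _ _).trans ?_
  rw [abs_mul, abs_mul, abs_of_nonneg hτ.1, abs_of_nonneg h4]
  nlinarith [mul_le_mul_of_nonneg_left h1 h4, mul_le_mul_of_nonneg_left h2 hτ.1]

lemma abs_integral_unit_le {f : ℝ → ℝ} {M : ℝ} (h : ∀ τ ∈ Icc (0 : ℝ) 1, |f τ| ≤ M) :
    |∫ τ in (0 : ℝ)..1, f τ| ≤ M := by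
  have := intervalIntegral.norm_integral_le_of_norm_le_const (a := 0) (b := 1) (f := f) (C := M)
    (fun τ hτ => h τ (by rw [uIoc_of_le zero_le_one] at hτ; exact ⟨hτ.1.le, hτ.2⟩))
  simpa using this

lemma abs_integral_unit_sub_le {f g : ℝ → ℝ} {M : ℝ} (hf : Continuous f) (hg : Continuous g)
    (h : ∀ τ ∈ Icc (0 : ℝ) 1, |f τ - g τ| ≤ M) :
    |(∫ τ in (0 : ℝ)..1, f τ) - ∫ τ in (0 : ℝ)..1, g τ| ≤ M := by
  rw [← intervalIntegral.integral_sub (hf.intervalIntegrable _ _) (hg.intervalIntegrable _ _)]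
  exact abs_integral_unit_le h

lemma integral_fderiv_segment {F : ℝ × ℝ → ℝ} (hF : ContDiff ℝ 1 F) (x w : ℝ × ℝ) (s : ℝ) :
    F (x + s • w) - F x = (∫ τ in (0 : ℝ)..1, fderiv ℝ F (x + (τ * s) • w) w) * s := by
  have h1 : ∀ τ, HasDerivAt (fun τ : ℝ => F (x + (τ * s) • w))
      (fderiv ℝ F (x + (τ * s) • w) w * s) τ := fun τ => by
    have h1 : HasDerivAt (fun τ : ℝ => x + (τ * s) • w) (s • w) τ := by
      have := (((hasDerivAt_id τ).mul_const s).smul_const w).const_add x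
      rwa [one_mul] at this
    have h2 := (hF.differentiable one_ne_zero _).hasFDerivAt.comp_hasDerivAt τ h1
    rw [map_smul, smul_eq_mul, mul_comm] at h2
    exact h2
  have hc : Continuous fun τ : ℝ => fderiv ℝ F (x + (τ * s) • w) w :=
    ((hF.continuous_fderiv one_ne_zero).comp (by fun_prop)).clm_apply continuous_const
  have h2 := intervalIntegral.integral_eq_sub_of_hasDerivAt (a := 0) (b := 1) (fun τ _ => h1 τ)
    ((hc.mul continuous_const).intervalIntegrable _ _)
  rw [intervalIntegral.integral_mul_const] at h2
  rw [h2]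
  simp

/-- Hölder solutions of a nonlinear Riemann–Hilbert problem are as regular as the data. -/
lemma Reg.of_isHarmonicConj_graph {α K κ : ℝ} (hα : 0 < α) (hα1 : α < 1) (hK : IsPrivalovConst α K)
    (hκ : 0 ≤ κ) (hκ2 : κ ≤ 1 / 2) (hκK : κ * K ≤ 1 / 4) {F : ℝ × ℝ → ℝ} (h : IsBiperiodic F)
    (hF : ContDiff ℝ 2 F) (hFκ : ∀ x, |fderiv ℝ F x (0, 1)| ≤ κ) {v : ℝ → ℝ} {A : ℝ} (hA : 0 ≤ A)
    (hv : HolderBound α A v) (hc : IsHarmonicConj (fun t => F (t, v t)) v) :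
    ∃ u' v' B, 0 ≤ B ∧ IsHarmonicConj u' v' ∧ HolderBound α B u' ∧
      (∀ t, HasDerivAt (fun t => F (t, v t)) (u' t) t) ∧
      (∀ t, HasDerivAt v (v' t) t) ∧ HolderBound α B v' ∧
      ∀ t, u' t = fderiv ℝ F (t, v t) (1, 0) + fderiv ℝ F (t, v t) (0, 1) * v' t := by
  have hF1 : ContDiff ℝ 1 F := hF.of_le (by norm_num)
  obtain ⟨M₀, hM₀, h01, h02⟩ := h.exists_holder hα hα1.le hF1
  have hF' : ∀ w, ContDiff ℝ 1 fun x => fderiv ℝ F x w := fun w =>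
    ContDiff.fderiv_apply_const (k := 1) (by exact_mod_cast hF) w
  obtain ⟨M₁, hM₁, h11, h12⟩ := (h.fderiv_apply (0, 1)).exists_holder hα hα1.le (hF' _)
  obtain ⟨M₂, hM₂, h21, h22⟩ := (h.fderiv_apply (1, 0)).exists_holder hα hα1.le (hF' _)
  have hvc := hv.continuous hα
  have hcont : ∀ (w : ℝ × ℝ) (γ : ℝ → ℝ × ℝ), Continuous γ →
      Continuous fun τ => fderiv ℝ F (γ τ) w := fun w γ hγ => (hF' w).continuous.comp hγ
  have hvH : ∀ {s τ : ℝ}, τ ∈ Icc (0 : ℝ) 1 → ∀ t t', |v t + τ * (v (t + s) - v t) -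
      (v t' + τ * (v (t' + s) - v t'))| ≤ A * |t - t'| ^ α :=
    fun hτ t t' => hv.segment hτ t t'
  have hlim := tendsto_abs_rpow_punctured hα (M₁ + M₁ * A + M₂)
  obtain ⟨u', v', B, hB, h1, h2, h3, h4, h5, h6⟩ := exists_hasDerivAt_of_diffQuot hα hK hκ hκ2 hκK
    (M := M₁ + M₁ * A + (M₂ + M₂ * A)) (by positivity) hc (A₀ := M₀ + M₀ * A)
    (fun t t' => by
      have e1 := h02 t t' (v t) (v t')
      have e2 := hv t t'
      rw [Real.norm_eq_abs] at e2 ⊢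
      nlinarith [mul_le_mul_of_nonneg_left e2 hM₀])
    (b := fun s t => ∫ τ in (0 : ℝ)..1, fderiv ℝ F (t + s.1, v t + τ * (v (t + s.1) - v t)) (0, 1))
    (c := fun s t => ∫ τ in (0 : ℝ)..1, fderiv ℝ F (t + τ * s.1, v t) (1, 0))
    (b₀ := fun t => fderiv ℝ F (t, v t) (0, 1)) (c₀ := fun t => fderiv ℝ F (t, v t) (1, 0))
    (fun s t => by
      have e1 := integral_fderiv_segment hF1 (t + s.1, v t) (0, 1) (v (t + s.1) - v t)
      have e2 := integral_fderiv_segment hF1 (t, v t) (1, 0) s.1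
      simp only [Prod.smul_mk, smul_eq_mul, mul_zero, mul_one, Prod.mk_add_mk, add_zero,
        add_sub_cancel] at e1 e2
      linarith)
    (fun s t => abs_integral_unit_le fun τ _ => hFκ _)
    (fun s t => abs_integral_unit_le fun τ _ => (h21 _).trans (by
      nlinarith [mul_nonneg hM₁ hA, mul_nonneg hM₂ hA]))
    (fun s t t' => abs_integral_unit_sub_le (hcont _ _ (by fun_prop)) (hcont _ _ (by fun_prop))
      fun τ hτ => by
        have e1 := h12 (t + s.1) (t' + s.1) (v t + τ * (v (t + s.1) - v t))
          (v t' + τ * (v (t' + s.1) - v t'))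
        have e2 := hvH (s := s.1) hτ t t'
        rw [add_sub_add_right_eq_sub] at e1
        have e3 : 0 ≤ (M₂ + M₂ * A) * |t - t'| ^ α := by positivity
        nlinarith [mul_le_mul_of_nonneg_left e2 hM₁])
    (fun s t t' => abs_integral_unit_sub_le (hcont _ _ (by fun_prop)) (hcont _ _ (by fun_prop))
      fun τ hτ => by
        have e1 := h22 (t + τ * s.1) (t' + τ * s.1) (v t) (v t')
        have e2 := hv t t'
        rw [Real.norm_eq_abs] at e2
        rw [add_sub_add_right_eq_sub] at e1
        have e3 : 0 ≤ (M₁ + M₁ * A) * |t - t'| ^ α := by positivity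
        nlinarith [mul_le_mul_of_nonneg_left e2 hM₂])
    (tendstoUniformly_of_abs_le hlim fun s t => by
      have := abs_integral_unit_sub_le
        (f := fun τ => fderiv ℝ F (t + s.1, v t + τ * (v (t + s.1) - v t)) (0, 1))
        (g := fun _ => fderiv ℝ F (t, v t) (0, 1)) (M := (M₁ + M₁ * A + M₂) * |s.1| ^ α)
        (hcont _ _ (by fun_prop)) continuous_const fun τ hτ => by
          have e1 := h12 (t + s.1) t (v t + τ * (v (t + s.1) - v t)) (v t)
          have e2 := hv (t + s.1) t
          rw [add_sub_cancel_left] at e1 e2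
          rw [Real.norm_eq_abs] at e2
          rw [add_sub_cancel_left, abs_mul, abs_of_nonneg hτ.1] at e1
          have e3 : τ * |v (t + s.1) - v t| ≤ A * |s.1| ^ α :=
            (mul_le_of_le_one_left (abs_nonneg _) hτ.2).trans e2
          have e4 : 0 ≤ M₂ * |s.1| ^ α := by positivity
          nlinarith [mul_le_mul_of_nonneg_left e3 hM₁]
      simpa using this)
    (tendstoUniformly_of_abs_le hlim fun s t => by
      have := abs_integral_unit_sub_le
        (f := fun τ => fderiv ℝ F (t + τ * s.1, v t) (1, 0))
        (g := fun _ => fderiv ℝ F (t, v t) (1, 0)) (M := (M₁ + M₁ * A + M₂) * |s.1| ^ α)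
        (hcont _ _ (by fun_prop)) continuous_const fun τ hτ => by
          have e1 := h22 (t + τ * s.1) t (v t) (v t)
          rw [add_sub_cancel_left, sub_self, abs_zero, mul_zero, add_zero, abs_mul,
            abs_of_nonneg hτ.1] at e1
          have e3 : (τ * |s.1|) ^ α ≤ |s.1| ^ α := by
            have := hτ.1
            exact Real.rpow_le_rpow (by positivity)
              (mul_le_of_le_one_left (abs_nonneg _) hτ.2) hα.le
          have e4 : 0 ≤ (M₁ + M₁ * A) * |s.1| ^ α := by positivity
          nlinarith [mul_le_mul_of_nonneg_left e3 hM₂]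
      simpa using this)
  exact ⟨u', v', max B (K * B), le_max_of_le_left hB, h1, h2.mono (le_max_left _ _), h4, h5,
    h3.mono (le_max_left _ _), h6⟩

/-- Solutions of a nonlinear Riemann–Hilbert problem with `C⁴` data. -/
lemma exists_reg_isHarmonicConj_graph {α : ℝ} (hα : 0 < α) (hα1 : α < 1) : ∃ κ > 0,
    ∀ F : ℝ × ℝ → ℝ, IsBiperiodic F → ContDiff ℝ 4 F → (∀ x, |fderiv ℝ F x (0, 1)| ≤ κ) →
      ∃ v, IsHarmonicConj (fun t => F (t, v t)) v ∧ Reg α 3 (fun t => F (t, v t)) ∧ Reg α 3 v := by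
  obtain ⟨K, hK⟩ := exists_isPrivalovConst hα hα1
  have hK0 := hK.1
  have hκ2 : min (1 / 2) (1 / (4 * K)) ≤ 1 / 2 := min_le_left _ _
  have hκK : min (1 / 2) (1 / (4 * K)) * K ≤ 1 / 4 := by
    refine (mul_le_mul_of_nonneg_right (min_le_right _ _) hK0.le).trans_eq ?_
    field_simp
  have hκ : 0 < min (1 / 2) (1 / (4 * K)) := by positivity
  refine ⟨_, hκ, fun F h hF hFκ => ?_⟩
  obtain ⟨v, A, hA, hv, hc⟩ := exists_isHarmonicConj_graph hα hα1 hK hκ.le hκ2 hκK h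
    (hF.of_le (by norm_num)) hFκ
  obtain ⟨u', v', B, hB, h1, h2, h3, h4, h5, h6⟩ := Reg.of_isHarmonicConj_graph hα hα1 hK hκ.le hκ2
    hκK h (hF.of_le (by norm_num)) hFκ hA hv hc
  have hF' : ∀ w, ContDiff ℝ 3 fun x => fderiv ℝ F x w := fun w =>
    ContDiff.fderiv_apply_const (k := 3) (by exact_mod_cast hF) w
  have hv0 : Reg α 0 v := by
    obtain ⟨N, hN, hvN⟩ := abs_le_of_periodic_continuous hc.continuous.2 hc.periodic.2
    exact ⟨max A N, by positivity, hv.mono (le_max_left _ _),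
      fun t => (hvN t).trans (le_max_right _ _)⟩
  have hv1 : Reg α 1 v := ⟨hv0, v', h4, (h1.reg_zero hα hB h2 h5).2⟩
  have hstep : ∀ k ≤ 2, Reg α k v → Reg α (k + 1) v := by
    intro k hk hvk
    have hFk : ∀ w, ContDiff ℝ (k + 1 : ℕ) fun x => fderiv ℝ F x w := fun w =>
      (hF' w).of_le (by norm_cast; omega)
    exact ⟨hv0, v', h4, (Reg.of_linear hα hK hκ.le hκ2 hκK h1 hB h2 (fun t => h6 t)
      (fun t => hFκ _) (Reg.comp_graph hα hα1.le (h.fderiv_apply (0, 1)) (hFk _) hvk)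
      (Reg.comp_graph hα hα1.le (h.fderiv_apply (1, 0)) (hFk _) hvk)).2⟩
  have hv3 := hstep 2 le_rfl (hstep 1 (by norm_num) hv1)
  exact ⟨v, hc, Reg.comp_graph hα hα1.le h (hF.of_le (by norm_num)) hv3, hv3⟩

/-- The derivative of a function in the disc algebra with differentiable boundary values. -/
lemma exists_deriv_of_boundary {α M : ℝ} (hα : 0 < α) (hM : 0 ≤ M) {h : ℂ → ℂ}
    (hh : DiffContOnCl ℂ h (ball 0 1)) {u v u' v' : ℝ → ℝ}
    (hb : ∀ t : ℝ, h (cexp (t * I)) = u t + v t * I) (hu : ∀ t, HasDerivAt u (u' t) t)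
    (hv : ∀ t, HasDerivAt v (v' t) t) (hu' : HolderBound α M u') (hv' : HolderBound α M v') :
    ∃ q : ℂ → ℂ, DiffContOnCl ℂ q (ball 0 1) ∧ (∀ z ∈ ball (0 : ℂ) 1, HasDerivAt h (q z) z) ∧
      ∀ t : ℝ, q (cexp (t * I)) = (Real.cos t * v' t + -1 * (Real.sin t * u' t) : ℝ) +
        ((-1 * (Real.sin t * v' t) + -1 * (Real.cos t * u' t) : ℝ) : ℂ) * I := by
  have hn : ∀ (s : ℝ) (z : ℂ), ‖cexp (s * I) * z‖ = ‖z‖ := fun s z => by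
    rw [norm_mul, norm_exp_ofReal_mul_I, one_mul]
  obtain ⟨H, hH, hT⟩ := exists_diffContOnCl_of_tendstoUniformly (l := punctured)
    (h := fun s z => ((s.1 : ℂ))⁻¹ • (h (cexp (s.1 * I) * z) - h z))
    (g := fun t => u' t + v' t * I) (fun s => by
      have h1 : DiffContOnCl ℂ (fun z => h (cexp (s.1 * I) * z)) (ball 0 1) := by
        refine ⟨hh.differentiableOn.comp (by fun_prop) fun z hz => by simpa [hn] using hz, ?_⟩
        refine hh.continuousOn.comp (by fun_prop) fun z hz => ?_
        rw [closure_ball _ one_ne_zero] at hz ⊢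
        simpa [hn] using hz
      exact (h1.sub hh).const_smul ((s.1 : ℂ))⁻¹) (by
      rw [Metric.tendstoUniformly_iff]
      intro ε hε
      filter_upwards [(tendsto_abs_rpow_punctured hα (2 * M)).eventually
        (gt_mem_nhds hε)] with s hs t
      have e1 : ((s.1 : ℂ))⁻¹ • (h (cexp (s.1 * I) * cexp (t * I)) - h (cexp (t * I))) -
          (u' t + v' t * I) = (((u (t + s.1) - u t) / s.1 - u' t : ℝ) : ℂ) +
            (((v (t + s.1) - v t) / s.1 - v' t : ℝ) : ℂ) * I := by
        have : cexp (s.1 * I) * cexp (t * I) = cexp (((t + s.1 : ℝ) : ℂ) * I) := by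
          rw [← Complex.exp_add]
          congr 1
          push_cast
          ring
        rw [this, hb, hb, smul_eq_mul]
        push_cast
        ring
      rw [dist_comm, dist_eq_norm, e1]
      refine lt_of_le_of_lt (norm_add_le _ _) ?_
      rw [norm_mul, norm_I, mul_one, norm_real, norm_real, Real.norm_eq_abs, Real.norm_eq_abs]
      have e2 := abs_diffQuot_sub_le hα.le hM hu hu' s.2 t
      have e3 := abs_diffQuot_sub_le hα.le hM hv hv' s.2 t
      linarith)
  have hlim : ∀ z ∈ closedBall (0 : ℂ) 1, Filter.Tendsto
      (fun s : {s : ℝ // s ≠ 0} => ((s.1 : ℂ))⁻¹ • (h (cexp (s.1 * I) * z) - h z)) punctured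
      (𝓝 (H z)) := fun z hz => hT.tendsto_at hz
  have hHd : ∀ z ∈ ball (0 : ℂ) 1, H z = I * (z * deriv h z) := by
    intro z hz
    refine tendsto_nhds_unique (hlim z (ball_subset_closedBall hz)) ?_
    have h1 : HasDerivAt (fun s : ℝ => h (cexp (s * I) * z)) (I * (z * deriv h z)) 0 := by
      have h2 : HasDerivAt (fun s : ℝ => cexp (s * I) * z) (I * z) 0 := by
        have h3 := ((hasDerivAt_id (0 : ℂ)).mul_const I).cexp.mul_const z
        have h4 := h3.comp_ofReal
        simpa using h4
      have h5 : HasDerivAt h (deriv h z) (cexp ((0 : ℝ) * I) * z) := by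
        simpa using (hh.differentiableAt isOpen_ball hz).hasDerivAt
      have h6 := h5.comp_of_eq (0 : ℝ) h2 rfl
      exact h6.congr_deriv (by ring)
    have h2 := hasDerivAt_iff_tendsto_slope_zero.1 h1
    rw [← map_punctured, Filter.tendsto_map'_iff] at h2
    refine h2.congr fun s => ?_
    simp only [Function.comp_apply, zero_add, ofReal_zero, zero_mul, Complex.exp_zero, one_mul]
    rw [← ofReal_inv, Complex.real_smul, smul_eq_mul]
  have hHb : ∀ t : ℝ, H (cexp (t * I)) = u' t + v' t * I := by
    intro t
    have h1 := hlim (cexp (t * I)) (by simp [norm_exp_ofReal_mul_I])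
    refine tendsto_nhds_unique h1 ?_
    have h2 : HasDerivAt (fun s : ℝ => h (cexp (s * I))) (u' t + v' t * I) t := by
      have h3 := (hu t).ofReal_comp.add ((hv t).ofReal_comp.mul_const I)
      refine h3.congr_of_eventuallyEq (Filter.Eventually.of_forall fun s => ?_)
      exact hb s
    have h2 := hasDerivAt_iff_tendsto_slope_zero.1 h2
    rw [← map_punctured, Filter.tendsto_map'_iff] at h2
    refine h2.congr fun s => ?_
    simp only [Function.comp_apply]
    rw [← ofReal_inv, Complex.real_smul, smul_eq_mul, ← Complex.exp_add, ofReal_add, add_mul,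
      add_comm]
  have hH0 : H 0 = 0 := by rw [hHd 0 (mem_ball_self one_pos)]; simp
  have hnhds : ball (0 : ℂ) 1 ∈ 𝓝 (0 : ℂ) := ball_mem_nhds _ one_pos
  have hds : DiffContOnCl ℂ (dslope H 0) (ball 0 1) := by
    refine ⟨(differentiableOn_dslope hnhds).2 hH.differentiableOn,
      (continuousOn_dslope (Filter.mem_of_superset hnhds subset_closure)).2 ⟨hH.continuousOn, ?_⟩⟩
    exact hH.differentiableAt isOpen_ball (mem_ball_self one_pos)
  have hne : ∀ z ∈ ball (0 : ℂ) 1, dslope H 0 z = I * deriv h z := by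
    intro z hz
    rcases eq_or_ne z 0 with rfl | hz0
    · have h1 : HasDerivAt H (I * deriv h 0) 0 := by
        have h2 : HasDerivAt (fun z => I * (z * deriv h z)) (I * deriv h 0) 0 := by
          have h3 := ((hasDerivAt_id (0 : ℂ)).mul
            ((hh.differentiableOn.deriv isOpen_ball).differentiableAt
            hnhds).hasDerivAt).const_mul I
          simpa using h3
        refine h2.congr_of_eventuallyEq ?_
        filter_upwards [hnhds] with z hz using hHd z hz
      rw [dslope_same, h1.deriv]
    · rw [dslope_of_ne _ hz0, slope_def_field, hHd z hz, hH0]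
      field_simp
      ring
  refine ⟨fun z => -I • dslope H 0 z, hds.const_smul (-I), fun z hz => ?_, fun t => ?_⟩
  · have h1 := (hh.differentiableAt isOpen_ball hz).hasDerivAt
    refine h1.congr_deriv ?_
    change _ = -I • dslope H 0 z
    rw [hne z hz, smul_eq_mul, ← mul_assoc]
    simp
  · have h0 : cexp (t * I) ≠ 0 := Complex.exp_ne_zero _
    have h1 : cexp (t * I) * (Complex.cos t - Complex.sin t * I) = 1 := by
      rw [Complex.exp_mul_I]
      linear_combination Complex.cos_sq_add_sin_sq (t : ℂ) - Complex.sin t ^ 2 * I_sq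
    have h2 : (cexp (t * I))⁻¹ = Complex.cos t - Complex.sin t * I := by
      rw [eq_comm]
      exact eq_inv_of_mul_eq_one_right h1
    change -I • dslope H 0 (cexp (t * I)) = _
    rw [dslope_of_ne _ h0, slope_def_field, hH0, hHb, sub_zero, sub_zero, div_eq_mul_inv, h2,
      smul_eq_mul]
    push_cast
    linear_combination (-(v' t : ℂ) * Complex.cos t +
        (u' t) * Complex.sin t + v' t * Complex.sin t * I) * I_sq

/-- Functions in the disc algebra that are `α`-Hölder on the closed disc. -/
def DiscHolder {G : Type*} [NormedAddCommGroup G] [NormedSpace ℂ G] (α : ℝ) (p : ℂ → G) : Prop :=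
  DiffContOnCl ℂ p (ball 0 1) ∧
    ∃ C, 0 ≤ C ∧ ∀ z w, ‖z‖ ≤ 1 → ‖w‖ ≤ 1 → ‖p z - p w‖ ≤ C * ‖z - w‖ ^ α

/-- Functions in the disc algebra whose derivatives of order at most `k` extend to `α`-Hölder
functions on the closed disc. -/
def DiscReg {G : Type*} [NormedAddCommGroup G] [NormedSpace ℂ G] (α : ℝ) : ℕ → (ℂ → G) → Prop
  | 0, p => DiscHolder α p
  | k + 1, p => DiscHolder α p ∧ ∃ q : ℂ → G, (∀ z ∈ ball (0 : ℂ) 1, HasDerivAt p (q z) z) ∧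
      DiscReg α k q

section

variable {G : Type*} [NormedAddCommGroup G] [NormedSpace ℂ G] {α : ℝ} {k : ℕ}

lemma DiscReg.holder {p : ℂ → G} (h : DiscReg α k p) : DiscHolder α p := by
  cases k with
  | zero => exact h
  | succ k => exact h.1

lemma DiscReg.of_succ {p : ℂ → G} (h : DiscReg α (k + 1) p) : DiscReg α k p := by
  induction k generalizing p with
  | zero => exact h.holder
  | succ k ih =>
    obtain ⟨h0, q, h1, h2⟩ := h
    exact ⟨h0, q, h1, ih h2⟩

lemma DiscHolder.exists_bound {p : ℂ → G} (h : DiscHolder α p) :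
    ∃ M, 0 ≤ M ∧ ∀ z, ‖z‖ ≤ 1 → ‖p z‖ ≤ M := by
  obtain ⟨M, hM⟩ := (isCompact_closedBall (0 : ℂ) 1).exists_bound_of_continuousOn
    h.1.continuousOn_ball
  exact ⟨max M 0, le_max_right _ _, fun z hz =>
    le_max_of_le_left (hM z (mem_closedBall_zero_iff.2 hz))⟩

lemma DiscHolder.add {p q : ℂ → G} (hp : DiscHolder α p) (hq : DiscHolder α q) :
    DiscHolder α fun z => p z + q z := by
  obtain ⟨h1, C, hC, h2⟩ := hp
  obtain ⟨h3, D, hD, h4⟩ := hq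
  refine ⟨h1.add h3, C + D, by positivity, fun z w hz hw => ?_⟩
  rw [add_sub_add_comm, add_mul]
  exact (norm_add_le _ _).trans (add_le_add (h2 z w hz hw) (h4 z w hz hw))

lemma DiscReg.add {p q : ℂ → G} (hp : DiscReg α k p) (hq : DiscReg α k q) :
    DiscReg α k fun z => p z + q z := by
  induction k generalizing p q with
  | zero => exact DiscHolder.add hp hq
  | succ k ih =>
    obtain ⟨h1, p', h2, h3⟩ := hp
    obtain ⟨h4, q', h5, h6⟩ := hq
    exact ⟨h1.add h4, _, fun z hz => (h2 z hz).add (h5 z hz), ih h3 h6⟩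

lemma DiscHolder.smul {c : ℂ → ℂ} {p : ℂ → G} (hc : DiscHolder α c) (hp : DiscHolder α p) :
    DiscHolder α fun z => c z • p z := by
  obtain ⟨M, hM, hcM⟩ := hc.exists_bound
  obtain ⟨N, hN, hpN⟩ := hp.exists_bound
  obtain ⟨h1, C, hC, h2⟩ := hc
  obtain ⟨h3, D, hD, h4⟩ := hp
  refine ⟨h1.smul h3, M * D + C * N, by positivity, fun z w hz hw => ?_⟩
  have h5 : c z • p z - c w • p w = c z • (p z - p w) + (c z - c w) • p w := by
    rw [smul_sub, sub_smul]
    abel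
  rw [h5]
  refine (norm_add_le _ _).trans ?_
  rw [norm_smul, norm_smul]
  have h6 := h2 z w hz hw
  have h7 := h4 z w hz hw
  have h8 := hcM z hz
  have h9 := hpN w hw
  calc _ ≤ M * (D * ‖z - w‖ ^ α) + C * ‖z - w‖ ^ α * N := by gcongr
    _ = _ := by ring

lemma DiscReg.smul {c : ℂ → ℂ} {p : ℂ → G} (hc : DiscReg α k c) (hp : DiscReg α k p) :
    DiscReg α k fun z => c z • p z := by
  induction k generalizing c p with
  | zero => exact DiscHolder.smul hc hp
  | succ k ih =>
    have hck := hc.of_succ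
    have hpk := hp.of_succ
    obtain ⟨h1, c', h2, h3⟩ := hc
    obtain ⟨h4, p', h5, h6⟩ := hp
    exact ⟨h1.smul h4, _, fun z hz => (h2 z hz).smul (h5 z hz), (ih hck h6).add (ih h3 hpk)⟩

lemma norm_sub_le_rpow {z w : ℂ} (hα : 0 ≤ α) (hα1 : α ≤ 1) (hz : ‖z‖ ≤ 1) (hw : ‖w‖ ≤ 1) :
    ‖z - w‖ ≤ 2 * ‖z - w‖ ^ α := by
  rcases le_total ‖z - w‖ 1 with h | h
  · have h1 := Real.rpow_le_rpow_of_exponent_ge' (norm_nonneg (z - w)) h hα hα1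
    rw [Real.rpow_one] at h1
    linarith [norm_nonneg (z - w)]
  · have h1 := Real.one_le_rpow h hα
    have h2 := norm_sub_le z w
    linarith

lemma DiscHolder.of_differentiableOn (hα : 0 < α) (hα1 : α ≤ 1) {p : ℂ → G} {R : ℝ}
    (hR : 1 < R) [CompleteSpace G] (hp : DifferentiableOn ℂ p (ball 0 R)) : DiscHolder α p := by
  have hsub : closedBall (0 : ℂ) 1 ⊆ ball 0 R := closedBall_subset_ball hR
  obtain ⟨L, hL⟩ := (isCompact_closedBall (0 : ℂ) 1).exists_bound_of_continuousOn
    ((hp.deriv isOpen_ball).continuousOn.mono hsub)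
  have hL0 : 0 ≤ L := (norm_nonneg _).trans (hL 0 (by simp))
  refine ⟨(hp.mono hsub).diffContOnCl_ball (fun _ h => h), 2 * L, by positivity,
    fun z w hz hw => ?_⟩
  have h1 := (convex_closedBall (0 : ℂ) 1).norm_image_sub_le_of_norm_deriv_le (f := p)
    (fun x hx => hp.differentiableAt (isOpen_ball.mem_nhds (hsub hx))) hL
    (mem_closedBall_zero_iff.2 hw) (mem_closedBall_zero_iff.2 hz)
  have h2 := norm_sub_le_rpow hα.le hα1 hz hw
  nlinarith

lemma DiscReg.of_differentiableOn (hα : 0 < α) (hα1 : α ≤ 1) {p : ℂ → G} {R : ℝ}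
    (hR : 1 < R) [CompleteSpace G] (hp : DifferentiableOn ℂ p (ball 0 R)) : DiscReg α k p := by
  induction k generalizing p with
  | zero => exact DiscHolder.of_differentiableOn hα hα1 hR hp
  | succ k ih =>
    exact ⟨DiscHolder.of_differentiableOn hα hα1 hR hp, deriv p, fun z hz =>
      (hp.differentiableAt (isOpen_ball.mem_nhds (ball_subset_ball hR.le hz))).hasDerivAt,
      ih (hp.deriv isOpen_ball)⟩

lemma DiscHolder.cexp {h : ℂ → ℂ} (hh : DiscHolder α h) : DiscHolder α fun z => cexp (h z) := by
  obtain ⟨M, hM, hM'⟩ := hh.exists_bound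
  obtain ⟨h1, C, hC, h2⟩ := hh
  refine ⟨⟨h1.differentiableOn.cexp, h1.continuousOn.cexp⟩, Real.exp M * C, by positivity,
    fun z w hz hw => ?_⟩
  have h3 := (convex_closedBall (0 : ℂ) M).norm_image_sub_le_of_norm_deriv_le (f := Complex.exp)
    (C := Real.exp M) (fun x _ => Complex.differentiable_exp x) (fun x hx => by
      rw [Complex.deriv_exp, Complex.norm_exp]
      exact Real.exp_le_exp.2 ((re_le_norm x).trans (mem_closedBall_zero_iff.1 hx)))
    (mem_closedBall_zero_iff.2 (hM' w hw)) (mem_closedBall_zero_iff.2 (hM' z hz))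
  refine h3.trans ?_
  rw [mul_assoc]
  exact mul_le_mul_of_nonneg_left (h2 z w hz hw) (Real.exp_pos _).le

lemma DiscReg.cexp {h : ℂ → ℂ} (hh : DiscReg α k h) : DiscReg α k fun z => cexp (h z) := by
  induction k generalizing h with
  | zero => exact DiscHolder.cexp hh
  | succ k ih =>
    have hk := hh.of_succ
    obtain ⟨h1, q, h2, h3⟩ := hh
    exact ⟨h1.cexp, _, fun z hz => (h2 z hz).cexp, (ih hk).smul h3⟩

lemma DiscReg.exists_iteratedDeriv {p : ℂ → G} (hp : DiscReg α k p) :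
    ∃ g : ℕ → ℂ → G, (∀ m ≤ k, ContinuousOn (g m) (closedBall 0 1) ∧
        ∀ ζ ∈ ball (0 : ℂ) 1, g m ζ = iteratedDeriv m p ζ) ∧ DiscHolder α (g k) := by
  induction k generalizing p with
  | zero =>
    refine ⟨fun _ => p, fun m hm => ?_, hp⟩
    obtain rfl : m = 0 := by omega
    exact ⟨hp.holder.1.continuousOn_ball, fun ζ _ => by rw [iteratedDeriv_zero]⟩
  | succ k ih =>
    obtain ⟨h1, q, h2, h3⟩ := hp
    obtain ⟨g, hg, hgk⟩ := ih h3
    refine ⟨fun m => Nat.casesOn m p g, fun m hm => ?_, hgk⟩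
    cases m with
    | zero => exact ⟨h1.1.continuousOn_ball, fun ζ _ => (congrFun iteratedDeriv_zero ζ).symm⟩
    | succ m =>
      refine ⟨(hg m (by omega)).1, fun ζ hζ => ?_⟩
      rw [iteratedDeriv_succ']
      refine ((hg m (by omega)).2 ζ hζ).trans (Filter.EventuallyEq.iteratedDeriv_eq m ?_)
      filter_upwards [isOpen_ball.mem_nhds hζ] with z hz using (h2 z hz).deriv.symm

end

lemma reg_neg_one {α : ℝ} (k : ℕ) : Reg α k fun _ => (-1 : ℝ) := by
  have h0 : ∀ c : ℝ, Reg α 0 fun _ => c := fun c => ⟨|c|, abs_nonneg c, fun t s => by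
    simpa using by positivity, fun _ => le_rfl⟩
  have h1 : ∀ k, Reg α k fun _ => (0 : ℝ) := by
    intro k
    induction k with
    | zero => exact h0 0
    | succ k ih => exact ⟨h0 0, _, fun t => hasDerivAt_const t 0, ih⟩
  cases k with
  | zero => exact h0 (-1)
  | succ k => exact ⟨h0 (-1), _, fun t => hasDerivAt_const t (-1), h1 k⟩

lemma reg_sin_cos {α : ℝ} (hα : 0 < α) (hα1 : α ≤ 1) (k : ℕ) :
    Reg α k Real.sin ∧ Reg α k Real.cos := by
  have key : ∀ {f f' : ℝ → ℝ}, (∀ t, HasDerivAt f (f' t) t) → (∀ t, |f t| ≤ 1) →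
      (∀ t, |f' t| ≤ 1) → Reg α 0 f := by
    intro f f' hf h1 h2
    refine ⟨2, by norm_num, fun t s => ?_, fun t => (h1 t).trans (by norm_num)⟩
    rcases le_total |t - s| 1 with h | h
    · have h3 := convex_univ.norm_image_sub_le_of_norm_hasDerivWithin_le (f := f) (f' := f')
        (C := 1)
        (fun x _ => (hf x).hasDerivWithinAt) (fun x _ => h2 x) (mem_univ s) (mem_univ t)
      have h4 := Real.rpow_le_rpow_of_exponent_ge' (abs_nonneg (t - s)) h hα.le hα1
      rw [Real.rpow_one] at h4
      rw [Real.norm_eq_abs (t - s)] at h3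
      linarith [abs_nonneg (t - s)]
    · have h3 := Real.one_le_rpow h hα.le
      have h4 := (abs_sub (f t) (f s)).trans (add_le_add (h1 t) (h1 s))
      rw [Real.norm_eq_abs]
      linarith
  have hs : Reg α 0 Real.sin := key Real.hasDerivAt_sin Real.abs_sin_le_one Real.abs_cos_le_one
  have hc : Reg α 0 Real.cos := key Real.hasDerivAt_cos Real.abs_cos_le_one (fun t => by
    rw [abs_neg]
    exact Real.abs_sin_le_one t)
  induction k with
  | zero => exact ⟨hs, hc⟩
  | succ k ih =>
    refine ⟨⟨hs, _, Real.hasDerivAt_sin, ih.2⟩, ⟨hc, _, fun t => ?_, (reg_neg_one k).mul ih.1⟩⟩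
    simpa using Real.hasDerivAt_cos t

/-- Regularity on the closed disc from regularity of the boundary values. -/
lemma DiscReg.of_boundary {α : ℝ} (hα : 0 < α) (hα1 : α < 1) {k : ℕ} {h : ℂ → ℂ}
    (hh : DiffContOnCl ℂ h (ball 0 1)) {u v : ℝ → ℝ}
    (hb : ∀ t : ℝ, h (cexp (t * I)) = u t + v t * I) (hu : Reg α k u) (hv : Reg α k v) :
    DiscReg α k h := by
  have h0 : ∀ {h : ℂ → ℂ} {u v : ℝ → ℝ}, DiffContOnCl ℂ h (ball 0 1) →
      (∀ t : ℝ, h (cexp (t * I)) = u t + v t * I) → Reg α 0 u → Reg α 0 v → DiscHolder α h := by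
    intro h u v hh hb hu hv
    obtain ⟨M, hM, hu, _⟩ := hu
    obtain ⟨N, hN, hv, _⟩ := hv
    refine ⟨hh, exists_holder_closedBall hα hα1 hh (M := M + N) (by positivity) fun t s => ?_⟩
    have h1 : h (cexp (t * I)) - h (cexp (s * I)) =
        ((u t - u s : ℝ) : ℂ) + ((v t - v s : ℝ) : ℂ) * I := by
      rw [hb, hb]
      push_cast
      ring
    rw [h1, add_mul]
    refine (norm_add_le _ _).trans ?_
    rw [norm_mul, norm_I, mul_one, norm_real, norm_real]
    exact add_le_add (hu t s) (hv t s)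
  induction k generalizing h u v with
  | zero => exact h0 hh hb hu hv
  | succ k ih =>
    refine ⟨h0 hh hb hu.zero hv.zero, ?_⟩
    obtain ⟨_, u', hu, hu'⟩ := hu
    obtain ⟨_, v', hv, hv'⟩ := hv
    obtain ⟨M, hM, h1, _⟩ := hu'.zero
    obtain ⟨N, hN, h2, _⟩ := hv'.zero
    obtain ⟨q, hq, hd, hqb⟩ := exists_deriv_of_boundary hα (le_max_of_le_left hM) hh hb hu hv
      (h1.mono (le_max_left M N)) (h2.mono (le_max_right M N))
    have hs := (reg_sin_cos hα hα1.le k).1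
    have hc := (reg_sin_cos hα hα1.le k).2
    have hm := reg_neg_one (α := α) k
    exact ⟨q, hd, ih hq hqb ((hc.mul hv').add (hm.mul (hs.mul hu')))
      ((hm.mul (hs.mul hv')).add (hm.mul (hc.mul hu')))⟩

/-- A global implicit function on a strip on which the function is strictly increasing in the last
variable and changes sign. -/
theorem exists_implicit_function {E : Type*} [NormedAddCommGroup E] [NormedSpace ℝ E]
    [CompleteSpace E] {R : E × ℝ → ℝ} {s₁ s₀ : ℝ} (hs : s₁ < s₀)
    (hR : ∀ x, ∀ s ∈ Icc s₁ s₀, ContDiffAt ℝ 4 R (x, s))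
    (hpos : ∀ x, ∀ s ∈ Icc s₁ s₀, 0 < fderiv ℝ R (x, s) (0, 1))
    (h₁ : ∀ x, R (x, s₁) < 0) (h₀ : ∀ x, 0 < R (x, s₀)) :
    ∃ F : E → ℝ, ContDiff ℝ 4 F ∧ (∀ x, F x ∈ Ioo s₁ s₀ ∧ R (x, F x) = 0) ∧
      ∀ x, ∀ s ∈ Icc s₁ s₀, R (x, s) = 0 → s = F x := by
  have hline : ∀ x, ∀ s ∈ Icc s₁ s₀,
      HasDerivAt (fun s => R (x, s)) (fderiv ℝ R (x, s) (0, 1)) s := fun x s h => by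
    have h1 : HasDerivAt (fun s : ℝ => (x, s)) ((0 : E), (1 : ℝ)) s :=
      (hasDerivAt_const s x).prodMk (hasDerivAt_id s)
    exact ((hR x s h).differentiableAt (by norm_num)).hasFDerivAt.comp_hasDerivAt s h1
  have hmono : ∀ x, StrictMonoOn (fun s => R (x, s)) (Icc s₁ s₀) := fun x => by
    refine strictMonoOn_of_deriv_pos (convex_Icc _ _)
      (fun s h => (hline x s h).continuousAt.continuousWithinAt) fun s h => ?_
    rw [(hline x s (interior_subset h)).deriv]
    exact hpos x s (interior_subset h)
  have hex : ∀ x, ∃ s ∈ Ioo s₁ s₀, R (x, s) = 0 := fun x => by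
    have := intermediate_value_Ioo hs.le
      (f := fun s => R (x, s)) fun s h => (hline x s h).continuousAt.continuousWithinAt
    exact this ⟨h₁ x, h₀ x⟩
  choose F hF hF0 using hex
  have huniq : ∀ x, ∀ s ∈ Icc s₁ s₀, R (x, s) = 0 → s = F x := fun x s h h0 =>
    (hmono x).injOn h (Ioo_subset_Icc_self (hF x)) (h0.trans (hF0 x).symm)
  refine ⟨F, contDiff_iff_contDiffAt.2 fun x => ?_, fun x => ⟨hF x, hF0 x⟩, huniq⟩
  have hx := Ioo_subset_Icc_self (hF x)
  have cdf := hR x (F x) hx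
  have if₂ : (fderiv ℝ R (x, F x) ∘L .inr ℝ E ℝ).IsInvertible := by
    refine ⟨ContinuousLinearEquiv.unitsEquivAut ℝ (Units.mk0 _ (hpos x (F x) hx).ne'), ?_⟩
    ext
    simp
  have hψ := cdf.contDiffAt_implicitFunction (by norm_num) if₂
  have hψ0 := cdf.implicitFunction_apply_self (by norm_num) if₂
  refine hψ.congr_of_eventuallyEq ?_
  have h2 := cdf.eventually_apply_implicitFunction (by norm_num) if₂
  have h3 : ∀ᶠ y in 𝓝 x, cdf.implicitFunction (by norm_num) if₂ y ∈ Ioo s₁ s₀ := by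
    refine hψ.continuousAt.eventually_mem (Ioo_mem_nhds ?_ ?_)
    · exact hψ0.symm ▸ (hF x).1
    · exact hψ0.symm ▸ (hF x).2
  filter_upwards [h2, h3] with y hy hy'
  exact (huniq y _ (Ioo_subset_Icc_self hy') (hy.trans (hF0 x))).symm

/-- The implicit function theorem on the torus, with a bound for the slope in one direction. -/
theorem exists_biperiodic_implicit_function {R : (ℝ × ℝ) × ℝ → ℝ} {s₁ s₀ κ : ℝ} (hs : s₁ < s₀)
    (hper : ∀ s, IsBiperiodic fun x => R (x, s))
    (hR : ∀ x, ∀ s ∈ Icc s₁ s₀, ContDiffAt ℝ 4 R (x, s))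
    (hpos : ∀ x, ∀ s ∈ Icc s₁ s₀, 0 < fderiv ℝ R (x, s) (0, 1))
    (hκ : ∀ x, ∀ s ∈ Icc s₁ s₀,
      |fderiv ℝ R (x, s) ((0, 1), 0)| ≤ κ * fderiv ℝ R (x, s) (0, 1))
    (h₁ : ∀ x, R (x, s₁) < 0) (h₀ : ∀ x, 0 < R (x, s₀)) :
    ∃ F : ℝ × ℝ → ℝ, IsBiperiodic F ∧ ContDiff ℝ 4 F ∧ (∀ x, |fderiv ℝ F x (0, 1)| ≤ κ) ∧
      ∀ x, F x ∈ Ioo s₁ s₀ ∧ R (x, F x) = 0 := by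
  obtain ⟨F, hF, hF0, huniq⟩ := exists_implicit_function hs hR hpos h₁ h₀
  refine ⟨F, fun x => ⟨?_, ?_⟩, hF, fun x => ?_, hF0⟩
  · exact huniq x _ (Ioo_subset_Icc_self (hF0 _).1) (((hper _ x).1).symm.trans (hF0 _).2)
  · exact huniq x _ (Ioo_subset_Icc_self (hF0 _).1) (((hper _ x).2).symm.trans (hF0 _).2)
  · have hx := Ioo_subset_Icc_self (hF0 x).1
    have h1 : HasFDerivAt (fun y => (y, F y))
        ((ContinuousLinearMap.id ℝ (ℝ × ℝ)).prod (fderiv ℝ F x)) x :=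
      (hasFDerivAt_id x).prodMk ((hF.differentiable (by norm_num)) x).hasFDerivAt
    have h2 := ((hR x _ hx).differentiableAt (by norm_num)).hasFDerivAt.comp x h1
    have h3 : HasFDerivAt (R ∘ fun y => (y, F y)) (0 : ℝ × ℝ →L[ℝ] ℝ) x := by
      have : (R ∘ fun y => (y, F y)) = fun _ => 0 := funext fun y => (hF0 y).2
      rw [this]
      exact hasFDerivAt_const _ _
    have h4 := DFunLike.congr_fun (h2.unique h3) (0, 1)
    have h5 : (((0 : ℝ), (1 : ℝ)), fderiv ℝ F x (0, 1))
        = ((0, 1), 0) + (fderiv ℝ F x (0, 1)) • ((0 : ℝ × ℝ), (1 : ℝ)) := by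
      ext <;> simp
    have h6 : fderiv ℝ R (x, F x) ((0, 1), 0)
        + fderiv ℝ F x (0, 1) * fderiv ℝ R (x, F x) (0, 1) = 0 := by
      rw [← smul_eq_mul, ← map_smul, ← map_add, ← h5]
      exact h4
    have h7 := hκ x _ hx
    have h8 := hpos x _ hx
    rw [show fderiv ℝ R (x, F x) ((0, 1), 0)
      = -(fderiv ℝ F x (0, 1) * fderiv ℝ R (x, F x) (0, 1)) by linarith, abs_neg, abs_mul,
      abs_of_pos h8] at h7
    exact le_of_mul_le_mul_right h7 h8

section LevelFamily

variable {E : Type*} [NormedAddCommGroup E] [NormedSpace ℂ E]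

/-- The quadratic disc `l ↦ p + l v + l² w`, of radius `r`, stays in `U` and crosses the zero level
of `T` transversally in the region `r₁ ≤ |l|`, with a control of the angular slope. -/
def IsLevelFamily (T : E → ℝ) (U : Set E) (κ r₁ r : ℝ) (p v w : E) : Prop :=
  ∀ l : ℂ, ‖l‖ ≤ r → p + l • v + l ^ 2 • w ∈ U ∧
    (‖l‖ ≤ r₁ → T (p + l • v + l ^ 2 • w) < 0) ∧
    (r ≤ ‖l‖ → 0 < T (p + l • v + l ^ 2 • w)) ∧
    (r₁ ≤ ‖l‖ → |fderiv ℝ T (p + l • v + l ^ 2 • w) (I • (l • v + (2 * l ^ 2) • w))| <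
      κ * fderiv ℝ T (p + l • v + l ^ 2 • w) (l • v + (2 * l ^ 2) • w))

lemma IsCompact.exists_uniform_nhds {X : Type*} [MetricSpace X] {K : Set X} (hK : IsCompact K)
    {P : X → Prop} (h : ∀ x ∈ K, ∀ᶠ y in 𝓝 x, P y) :
    ∃ σ > 0, ∀ x ∈ K, ∀ y, dist y x < σ → P y := by
  obtain ⟨σ, hσ, h1⟩ := hK.exists_thickening_subset_open (isOpen_interior (s := {y | P y}))
    fun x hx => mem_interior_iff_mem_nhds.2 (h x hx)
  exact ⟨σ, hσ, fun x hx y hy => interior_subset (h1 (mem_thickening_iff.2 ⟨x, hx, hy⟩))⟩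

lemma IsLevelFamily.exists_stable {T : E → ℝ} {U : Set E} (hU : IsOpen U)
    (hT : ContDiffOn ℝ 1 T U) {κ r₁ r : ℝ} {S : Set ℂ} (hS : IsCompact S) {f V W : ℂ → E}
    (hf : ContinuousOn f S) (hV : ContinuousOn V S) (hW : ContinuousOn W S)
    (h : ∀ ζ ∈ S, IsLevelFamily T U κ r₁ r (f ζ) (V ζ) (W ζ)) :
    ∃ σ > 0, ∀ ζ ∈ S, ∀ p v w, ‖p - f ζ‖ < σ → ‖v - V ζ‖ < σ → ‖w - W ζ‖ < σ →
      IsLevelFamily T U κ r₁ r p v w := by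
  have hT1 : ContinuousOn (fderiv ℝ T) U := hT.continuousOn_fderiv_of_isOpen hU le_rfl
  set g : ℂ × ℂ → E × E × E × ℂ := fun x => (f x.1, V x.1, W x.1, x.2)
  have hg : ContinuousOn g (S ×ˢ closedBall 0 r) := by
    have h1 : MapsTo Prod.fst (S ×ˢ closedBall (0:ℂ) r) S := fun x hx => hx.1
    exact (hf.comp continuousOn_fst h1).prodMk ((hV.comp continuousOn_fst h1).prodMk
      ((hW.comp continuousOn_fst h1).prodMk continuousOn_snd))
  have hK := (hS.prod (isCompact_closedBall (0:ℂ) r)).image_of_continuousOn hg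
  set X : E × E × E × ℂ → E := fun y => y.1 + y.2.2.2 • y.2.1 + y.2.2.2 ^ 2 • y.2.2.1 with hX
  set Y : E × E × E × ℂ → E := fun y => y.2.2.2 • y.2.1 + (2 * y.2.2.2 ^ 2) • y.2.2.1 with hY
  have hXc : Continuous X := by fun_prop
  have hYc : Continuous Y := by fun_prop
  obtain ⟨σ, hσ, hσP⟩ := hK.exists_uniform_nhds (P := fun y => X y ∈ U ∧
    (‖y.2.2.2‖ ≤ r₁ → T (X y) < 0) ∧ (r ≤ ‖y.2.2.2‖ → 0 < T (X y)) ∧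
    (r₁ ≤ ‖y.2.2.2‖ → |fderiv ℝ T (X y) (I • Y y)| < κ * fderiv ℝ T (X y) (Y y))) (by
    rintro _ ⟨⟨ζ, l⟩, ⟨hζ, hl⟩, rfl⟩
    obtain ⟨h1, h2, h3, h4⟩ := h ζ hζ l (mem_closedBall_zero_iff.1 hl)
    have hU' : U ∈ 𝓝 (X (g (ζ, l))) := hU.mem_nhds h1
    have hTX : ContinuousAt (fun y => T (X y)) (g (ζ, l)) :=
      (hT.continuousOn.continuousAt hU').comp hXc.continuousAt
    have hDX : ContinuousAt (fun y => fderiv ℝ T (X y)) (g (ζ, l)) :=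
      (hT1.continuousAt hU').comp hXc.continuousAt
    have hn : ContinuousAt (fun y : E × E × E × ℂ => ‖y.2.2.2‖) (g (ζ, l)) := by fun_prop
    refine (hXc.continuousAt.eventually_mem hU').and (Filter.Eventually.and ?_
      (Filter.Eventually.and ?_ ?_))
    · by_cases hc : ‖l‖ ≤ r₁
      · filter_upwards [hTX.eventually_lt_const (h2 hc)] with y hy _ using hy
      · filter_upwards [hn.eventually_const_lt (not_le.1 hc)] with y hy hy'
        exact absurd hy' (not_le.2 hy)
    · by_cases hc : r ≤ ‖l‖
      · filter_upwards [hTX.eventually_const_lt (h3 hc)] with y hy _ using hy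
      · filter_upwards [hn.eventually_lt_const (not_le.1 hc)] with y hy hy'
        exact absurd hy' (not_le.2 hy)
    · by_cases hc : r₁ ≤ ‖l‖
      · have := ((hDX.clm_apply (hYc.const_smul I).continuousAt).abs).eventually_lt
          ((hDX.clm_apply hYc.continuousAt).const_mul κ) (h4 hc)
        filter_upwards [this] with y hy _ using hy
      · filter_upwards [hn.eventually_lt_const (not_le.1 hc)] with y hy hy'
        exact absurd hy' (not_le.2 hy))
  refine ⟨σ, hσ, fun ζ hζ p v w hp hv hw l hl => ?_⟩
  refine hσP (g (ζ, l)) ⟨(ζ, l), ⟨hζ, mem_closedBall_zero_iff.2 hl⟩, rfl⟩ (p, v, w, l) ?_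
  simp only [g, Prod.dist_eq, dist_self]
  rw [← dist_eq_norm] at hp hv hw
  exact max_lt hp (max_lt hv (max_lt hw hσ))

end LevelFamily

section Existence

/-- Over a neighbourhood of a compact piece of a strongly pseudoconvex hypersurface, every curve of
base points slightly inside carries a family of quadratic discs crossing the hypersurface. -/
lemma exists_isLevelFamily {n : ℕ} (hn : 2 ≤ n) {T : EuclideanSpace ℂ (Fin n) → ℝ}
    {U Z : Set (EuclideanSpace ℂ (Fin n))} (hU : IsOpen U) (hT : ContDiffOn ℝ 2 T U)
    (hZ : IsCompact Z) (hZU : Z ⊆ U) (hD : ∀ p ∈ Z, fderiv ℝ T p ≠ 0)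
    (hL : ∀ p ∈ Z, ∀ w : EuclideanSpace ℂ (Fin n), w ≠ 0 → 0 < levi T p w)
    {κ : ℝ} (hκ : 0 < κ) :
    ∃ r > 0, ∃ δ > 0, ∀ f : ℂ → EuclideanSpace ℂ (Fin n), ContinuousOn f (sphere 0 1) →
      (∀ ζ ∈ sphere (0:ℂ) 1, f ζ ∈ Z ∧ -δ ≤ T (f ζ) ∧ T (f ζ) < 0) →
      ∃ V W : ℂ → EuclideanSpace ℂ (Fin n), ContinuousOn V (sphere 0 1) ∧
        ContinuousOn W (sphere 0 1) ∧ ∃ r₁ > 0, r₁ < r ∧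
          ∀ ζ ∈ sphere (0:ℂ) 1, IsLevelFamily T U κ r₁ r (f ζ) (V ζ) (W ζ) := by
  obtain ⟨m, hm, hmL⟩ := exists_levi_lower hU hT hZ hZU hL
  set κ₁ := m * min κ 1 / 2 with hκ₁
  have hκ1 : 0 < κ₁ := by positivity
  have hκm : κ₁ ≤ m / 2 := by
    have := mul_le_mul_of_nonneg_left (min_le_right κ 1) hm.le
    linarith
  have hκκ : κ₁ ≤ κ * m / 2 := by
    have := mul_le_mul_of_nonneg_left (min_le_left κ 1) hm.le
    linarith
  obtain ⟨r, hr, hkey⟩ := exists_key_estimate hU hT hZ hZU hD hκ1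
  refine ⟨r, hr, m * r ^ 2 / 4, by positivity, fun f hf hfZ => ?_⟩
  have hT1 : ContDiffOn ℝ 1 (fderiv ℝ T) U := hT.fderiv_of_isOpen hU (by norm_num)
  obtain ⟨V, hV, hV1, -⟩ := exists_unit_section hn
    ((continuousOn_cgrad hT1.continuousOn).comp hf fun ζ hζ => hZU (hfZ ζ hζ).1)
    (isCompact_sphere (0:ℂ) 1) le_rfl fun ζ hζ => cgrad_ne_zero (hD _ (hfZ ζ hζ).1)
  set W := fun ζ => corr T (f ζ) (V ζ) with hW
  have hWc : ContinuousOn W (sphere 0 1) := fun ζ hζ =>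
    continuousAt_comp_corr hU hT (hf ζ hζ) (hV ζ hζ) (hZU (hfZ ζ hζ).1) (hD _ (hfZ ζ hζ).1)
  have h1 : ∀ ζ ∈ sphere (0:ℂ) 1, _ := fun ζ hζ =>
    hkey (f ζ) (hfZ ζ hζ).1 (V ζ) (hV1 ζ hζ).2.le (hV1 ζ hζ).1
  obtain ⟨r₁, hr₁, hr₁r, hneg⟩ : ∃ r₁ > 0, r₁ < r ∧ ∀ ζ ∈ sphere (0:ℂ) 1, ∀ l : ℂ, ‖l‖ ≤ r₁ →
      T (f ζ + l • V ζ + l ^ 2 • W ζ) < 0 := by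
    have hK : IsCompact ((fun ζ => (f ζ, V ζ, W ζ, (0:ℂ))) '' sphere (0:ℂ) 1) :=
      (isCompact_sphere (0:ℂ) 1).image_of_continuousOn
        (hf.prodMk (hV.prodMk (hWc.prodMk continuousOn_const)))
    obtain ⟨σ, hσ, hσP⟩ := hK.exists_uniform_nhds
      (P := fun y => T (y.1 + y.2.2.2 • y.2.1 + y.2.2.2 ^ 2 • y.2.2.1) < 0) (by
      rintro _ ⟨ζ, hζ, rfl⟩
      refine Filter.Tendsto.eventually_lt_const
        (v := T (f ζ + (0 : ℂ) • V ζ + (0 : ℂ) ^ 2 • W ζ)) (by simpa using (hfZ ζ hζ).2.2) ?_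
      refine ContinuousAt.comp (g := T) (f := fun y : _ × _ × _ × ℂ =>
        y.1 + y.2.2.2 • y.2.1 + y.2.2.2 ^ 2 • y.2.2.1)
          (hT.continuousOn.continuousAt (hU.mem_nhds ?_)) (by fun_prop)
      simpa using hZU (hfZ ζ hζ).1)
    refine ⟨min (σ / 2) (r / 2), by positivity, (min_le_right _ _).trans_lt (by linarith),
      fun ζ hζ l hl => hσP _ ⟨ζ, hζ, rfl⟩ (f ζ, V ζ, W ζ, l) ?_⟩
    simp only [Prod.dist_eq, dist_self, dist_zero_right]
    have := hl.trans (min_le_left _ _)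
    exact max_lt hσ (max_lt hσ (max_lt hσ (by linarith)))
  refine ⟨V, W, hV, hWc, r₁, hr₁, hr₁r, fun ζ hζ l hl => ⟨(h1 ζ hζ l hl).1, hneg ζ hζ l,
    fun hl' => ?_, fun hl' => ?_⟩⟩
  · have h2 := le_of_key_estimate hU hT (h1 ζ hζ) hl
    have h3 := hmL (f ζ) (hfZ ζ hζ).1 (V ζ)
    rw [(hV1 ζ hζ).2, le_antisymm hl hl'] at *
    have h4 := (hfZ ζ hζ).2.1
    have h5 : (m - κ₁ / 2) * r ^ 2 ≤ (levi T (f ζ) (V ζ) - κ₁ / 2) * r ^ 2 := by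
      gcongr
      linarith
    have h6 : (m / 2) * r ^ 2 ≤ (m - κ₁ / 2) * r ^ 2 := by
      gcongr
      linarith
    have h7 : 0 < m * r ^ 2 := by positivity
    refine lt_of_lt_of_le ?_ h2
    linarith
  · have h2 := (h1 ζ hζ l hl).2 l
    have h3 := (h1 ζ hζ l hl).2 (I * l)
    have h4 := hmL (f ζ) (hfZ ζ hζ).1 (V ζ)
    rw [(hV1 ζ hζ).2] at h4
    have e1 : l • V ζ + (2 * l * l) • W ζ = l • V ζ + (2 * l ^ 2) • W ζ := by
      rw [pow_two, mul_assoc]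
    have e2 : (I * l) • V ζ + (2 * l * (I * l)) • W ζ = I • (l • V ζ + (2 * l ^ 2) • W ζ) := by
      rw [smul_add, smul_smul, smul_smul]
      congr 2
      ring
    have e3 : ((starRingEnd ℂ) l * l).re = ‖l‖ ^ 2 := by
      rw [mul_comm, Complex.mul_conj, Complex.normSq_eq_norm_sq, ofReal_re]
    have e4 : ((starRingEnd ℂ) l * (I * l)).re = 0 := by
      simp [mul_comm]
    rw [e4, mul_zero, sub_zero, norm_mul, norm_I, one_mul] at h3
    rw [e3] at h2
    change |fderiv ℝ T (f ζ + l • V ζ + l ^ 2 • W ζ) (l • V ζ + (2 * l * l) • W ζ) - _| ≤ _ at h2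
    change |fderiv ℝ T (f ζ + l • V ζ + l ^ 2 • W ζ)
      ((I * l) • V ζ + (2 * l * (I * l)) • W ζ)| ≤ _ at h3
    rw [e1] at h2
    rw [e2] at h3
    refine lt_of_le_of_lt h3 ?_
    have h5 := (abs_le.1 h2).1
    have h6 : 0 < ‖l‖ ^ 2 := by have := hr₁.trans_le hl'; positivity
    have h7 : m * ‖l‖ ^ 2 ≤ levi T (f ζ) (V ζ) * ‖l‖ ^ 2 := by gcongr; linarith
    have h8 : κ₁ * ‖l‖ ^ 2 ≤ m / 2 * ‖l‖ ^ 2 := by gcongr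
    have h9 : 3 / 2 * m * ‖l‖ ^ 2 ≤
      fderiv ℝ T (f ζ + l • V ζ + l ^ 2 • W ζ) (l • V ζ + (2 * l ^ 2) • W ζ) := by nlinarith
    have h10 := mul_le_mul_of_nonneg_left h9 hκ.le
    have h11 : κ₁ * ‖l‖ ^ 2 ≤ κ * m / 2 * ‖l‖ ^ 2 := by gcongr
    have h12 : 0 < κ * m * ‖l‖ ^ 2 := by positivity
    nlinarith

end Existence

section CloseUp

variable {E : Type*} [NormedAddCommGroup E] [NormedSpace ℂ E]

/-- The zero level of `T` on a family of quadratic discs over the circle, in logarithmic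
coordinates, is a graph over the torus with small angular slope. -/
lemma IsLevelFamily.exists_graph {T : E → ℝ} {U : Set E} (hU : IsOpen U)
    (hT : ContDiffOn ℝ 4 T U) {κ r₁ r : ℝ} (hκ : 0 < κ) (hr₁ : 0 < r₁) (hr : r₁ < r)
    {φ a b : ℝ → E} (hφ : ContDiff ℝ 4 φ) (ha : ContDiff ℝ 4 a) (hb : ContDiff ℝ 4 b)
    (hφp : φ.Periodic (2 * Real.pi)) (hap : a.Periodic (2 * Real.pi))
    (hbp : b.Periodic (2 * Real.pi)) (h : ∀ t, IsLevelFamily T U κ r₁ r (φ t) (a t) (b t))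
    (N : ℕ) :
    ∃ F : ℝ × ℝ → ℝ, IsBiperiodic F ∧ ContDiff ℝ 4 F ∧ (∀ x, |fderiv ℝ F x (0, 1)| ≤ κ) ∧
      ∀ x, F x < Real.log r ∧ T (φ x.1 + cexp (F x + (x.2 + N * x.1) * I) • a x.1 +
        cexp (F x + (x.2 + N * x.1) * I) ^ 2 • b x.1) = 0 := by
  set L : (ℝ × ℝ) × ℝ → ℂ := fun y => cexp (y.2 + (y.1.2 + N * y.1.1) * I) with hL
  set X : (ℝ × ℝ) × ℝ → E := fun y => φ y.1.1 + L y • a y.1.1 + L y ^ 2 • b y.1.1 with hX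
  have hofReal : ContDiff ℝ 4 (fun x : ℝ => (x : ℂ)) := ofRealCLM.contDiff
  have hexp : ContDiff ℝ 4 cexp := (Complex.contDiff_exp (𝕜 := ℝ))
  have hLc : ContDiff ℝ 4 L := by
    refine hexp.comp ?_
    have h1 : ContDiff ℝ 4 (fun y : (ℝ × ℝ) × ℝ => (y.2 : ℂ)) := hofReal.comp contDiff_snd
    have h2 : ContDiff ℝ 4 (fun y : (ℝ × ℝ) × ℝ => (y.1.1 : ℂ)) :=
      hofReal.comp (contDiff_fst.comp contDiff_fst)
    have h3 : ContDiff ℝ 4 (fun y : (ℝ × ℝ) × ℝ => (y.1.2 : ℂ)) :=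
      hofReal.comp (contDiff_snd.comp contDiff_fst)
    exact h1.add ((h3.add (contDiff_const.mul h2)).mul contDiff_const)
  have h11 : ContDiff ℝ 4 (fun y : (ℝ × ℝ) × ℝ => y.1.1) := contDiff_fst.comp contDiff_fst
  have hXc : ContDiff ℝ 4 X :=
    ((hφ.comp h11).add (hLc.smul (ha.comp h11))).add ((hLc.pow 2).smul (hb.comp h11))
  have hnorm : ∀ x s, ‖L (x, s)‖ = Real.exp s := fun x s => by
    simp [hL, Complex.norm_exp]
  have hIcc : ∀ x, ∀ s ∈ Icc (Real.log r₁) (Real.log r), r₁ ≤ ‖L (x, s)‖ ∧ ‖L (x, s)‖ ≤ r :=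
    fun x s hs => by
      rw [hnorm]
      exact ⟨(Real.log_le_iff_le_exp hr₁).1 hs.1, (Real.le_log_iff_exp_le (hr₁.trans hr)).1 hs.2⟩
  have hTX : ∀ x, ∀ s ∈ Icc (Real.log r₁) (Real.log r), ContDiffAt ℝ 4 T (X (x, s)) :=
    fun x s hs => hT.contDiffAt (hU.mem_nhds (h x.1 _ (hIcc x s hs).2).1)
  have hR : ∀ x, ∀ s ∈ Icc (Real.log r₁) (Real.log r), ContDiffAt ℝ 4 (T ∘ X) (x, s) :=
    fun x s hs => (hTX x s hs).comp (x, s) hXc.contDiffAt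
  have hd : ∀ x, ∀ s ∈ Icc (Real.log r₁) (Real.log r), ∀ w, fderiv ℝ (T ∘ X) (x, s) w =
      fderiv ℝ T (X (x, s)) (fderiv ℝ X (x, s) w) := fun x s hs w => by
    rw [fderiv_comp (x, s) ((hTX x s hs).differentiableAt (by norm_num))
      (hXc.contDiffAt.differentiableAt (by norm_num))]
    rfl
  have hXd : ∀ (y : (ℝ × ℝ) × ℝ) (w : (ℝ × ℝ) × ℝ) (c : ℂ), w.1.1 = 0 →
      (w.2 + w.1.2 * I = c) →
      fderiv ℝ X y w = c • (L y • a y.1.1 + (2 * L y ^ 2) • b y.1.1) := fun y w c hw hc => by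
    have h1 : HasDerivAt (fun τ : ℝ => y + τ • w) w 0 := by
      simpa using ((hasDerivAt_id (0:ℝ)).smul_const w).const_add y
    have h2 : HasDerivAt (fun τ : ℝ => X (y + τ • w)) (fderiv ℝ X y w) 0 := by
      have h3 : HasFDerivAt X (fderiv ℝ X y) (y + (0:ℝ) • w) := by
        simpa using (hXc.contDiffAt.differentiableAt (by norm_num)).hasFDerivAt
      exact h3.comp_hasDerivAt (0:ℝ) h1
    have h4 : ∀ τ : ℝ, X (y + τ • w) = φ y.1.1 + (L y * cexp (τ * c)) • a y.1.1 +
        (L y * cexp (τ * c)) ^ 2 • b y.1.1 := fun τ => by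
      have e : L (y + τ • w) = L y * cexp (τ * c) := by
        simp only [hL, ← Complex.exp_add, ← hc]
        congr 1
        simp [hw]
        ring
      simp only [hX, e]
      simp [hw]
    have h5 : HasDerivAt (fun τ : ℝ => L y * cexp (τ * c)) (L y * c) 0 := by
      have := (((hasDerivAt_id (0:ℝ)).ofReal_comp.mul_const c).cexp).const_mul (L y)
      simpa using this
    have h6 := ((h5.smul_const (a y.1.1)).const_add (φ y.1.1)).add
      ((h5.pow 2).smul_const (b y.1.1))
    have h7 : HasDerivAt (fun τ : ℝ => X (y + τ • w)) ((L y * c) • a y.1.1 +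
        (((2 : ℕ) : ℂ) * (L y * cexp (((0 : ℝ) : ℂ) * c)) ^ (2 - 1) * (L y * c)) • b y.1.1) 0 := by
      refine h6.congr_of_eventuallyEq (Filter.Eventually.of_forall fun τ => ?_)
      exact h4 τ
    rw [h2.unique h7]
    simp only [ofReal_zero, zero_mul, Complex.exp_zero, mul_one, smul_add, smul_smul]
    congr 2
    · ring
    · push_cast
      ring
  have hs1 : ∀ y, fderiv ℝ X y (0, 1) = L y • a y.1.1 + (2 * L y ^ 2) • b y.1.1 := fun y => by
    rw [hXd y (0, 1) 1 (by simp) (by simp), one_smul]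
  have hθ : ∀ y, fderiv ℝ X y ((0, 1), 0) = I • (L y • a y.1.1 + (2 * L y ^ 2) • b y.1.1) :=
    fun y => hXd y ((0, 1), 0) I (by simp) (by simp)
  have hslope : ∀ x, ∀ s ∈ Icc (Real.log r₁) (Real.log r),
      |fderiv ℝ (T ∘ X) (x, s) ((0, 1), 0)| < κ * fderiv ℝ (T ∘ X) (x, s) (0, 1) :=
    fun x s hs => by
      rw [hd x s hs, hd x s hs, hs1, hθ]
      exact (h x.1 _ (hIcc x s hs).2).2.2.2 (hIcc x s hs).1
  have hlog : Real.log r₁ < Real.log r := Real.log_lt_log hr₁ hr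
  obtain ⟨F, h1, h2, h3, h4⟩ := exists_biperiodic_implicit_function (R := T ∘ X) (κ := κ) hlog
    (fun s x => by
      have hexp2 : ∀ (z : ℂ) (k : ℕ), cexp (z + k * (2 * Real.pi * I)) = cexp z := fun z k => by
        rw [Complex.exp_add, Complex.exp_nat_mul_two_pi_mul_I, mul_one]
      have e1 : L (x + (2 * Real.pi, 0), s) = L (x, s) := by
        have e : ((s : ℂ) +
            (((x + (2 * Real.pi, 0)).2 : ℝ) + N * ((x + (2 * Real.pi, 0)).1 : ℝ)) * I) =
            (s + (x.2 + N * x.1) * I) + N * (2 * Real.pi * I) := by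
          simp only [Prod.fst_add, Prod.snd_add]
          push_cast
          ring
        exact (congrArg cexp e).trans (hexp2 _ _)
      have e2 : L (x + (0, 2 * Real.pi), s) = L (x, s) := by
        have e : ((s : ℂ) +
            (((x + (0, 2 * Real.pi)).2 : ℝ) + N * ((x + (0, 2 * Real.pi)).1 : ℝ)) * I) =
            (s + (x.2 + N * x.1) * I) + (1 : ℕ) * (2 * Real.pi * I) := by
          simp only [Prod.fst_add, Prod.snd_add]
          push_cast
          ring
        exact (congrArg cexp e).trans (hexp2 _ _)
      simp only [Function.comp, hX, e1, e2]
      simp [hφp x.1, hap x.1, hbp x.1])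
    hR (fun x s hs => (mul_pos_iff_of_pos_left hκ).1 ((abs_nonneg _).trans_lt (hslope x s hs)))
    (fun x s hs => (hslope x s hs).le)
    (fun x => by
      have := hIcc x _ (left_mem_Icc.2 hlog.le)
      refine (h x.1 _ this.2).2.1 ?_
      rw [hnorm, Real.exp_log hr₁])
    (fun x => by
      have := hIcc x _ (right_mem_Icc.2 hlog.le)
      refine (h x.1 _ this.2).2.2.1 ?_
      rw [hnorm, Real.exp_log (hr₁.trans hr)])
  exact ⟨F, h1, h2, h3, fun x => ⟨(h4 x).1.2, (h4 x).2⟩⟩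

end CloseUp

section DiscLevel

variable {E : Type*} [NormedAddCommGroup E] [NormedSpace ℂ E]

lemma DifferentiableOn.contDiff_comp_circle [CompleteSpace E] {f : ℂ → E} {O : Set ℂ}
    (hf : DifferentiableOn ℂ f O) (hO : IsOpen O) (hS : sphere 0 1 ⊆ O) (k : ℕ) :
    ContDiff ℝ k (fun t : ℝ => f (cexp (t * I))) := by
  rw [contDiff_iff_contDiffAt]
  intro t
  have h1 : cexp (t * I) ∈ O := hS (by simp [Complex.norm_exp_ofReal_mul_I])
  have h2 : ContDiffAt ℝ k f (cexp (t * I)) :=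
    (((hf.contDiffOn hO).contDiffAt (hO.mem_nhds h1) :
      ContDiffAt ℂ k f (cexp (t * I)))).restrict_scalars ℝ
  have h3 : ContDiff ℝ k (fun t : ℝ => cexp (t * I)) := by
    have : ContDiff ℝ k (fun x : ℝ => (x : ℂ)) := ofRealCLM.contDiff
    exact (Complex.contDiff_exp (𝕜 := ℝ)).comp (this.mul contDiff_const)
  exact h2.comp t h3.contDiffAt

lemma periodic_comp_circle {X : Type*} (f : ℂ → X) :
    (fun t : ℝ => f (cexp (t * I))).Periodic (2 * Real.pi) := fun t => by
  have : cexp (((t + 2 * Real.pi : ℝ) : ℂ) * I) = cexp (t * I) := by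
    push_cast
    rw [add_mul, Complex.exp_add, Complex.exp_two_pi_mul_I, mul_one]
  simp only [this]

/-- A disc carrying a family of quadratic discs over the circle can be modified so that its boundary
lies in the zero level, the parameter being a nonvanishing regular function times `ζ ^ N`. -/
lemma exists_discReg_level [CompleteSpace E] {α : ℝ} (hα : 0 < α) (hα1 : α < 1) : ∃ κ > 0,
    ∀ {T : E → ℝ} {U : Set E} {r₁ r : ℝ} {f A B : ℂ → E} {O : Set ℂ}, IsOpen U →
      ContDiffOn ℝ 4 T U → 0 < r₁ → r₁ < r → IsOpen O → sphere 0 1 ⊆ O →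
      DifferentiableOn ℂ f O → DifferentiableOn ℂ A O → DifferentiableOn ℂ B O →
      (∀ ζ ∈ sphere (0:ℂ) 1, IsLevelFamily T U κ r₁ r (f ζ) (A ζ) (B ζ)) → ∀ N : ℕ,
      ∃ h : ℂ → ℂ, DiscReg α 3 h ∧ (∀ z, ‖z‖ ≤ 1 → ‖cexp (h z)‖ ≤ r) ∧ ∀ ζ, ‖ζ‖ = 1 →
        T (f ζ + (ζ ^ N * cexp (h ζ)) • A ζ + (ζ ^ N * cexp (h ζ)) ^ 2 • B ζ) = 0 := by
  obtain ⟨κ, hκ, hG⟩ := exists_reg_isHarmonicConj_graph hα hα1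
  refine ⟨κ, hκ, fun {T U r₁ r f A B O} hU hT hr₁ hr hO hS hf hA hB hlev N => ?_⟩
  obtain ⟨F, hF1, hF2, hF3, hF4⟩ := IsLevelFamily.exists_graph hU hT hκ hr₁ hr
    (hf.contDiff_comp_circle hO hS 4) (hA.contDiff_comp_circle hO hS 4)
    (hB.contDiff_comp_circle hO hS 4) (periodic_comp_circle f) (periodic_comp_circle A)
    (periodic_comp_circle B) (fun t => hlev _ (by simp [Complex.norm_exp_ofReal_mul_I])) N
  obtain ⟨v, ⟨h, hh, hhb, -⟩, hu, hv⟩ := hG F hF1 hF2 hF3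
  have hcirc : ∀ ζ : ℂ, ‖ζ‖ = 1 → ∃ t : ℝ, cexp (t * I) = ζ := fun ζ hζ =>
    ⟨ζ.arg, by simpa [hζ] using Complex.norm_mul_exp_arg_mul_I ζ⟩
  refine ⟨h, DiscReg.of_boundary hα hα1 hh hhb hu hv, fun z hz => ?_, fun ζ hζ => ?_⟩
  · rw [Complex.norm_exp, ← Real.le_log_iff_exp_le (hr₁.trans hr)]
    refine re_le_of_re_le_on_sphere hh (fun ζ hζ => ?_) hz
    obtain ⟨t, rfl⟩ := hcirc ζ hζ
    rw [hhb]
    simpa using (hF4 (t, v t)).1.le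
  · obtain ⟨t, rfl⟩ := hcirc ζ hζ
    have e : cexp (t * I) ^ N * cexp (h (cexp (t * I))) =
        cexp (F (t, v t) + (v t + N * t) * I) := by
      rw [hhb, ← Complex.exp_nat_mul, ← Complex.exp_add]
      congr 1
      ring
    rw [e]
    exact (hF4 (t, v t)).2

end DiscLevel

section Subharmonic

lemma not_isLocalMax_of_levi_pos {S : ℂ → ℝ} {z w : ℂ} (hS : ContDiffAt ℝ 2 S z)
    (hL : 0 < levi S z w) : ¬ IsLocalMax S z := fun hmax => by
  have key : ∀ w, D2 S z w w ≤ 0 := fun w => by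
    by_contra! hpos
    obtain ⟨h1, h2⟩ := hS.hasDerivAt_line w
    set φ : ℝ → ℝ := fun s => S (z + s • w) with hφ
    have hl : Filter.Tendsto (fun s : ℝ => z + s • w) (𝓝 0) (𝓝 z) := by
      have : Continuous (fun s : ℝ => z + s • w) := by fun_prop
      simpa using this.tendsto 0
    have hmaxφ : IsLocalMax φ 0 := by
      filter_upwards [hl.eventually hmax] with s hs
      simpa [hφ] using hs
    have e : deriv φ =ᶠ[𝓝 0] fun s => fderiv ℝ S (z + s • w) w := by
      filter_upwards [h1] with s hs using hs.deriv
    have hdd : deriv (deriv φ) 0 = D2 S z w w := by rw [e.deriv_eq, h2.deriv]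
    have hmin : IsLocalMin φ 0 := isLocalMin_of_deriv_deriv_pos (by rw [hdd]; exact hpos)
      hmaxφ.deriv_eq_zero (h1.self_of_nhds).continuousAt
    have hc : φ =ᶠ[𝓝 0] fun _ => φ 0 := by
      filter_upwards [hmin, hmaxφ] with s h3 h4 using le_antisymm h4 h3
    have h5 : deriv φ =ᶠ[𝓝 0] fun _ => 0 := by
      have := hc.deriv
      simpa using this
    rw [h5.deriv_eq, deriv_const] at hdd
    exact hpos.ne hdd
  have h1 := key w
  have h2 := key (I • w)
  rw [levi] at hL
  linarith

variable {E : Type*} [NormedAddCommGroup E] [NormedSpace ℂ E]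

lemma levi_comp_holomorphic [CompleteSpace E] {T : E → ℝ} {q : ℂ → E} {z : ℂ} {O : Set ℂ}
    (hO : IsOpen O) (hq : DifferentiableOn ℂ q O) (hz : z ∈ O) (hT : ContDiffAt ℝ 2 T (q z))
    (w : ℂ) : levi (T ∘ q) z w = levi T (q z) (w • deriv q z) := by
  have hqc : ContDiffAt ℝ 2 q z :=
    (((hq.contDiffOn hO).contDiffAt (hO.mem_nhds hz) : ContDiffAt ℂ 2 q z)).restrict_scalars ℝ
  have hq2 : DifferentiableOn ℂ (deriv q) O := hq.deriv hO
  have key : ∀ w : ℂ, D2 (T ∘ q) z w w = D2 T (q z) (w • deriv q z) (w • deriv q z) +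
      fderiv ℝ T (q z) (w ^ 2 • deriv (deriv q) z) := fun w => by
    have hl : ∀ s : ℝ, HasDerivAt (fun s : ℝ => z + s • w) w s := fun s => by
      simpa using ((hasDerivAt_id s).smul_const w).const_add z
    have hlt : Filter.Tendsto (fun s : ℝ => z + s • w) (𝓝 0) (𝓝 z) := by
      simpa using (hl 0).continuousAt.tendsto
    have hqs : ∀ᶠ y in 𝓝 z, DifferentiableAt ℝ T (q y) := by
      have : ∀ᶠ p in 𝓝 (q z), DifferentiableAt ℝ T p := by
        filter_upwards [hT.eventually (by norm_num)] with p hp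
        exact hp.differentiableAt (by norm_num)
      exact hqc.continuousAt.eventually this
    refine D2_eq_of_line (hT.comp z hqc)
      (ψ' := fun s => fderiv ℝ T (q (z + s • w)) (w • deriv q (z + s • w))) ?_ ?_
    · filter_upwards [hlt.eventually hqs, hlt.eventually (hO.mem_nhds hz)] with s h1 h2
      have h3 : HasDerivAt q (deriv q (z + s • w)) (z + s • w) :=
        (hq.differentiableAt (hO.mem_nhds h2)).hasDerivAt
      exact h1.hasFDerivAt.comp_hasDerivAt s (h3.scomp s (hl s))
    · have h1 : HasFDerivAt (fderiv ℝ T) (fderiv ℝ (fderiv ℝ T) (q z)) (q (z + (0:ℝ) • w)) := by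
        simpa using ((hT.fderiv_right (m := 1) (by norm_num)).differentiableAt
          (by norm_num)).hasFDerivAt
      have h2 : ∀ {g : ℂ → E}, DifferentiableOn ℂ g O →
          HasDerivAt (fun s : ℝ => g (z + s • w)) (w • deriv g z) 0 := fun {g} hg => by
        have h3 : HasDerivAt g (deriv g z) (z + (0:ℝ) • w) := by
          simpa using (hg.differentiableAt (hO.mem_nhds hz)).hasDerivAt
        exact h3.scomp (0:ℝ) (hl 0)
      have h4 := h1.comp_hasDerivAt (0:ℝ) (h2 hq)
      have h5 := h4.clm_apply ((h2 hq2).const_smul w)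
      simpa [D2, smul_smul, pow_two] using h5
  rw [levi, key, key, levi, smul_eq_mul I w, smul_smul I w]
  have : (I * w) ^ 2 • deriv (deriv q) z = -(w ^ 2 • deriv (deriv q) z) := by
    rw [mul_pow, I_sq, neg_one_mul, neg_smul]
  rw [this, map_neg]
  ring

lemma levi_norm_sq (c : ℝ) (z w : ℂ) : levi (fun p : ℂ => c * ‖p‖ ^ 2) z w = c * ‖w‖ ^ 2 := by
  have hc : ContDiff ℝ 2 (fun p : ℂ => c * ‖p‖ ^ 2) := contDiff_const.mul (contDiff_norm_sq ℝ)
  have key : ∀ w : ℂ, D2 (fun p : ℂ => c * ‖p‖ ^ 2) z w w = c * (2 * ‖w‖ ^ 2) := fun w => by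
    refine D2_eq_of_line hc.contDiffAt
      (ψ' := fun s => c * (2 * ⟪z, w⟫_ℝ + 2 * s * ‖w‖ ^ 2)) ?_ ?_
    · refine Filter.Eventually.of_forall fun s => ?_
      have e : (fun s : ℝ => c * ‖z + s • w‖ ^ 2) =
          fun s => c * (‖z‖ ^ 2 + s * (2 * ⟪z, w⟫_ℝ) + s ^ 2 * ‖w‖ ^ 2) := by
        funext s
        rw [norm_add_sq_real, inner_smul_right, norm_smul, mul_pow, Real.norm_eq_abs, sq_abs]
        ring
      rw [e]
      have h := ((((hasDerivAt_id s).mul_const (2 * ⟪z, w⟫_ℝ)).const_add (‖z‖ ^ 2)).add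
        ((hasDerivAt_pow 2 s).mul_const (‖w‖ ^ 2))).const_mul c
      simpa using h
    · have h := ((((hasDerivAt_id (0:ℝ)).const_mul 2).mul_const (‖w‖ ^ 2)).const_add
        (2 * ⟪z, w⟫_ℝ)).const_mul c
      simpa using h
  rw [levi, key, key, norm_smul, norm_I, one_mul]
  ring

/-- A disc mapped into the domain of a plurisubharmonic function that vanishes on the boundary and
is negative well inside is mapped to the negative set. -/
lemma neg_of_levi_nonneg [CompleteSpace E] {T : E → ℝ} {U : Set E} (hU : IsOpen U)
    (hT : ContDiffOn ℝ 2 T U) (hL : ∀ p ∈ U, ∀ w, 0 ≤ levi T p w) {q : ℂ → E}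
    (hqc : ContinuousOn q (closedBall 0 1)) (hq : DifferentiableOn ℂ q (ball 0 1))
    (hqU : MapsTo q (closedBall 0 1) U) (hq0 : ∀ ζ, ‖ζ‖ = 1 → T (q ζ) = 0) {s : ℝ} (hs : 0 < s)
    (hs1 : s < 1) (hqs : ∀ z, ‖z‖ ≤ s → T (q z) < 0) {z : ℂ} (hz : ‖z‖ < 1) : T (q z) < 0 := by
  rcases le_or_gt ‖z‖ s with hzs | hzs
  · exact hqs z hzs
  have hTq : ContinuousOn (T ∘ q) (closedBall 0 1) := hT.continuousOn.comp hqc hqU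
  obtain ⟨c₀, hc₀, hqc₀⟩ : ∃ c₀ > 0, ∀ z, ‖z‖ = s → T (q z) ≤ -c₀ := by
    obtain ⟨x, hx, hmax⟩ := (isCompact_sphere (0:ℂ) s).exists_isMaxOn
      (NormedSpace.sphere_nonempty.2 hs.le)
      (hTq.mono (sphere_subset_closedBall.trans (closedBall_subset_closedBall hs1.le)))
    refine ⟨-T (q x), neg_pos.2 (hqs x (mem_sphere_zero_iff_norm.1 hx).le), fun z hz => ?_⟩
    rw [neg_neg]
    exact hmax (mem_sphere_zero_iff_norm.2 hz)
  set c : ℝ := c₀ * s ^ 2 with hc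
  have hc' : 0 < c := by positivity
  set G : ℂ → ℝ := fun z => (T ∘ q) z - ((fun p : ℂ => -c * ‖p‖ ^ 2) ∘ (fun z => z⁻¹)) z with hG
  set A : Set ℂ := closedBall 0 1 \ ball 0 s with hA
  have hAc : IsCompact A := (isCompact_closedBall 0 1).diff isOpen_ball
  have hA0 : ∀ x ∈ A, x ≠ 0 := fun x hx h => hx.2 (by simp [h, hs])
  have hGc : ContinuousOn G A := by
    refine (hTq.mono sdiff_subset).sub ?_
    have : ContinuousOn (fun z : ℂ => z⁻¹) A := continuousOn_id.inv₀ hA0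
    exact continuousOn_const.mul (this.norm.pow 2)
  have hzA : z ∈ A := ⟨mem_closedBall_zero_iff.2 hz.le, fun h =>
    (mem_ball_zero_iff.1 h).not_ge hzs.le⟩
  obtain ⟨x, hx, hmax⟩ := hAc.exists_isMaxOn ⟨z, hzA⟩ hGc
  have hGval : ∀ y, G y = T (q y) + c * (‖y‖⁻¹) ^ 2 := fun y => by simp [hG]
  have hGz : G z ≤ c := by
    have hx1 : ‖x‖ ≤ 1 := mem_closedBall_zero_iff.1 hx.1
    have hxs : s ≤ ‖x‖ := not_lt.1 fun h => hx.2 (mem_ball_zero_iff.2 h)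
    refine le_trans (hmax hzA) ?_
    change G x ≤ c
    rcases hx1.eq_or_lt with hx1 | hx1
    · rw [hGval, hq0 x hx1, hx1]
      simp
    rcases hxs.eq_or_lt with hxs | hxs
    · have h1 := hqc₀ x hxs.symm
      rw [hGval, ← hxs, hc]
      have : c₀ * s ^ 2 * s⁻¹ ^ 2 = c₀ := by field_simp
      rw [this]
      have : 0 < c₀ * s ^ 2 := by positivity
      linarith
    exfalso
    have hx0 := hA0 x hx
    have hxb : x ∈ ball (0:ℂ) 1 := mem_ball_zero_iff.2 hx1
    have hqU' : U ∈ 𝓝 (q x) := hU.mem_nhds (hqU (ball_subset_closedBall hxb))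
    have hinv : DifferentiableOn ℂ (fun z : ℂ => z⁻¹) {0}ᶜ := fun y hy =>
      (differentiableAt_inv hy).differentiableWithinAt
    have hn : ContDiff ℝ 2 (fun p : ℂ => -c * ‖p‖ ^ 2) := contDiff_const.mul (contDiff_norm_sq ℝ)
    have hC1 : ContDiffAt ℝ 2 (T ∘ q) x := (hT.contDiffAt hqU').comp x
      (((hq.contDiffOn isOpen_ball).contDiffAt (isOpen_ball.mem_nhds hxb) :
        ContDiffAt ℂ 2 q x).restrict_scalars ℝ)
    have hC2 : ContDiffAt ℝ 2 ((fun p : ℂ => -c * ‖p‖ ^ 2) ∘ (fun z => z⁻¹)) x :=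
      hn.contDiffAt.comp x (((hinv.contDiffOn isOpen_compl_singleton).contDiffAt
        (isOpen_compl_singleton.mem_nhds hx0) : ContDiffAt ℂ 2 _ x).restrict_scalars ℝ)
    refine not_isLocalMax_of_levi_pos (w := 1) (hC1.sub hC2) ?_ (hmax.isLocalMax ?_)
    · have e : levi (fun y => (T ∘ q) y - ((fun p : ℂ => -c * ‖p‖ ^ 2) ∘ (fun z => z⁻¹)) y) x 1 =
          levi (T ∘ q) x 1 - levi ((fun p : ℂ => -c * ‖p‖ ^ 2) ∘ (fun z => z⁻¹)) x 1 := by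
        simp only [levi]
        have h1 := D2_sub hC1 hC2 1
        have h2 := D2_sub hC1 hC2 (I • 1)
        rw [h1, h2]
        ring
      rw [e, levi_comp_holomorphic isOpen_ball hq hxb (hT.contDiffAt hqU'),
        levi_comp_holomorphic isOpen_compl_singleton hinv hx0 hn.contDiffAt, levi_norm_sq]
      have h1 := hL _ (hqU (ball_subset_closedBall hxb)) ((1:ℂ) • deriv q x)
      have h2 : 0 < ‖(1:ℂ) • deriv (fun z : ℂ => z⁻¹) x‖ := by
        rw [norm_pos_iff, one_smul, deriv_inv]
        exact neg_ne_zero.2 (inv_ne_zero (pow_ne_zero _ hx0))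
      have : 0 < c * ‖(1:ℂ) • deriv (fun z : ℂ => z⁻¹) x‖ ^ 2 := by positivity
      linarith
    · have h1 : IsOpen (ball (0:ℂ) 1 \ closedBall 0 s) := isOpen_ball.sdiff isClosed_closedBall
      refine Filter.mem_of_superset (h1.mem_nhds ⟨hxb, fun h =>
        (mem_closedBall_zero_iff.1 h).not_gt hxs⟩) ?_
      exact sdiff_subset_sdiff ball_subset_closedBall ball_subset_closedBall
  rw [hGval] at hGz
  have h1 : 1 < ‖z‖⁻¹ := (one_lt_inv₀ (hs.trans hzs)).2 hz
  have h2 : 1 < ‖z‖⁻¹ ^ 2 := one_lt_pow₀ h1 (by norm_num)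
  nlinarith

end Subharmonic

section Divisor

variable {n : ℕ}

lemma isDivisor_one : IsDivisor n (fun _ => 1) :=
  ⟨differentiable_const _, fun _ _ => one_ne_zero, fun f hf =>
    ⟨0, f, differentiable_const _, hf, fun z _ => by simp⟩⟩

lemma IsDivisor.mul_sub {b : ℂ → ℂ} (hb : IsDivisor n b) {a : ℂ} (ha : a ∈ ball (0:ℂ) 1) :
    IsDivisor n (fun z => b z * (z - a)) := by
  obtain ⟨h1, h2, h3⟩ := hb
  refine ⟨h1.mul (differentiable_id.sub_const a), fun ζ hζ => mul_ne_zero (h2 ζ hζ) ?_,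
    fun f hf => ?_⟩
  · rintro h
    rw [sub_eq_zero.1 h] at hζ
    exact (mem_ball_zero_iff.1 ha).ne hζ
  · obtain ⟨H, q, hH, hq, hf'⟩ := h3 f hf
    have hqa : DifferentiableAt ℂ q a := hq.differentiableAt isOpen_ball ha
    refine ⟨fun z => H z + b z • q a, dslope q a, hH.add (h1.smul_const _), ⟨?_, ?_⟩,
      fun z hz => ?_⟩
    · exact (differentiableOn_dslope (isOpen_ball.mem_nhds ha)).2 hq.1
    · rw [closure_ball _ one_ne_zero]
      have hqc := hq.2
      rw [closure_ball _ one_ne_zero] at hqc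
      exact (continuousOn_dslope (Filter.mem_of_superset (isOpen_ball.mem_nhds ha)
        ball_subset_closedBall)).2 ⟨hqc, hqa⟩
    · rw [hf' z hz, mul_smul, sub_smul_dslope, add_assoc, ← smul_add]
      simp

lemma IsDivisor.mul_sub_pow {b : ℂ → ℂ} (hb : IsDivisor n b) {a : ℂ} (ha : a ∈ ball (0:ℂ) 1)
    (d : ℕ) : IsDivisor n (fun z => b z * (z - a) ^ d) := by
  induction d with
  | zero => simpa using hb
  | succ d ih => simpa only [pow_succ, mul_assoc] using ih.mul_sub ha

lemma isDivisor_prod {ι : Type*} (s : Finset ι) {a : ι → ℂ} (ha : ∀ j, a j ∈ ball (0:ℂ) 1) (d : ℕ) :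
    IsDivisor n (fun z => ∏ j ∈ s, (z - a j) ^ d) := by
  classical
  induction s using Finset.induction_on with
  | empty => simpa using isDivisor_one
  | insert i s hi ih =>
    have := ih.mul_sub_pow (ha i) d
    simpa only [Finset.prod_insert hi, mul_comm] using this

lemma iteratedDeriv_eq_zero_of_eventuallyEq {G : Type*} [NormedAddCommGroup G] [NormedSpace ℂ G]
    [CompleteSpace G] {a : ℂ} {O : Set ℂ} (hO : IsOpen O) (ha : a ∈ O) :
    ∀ (m d : ℕ) (F g : ℂ → G), m < d → DifferentiableOn ℂ g O →
      F =ᶠ[𝓝 a] (fun z => (z - a) ^ d • g z) → iteratedDeriv m F a = 0 := by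
  intro m
  induction m with
  | zero =>
    intro d F g hd hg hF
    rw [iteratedDeriv_zero, hF.eq_of_nhds]
    simp [hd.ne']
  | succ m ih =>
    intro d F g hd hg hF
    obtain ⟨d, rfl⟩ : ∃ k, d = k + 1 := ⟨d - 1, by omega⟩
    rw [iteratedDeriv_succ']
    refine ih d _ (fun z => ((d + 1 : ℕ) : ℂ) • g z + (z - a) • deriv g z) (by omega)
      ((hg.const_smul (((d + 1 : ℕ) : ℂ))).add
        ((differentiableOn_id.sub_const a).smul (hg.deriv hO))) ?_
    refine hF.deriv.trans ?_
    filter_upwards [hO.mem_nhds ha] with z hz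
    have h1 : HasDerivAt (fun z : ℂ => (z - a) ^ (d + 1)) (((d + 1 : ℕ) : ℂ) * (z - a) ^ d) z := by
      have h := ((hasDerivAt_id z).sub_const a).pow (d + 1)
      simp only [Nat.add_sub_cancel, mul_one, id] at h
      exact h
    have h2 := h1.smul (hg.differentiableAt (hO.mem_nhds hz)).hasDerivAt
    have h3 := h2.deriv
    change deriv (fun z => (z - a) ^ (d + 1) • g z) z = _ at h3
    rw [h3, smul_add, smul_smul, smul_smul, add_comm, pow_succ, mul_comm ((d + 1 : ℕ) : ℂ)]

end Divisor

section Closing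

variable {n : ℕ}

/-- A disc can be approximated, modulo `b`, by discs holomorphic in a neighbourhood of the closed
unit disc. -/
lemma IsDivisor.exists_dilation {b : ℂ → ℂ} (hb : IsDivisor n b)
    {f : ℂ → EuclideanSpace ℂ (Fin n)} (hf : DiffContOnCl ℂ f (ball 0 1)) {η : ℝ} (hη : 0 < η) :
    ∃ (f' G : ℂ → EuclideanSpace ℂ (Fin n)) (R : ℝ), 1 < R ∧ DifferentiableOn ℂ f' (ball 0 R) ∧
      DiffContOnCl ℂ G (ball 0 1) ∧
      ∀ z ∈ closedBall (0:ℂ) 1, f' z = f z + b z • G z ∧ ‖f' z - f z‖ < η := by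
  obtain ⟨hbd, -, h3⟩ := hb
  obtain ⟨H, q, hH, hq, hfq⟩ := h3 f hf
  obtain ⟨C, hC⟩ := (isCompact_closedBall (0:ℂ) 1).exists_bound_of_continuousOn
    hbd.continuous.continuousOn
  have hC0 : 0 ≤ C := (norm_nonneg _).trans (hC 0 (by simp))
  obtain ⟨r, hr, hr1, hrq⟩ := hq.exists_dilation (show 0 < η / (C + 1) by positivity)
  have hR : 1 < r⁻¹ := (one_lt_inv₀ hr).2 hr1
  have hqr := hq.comp_dilation hr
  have hsub : closedBall (0:ℂ) 1 ⊆ ball 0 r⁻¹ := closedBall_subset_ball hR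
  have e : ∀ z ∈ closedBall (0:ℂ) 1,
      H z + b z • q (r * z) = f z + b z • (q (r * z) - q z) := fun z hz => by
    rw [hfq z hz, smul_sub]
    abel
  refine ⟨fun z => H z + b z • q (r * z), fun z => q (r * z) - q z, r⁻¹, hR,
    hH.differentiableOn.add (hbd.differentiableOn.smul hqr), ?_, fun z hz => ⟨e z hz, ?_⟩⟩
  · refine DiffContOnCl.sub ⟨hqr.mono (ball_subset_ball hR.le), ?_⟩ hq
    rw [closure_ball _ one_ne_zero]
    exact hqr.continuousOn.mono hsub
  · change ‖H z + b z • q (r * z) - f z‖ < η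
    rw [e z hz, add_sub_cancel_left, norm_smul]
    calc ‖b z‖ * ‖q (r * z) - q z‖ ≤ C * (η / (C + 1)) :=
          mul_le_mul (hC z hz) (hrq z hz).le (norm_nonneg _) hC0
      _ < η := by
          rw [← mul_div_assoc, div_lt_iff₀ (by positivity)]
          nlinarith

variable {U : Set (EuclideanSpace ℂ (Fin n))} {K : Set ℂ}

/-- A neighbourhood of a compact set of boundary discs contains nearby interior discs. -/
lemma exists_annulus_mapsTo {f A B : ℂ → EuclideanSpace ℂ (Fin n)} {O : Set ℂ} {r : ℝ}
    (hU : IsOpen U) (hO : IsOpen O) (hSO : sphere 0 1 ⊆ O) (hf : ContinuousOn f O)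
    (hA : ContinuousOn A O) (hB : ContinuousOn B O)
    (h : ∀ ζ ∈ sphere (0:ℂ) 1, ∀ l : ℂ, ‖l‖ ≤ r → f ζ + l • A ζ + l ^ 2 • B ζ ∈ U)
    (hK : IsCompact K) (hKb : K ⊆ ball 0 1) :
    ∃ s : ℝ, 0 < s ∧ s < 1 ∧ K ⊆ closedBall 0 s ∧ ∀ z : ℂ, s ≤ ‖z‖ → ‖z‖ ≤ 1 → ∀ l : ℂ, ‖l‖ ≤ r →
      f z + l • A z + l ^ 2 • B z ∈ U := by
  have hc : IsCompact (sphere (0:ℂ) 1 ×ˢ closedBall (0:ℂ) r) :=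
    (isCompact_sphere 0 1).prod (isCompact_closedBall 0 r)
  obtain ⟨σ, hσ, hu⟩ := hc.exists_uniform_nhds
    (P := fun p : ℂ × ℂ => f p.1 + p.2 • A p.1 + p.2 ^ 2 • B p.1 ∈ U) (fun x hx => by
      have hx1 : O ∈ 𝓝 x.1 := hO.mem_nhds (hSO hx.1)
      have h1 : ∀ {g : ℂ → EuclideanSpace ℂ (Fin n)}, ContinuousOn g O →
          ContinuousAt (fun p : ℂ × ℂ => g p.1) x := fun hg =>
        ContinuousAt.comp (f := Prod.fst) (hg.continuousAt hx1) continuousAt_fst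
      have h2 : ContinuousAt (fun p : ℂ × ℂ => f p.1 + p.2 • A p.1 + p.2 ^ 2 • B p.1) x :=
        ((h1 hf).add (continuousAt_snd.smul (h1 hA))).add ((continuousAt_snd.pow 2).smul (h1 hB))
      exact h2.eventually_mem (hU.mem_nhds (h _ hx.1 _ (mem_closedBall_zero_iff.1 hx.2))))
  obtain ⟨s₀, hs₀, hKs⟩ : ∃ s₀ < (1:ℝ), K ⊆ closedBall 0 s₀ := by
    obtain ⟨s₀, h1, h2⟩ := exists_lt_subset_ball hK.isClosed hKb
    exact ⟨s₀, h1, h2.trans ball_subset_closedBall⟩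
  refine ⟨max (max s₀ (1 - σ / 2)) (1 / 2), by simp, by simp [hs₀, hσ]; norm_num,
    hKs.trans (closedBall_subset_closedBall (by simp)), fun z hz hz1 l hl => ?_⟩
  have hz0 : 1 / 2 ≤ ‖z‖ := (le_max_right _ _).trans hz
  have hzσ : 1 - σ / 2 ≤ ‖z‖ := ((le_max_right _ _).trans (le_max_left _ _)).trans hz
  have hzp : 0 < ‖z‖ := by linarith
  refine hu (((‖z‖⁻¹ : ℝ) : ℂ) * z, l) ⟨?_, mem_closedBall_zero_iff.2 hl⟩ (z, l) ?_
  · rw [mem_sphere_zero_iff_norm, norm_mul, norm_real, norm_inv, norm_norm,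
      inv_mul_cancel₀ hzp.ne']
  · rw [Prod.dist_eq, dist_self, max_lt_iff, dist_eq_norm]
    refine ⟨?_, hσ⟩
    have e : z - ((‖z‖⁻¹ : ℝ) : ℂ) * z = ((1 - ‖z‖⁻¹ : ℝ) : ℂ) * z := by
      push_cast
      ring
    have e2 : (1 - ‖z‖⁻¹) * ‖z‖ = ‖z‖ - 1 := by
      rw [sub_mul, inv_mul_cancel₀ hzp.ne', one_mul]
    change ‖z - ((‖z‖⁻¹ : ℝ) : ℂ) * z‖ < σ
    rw [e, norm_mul, norm_real, ← norm_norm z, ← norm_mul, norm_norm z, e2, Real.norm_eq_abs,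
        abs_lt]
    constructor <;> linarith

end Closing

section Attach

variable {n : ℕ} {U Ω : Set (EuclideanSpace ℂ (Fin n))} {K : Set ℂ}

/-- Discs whose boundary circle solves the level equation are attached to the boundary. -/
lemma exists_attached {T : EuclideanSpace ℂ (Fin n) → ℝ} {b : ℂ → ℂ}
    {f P Q : ℂ → EuclideanSpace ℂ (Fin n)} {R r α η : ℝ} {M₁ M₂ : ℕ}
    (hU : IsOpen U) (hT : ContDiffOn ℝ 2 T U) (hL : ∀ p ∈ U, ∀ w, 0 ≤ levi T p w)
    (hΩo : IsOpen Ω) (hΩ : Ω = {z ∈ U | T z < 0}) (hb : Differentiable ℂ b) (hR : 1 < R)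
    (hf : DifferentiableOn ℂ f (ball 0 R)) (hfΩ : MapsTo f (closedBall 0 1) Ω)
    (hP : Differentiable ℂ P) (hQ : Differentiable ℂ Q) (hr : 0 ≤ r)
    (hmem : ∀ ζ ∈ sphere (0:ℂ) 1, ∀ l : ℂ, ‖l‖ ≤ r →
      f ζ + l • (b ζ • (ζ ^ M₁)⁻¹ • P ζ) + l ^ 2 • (b ζ • (ζ ^ M₂)⁻¹ • Q ζ) ∈ U)
    (hα : 0 < α) (hα1 : α ≤ 1)
    (hh : ∀ N : ℕ, ∃ h : ℂ → ℂ, DiscReg α 3 h ∧ (∀ z, ‖z‖ ≤ 1 → ‖cexp (h z)‖ ≤ r) ∧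
      ∀ ζ : ℂ, ‖ζ‖ = 1 → T (f ζ + (ζ ^ N * cexp (h ζ)) • (b ζ • (ζ ^ M₁)⁻¹ • P ζ) +
        (ζ ^ N * cexp (h ζ)) ^ 2 • (b ζ • (ζ ^ M₂)⁻¹ • Q ζ)) = 0)
    (hK : IsCompact K) (hKb : K ⊆ ball 0 1) (hη : 0 < η) :
    ∃ G : ℂ → EuclideanSpace ℂ (Fin n), DiscReg α 3 G ∧ (∀ z ∈ K, ‖b z • G z‖ < η) ∧
      MapsTo (fun z => f z + b z • G z) (ball 0 1) Ω ∧
      ∀ ζ : ℂ, ‖ζ‖ = 1 → T (f ζ + b ζ • G ζ) = 0 := by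
  have hsub : closedBall (0:ℂ) 1 ⊆ ball 0 R := closedBall_subset_ball hR
  have hinv : ∀ M : ℕ, ContinuousOn (fun z : ℂ => (z ^ M)⁻¹) (ball (0:ℂ) R \ {0}) := fun M =>
    (continuousOn_pow M).inv₀ fun z hz => pow_ne_zero _ hz.2
  obtain ⟨s, hs, hs1, hKs, htube⟩ := exists_annulus_mapsTo (f := f)
    (A := fun z => b z • (z ^ M₁)⁻¹ • P z) (B := fun z => b z • (z ^ M₂)⁻¹ • Q z)
    (O := ball (0:ℂ) R \ {0}) (r := r) hU (isOpen_ball.sdiff isClosed_singleton)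
    (fun ζ hζ => ⟨hsub (sphere_subset_closedBall hζ), by
      rintro rfl
      simp at hζ⟩)
    (hf.continuousOn.mono sdiff_subset)
    (hb.continuous.continuousOn.smul ((hinv M₁).smul hP.continuous.continuousOn))
    (hb.continuous.continuousOn.smul ((hinv M₂).smul hQ.continuous.continuousOn)) hmem hK hKb
  have hfc : ContinuousOn f (closedBall 0 1) := hf.continuousOn.mono hsub
  obtain ⟨τ, hτ, hτΩ⟩ := ((isCompact_closedBall (0:ℂ) 1).image_of_continuousOn
    hfc).exists_thickening_subset_open hΩo hfΩ.image_subset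
  have hbound : ∀ {E : Type} [NormedAddCommGroup E] {g : ℂ → E}, Continuous g →
      ∃ C, 0 ≤ C ∧ ∀ z ∈ closedBall (0:ℂ) 1, ‖g z‖ ≤ C := fun {E} _ {g} hg => by
    obtain ⟨C, hC⟩ := (isCompact_closedBall (0:ℂ) 1).exists_bound_of_continuousOn hg.continuousOn
    exact ⟨C, (norm_nonneg _).trans (hC 0 (by simp)), hC⟩
  obtain ⟨Cb, hCb0, hCb⟩ := hbound hb.continuous
  obtain ⟨C₁, hC₁0, hC₁⟩ := hbound hP.continuous
  obtain ⟨C₂, hC₂0, hC₂⟩ := hbound hQ.continuous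
  set C := Cb * (r * C₁ + r ^ 2 * C₂) with hCdef
  have hC0 : 0 ≤ C := by positivity
  have hmη : 0 < min η τ := lt_min hη hτ
  obtain ⟨k, hk⟩ := exists_pow_lt_of_lt_one (show 0 < min η τ / (C + 1) by positivity) hs1
  have hkC : s ^ k * C < min η τ := by
    rw [lt_div_iff₀ (by positivity)] at hk
    have : 0 < s ^ k := by positivity
    nlinarith
  obtain ⟨h, hreg, hhr, hh0⟩ := hh (k + M₁ + M₂)
  set G : ℂ → EuclideanSpace ℂ (Fin n) := fun z => (z ^ (k + M₂) * cexp (h z)) • P z +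
    (z ^ (2 * k + 2 * M₁ + M₂) * (cexp (h z) * cexp (h z))) • Q z with hG
  have hentire : ∀ {E : Type} [NormedAddCommGroup E] [NormedSpace ℂ E] [CompleteSpace E]
      {g : ℂ → E}, Differentiable ℂ g → DiscReg α 3 g := fun {E} _ _ _ {g} hg =>
    DiscReg.of_differentiableOn hα hα1 hR hg.differentiableOn
  have hGreg : DiscReg α 3 G :=
    (((hentire (differentiable_id.pow (k + M₂))).smul hreg.cexp).smul (hentire hP)).add
      (((hentire (differentiable_id.pow (2 * k + 2 * M₁ + M₂))).smul
        (hreg.cexp.smul hreg.cexp)).smul (hentire hQ))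
  have hGsmall : ∀ z : ℂ, ‖z‖ ≤ s → ‖b z • G z‖ < min η τ := fun z hz => by
    have hz1 : ‖z‖ ≤ 1 := hz.trans hs1.le
    have hzm := mem_closedBall_zero_iff.2 hz1
    have he := hhr z hz1
    have hp : ∀ m, k ≤ m → ‖z‖ ^ m ≤ s ^ k := fun m hm =>
      (pow_le_pow_of_le_one (norm_nonneg _) hz1 hm).trans (pow_le_pow_left₀ (norm_nonneg _) hz k)
    refine lt_of_le_of_lt ?_ hkC
    rw [norm_smul]
    have h1 : ‖(z ^ (k + M₂) * cexp (h z)) • P z‖ ≤ s ^ k * r * C₁ := by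
      rw [norm_smul, norm_mul, norm_pow]
      exact mul_le_mul (mul_le_mul (hp _ (by omega)) he (norm_nonneg _) (by positivity))
        (hC₁ z hzm) (norm_nonneg _) (by positivity)
    have h2 : ‖(z ^ (2 * k + 2 * M₁ + M₂) * (cexp (h z) * cexp (h z))) • Q z‖ ≤
        s ^ k * (r * r) * C₂ := by
      rw [norm_smul, norm_mul, norm_pow, norm_mul]
      exact mul_le_mul (mul_le_mul (hp _ (by omega)) (mul_le_mul he he (norm_nonneg _) hr)
        (by positivity) (by positivity)) (hC₂ z hzm) (norm_nonneg _) (by positivity)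
    calc ‖b z‖ * ‖G z‖ ≤ Cb * (s ^ k * r * C₁ + s ^ k * (r * r) * C₂) :=
          mul_le_mul (hCb z hzm) ((norm_add_le _ _).trans (add_le_add h1 h2)) (norm_nonneg _) hCb0
      _ = s ^ k * C := by rw [hCdef]; ring
  have hGeq : ∀ z : ℂ, z ≠ 0 → f z + b z • G z =
      f z + (z ^ (k + M₁ + M₂) * cexp (h z)) • (b z • (z ^ M₁)⁻¹ • P z) +
        (z ^ (k + M₁ + M₂) * cexp (h z)) ^ 2 • (b z • (z ^ M₂)⁻¹ • Q z) := fun z hz => by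
    have hc : ∀ M : ℕ, z ^ M * (z ^ M)⁻¹ = 1 := fun M => mul_inv_cancel₀ (pow_ne_zero M hz)
    have h1 : b z * (z ^ (k + M₂) * cexp (h z)) =
        z ^ (k + M₁ + M₂) * cexp (h z) * (b z * (z ^ M₁)⁻¹) := by
      rw [show z ^ (k + M₁ + M₂) = z ^ (k + M₂) * z ^ M₁ by ring]
      linear_combination (-(b z * (z ^ (k + M₂) * cexp (h z)))) * hc M₁
    have h2 : b z * (z ^ (2 * k + 2 * M₁ + M₂) * (cexp (h z) * cexp (h z))) =
        (z ^ (k + M₁ + M₂) * cexp (h z)) ^ 2 * (b z * (z ^ M₂)⁻¹) := by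
      rw [mul_pow, ← pow_mul, show z ^ ((k + M₁ + M₂) * 2) =
        z ^ (2 * k + 2 * M₁ + M₂) * z ^ M₂ by ring]
      linear_combination (-(b z * (z ^ (2 * k + 2 * M₁ + M₂) * (cexp (h z) * cexp (h z))))) * hc M₂
    simp only [hG, smul_add, smul_smul]
    rw [h1, h2, ← add_assoc (f z)]
  have hqneg : ∀ z : ℂ, ‖z‖ ≤ s → f z + b z • G z ∈ Ω := fun z hz => by
    refine hτΩ (mem_thickening_iff.2 ⟨f z, mem_image_of_mem f
      (mem_closedBall_zero_iff.2 (hz.trans hs1.le)), ?_⟩)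
    rw [dist_eq_norm, add_sub_cancel_left]
    exact (hGsmall z hz).trans_le (min_le_right _ _)
  have hqU : MapsTo (fun z => f z + b z • G z) (closedBall 0 1) U := fun z hz => by
    have hz1 := mem_closedBall_zero_iff.1 hz
    rcases le_total ‖z‖ s with hzs | hzs
    · have := hqneg z hzs
      rw [hΩ] at this
      exact this.1
    · change f z + b z • G z ∈ U
      rw [hGeq z (norm_pos_iff.1 (hs.trans_le hzs))]
      refine htube z hzs hz1 _ ?_
      rw [norm_mul, norm_pow]
      exact (mul_le_of_le_one_left (norm_nonneg _) (pow_le_one₀ (norm_nonneg _) hz1)).trans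
        (hhr z hz1)
  have hq0 : ∀ ζ : ℂ, ‖ζ‖ = 1 → T (f ζ + b ζ • G ζ) = 0 := fun ζ hζ => by
    rw [hGeq ζ (norm_pos_iff.1 (by rw [hζ]; exact one_pos))]
    exact hh0 ζ hζ
  have hGd := hGreg.holder.1
  have hGc : ContinuousOn G (closedBall 0 1) := by
    have := hGd.continuousOn; rwa [closure_ball _ one_ne_zero] at this
  refine ⟨G, hGreg, fun z hz => (hGsmall z (mem_closedBall_zero_iff.1 (hKs hz))).trans_le
    (min_le_left _ _), fun z hz => ?_, hq0⟩
  have := neg_of_levi_nonneg (q := fun z => f z + b z • G z) hU hT hL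
    (hfc.add (hb.continuous.continuousOn.smul hGc))
    ((hf.mono (ball_subset_ball hR.le)).add (hb.differentiableOn.smul hGd.differentiableOn))
    hqU hq0 hs hs1 (fun z hz => by
      have := hqneg z hz
      rw [hΩ] at this
      exact this.2) (mem_ball_zero_iff.1 hz)
  rw [hΩ]
  exact ⟨hqU (ball_subset_closedBall hz), this⟩

end Attach

section Domain

variable {n : ℕ} {U Ω : Set (EuclideanSpace ℂ (Fin n))} {ρ : EuclideanSpace ℂ (Fin n) → ℝ}

/-- Boundary maps are uniform limits of rational maps divisible by `b`. -/
lemma exists_divisible_approx {b : ℂ → ℂ} (hb : Differentiable ℂ b)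
    (hb0 : ∀ ζ : ℂ, ‖ζ‖ = 1 → b ζ ≠ 0) {V : ℂ → EuclideanSpace ℂ (Fin n)}
    (hV : ContinuousOn V (sphere 0 1)) {σ : ℝ} (hσ : 0 < σ) :
    ∃ (M : ℕ) (P : ℂ → EuclideanSpace ℂ (Fin n)), Differentiable ℂ P ∧
      ∀ ζ : ℂ, ‖ζ‖ = 1 → ‖b ζ • (ζ ^ M)⁻¹ • P ζ - V ζ‖ < σ := by
  obtain ⟨C, hC⟩ := (isCompact_sphere (0:ℂ) 1).exists_bound_of_continuousOn
    hb.continuous.continuousOn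
  have hC0 : 0 ≤ C := (norm_nonneg _).trans (hC 1 (by simp))
  obtain ⟨M, P, hP, h⟩ := exists_entire_approx (fun ζ => (b ζ)⁻¹ • V ζ)
    ((hb.continuous.continuousOn.inv₀ fun ζ hζ => hb0 ζ (mem_sphere_zero_iff_norm.1 hζ)).smul hV)
    (show 0 < σ / (C + 1) by positivity)
  refine ⟨M, P, hP, fun ζ hζ => ?_⟩
  have hζ0 : ζ ≠ 0 := norm_pos_iff.1 (by rw [hζ]; exact one_pos)
  have e : b ζ • (ζ ^ M)⁻¹ • P ζ - V ζ =
      -(b ζ • (ζ ^ M)⁻¹ • (ζ ^ M • (b ζ)⁻¹ • V ζ - P ζ)) := by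
    rw [smul_sub, smul_sub, inv_smul_smul₀ (pow_ne_zero _ hζ0), smul_inv_smul₀ (hb0 ζ hζ)]
    abel
  rw [e, norm_neg, norm_smul, norm_smul, norm_inv, norm_pow, hζ, one_pow, inv_one, one_mul]
  calc ‖b ζ‖ * ‖ζ ^ M • (b ζ)⁻¹ • V ζ - P ζ‖ ≤ C * (σ / (C + 1)) :=
        mul_le_mul (hC ζ (mem_sphere_zero_iff_norm.2 hζ)) (h ζ hζ).le (norm_nonneg _) hC0
    _ < σ := by
        rw [← mul_div_assoc, div_lt_iff₀ (by positivity)]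
        nlinarith

lemma isCompact_sublevel_of_neg (hΩU : closure Ω ⊆ U) (hbd : IsBounded Ω) (hρ : ContinuousOn ρ U)
    (hΩ : Ω = {z ∈ U | ρ z < 0}) {c : ℝ} (hc : c < 0) : IsCompact {z ∈ Ω | ρ z ≤ c} := by
  have h : {z ∈ Ω | ρ z ≤ c} = closure Ω ∩ ρ ⁻¹' Iic c := by
    ext z
    refine ⟨fun h => ⟨subset_closure h.1, h.2⟩, fun h => ⟨?_, h.2⟩⟩
    rw [hΩ]
    exact ⟨hΩU h.1, lt_of_le_of_lt h.2 hc⟩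
  rw [h]
  exact hbd.isCompact_closure.of_isClosed_subset ((hρ.mono hΩU).preimage_isClosed_of_isClosed
    isClosed_closure isClosed_Iic) inter_subset_left

/-- Near the boundary, the defining function has no critical points. -/
lemma exists_noncritical (hU : IsOpen U) (hΩU : closure Ω ⊆ U) (hbd : IsBounded Ω)
    (hΩo : IsOpen Ω) (hρ : ContDiffOn ℝ 2 ρ U) (hΩ : Ω = {z ∈ U | ρ z < 0})
    (hD : ∀ z ∈ frontier Ω, fderiv ℝ ρ z ≠ 0) :
    ∃ δ > 0, ∀ z ∈ closure Ω, -δ ≤ ρ z → fderiv ℝ ρ z ≠ 0 := by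
  have hD1 : ContinuousOn (fderiv ℝ ρ) U := hρ.continuousOn_fderiv_of_isOpen hU (by norm_num)
  have hc : IsCompact (closure Ω ∩ fderiv ℝ ρ ⁻¹' {0}) :=
    hbd.isCompact_closure.of_isClosed_subset ((hD1.mono hΩU).preimage_isClosed_of_isClosed
      isClosed_closure isClosed_singleton) inter_subset_left
  rcases (closure Ω ∩ fderiv ℝ ρ ⁻¹' {0}).eq_empty_or_nonempty with h0 | h0
  · refine ⟨1, one_pos, fun z hz _ h => ?_⟩
    have : z ∈ closure Ω ∩ fderiv ℝ ρ ⁻¹' {0} := ⟨hz, h⟩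
    rw [h0] at this
    exact this
  · obtain ⟨x, hx, hmax⟩ := hc.exists_isMaxOn h0
      (hρ.continuousOn.mono (inter_subset_left.trans hΩU))
    have hx0 : ρ x < 0 := by
      by_contra h
      refine hD x ?_ hx.2
      rw [hΩo.frontier_eq]
      refine ⟨hx.1, fun hx' => h ?_⟩
      rw [hΩ] at hx'
      exact hx'.2
    refine ⟨-ρ x / 2, by linarith, fun z hz h1 h2 => ?_⟩
    have : ρ z ≤ ρ x := hmax ⟨hz, h2⟩
    linarith

end Domain

/-- Every holomorphic disc in a bounded strongly pseudoconvex domain `Ω ⊂ ℂⁿ`, `n ≥ 2`, with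
defining function of class `C⁴` can be approximated on compacts, with jet interpolation at
finitely many points, by proper holomorphic discs `𝔻 → Ω` extending to maps of class
`C^{3,α}` on the closed disc and sending the circle to `bΩ`. -/
theorem embed_disc_in_spsc_domain (n : ℕ) (hn : 2 ≤ n)
    (Ω U : Set (EuclideanSpace ℂ (Fin n))) (ρ : EuclideanSpace ℂ (Fin n) → ℝ)
    (hΩbd : IsBounded Ω) (hUopen : IsOpen U) (hΩU : closure Ω ⊆ U)
    (hρC : ContDiffOn ℝ 4 ρ U)
    (hpsh : ∀ z ∈ U, ∀ w : EuclideanSpace ℂ (Fin n), w ≠ 0 → 0 < levi ρ z w)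
    (hΩdef : Ω = {z ∈ U | ρ z < 0})
    (hDρ : ∀ z ∈ frontier Ω, fderiv ℝ ρ z ≠ 0)
    (f₀ : ℂ → EuclideanSpace ℂ (Fin n))
    (hf₀c : ContinuousOn f₀ (closedBall 0 1))
    (hf₀h : DifferentiableOn ℂ f₀ (ball 0 1))
    (hf₀Ω : Set.MapsTo f₀ (closedBall 0 1) Ω)
    (K : Set ℂ) (hKc : IsCompact K) (hKD : K ⊆ ball 0 1)
    (ε : ℝ) (hε : 0 < ε)
    (l : ℕ) (a : Fin l → ℂ) (ha : ∀ j, a j ∈ ball (0:ℂ) 1)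
    (d : ℕ) (α : ℝ) (hα : α ∈ Set.Ioo (0:ℝ) 1) :
    ∃ f : ℂ → EuclideanSpace ℂ (Fin n),
      -- continuous on the closed disc, holomorphic in the open disc
      ContinuousOn f (closedBall 0 1) ∧
      DifferentiableOn ℂ f (ball 0 1) ∧
      -- (i) maps 𝔻 into Ω and the unit circle into {ρ = 0}
      Set.MapsTo f (ball 0 1) Ω ∧
      (∀ ζ : ℂ, ‖ζ‖ = 1 → ρ (f ζ) = 0) ∧
      -- (ii) the restriction f : 𝔻 → Ω is proper
      (∀ L : Set (EuclideanSpace ℂ (Fin n)), L ⊆ Ω → IsCompact L →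
        IsCompact {ζ ∈ ball (0:ℂ) 1 | f ζ ∈ L}) ∧
      -- (iii) approximation on K
      (∀ ζ ∈ K, ‖f ζ - f₀ ζ‖ < ε) ∧
      -- (iv) interpolation of the d-jet at the points a j
      (∀ j : Fin l, ∀ m : ℕ, m < d → iteratedDeriv m (fun ζ => f ζ - f₀ ζ) (a j) = 0) ∧
      -- (v) the derivatives up to order 3 extend continuously to the closed disc,
      -- and the third derivative is α-Hölder on the closed disc
      (∃ g : ℕ → ℂ → EuclideanSpace ℂ (Fin n),
        (∀ m : ℕ, m ≤ 3 → ContinuousOn (g m) (closedBall 0 1) ∧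
          ∀ ζ ∈ ball (0:ℂ) 1, g m ζ = iteratedDeriv m f ζ) ∧
        ∃ C : ℝ, 0 ≤ C ∧ ∀ ζ ∈ closedBall (0:ℂ) 1, ∀ ξ ∈ closedBall (0:ℂ) 1,
          ‖g 3 ζ - g 3 ξ‖ ≤ C * ‖ζ - ξ‖ ^ α) := by
  have hρc : ContinuousOn ρ U := hρC.continuousOn
  have hρ2 : ContDiffOn ℝ 2 ρ U := hρC.of_le (by norm_num)
  have hΩo : IsOpen Ω := by
    rw [hΩdef]
    exact hρc.isOpen_inter_preimage hUopen isOpen_Iio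
  have hΩsub : Ω ⊆ U := subset_closure.trans hΩU
  have hneg : ∀ z ∈ Ω, ρ z < 0 := fun z hz => by
    rw [hΩdef] at hz
    exact hz.2
  obtain ⟨δ₀, hδ₀, hcrit⟩ := exists_noncritical hUopen hΩU hΩbd hΩo hρ2 hΩdef hDρ
  obtain ⟨κ, hκ, hlevel⟩ := exists_discReg_level (E := EuclideanSpace ℂ (Fin n)) hα.1 hα.2
  have hZ : IsCompact (closure Ω ∩ ρ ⁻¹' Ici (-δ₀)) :=
    hΩbd.isCompact_closure.of_isClosed_subset ((hρc.mono hΩU).preimage_isClosed_of_isClosed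
      isClosed_closure isClosed_Ici) inter_subset_left
  obtain ⟨r, hr, δ, hδ, hfam⟩ := exists_isLevelFamily hn hUopen hρ2 hZ
    (inter_subset_left.trans hΩU) (fun p hp => hcrit p hp.1 hp.2)
    (fun p hp => hpsh p (hΩU hp.1)) hκ
  set δ₁ := min δ δ₀ with hδ₁def
  have hδ₁ : 0 < δ₁ := lt_min hδ hδ₀
  have hb : IsDivisor n (fun z => ∏ j, (z - a j) ^ d) := isDivisor_prod Finset.univ ha d
  set b : ℂ → ℂ := fun z => ∏ j, (z - a j) ^ d with hbdef
  have hf₀ : IsDisc Ω f₀ := ⟨⟨hf₀h, by rwa [closure_ball _ one_ne_zero]⟩, hf₀Ω⟩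
  have hε3 : 0 < ε / 3 := by positivity
  -- push the boundary close to the level zero
  obtain ⟨f₁, hf₁, ⟨G₁, hG₁, hf₁eq, hG₁K⟩, hf₁ρ⟩ := reaches_level hn hΩo hΩbd hb hKc hKD
    (hρ2.mono hΩsub) (fun z hz => hpsh z (hΩsub hz)) (show -δ₁ / 2 < -δ₁ / 4 by linarith)
    (isCompact_sublevel_of_neg hΩU hΩbd hρc hΩdef (by linarith)) hf₀ _ hε3
  -- make the disc holomorphic across the circle
  have hS : IsCompact (f₁ '' closedBall 0 1) :=
    (isCompact_closedBall 0 1).image_of_continuousOn hf₁.continuousOn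
  obtain ⟨τ, hτ, hτΩ⟩ := hS.exists_thickening_subset_open hΩo hf₁.2.image_subset
  obtain ⟨τ', hτ', hmod⟩ := exists_modulus hΩo (hρc.mono hΩsub) hS hf₁.2.image_subset
    (half_pos hδ₁)
  obtain ⟨f₂, G₂, R, hR, hf₂, hG₂, hf₂eq⟩ := hb.exists_dilation hf₁.1
    (lt_min hε3 (lt_min hτ hτ'))
  have hf₂Ω : MapsTo f₂ (closedBall 0 1) Ω := fun z hz =>
    hτΩ (mem_thickening_iff.2 ⟨f₁ z, mem_image_of_mem f₁ hz, by
      rw [dist_eq_norm]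
      exact ((hf₂eq z hz).2.trans_le (min_le_right _ _)).trans_le (min_le_left _ _)⟩)
  have hf₂ρ : ∀ ζ ∈ sphere (0:ℂ) 1, -δ₁ ≤ ρ (f₂ ζ) := fun ζ hζ => by
    have hζ' := sphere_subset_closedBall hζ
    have h1 := hmod (f₁ ζ) (mem_image_of_mem f₁ hζ') (f₂ ζ)
      (((hf₂eq ζ hζ').2.trans_le (min_le_right _ _)).trans_le (min_le_right _ _))
    have h2 := hf₁ρ ζ (mem_sphere_zero_iff_norm.1 hζ)
    have h3 := (abs_lt.1 h1).1
    linarith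
  -- attach the boundary
  have hsub : closedBall (0:ℂ) 1 ⊆ ball 0 R := closedBall_subset_ball hR
  have hf₂c : ContinuousOn f₂ (sphere 0 1) :=
    hf₂.continuousOn.mono (sphere_subset_closedBall.trans hsub)
  obtain ⟨V, W, hV, hW, r₁, hr₁, hr₁r, hVW⟩ := hfam f₂ hf₂c fun ζ hζ => by
    have h1 := hf₂Ω (sphere_subset_closedBall hζ)
    have h2 := hf₂ρ ζ hζ
    have h3 : δ₁ ≤ δ := min_le_left _ _
    have h4 : δ₁ ≤ δ₀ := min_le_right _ _
    exact ⟨⟨subset_closure h1, show -δ₀ ≤ ρ (f₂ ζ) by linarith⟩, by linarith, hneg _ h1⟩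
  obtain ⟨σ, hσ, hstab⟩ := IsLevelFamily.exists_stable hUopen (hρC.of_le (by norm_num))
    (isCompact_sphere 0 1) hf₂c hV hW hVW
  obtain ⟨M₁, P, hP, hPV⟩ := exists_divisible_approx hb.1 hb.2.1 hV hσ
  obtain ⟨M₂, Q, hQ, hQW⟩ := exists_divisible_approx hb.1 hb.2.1 hW hσ
  have hAB : ∀ ζ ∈ sphere (0:ℂ) 1, IsLevelFamily ρ U κ r₁ r (f₂ ζ)
      (b ζ • (ζ ^ M₁)⁻¹ • P ζ) (b ζ • (ζ ^ M₂)⁻¹ • Q ζ) := fun ζ hζ =>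
    hstab ζ hζ _ _ _ (by simpa using hσ) (hPV ζ (mem_sphere_zero_iff_norm.1 hζ))
      (hQW ζ (mem_sphere_zero_iff_norm.1 hζ))
  have hinv : ∀ M : ℕ, DifferentiableOn ℂ (fun z : ℂ => (z ^ M)⁻¹) (ball (0:ℂ) R \ {0}) :=
    fun M => (differentiableOn_pow M).inv fun z hz => pow_ne_zero _ hz.2
  obtain ⟨G₃, hG₃, hG₃K, hG₃Ω, hG₃ρ⟩ := exists_attached hUopen hρ2
    (fun p hp w => by
      rcases eq_or_ne w 0 with rfl | hw
      · simp [levi, D2]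
      · exact (hpsh p hp w hw).le)
    hΩo hΩdef hb.1 hR hf₂ hf₂Ω hP hQ hr.le (fun ζ hζ t ht => (hAB ζ hζ t ht).1) hα.1 hα.2.le
    (hlevel hUopen hρC hr₁ hr₁r (isOpen_ball.sdiff isClosed_singleton)
      (fun ζ hζ => ⟨hsub (sphere_subset_closedBall hζ), by
        rintro rfl
        simp at hζ⟩)
      (hf₂.mono sdiff_subset) (hb.1.differentiableOn.smul ((hinv M₁).smul hP.differentiableOn))
      (hb.1.differentiableOn.smul ((hinv M₂).smul hQ.differentiableOn)) hAB) hKc hKD hε3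
  have hreg : DiscReg α 3 (fun z => f₂ z + b z • G₃ z) :=
    (DiscReg.of_differentiableOn hα.1 hα.2.le hR hf₂).add
      ((DiscReg.of_differentiableOn hα.1 hα.2.le hR hb.1.differentiableOn).smul hG₃)
  have hfc : ContinuousOn (fun z => f₂ z + b z • G₃ z) (closedBall 0 1) := by
    have := hreg.holder.1.continuousOn
    rwa [closure_ball _ one_ne_zero] at this
  refine ⟨fun z => f₂ z + b z • G₃ z, hfc, hreg.holder.1.differentiableOn, hG₃Ω, hG₃ρ,
    fun L hL hLc => ?_, fun ζ hζ => ?_, fun j m hm => ?_, ?_⟩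
  · have h : {ζ ∈ ball (0:ℂ) 1 | f₂ ζ + b ζ • G₃ ζ ∈ L} =
        closedBall 0 1 ∩ (fun z => f₂ z + b z • G₃ z) ⁻¹' L := by
      ext ζ
      refine ⟨fun h => ⟨ball_subset_closedBall h.1, h.2⟩, fun h => ⟨?_, h.2⟩⟩
      rw [mem_ball_zero_iff]
      refine (mem_closedBall_zero_iff.1 h.1).lt_of_ne fun h1 => ?_
      exact (hneg _ (hL h.2)).ne (hG₃ρ ζ h1)
    rw [h]
    exact (isCompact_closedBall (0:ℂ) 1).of_isClosed_subset
      (hfc.preimage_isClosed_of_isClosed isClosed_closedBall hLc.isClosed) inter_subset_left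
  · have h1 := hG₃K ζ hζ
    have h2 := (hf₂eq ζ (ball_subset_closedBall (hKD hζ))).2.trans_le (min_le_left _ _)
    have h3 := hG₁K ζ hζ
    have h4 : f₁ ζ - f₀ ζ = b ζ • G₁ ζ := by
      rw [hf₁eq]
      exact add_sub_cancel_left _ _
    change ‖f₂ ζ + b ζ • G₃ ζ - f₀ ζ‖ < ε
    have h5 : f₂ ζ + b ζ • G₃ ζ - f₀ ζ = (f₂ ζ - f₁ ζ) + b ζ • G₁ ζ + b ζ • G₃ ζ := by
      rw [← h4]
      abel
    rw [h5]
    have := norm_add₃_le (a := f₂ ζ - f₁ ζ) (b := b ζ • G₁ ζ) (c := b ζ • G₃ ζ)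
    linarith
  · refine iteratedDeriv_eq_zero_of_eventuallyEq isOpen_ball (ha j) m d _
      (fun z => (∏ i ∈ Finset.univ.erase j, (z - a i) ^ d) • (G₁ z + G₂ z + G₃ z)) hm
      (DifferentiableOn.smul (Differentiable.differentiableOn
        (isDivisor_prod (n := n) (Finset.univ.erase j) ha d).1)
        ((hG₁.differentiableOn.add hG₂.differentiableOn).add hG₃.holder.1.differentiableOn)) ?_
    filter_upwards [isOpen_ball.mem_nhds (ha j)] with z hz
    have h1 : b z = (z - a j) ^ d * ∏ i ∈ Finset.univ.erase j, (z - a i) ^ d :=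
      (Finset.mul_prod_erase Finset.univ (fun i => (z - a i) ^ d) (Finset.mem_univ j)).symm
    rw [(hf₂eq z (ball_subset_closedBall hz)).1, hf₁eq, smul_smul, ← h1]
    change f₀ z + b z • G₁ z + b z • G₂ z + b z • G₃ z - f₀ z = _
    rw [smul_add, smul_add]
    abel
  · obtain ⟨g, hg, -, C, hC, hCg⟩ := hreg.exists_iteratedDeriv
    exact ⟨g, hg, C, hC, fun ζ hζ ξ hξ => hCg ζ ξ (mem_closedBall_zero_iff.1 hζ)
      (mem_closedBall_zero_iff.1 hξ)⟩
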